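/- Let K ⊆ ℂ be a compact set whose complement Ω := ℂ∞ ∖ K is a finitely connected domain with C^∞ boundary. Then γ(K) = min{ (1/2π) ∫_{∂Ω} |g(z)|² |dz| : g ∈ A(Ω), g(∞) = 1 }, and the minimum is attained. -/

import Mathlib

open Complex Filter Metric Set Topology Bornology MeasureTheory

noncomputable section

/-- `f` has value `l` at infinity and derivative `w` at infinity (within the set `s`), i.e.
`f(z) → l` and `z (f(z) - l) → w` as `z → ∞` within `s`. -/
def HasDerivAtInftyOn (f : ℂ → ℂ) (s : Set ℂ) (l w : ℂ) : Prop :=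
  Tendsto f (cobounded ℂ ⊓ 𝓟 s) (𝓝 l) ∧
    Tendsto (fun z => z * (f z - l)) (cobounded ℂ ⊓ 𝓟 s) (𝓝 w)

/-- The analytic capacity of a plane set `K`:
`γ(K) = sup { |f′(∞)| : f` holomorphic on `ℂ∞ ∖ K`, `‖f‖ ≤ 1 }`. -/
def analyticCapacity (K : Set ℂ) : ℝ :=
  sSup { r : ℝ | ∃ (f : ℂ → ℂ) (l w : ℂ),
    DifferentiableOn ℂ f Kᶜ ∧ (∀ z ∈ Kᶜ, ‖f z‖ ≤ 1) ∧
    HasDerivAtInftyOn f Kᶜ l w ∧ r = ‖w‖ }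

/-- Data exhibiting the boundary of a compact set `K ⊆ ℂ` as a finite union of pairwise
disjoint `C^∞` Jordan curves, positively oriented: each curve is a `1`-periodic regular `C^∞`
parametrization, injective on a period, the curve images are pairwise disjoint and their union
is the frontier of `K`, and the total winding number around every point of `interior K` is `1`
(counterclockwise orientation). -/
structure SmoothBoundary (K : Set ℂ) where
  n : ℕ
  npos : 0 < n
  curve : Fin n → ℝ → ℂ
  smooth : ∀ i, ContDiff ℝ (⊤ : ℕ∞) (curve i)
  periodic : ∀ i, Function.Periodic (curve i) 1
  injOn : ∀ i, Set.InjOn (curve i) (Set.Ico (0:ℝ) 1)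
  regular : ∀ i t, deriv (curve i) t ≠ 0
  boundary : (⋃ i, Set.range (curve i)) = frontier K
  disjointCurves : ∀ i j, i ≠ j → Disjoint (Set.range (curve i)) (Set.range (curve j))
  orientation : ∀ w ∈ interior K,
    (∑ i, ∫ t in (0:ℝ)..1, deriv (curve i) t / (curve i t - w)) = 2 * Real.pi * Complex.I

/-- The contour integral `∫_{∂Ω} f(ζ) dζ` over a finite family of parametrized curves. -/
def contourIntegralOf {n : ℕ} (curve : Fin n → ℝ → ℂ) (f : ℂ → ℂ) : ℂ :=
  ∑ i, ∫ t in (0:ℝ)..1, f (curve i t) * deriv (curve i) t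

/-- The arc-length integral `∫_{∂Ω} f(ζ) |dζ|` over a finite family of parametrized curves. -/
def arcIntegralOf {n : ℕ} (curve : Fin n → ℝ → ℂ) (f : ℂ → ℝ) : ℝ :=
  ∑ i, ∫ t in (0:ℝ)..1, f (curve i t) * ‖deriv (curve i) t‖

/-- `f ∈ A(Ω)` with value `l` at `∞`, where `Ω = ℂ∞ ∖ K`: `f` is continuous on the closure of
`Ω` (whose finite part is `(interior K)ᶜ`), holomorphic on `Ω`, and `f(z) → l` as `z → ∞`. -/
def MemA (K : Set ℂ) (f : ℂ → ℂ) (l : ℂ) : Prop :=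
  ContinuousOn f (interior K)ᶜ ∧ DifferentiableOn ℂ f Kᶜ ∧
    Tendsto f (cobounded ℂ ⊓ 𝓟 Kᶜ) (𝓝 l)

namespace ACap

/-- Derivative of a Cauchy type integral. -/
lemma cauchyInt_hasDerivAt {a b : ℝ} {φ c : ℝ → ℂ} (hφ : Continuous φ) (hc : Continuous c)
    {z : ℂ} (hz : ∀ t ∈ uIcc a b, c t ≠ z) :
    HasDerivAt (fun z => ∫ t in a..b, φ t / (c t - z)) (∫ t in a..b, φ t / (c t - z) ^ 2) z := by
  have hK : IsCompact (c '' uIcc a b) := isCompact_uIcc.image hc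
  have hzK : z ∈ (c '' uIcc a b)ᶜ := by
    rintro ⟨t, ht, h⟩; exact hz t ht h
  obtain ⟨ε, hε, hball⟩ := Metric.isOpen_iff.1 hK.isClosed.isOpen_compl z hzK
  have hdist : ∀ t ∈ uIcc a b, ∀ x ∈ ball z (ε/2), ε / 2 ≤ ‖c t - x‖ := by
    intro t ht x hx
    by_contra hlt
    push Not at hlt
    have : c t ∈ ball z ε := by
      rw [mem_ball, dist_eq_norm]
      rw [mem_ball, dist_eq_norm] at hx
      calc ‖c t - z‖ = ‖(c t - x) + (x - z)‖ := by ring_nf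
        _ ≤ ‖c t - x‖ + ‖x - z‖ := norm_add_le _ _
        _ < ε := by linarith
    exact hball this ⟨t, ht, rfl⟩
  have hne : ∀ t ∈ uIcc a b, ∀ x ∈ ball z (ε/2), c t - x ≠ 0 := by
    intro t ht x hx h0
    have := hdist t ht x hx
    rw [h0, norm_zero] at this; linarith
  obtain ⟨M, hM⟩ := (isCompact_uIcc (a := a) (b := b)).exists_bound_of_continuousOn hφ.continuousOn
  have hmeas : ∀ x, Measurable (fun t => φ t / (c t - x)) := fun x =>
    hφ.measurable.div (hc.measurable.sub_const x)
  have hmeas2 : ∀ x, Measurable (fun t => φ t / (c t - x) ^ 2) := fun x =>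
    hφ.measurable.div ((hc.measurable.sub_const x).pow_const 2)
  have hzb : z ∈ ball z (ε/2) := mem_ball_self (by linarith)
  refine (intervalIntegral.hasDerivAt_integral_of_dominated_loc_of_deriv_le (μ := volume)
    (F := fun z t => φ t / (c t - z)) (F' := fun z t => φ t / (c t - z) ^ 2)
    (bound := fun _ => M / (ε/2)^2) (ball_mem_nhds z (by linarith : 0 < ε/2)) ?_ ?_ ?_ ?_ ?_ ?_).2
  · exact Eventually.of_forall fun x => (hmeas x).aestronglyMeasurable
  · apply ContinuousOn.intervalIntegrable
    exact hφ.continuousOn.div (by fun_prop) (fun t ht => hne t ht z hzb)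
  · exact (hmeas2 z).aestronglyMeasurable
  · refine Eventually.of_forall fun t ht x hx => ?_
    have ht' := uIoc_subset_uIcc ht
    rw [norm_div, norm_pow]
    have h1 := hdist t ht' x hx
    have h2 := hM t ht'
    have h3 : 0 ≤ M := le_trans (norm_nonneg _) h2
    gcongr
  · exact intervalIntegrable_const
  · refine Eventually.of_forall fun t ht x hx => ?_
    have ht' := uIoc_subset_uIcc ht
    have h0 := hne t ht' x hx
    have h1 : HasDerivAt (fun x => c t - x) (-1) x := by
      simpa using (hasDerivAt_id x).const_sub (c t)
    have := (h1.inv h0).const_mul (φ t)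
    simp only [div_eq_mul_inv]
    convert! this using 1
    simp [div_eq_mul_inv]

lemma cauchyInt_bound {a b : ℝ} {φ c : ℝ → ℂ} (hφ : Continuous φ) (hc : Continuous c) :
    ∃ M R : ℝ, ∀ z : ℂ, R < ‖z‖ →
      ‖z * (∫ t in a..b, φ t / (c t - z)) + ∫ t in a..b, φ t‖ ≤ M / ‖z‖ := by
  obtain ⟨M, hM⟩ := (isCompact_uIcc (a := a) (b := b)).exists_bound_of_continuousOn hφ.continuousOn
  obtain ⟨R, hR⟩ := (isCompact_uIcc (a := a) (b := b)).exists_bound_of_continuousOn hc.continuousOn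
  have hM0 : 0 ≤ M := (norm_nonneg _).trans (hM a left_mem_uIcc)
  have hR0 : 0 ≤ R := (norm_nonneg _).trans (hR a left_mem_uIcc)
  refine ⟨2 * M * R * |b - a|, 2 * R, fun z hz => ?_⟩
  have hz0 : 0 < ‖z‖ := by linarith
  have hlow : ∀ t ∈ uIcc a b, ‖z‖ / 2 ≤ ‖c t - z‖ := by
    intro t ht
    have := norm_sub_norm_le z (c t)
    rw [norm_sub_rev] at this
    have := hR t ht
    linarith
  have hne : ∀ t ∈ uIcc a b, c t - z ≠ 0 := by
    intro t ht h0
    have := hlow t ht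
    rw [h0, norm_zero] at this; linarith
  have hi1 : IntervalIntegrable (fun t => φ t / (c t - z)) volume a b :=
    ContinuousOn.intervalIntegrable (hφ.continuousOn.div (by fun_prop) hne)
  have hi2 : IntervalIntegrable φ volume a b := hφ.intervalIntegrable _ _
  rw [← intervalIntegral.integral_const_mul, ← intervalIntegral.integral_add (hi1.const_mul z) hi2]
  calc ‖∫ t in a..b, (z * (φ t / (c t - z)) + φ t)‖ ≤ (2 * M * R / ‖z‖) * |b - a| := by
        apply intervalIntegral.norm_integral_le_of_norm_le_const
        intro t ht
        have ht' := uIoc_subset_uIcc ht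
        have h0 := hne t ht'
        have : z * (φ t / (c t - z)) + φ t = φ t * c t / (c t - z) := by
          field_simp; ring
        rw [this, norm_div, norm_mul]
        rw [div_le_div_iff₀ (norm_pos_iff.2 h0) hz0]
        have h1 := hM t ht'
        have h2 := hR t ht'
        have h3 := hlow t ht'
        calc ‖φ t‖ * ‖c t‖ * ‖z‖ ≤ M * R * ‖z‖ := by gcongr
          _ ≤ M * R * (2 * ‖c t - z‖) := by
              apply mul_le_mul_of_nonneg_left _ (by positivity); linarith
          _ = _ := by ring
    _ = _ := by ring

lemma tendsto_const_div_norm (M : ℝ) : Tendsto (fun z : ℂ => M / ‖z‖) (cobounded ℂ) (𝓝 0) :=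
  Tendsto.const_div_atTop tendsto_norm_cobounded_atTop M

lemma eventually_norm_gt (R : ℝ) : ∀ᶠ z in cobounded ℂ, R < ‖z‖ :=
  tendsto_norm_cobounded_atTop.eventually_gt_atTop R

lemma cauchyInt_tendsto_mul {a b : ℝ} {φ c : ℝ → ℂ} (hφ : Continuous φ) (hc : Continuous c) :
    Tendsto (fun z : ℂ => z * ∫ t in a..b, φ t / (c t - z)) (cobounded ℂ)
      (𝓝 (-∫ t in a..b, φ t)) := by
  obtain ⟨M, R, h⟩ := cauchyInt_bound (a := a) (b := b) hφ hc
  rw [tendsto_iff_norm_sub_tendsto_zero]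
  refine squeeze_zero' (Eventually.of_forall fun _ => norm_nonneg _) ?_ (tendsto_const_div_norm M)
  filter_upwards [eventually_norm_gt R] with z hz
  simpa using h z hz

lemma tendsto_zero_of_tendsto_mul {f : ℂ → ℂ} {l : ℂ} {F : Filter ℂ} (hF : F ≤ cobounded ℂ)
    (h : Tendsto (fun z => z * f z) F (𝓝 l)) : Tendsto f F (𝓝 0) := by
  have h1 : Tendsto (fun z : ℂ => z⁻¹) F (𝓝 0) := tendsto_inv₀_cobounded.mono_left hF
  have := h1.mul h
  rw [zero_mul] at this
  refine this.congr' ?_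
  filter_upwards [hF (eventually_norm_gt 0)] with z hz
  have : z ≠ 0 := norm_pos_iff.1 hz
  field_simp

/-- Open annulus around zero. -/
def ann (a b : ℝ) : Set ℂ := {w | a < ‖w‖ ∧ ‖w‖ < b}
/-- Closed annulus around zero. -/
def cann (a b : ℝ) : Set ℂ := {w | a ≤ ‖w‖ ∧ ‖w‖ ≤ b}

lemma mem_ann {a b : ℝ} {w : ℂ} : w ∈ ann a b ↔ a < ‖w‖ ∧ ‖w‖ < b := Iff.rfl
lemma mem_cann {a b : ℝ} {w : ℂ} : w ∈ cann a b ↔ a ≤ ‖w‖ ∧ ‖w‖ ≤ b := Iff.rfl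

lemma isOpen_ann (a b : ℝ) : IsOpen (ann a b) :=
  (isOpen_lt continuous_const continuous_norm).inter (isOpen_lt continuous_norm continuous_const)
lemma isClosed_cann (a b : ℝ) : IsClosed (cann a b) :=
  (isClosed_le continuous_const continuous_norm).inter (isClosed_le continuous_norm continuous_const)
lemma isCompact_cann (a b : ℝ) : IsCompact (cann a b) :=
  (isCompact_closedBall (0:ℂ) b).of_isClosed_subset (isClosed_cann a b)
    (fun w hw => by simpa using hw.2)
lemma ann_subset_cann (a b : ℝ) : ann a b ⊆ cann a b := fun _ h => ⟨h.1.le, h.2.le⟩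
lemma ann_mono {a b a' b' : ℝ} (h1 : a' ≤ a) (h2 : b ≤ b') : ann a b ⊆ ann a' b' :=
  fun _ h => ⟨h1.trans_lt h.1, h.2.trans_le h2⟩
lemma cann_subset_ann {a b a' b' : ℝ} (h1 : a' < a) (h2 : b < b') : cann a b ⊆ ann a' b' :=
  fun _ h => ⟨h1.trans_le h.1, h.2.trans_lt h2⟩

lemma sphere_subset_ann {a b r : ℝ} (h1 : a < r) (h2 : r < b) : sphere (0:ℂ) r ⊆ ann a b := by
  intro w hw
  have : ‖w‖ = r := by simpa using hw
  exact ⟨by linarith, by linarith⟩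

lemma circleMap_mem_ann {a b r : ℝ} (h0 : 0 < r) (h1 : a < r) (h2 : r < b) (θ : ℝ) :
    circleMap 0 r θ ∈ ann a b := by
  have : ‖circleMap 0 r θ‖ = r := by simp [abs_of_pos h0]
  exact ⟨by linarith, by linarith⟩

/-- Deformation of circles in an annulus. -/
lemma circleIntegral_deform {a b r R : ℝ} (ha : 0 ≤ a) (h1 : a < r) (h2 : r < b) (h3 : a < R)
    (h4 : R < b) {f : ℂ → ℂ} (hf : DifferentiableOn ℂ f (ann a b)) :
    (∮ z in C(0, R), f z) = ∮ z in C(0, r), f z := by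
  wlog hle : r ≤ R generalizing r R
  · exact (this h3 h4 h1 h2 (le_of_not_ge hle)).symm
  have hsub : closedBall (0:ℂ) R \ ball 0 r ⊆ ann a b := by
    rintro w ⟨hw1, hw2⟩
    simp at hw1 hw2
    exact ⟨by linarith, by linarith⟩
  refine Complex.circleIntegral_eq_of_differentiable_on_annulus_off_countable (by linarith) hle
    countable_empty (hf.continuousOn.mono hsub) ?_
  rintro z ⟨⟨hz1, hz2⟩, -⟩
  have : z ∈ ann a b := hsub ⟨ball_subset_closedBall hz1, fun h => hz2 (ball_subset_closedBall h)⟩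
  exact (hf z this).differentiableAt ((isOpen_ann a b).mem_nhds this)

/-- The Cauchy formula in an annulus. -/
lemma annulus_cauchy {a b r R : ℝ} (ha : 0 ≤ a) (h1 : a < r) (h4 : R < b) {f : ℂ → ℂ}
    (hf : DifferentiableOn ℂ f (ann a b)) {w : ℂ} (hw : w ∈ ann r R) :
    (∮ z in C(0, R), f z / (z - w)) - (∮ z in C(0, r), f z / (z - w)) = 2 * Real.pi * I * f w := by
  have hrR : r < R := hw.1.trans hw.2
  have hwab : w ∈ ann a b := ann_mono h1.le h4.le hw
  have hd : DifferentiableOn ℂ (dslope f w) (ann a b) :=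
    (Complex.differentiableOn_dslope ((isOpen_ann a b).mem_nhds hwab)).2 hf
  have hr0 : 0 < r := by linarith
  have key := circleIntegral_deform ha h1 (hrR.trans h4) (h1.trans hrR) h4 hd
  have hcont : ∀ ρ, a < ρ → ρ < b → ContinuousOn f (sphere 0 ρ) := fun ρ h h' =>
    hf.continuousOn.mono (sphere_subset_ann h h')
  have expand : ∀ ρ, a < ρ → ρ < b → ρ ≠ ‖w‖ → (∮ z in C(0, ρ), dslope f w z) =
      (∮ z in C(0, ρ), f z / (z - w)) - f w * ∮ z in C(0, ρ), (z - w)⁻¹ := by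
    intro ρ h h' hne
    have hρ : 0 ≤ ρ := by linarith
    have hne' : ∀ z ∈ sphere (0:ℂ) ρ, z - w ≠ 0 := by
      intro z hz h0
      rw [sub_eq_zero] at h0
      apply hne; rw [← h0]; simpa using hz.symm
    have hinv : ContinuousOn (fun z : ℂ => (z - w)⁻¹) (sphere 0 ρ) :=
      ContinuousOn.inv₀ (by fun_prop) hne'
    rw [← smul_eq_mul (f w), ← circleIntegral.integral_smul,
      ← circleIntegral.integral_sub]
    · apply circleIntegral.integral_congr hρ
      intro z hz
      have hzw : z ≠ w := fun e => hne' z hz (sub_eq_zero.2 e)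
      simp only [dslope_of_ne f hzw, slope_def_field, smul_eq_mul]
      have := hne' z hz
      field_simp
    · exact ((hcont ρ h h').div (by fun_prop) hne').circleIntegrable hρ
    · have hc2 : ContinuousOn (fun z : ℂ => f w • (z - w)⁻¹) (sphere 0 ρ) :=
        ContinuousOn.fun_smul continuousOn_const hinv
      exact hc2.circleIntegrable hρ
  rw [expand R (h1.trans hrR) h4 hw.2.ne', expand r h1 (hrR.trans h4) hw.1.ne] at key
  have e1 : (∮ z in C(0, R), (z - w)⁻¹) = 2 * Real.pi * I :=
    circleIntegral.integral_sub_inv_of_mem_ball (by simpa using hw.2)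
  have e2 : (∮ z in C(0, r), (z - w)⁻¹) = 0 := by
    apply DiffContOnCl.circleIntegral_eq_zero hr0.le
    apply DifferentiableOn.diffContOnCl
    intro z hz
    rw [closure_ball _ hr0.ne'] at hz
    have : z - w ≠ 0 := by
      intro h0
      rw [sub_eq_zero] at h0
      have : ‖z‖ ≤ r := by simpa using hz
      rw [h0] at this
      linarith [hw.1]
    fun_prop (disch := assumption)
  rw [e1, e2] at key
  linear_combination key

end ACap

namespace ACap

/-- A system of holomorphic annular collars around the boundary of `K`. -/
structure RingSys (K : Set ℂ) where
  n : ℕ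
  npos : 0 < n
  Z : Fin n → ℂ → ℂ
  r0 : ℝ
  ρ0 : ℝ
  r1 : ℝ
  h0 : 0 < r0
  h0ρ : r0 < ρ0
  hρ1 : ρ0 < 1
  h11 : 1 < r1
  holo : ∀ j, DifferentiableOn ℂ (Z j) {0}ᶜ
  inj : ∀ i j w w', w ∈ cann r0 r1 → w' ∈ cann r0 r1 → Z i w = Z j w' → i = j ∧ w = w'
  dne : ∀ j w, w ∈ cann r0 r1 → deriv (Z j) w ≠ 0
  front : frontier K ⊆ ⋃ j, Z j '' ann ρ0 1
  out : ∀ j w, w ∈ cann 1 r1 → Z j w ∈ Kᶜ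
  inn : ∀ j w, w ∈ cann r0 ρ0 → Z j w ∈ interior K

namespace RingSys

variable {K : Set ℂ} (R : RingSys K)

lemma ne_zero_of_mem_cann {w : ℂ} (hw : w ∈ cann R.r0 R.r1) : w ≠ 0 := by
  rintro rfl
  have := hw.1
  simp at this
  linarith [R.h0]

lemma h0r1 : R.r0 < R.r1 := by linarith [R.h0ρ, R.hρ1, R.h11]

lemma ann_sub {a b : ℝ} (ha : R.r0 ≤ a) (hb : b ≤ R.r1) : ann a b ⊆ cann R.r0 R.r1 :=
  (ann_mono ha hb).trans (ann_subset_cann _ _)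

lemma diffAt (j : Fin R.n) {w : ℂ} (hw : w ≠ 0) : DifferentiableAt ℂ (R.Z j) w :=
  (R.holo j w hw).differentiableAt (isOpen_compl_singleton.mem_nhds hw)

lemma analyticAt (j : Fin R.n) {w : ℂ} (hw : w ≠ 0) : AnalyticAt ℂ (R.Z j) w :=
  (R.holo j).analyticAt (isOpen_compl_singleton.mem_nhds hw)

lemma diffOn_deriv (j : Fin R.n) : DifferentiableOn ℂ (deriv (R.Z j)) {0}ᶜ :=
  (R.holo j).deriv isOpen_compl_singleton

lemma sub_ne {s : Set ℂ} (hs : s ⊆ cann R.r0 R.r1) : s ⊆ ({0}ᶜ : Set ℂ) :=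
  fun _ hw => R.ne_zero_of_mem_cann (hs hw)

lemma isOpen_image (j : Fin R.n) {a b : ℝ} (ha : R.r0 ≤ a) (hb : b ≤ R.r1) :
    IsOpen (R.Z j '' ann a b) := by
  rw [isOpen_iff_mem_nhds]
  rintro _ ⟨w, hw, rfl⟩
  have hw' := R.ann_sub ha hb hw
  have hs : HasStrictDerivAt (R.Z j) (deriv (R.Z j) w) w :=
    (R.analyticAt j (R.ne_zero_of_mem_cann hw')).hasStrictDerivAt
  have := hs.map_nhds_eq (R.dne j w hw')
  rw [← this]
  exact image_mem_map ((isOpen_ann a b).mem_nhds hw)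

lemma isCompact_image (j : Fin R.n) {a b : ℝ} (ha : R.r0 ≤ a) (hb : b ≤ R.r1) :
    IsCompact (R.Z j '' cann a b) := by
  apply (isCompact_cann a b).image_of_continuousOn
  apply (R.holo j).continuousOn.mono
  apply R.sub_ne
  intro w hw
  exact ⟨ha.trans hw.1, hw.2.trans hb⟩

/-- The union of all collars. -/
def AA (a b : ℝ) : Set ℂ := ⋃ j, R.Z j '' ann a b

lemma mem_AA {a b : ℝ} {z : ℂ} : z ∈ R.AA a b ↔ ∃ j, ∃ w ∈ ann a b, R.Z j w = z := by
  simp [AA]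

lemma Z_mem_AA {a b : ℝ} {j : Fin R.n} {w : ℂ} (hw : w ∈ ann a b) : R.Z j w ∈ R.AA a b :=
  R.mem_AA.2 ⟨j, w, hw, rfl⟩

lemma Z_mem_AA_iff {a b : ℝ} (ha : R.r0 ≤ a) (hb : b ≤ R.r1) {j : Fin R.n} {w : ℂ}
    (hw : w ∈ cann R.r0 R.r1) : R.Z j w ∈ R.AA a b ↔ w ∈ ann a b := by
  refine ⟨fun h => ?_, R.Z_mem_AA⟩
  obtain ⟨i, w', hw', e⟩ := R.mem_AA.1 h
  obtain ⟨-, rfl⟩ := R.inj _ _ _ _ (R.ann_sub ha hb hw') hw e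
  exact hw'

lemma isOpen_AA {a b : ℝ} (ha : R.r0 ≤ a) (hb : b ≤ R.r1) : IsOpen (R.AA a b) :=
  isOpen_iUnion fun j => R.isOpen_image j ha hb

lemma front_AA : frontier K ⊆ R.AA R.r0 R.r1 := by
  refine R.front.trans (iUnion_mono fun j => image_mono (ann_mono R.h0ρ.le R.h11.le))

/-- Outer domains. -/
def Uo (ρ : ℝ) : Set ℂ := (Kᶜ \ R.AA R.r0 R.r1) ∪ R.AA ρ R.r1
/-- Inner domains. -/
def Ui (ρ : ℝ) : Set ℂ := (K \ R.AA R.r0 R.r1) ∪ R.AA R.r0 ρ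

lemma Z_mem_Uo_iff {ρ : ℝ} (ha : R.r0 ≤ ρ) {j : Fin R.n} {w : ℂ}
    (hw : w ∈ ann R.r0 R.r1) : R.Z j w ∈ R.Uo ρ ↔ ρ < ‖w‖ := by
  have h1 : R.Z j w ∈ R.AA R.r0 R.r1 := R.Z_mem_AA hw
  simp only [Uo, mem_union, Set.mem_sdiff, h1, not_true, and_false, false_or]
  rw [R.Z_mem_AA_iff ha le_rfl (ann_subset_cann _ _ hw)]
  exact ⟨fun h => h.1, fun h => ⟨h, hw.2⟩⟩

lemma Z_mem_Ui_iff {ρ : ℝ} (ha : ρ ≤ R.r1) {j : Fin R.n} {w : ℂ}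
    (hw : w ∈ ann R.r0 R.r1) : R.Z j w ∈ R.Ui ρ ↔ ‖w‖ < ρ := by
  have h1 : R.Z j w ∈ R.AA R.r0 R.r1 := R.Z_mem_AA hw
  simp only [Ui, mem_union, Set.mem_sdiff, h1, not_true, and_false, false_or]
  rw [R.Z_mem_AA_iff le_rfl ha (ann_subset_cann _ _ hw)]
  exact ⟨fun h => h.2, fun h => ⟨hw.1, h⟩⟩

lemma isOpen_Uo (hK : IsCompact K) {ρ : ℝ} (ha : R.r0 ≤ ρ) (hb : ρ < R.r1) : IsOpen (R.Uo ρ) := by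
  rw [← isClosed_compl_iff]
  have : (R.Uo ρ)ᶜ = (K \ R.AA R.r0 R.r1) ∪ ⋃ j, R.Z j '' cann R.r0 ρ := by
    ext z
    by_cases hz : z ∈ R.AA R.r0 R.r1
    · obtain ⟨j, w, hw, rfl⟩ := R.mem_AA.1 hz
      rw [mem_compl_iff, R.Z_mem_Uo_iff ha hw]
      simp only [mem_union, Set.mem_sdiff, hz, not_true, and_false, false_or, mem_iUnion, not_lt]
      constructor
      · intro h; exact ⟨j, w, ⟨hw.1.le, h⟩, rfl⟩
      · rintro ⟨i, w', hw', e⟩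
        obtain ⟨-, rfl⟩ := R.inj _ _ _ _ ⟨hw'.1, hw'.2.trans hb.le⟩ (ann_subset_cann _ _ hw) e
        exact hw'.2
    · have hz2 : z ∉ R.AA ρ R.r1 := fun h => hz (iUnion_mono (fun j => image_mono (ann_mono ha le_rfl)) h)
      simp only [Uo, mem_compl_iff, mem_union, Set.mem_sdiff, hz, not_false_eq_true, and_true, hz2,
        or_false, not_not, mem_iUnion]
      refine ⟨Or.inl, ?_⟩
      rintro (h | ⟨i, w', hw', rfl⟩)
      · exact h
      · by_cases h : R.r0 < ‖w'‖
        · exact absurd (R.Z_mem_AA ⟨h, hw'.2.trans_lt hb⟩) hz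
        · exact interior_subset (R.inn i w' ⟨hw'.1, (not_lt.1 h).trans R.h0ρ.le⟩)
  rw [this]
  apply IsClosed.union
  · exact hK.isClosed.sdiff (R.isOpen_AA le_rfl le_rfl)
  · exact isClosed_iUnion_of_finite fun j => (R.isCompact_image j le_rfl hb.le).isClosed

lemma isOpen_Ui {ρ : ℝ} (ha : R.r0 < ρ) (hb : ρ ≤ R.r1) : IsOpen (R.Ui ρ) := by
  rw [← isClosed_compl_iff]
  have : (R.Ui ρ)ᶜ = (Kᶜ \ R.AA R.r0 R.r1) ∪ ⋃ j, R.Z j '' cann ρ R.r1 := by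
    ext z
    by_cases hz : z ∈ R.AA R.r0 R.r1
    · obtain ⟨j, w, hw, rfl⟩ := R.mem_AA.1 hz
      rw [mem_compl_iff, R.Z_mem_Ui_iff hb hw]
      simp only [mem_union, Set.mem_sdiff, hz, not_true, and_false, false_or, mem_iUnion, not_lt]
      constructor
      · intro h; exact ⟨j, w, ⟨h, hw.2.le⟩, rfl⟩
      · rintro ⟨i, w', hw', e⟩
        obtain ⟨-, rfl⟩ := R.inj _ _ _ _ ⟨ha.le.trans hw'.1, hw'.2⟩ (ann_subset_cann _ _ hw) e
        exact hw'.1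
    · have hz2 : z ∉ R.AA R.r0 ρ := fun h => hz (iUnion_mono (fun j => image_mono (ann_mono le_rfl hb)) h)
      simp only [Ui, mem_compl_iff, mem_union, Set.mem_sdiff, hz, not_false_eq_true, and_true, hz2,
        or_false, mem_iUnion]
      refine ⟨Or.inl, ?_⟩
      rintro (h | ⟨i, w', hw', rfl⟩)
      · exact h
      · by_cases h : ‖w'‖ < R.r1
        · exact absurd (R.Z_mem_AA ⟨ha.trans_le hw'.1, h⟩) hz
        · exact R.out i w' ⟨R.h11.le.trans (not_lt.1 h), hw'.2⟩
  rw [this]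
  apply IsClosed.union
  · have : Kᶜ \ R.AA R.r0 R.r1 = (interior K ∪ R.AA R.r0 R.r1)ᶜ := by
      ext z
      simp only [Set.mem_sdiff, mem_compl_iff, mem_union, not_or]
      refine ⟨fun h => ⟨fun h' => h.1 (interior_subset h'), h.2⟩, fun h => ⟨fun h' => ?_, h.2⟩⟩
      exact h.2 (R.front_AA ⟨subset_closure h', h.1⟩)
    rw [this, isClosed_compl_iff]
    exact isOpen_interior.union (R.isOpen_AA le_rfl le_rfl)
  · exact isClosed_iUnion_of_finite fun j => (R.isCompact_image j ha.le le_rfl).isClosed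

lemma Uo_cobounded (hK : IsCompact K) {ρ : ℝ} : R.Uo ρ ∈ cobounded ℂ := by
  have h1 : Kᶜ ∈ cobounded ℂ := hK.isBounded
  have h2 : (⋃ j, R.Z j '' cann R.r0 R.r1)ᶜ ∈ cobounded ℂ := by
    have : IsCompact (⋃ j, R.Z j '' cann R.r0 R.r1) :=
      isCompact_iUnion fun j => R.isCompact_image j le_rfl le_rfl
    exact this.isBounded
  filter_upwards [h1, h2] with z hz1 hz2
  refine Or.inl ⟨hz1, fun h => hz2 (iUnion_mono (fun j => image_mono (ann_subset_cann _ _)) h)⟩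

lemma Uo_one_subset : R.Uo 1 ⊆ Kᶜ := by
  rintro z (h | h)
  · exact h.1
  · obtain ⟨j, w, hw, rfl⟩ := R.mem_AA.1 h
    exact R.out j w (ann_subset_cann _ _ hw)

lemma Uo_mono {ρ ρ' : ℝ} (h : ρ ≤ ρ') : R.Uo ρ' ⊆ R.Uo ρ :=
  union_subset_union_right _ (iUnion_mono fun _ => image_mono (ann_mono h le_rfl))

lemma Ui_mono {ρ ρ' : ℝ} (h : ρ ≤ ρ') : R.Ui ρ ⊆ R.Ui ρ' :=
  union_subset_union_right _ (iUnion_mono fun _ => image_mono (ann_mono le_rfl h))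

lemma Ui_rho0_subset : R.Ui R.ρ0 ⊆ interior K := by
  rintro z (h | h)
  · by_contra h'
    exact h.2 (R.front_AA ⟨subset_closure h.1, h'⟩)
  · obtain ⟨j, w, hw, rfl⟩ := R.mem_AA.1 h
    exact R.inn j w (ann_subset_cann _ _ hw)

/-- Gluing a function on an outer domain and one on an inner domain. -/
lemma glue (hK : IsCompact K) {s s' : ℝ} (h1 : R.r0 ≤ s) (h2 : s < s') (h3 : s' ≤ R.r1)
    {u v : ℂ → ℂ} (hu : DifferentiableOn ℂ u (R.Uo s)) (hv : DifferentiableOn ℂ v (R.Ui s'))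
    (huv : ∀ j, ∀ w ∈ ann s s', u (R.Z j w) = v (R.Z j w)) :
    ∃ E : ℂ → ℂ, Differentiable ℂ E ∧ EqOn E u (R.Uo s) ∧ EqOn E v (R.Ui s') := by
  classical
  have ho : IsOpen (R.Uo s) := R.isOpen_Uo hK h1 (h2.trans_le h3)
  have hi : IsOpen (R.Ui s') := R.isOpen_Ui (h1.trans_lt h2) h3
  let E : ℂ → ℂ := fun z => if z ∈ R.Uo s then u z else v z
  have e1 : EqOn E u (R.Uo s) := fun z hz => if_pos hz
  have e2 : EqOn E v (R.Ui s') := by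
    intro z hz
    by_cases hz' : z ∈ R.Uo s
    · rw [e1 hz']
      rcases hz with hz | hz
      · rcases hz' with h | h
        · exact absurd hz.1 h.1
        · exact absurd (iUnion_mono (fun j => image_mono (ann_mono h1 le_rfl)) h) hz.2
      · obtain ⟨j, w, hw, rfl⟩ := R.mem_AA.1 hz
        have := (R.Z_mem_Uo_iff h1 (ann_mono le_rfl h3 hw)).1 hz'
        exact huv j w ⟨this, hw.2⟩
    · exact if_neg hz'
  refine ⟨E, ?_, e1, e2⟩
  intro z
  have hcov : z ∈ R.Uo s ∨ z ∈ R.Ui s' := by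
    by_cases hz : z ∈ R.AA R.r0 R.r1
    · obtain ⟨j, w, hw, rfl⟩ := R.mem_AA.1 hz
      rw [R.Z_mem_Uo_iff h1 hw, R.Z_mem_Ui_iff h3 hw]
      rcases lt_or_ge s ‖w‖ with h | h
      · exact Or.inl h
      · exact Or.inr (h.trans_lt h2)
    · by_cases hzK : z ∈ K
      · exact Or.inr (Or.inl ⟨hzK, hz⟩)
      · exact Or.inl (Or.inl ⟨hzK, hz⟩)
  rcases hcov with h | h
  · exact ((hu z h).differentiableAt (ho.mem_nhds h)).congr_of_eventuallyEq
      (e1.eventuallyEq_of_mem (ho.mem_nhds h))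
  · exact ((hv z h).differentiableAt (hi.mem_nhds h)).congr_of_eventuallyEq
      (e2.eventuallyEq_of_mem (hi.mem_nhds h))

/-- Cauchy transform over the circles of radius `r`. -/
def CT (r : ℝ) (h : Fin R.n → ℂ → ℂ) (a : ℂ) : ℂ :=
  -(2 * Real.pi * I)⁻¹ * ∑ j, ∮ w in C(0, r), h j w * deriv (R.Z j) w / (R.Z j w - a)

/-- The contour integral over the circles of radius `r`. -/
def CI (r : ℝ) (h : Fin R.n → ℂ → ℂ) : ℂ :=
  ∑ j, ∮ w in C(0, r), h j w * deriv (R.Z j) w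

lemma cont_circle {r : ℝ} (h1 : 0 < r) {f : ℂ → ℂ} (hf : ContinuousOn f (sphere 0 r)) :
    Continuous fun θ => f (circleMap 0 r θ) :=
  hf.comp_continuous (continuous_circleMap 0 r) (fun θ => circleMap_mem_sphere 0 h1.le θ)

lemma sphere_sub {r : ℝ} (h1 : R.r0 ≤ r) (h2 : r ≤ R.r1) : sphere (0:ℂ) r ⊆ cann R.r0 R.r1 := by
  intro w hw
  have : ‖w‖ = r := by simpa using hw
  exact ⟨by linarith, by linarith⟩

lemma continuousOn_Z (j : Fin R.n) {s : Set ℂ} (hs : s ⊆ cann R.r0 R.r1) :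
    ContinuousOn (R.Z j) s := (R.holo j).continuousOn.mono (R.sub_ne hs)
lemma continuousOn_dZ (j : Fin R.n) {s : Set ℂ} (hs : s ⊆ cann R.r0 R.r1) :
    ContinuousOn (deriv (R.Z j)) s := (R.diffOn_deriv j).continuousOn.mono (R.sub_ne hs)

lemma CT_term_eq {r : ℝ} {h : ℂ → ℂ} (j : Fin R.n) (a : ℂ) :
    (∮ w in C(0, r), h w * deriv (R.Z j) w / (R.Z j w - a)) =
    ∫ θ in (0:ℝ)..2 * Real.pi, (deriv (circleMap 0 r) θ * (h (circleMap 0 r θ) *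
      deriv (R.Z j) (circleMap 0 r θ))) / (R.Z j (circleMap 0 r θ) - a) := by
  rw [circleIntegral]
  simp only [smul_eq_mul, mul_div_assoc]

lemma CT_cont1 {r : ℝ} (h1 : R.r0 ≤ r) (h2 : r ≤ R.r1) {h : ℂ → ℂ} (j : Fin R.n)
    (hh : ContinuousOn h (sphere 0 r)) :
    Continuous fun θ => deriv (circleMap 0 r) θ * (h (circleMap 0 r θ) *
      deriv (R.Z j) (circleMap 0 r θ)) := by
  have hr := R.h0.trans_le h1
  have hd := R.continuousOn_dZ j (R.sphere_sub h1 h2)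
  refine Continuous.mul ?_ ((cont_circle hr hh).mul (cont_circle hr hd))
  have : deriv (circleMap 0 r) = fun θ => circleMap 0 r θ * I := by
    ext θ; simp [deriv_circleMap]
  rw [this]
  fun_prop

lemma CT_cont2 {r : ℝ} (h1 : R.r0 ≤ r) (h2 : r ≤ R.r1) (j : Fin R.n) :
    Continuous fun θ => R.Z j (circleMap 0 r θ) :=
  cont_circle (R.h0.trans_le h1) (R.continuousOn_Z j (R.sphere_sub h1 h2))

lemma CT_differentiableAt {r : ℝ} (h1 : R.r0 ≤ r) (h2 : r ≤ R.r1) {h : Fin R.n → ℂ → ℂ}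
    (hh : ∀ j, ContinuousOn (h j) (sphere 0 r)) {a : ℂ}
    (ha : ∀ j, ∀ w ∈ sphere (0:ℂ) r, R.Z j w ≠ a) : DifferentiableAt ℂ (R.CT r h) a := by
  have hr := R.h0.trans_le h1
  unfold CT
  simp only [CT_term_eq]
  refine DifferentiableAt.const_mul ?_ _
  refine DifferentiableAt.fun_sum fun j _ => ?_
  refine (cauchyInt_hasDerivAt (R.CT_cont1 h1 h2 j (hh j)) (R.CT_cont2 h1 h2 j)
    fun t _ => ?_).differentiableAt
  exact ha j _ (circleMap_mem_sphere 0 hr.le t)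

lemma CT_tendsto_mul {r : ℝ} (h1 : R.r0 ≤ r) (h2 : r ≤ R.r1) {h : Fin R.n → ℂ → ℂ}
    (hh : ∀ j, ContinuousOn (h j) (sphere 0 r)) :
    Tendsto (fun a => a * R.CT r h a) (cobounded ℂ) (𝓝 ((2 * Real.pi * I)⁻¹ * R.CI r h)) := by
  have key : ∀ j ∈ Finset.univ, Tendsto (fun a => a * ∮ w in C(0, r), h j w * deriv (R.Z j) w /
      (R.Z j w - a)) (cobounded ℂ) (𝓝 (-∮ w in C(0, r), h j w * deriv (R.Z j) w)) := by
    intro j _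
    simp only [CT_term_eq]
    exact cauchyInt_tendsto_mul (R.CT_cont1 h1 h2 j (hh j)) (R.CT_cont2 h1 h2 j)
  have := (tendsto_finsetSum _ key).const_mul (-(2 * Real.pi * I)⁻¹)
  unfold CI CT
  convert! this using 2
  · rw [Finset.mul_sum, Finset.mul_sum, Finset.mul_sum]
    exact Finset.sum_congr rfl fun j _ => by ring
  · rw [Finset.sum_neg_distrib]; ring

lemma CT_tendsto {r : ℝ} (h1 : R.r0 ≤ r) (h2 : r ≤ R.r1) {h : Fin R.n → ℂ → ℂ}
    (hh : ∀ j, ContinuousOn (h j) (sphere 0 r)) :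
    Tendsto (R.CT r h) (cobounded ℂ) (𝓝 0) :=
  tendsto_zero_of_tendsto_mul le_rfl (R.CT_tendsto_mul h1 h2 hh)

lemma not_mem_sphere_of_Uo {r : ℝ} (h1 : R.r0 < r) (h2 : r < R.r1) {a : ℂ} (ha : a ∈ R.Uo r)
    (j : Fin R.n) {w : ℂ} (hw : w ∈ sphere (0:ℂ) r) : R.Z j w ≠ a := by
  rintro rfl
  have := (R.Z_mem_Uo_iff h1.le (sphere_subset_ann h1 h2 hw)).1 ha
  have h : ‖w‖ = r := by simpa using hw
  linarith

lemma not_mem_sphere_of_Ui {r : ℝ} (h1 : R.r0 < r) (h2 : r < R.r1) {a : ℂ} (ha : a ∈ R.Ui r)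
    (j : Fin R.n) {w : ℂ} (hw : w ∈ sphere (0:ℂ) r) : R.Z j w ≠ a := by
  rintro rfl
  have := (R.Z_mem_Ui_iff h2.le (sphere_subset_ann h1 h2 hw)).1 ha
  have h : ‖w‖ = r := by simpa using hw
  linarith

lemma CT_diffOn_Uo {r : ℝ} (h1 : R.r0 < r) (h2 : r < R.r1) {h : Fin R.n → ℂ → ℂ}
    (hh : ∀ j, ContinuousOn (h j) (sphere 0 r)) : DifferentiableOn ℂ (R.CT r h) (R.Uo r) :=
  fun _ ha => (R.CT_differentiableAt h1.le h2.le hh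
    fun j _ hw => R.not_mem_sphere_of_Uo h1 h2 ha j hw).differentiableWithinAt

lemma CT_diffOn_Ui {r : ℝ} (h1 : R.r0 < r) (h2 : r < R.r1) {h : Fin R.n → ℂ → ℂ}
    (hh : ∀ j, ContinuousOn (h j) (sphere 0 r)) : DifferentiableOn ℂ (R.CT r h) (R.Ui r) :=
  fun _ ha => (R.CT_differentiableAt h1.le h2.le hh
    fun j _ hw => R.not_mem_sphere_of_Ui h1 h2 ha j hw).differentiableWithinAt

lemma CT_jump {s s' r r' : ℝ} (h1 : R.r0 ≤ s) (h2 : s < r) (h3 : r' < s') (h4 : s' ≤ R.r1)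
    {h : Fin R.n → ℂ → ℂ} (hh : ∀ j, DifferentiableOn ℂ (h j) (ann s s')) {i : Fin R.n} {w0 : ℂ}
    (hw0 : w0 ∈ ann r r') : R.CT r h (R.Z i w0) - R.CT r' h (R.Z i w0) = h i w0 := by
  classical
  have hrr : r < r' := hw0.1.trans hw0.2
  have hsub : ann s s' ⊆ cann R.r0 R.r1 := R.ann_sub h1 h4
  have hw0' : w0 ∈ ann s s' := ann_mono h2.le h3.le hw0
  have hs0 : 0 ≤ s := R.h0.le.trans h1
  have hdZ : ∀ j, DifferentiableOn ℂ (deriv (R.Z j)) (ann s s') := fun j =>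
    (R.diffOn_deriv j).mono (R.sub_ne hsub)
  have hZ : ∀ j, DifferentiableOn ℂ (R.Z j) (ann s s') := fun j =>
    (R.holo j).mono (R.sub_ne hsub)
  have key : ∀ j, (∮ w in C(0, r'), h j w * deriv (R.Z j) w / (R.Z j w - R.Z i w0)) -
      (∮ w in C(0, r), h j w * deriv (R.Z j) w / (R.Z j w - R.Z i w0)) =
      if j = i then 2 * Real.pi * I * h i w0 else 0 := by
    intro j
    split_ifs with hji
    · subst hji
      set q := dslope (R.Z j) w0 with hq
      have hqd : DifferentiableOn ℂ q (ann s s') :=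
        (Complex.differentiableOn_dslope ((isOpen_ann s s').mem_nhds hw0')).2 (hZ j)
      have hqmul : ∀ w, R.Z j w - R.Z j w0 = (w - w0) * q w := by
        intro w
        have := sub_smul_dslope (R.Z j) w0 w
        rw [smul_eq_mul] at this
        exact this.symm
      have hq0 : ∀ w ∈ ann s s', q w ≠ 0 := by
        intro w hw h0
        by_cases e : w = w0
        · rw [hq, e, dslope_same] at h0
          exact R.dne j w0 (hsub hw0') h0
        · have := hqmul w
          rw [h0, mul_zero, sub_eq_zero] at this
          exact e (R.inj _ _ _ _ (hsub hw) (hsub hw0') this).2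
      have hd : DifferentiableOn ℂ (fun w => h j w * deriv (R.Z j) w / q w) (ann s s') :=
        ((hh j).mul (hdZ j)).div hqd hq0
      have := annulus_cauchy hs0 h2 h3 hd hw0
      have ew0 : h j w0 * deriv (R.Z j) w0 / q w0 = h j w0 := by
        rw [hq, dslope_same]
        have := R.dne j w0 (hsub hw0')
        field_simp
      rw [ew0] at this
      rw [← this]
      congr 1 <;> congr 1 <;> ext w <;> rw [hqmul, div_div, mul_comm (q w)]
    · rw [sub_eq_zero]
      refine circleIntegral_deform hs0 h2 (hrr.trans h3) (h2.trans hrr) h3 ?_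
      refine ((hh j).mul (hdZ j)).div ((hZ j).sub_const _) fun w hw h0 => ?_
      exact hji (R.inj _ _ _ _ (hsub hw) (hsub hw0') (sub_eq_zero.1 h0)).1
  unfold CT
  rw [← mul_sub, ← Finset.sum_sub_distrib]
  have : ∀ j ∈ Finset.univ, ((∮ w in C(0, r), h j w * deriv (R.Z j) w / (R.Z j w - R.Z i w0)) -
      ∮ w in C(0, r'), h j w * deriv (R.Z j) w / (R.Z j w - R.Z i w0)) =
      -(if j = i then 2 * Real.pi * I * h i w0 else 0) := by
    intro j _
    rw [← key j]; ring
  rw [Finset.sum_congr rfl this, Finset.sum_neg_distrib, Finset.sum_ite_eq' Finset.univ i]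
  simp only [Finset.mem_univ, if_true]
  have : (2 * Real.pi * I : ℂ) ≠ 0 := Complex.two_pi_I_ne_zero
  field_simp

lemma comp_Z_diffOn_o {ρ : ℝ} (hρ : R.r0 ≤ ρ) (hρ1 : ρ < R.r1) (hK : IsCompact K) {h : ℂ → ℂ}
    (hh : DifferentiableOn ℂ h (R.Uo ρ)) (j : Fin R.n) :
    DifferentiableOn ℂ (fun w => h (R.Z j w)) (ann ρ R.r1) := by
  intro w hw
  have hw' := R.ann_sub hρ le_rfl hw
  have hm : R.Z j w ∈ R.Uo ρ := (R.Z_mem_Uo_iff hρ (ann_mono hρ le_rfl hw)).2 hw.1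
  have h1 := (hh _ hm).differentiableAt ((R.isOpen_Uo hK hρ hρ1).mem_nhds hm)
  exact (h1.comp w (R.diffAt j (R.ne_zero_of_mem_cann hw'))).differentiableWithinAt

lemma comp_Z_diffOn_i {ρ : ℝ} (hρ : R.r0 < ρ) (hρ1 : ρ ≤ R.r1) {h : ℂ → ℂ}
    (hh : DifferentiableOn ℂ h (R.Ui ρ)) (j : Fin R.n) :
    DifferentiableOn ℂ (fun w => h (R.Z j w)) (ann R.r0 ρ) := by
  intro w hw
  have hw' := R.ann_sub le_rfl hρ1 hw
  have hm : R.Z j w ∈ R.Ui ρ := (R.Z_mem_Ui_iff hρ1 (ann_mono le_rfl hρ1 hw)).2 hw.2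
  have h1 := (hh _ hm).differentiableAt ((R.isOpen_Ui hρ hρ1).mem_nhds hm)
  exact (h1.comp w (R.diffAt j (R.ne_zero_of_mem_cann hw'))).differentiableWithinAt

lemma RS1_aux (hK : IsCompact K) {ρ r r' : ℝ} (hρ : R.r0 ≤ ρ) (hr : ρ < r) (hrr : r < r')
    (hr1 : r' < R.r1) {h : ℂ → ℂ} {l : ℂ} (hh : DifferentiableOn ℂ h (R.Uo ρ))
    (hl : Tendsto h (cobounded ℂ) (𝓝 l)) :
    (∀ a ∈ R.Uo r, h a = l + R.CT r (fun j w => h (R.Z j w)) a) ∧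
    (∀ a ∈ R.Ui r', 0 = l + R.CT r' (fun j w => h (R.Z j w)) a) := by
  set H : Fin R.n → ℂ → ℂ := fun j w => h (R.Z j w) with hH
  have hρ1 : ρ < R.r1 := by linarith
  have hHd : ∀ j, DifferentiableOn ℂ (H j) (ann ρ R.r1) := R.comp_Z_diffOn_o hρ hρ1 hK hh
  have hc : ∀ x, ρ < x → x < R.r1 → ∀ j, ContinuousOn (H j) (sphere 0 x) := fun x hx hx' j =>
    (hHd j).continuousOn.mono (sphere_subset_ann hx hx')
  have hcr := hc r hr (hrr.trans hr1)
  obtain ⟨E, hE, e1, e2⟩ := R.glue hK (u := fun a => h a - R.CT r H a)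
    (v := fun a => - R.CT r' H a) (hρ.trans hr.le) hrr hr1.le
    ((hh.mono (R.Uo_mono hr.le)).sub (R.CT_diffOn_Uo (hρ.trans_lt hr) (hrr.trans hr1) hcr))
    (R.CT_diffOn_Ui (hρ.trans_lt (hr.trans hrr)) hr1 (hc r' (hr.trans hrr) hr1)).neg
    (by
      intro j w hw
      have := R.CT_jump hρ hr hr1 le_rfl hHd (i := j) hw
      simp only [hH] at this ⊢
      linear_combination -this)
  have hEl : Tendsto E (cobounded ℂ) (𝓝 l) := by
    have h1 := hl.sub (R.CT_tendsto (hρ.trans hr.le) (hrr.trans hr1).le hcr)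
    rw [sub_zero] at h1
    refine h1.congr' ?_
    filter_upwards [R.Uo_cobounded hK (ρ := r)] with z hz
    exact (e1 hz).symm
  have hconst : ∀ z, E z = l := by
    intro z
    exact hE.apply_eq_of_tendsto_cocompact z (by rwa [← Metric.cobounded_eq_cocompact])
  constructor
  · intro a ha
    have := e1 ha
    rw [hconst] at this
    simp only at this
    rw [this]; ring
  · intro a ha
    have := e2 ha
    rw [hconst] at this
    simp only at this
    rw [this]; ring

lemma RS1 (hK : IsCompact K) {ρ r : ℝ} (hρ : R.r0 ≤ ρ) (hr : ρ < r)
    (hr1 : r < R.r1) {h : ℂ → ℂ} {l : ℂ} (hh : DifferentiableOn ℂ h (R.Uo ρ))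
    (hl : Tendsto h (cobounded ℂ) (𝓝 l)) {a : ℂ} (ha : a ∈ R.Uo r) :
    h a = l + R.CT r (fun j w => h (R.Z j w)) a := by
  obtain ⟨r', h1, h2⟩ := exists_between hr1
  exact (R.RS1_aux hK hρ hr h1 h2 hh hl).1 a ha

lemma RS1_in (hK : IsCompact K) {ρ r : ℝ} (hρ : R.r0 ≤ ρ) (hr : ρ < r)
    (hr1 : r < R.r1) {h : ℂ → ℂ} {l : ℂ} (hh : DifferentiableOn ℂ h (R.Uo ρ))
    (hl : Tendsto h (cobounded ℂ) (𝓝 l)) {a : ℂ} (ha : a ∈ R.Ui r) :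
    0 = l + R.CT r (fun j w => h (R.Z j w)) a := by
  obtain ⟨r', h1, h2⟩ := exists_between hr
  exact (R.RS1_aux hK hρ h1 h2 hr1 hh hl).2 a ha

lemma RS2 (hK : IsCompact K) {ρ r : ℝ} (hρ : R.r0 ≤ ρ) (hr : ρ < r)
    (hr1 : r < R.r1) {h : ℂ → ℂ} {l d : ℂ} (hh : DifferentiableOn ℂ h (R.Uo ρ))
    (hl : Tendsto h (cobounded ℂ) (𝓝 l))
    (hd : Tendsto (fun z => z * (h z - l)) (cobounded ℂ) (𝓝 d)) :
    R.CI r (fun j w => h (R.Z j w)) = 2 * Real.pi * I * d := by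
  have hc : ∀ j, ContinuousOn (fun w => h (R.Z j w)) (sphere 0 r) := fun j =>
    (R.comp_Z_diffOn_o hρ (hr.trans hr1) hK hh j).continuousOn.mono (sphere_subset_ann hr hr1)
  have h1 := R.CT_tendsto_mul (hρ.trans hr.le) hr1.le hc
  have h2 : Tendsto (fun z => z * (h z - l)) (cobounded ℂ)
      (𝓝 ((2 * Real.pi * I)⁻¹ * R.CI r (fun j w => h (R.Z j w)))) := by
    refine h1.congr' ?_
    filter_upwards [R.Uo_cobounded hK (ρ := r)] with z hz
    rw [R.RS1 hK hρ hr hr1 hh hl hz]; ring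
  have := tendsto_nhds_unique hd h2
  rw [this]
  have : (2 * Real.pi * I : ℂ) ≠ 0 := Complex.two_pi_I_ne_zero
  field_simp

lemma RS3 (hK : IsCompact K) {ρ r : ℝ} (hρ : ρ ≤ R.r1) (hr : r < ρ)
    (hr0 : R.r0 < r) {h : ℂ → ℂ} (hh : DifferentiableOn ℂ h (R.Ui ρ)) :
    R.CI r (fun j w => h (R.Z j w)) = 0 := by
  obtain ⟨r', h1, h2⟩ := exists_between hr
  have hHd : ∀ j, DifferentiableOn ℂ (fun w => h (R.Z j w)) (ann R.r0 ρ) :=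
    R.comp_Z_diffOn_i (hr0.trans hr) hρ hh
  set H : Fin R.n → ℂ → ℂ := fun j w => h (R.Z j w) with hH
  have hc : ∀ x, R.r0 < x → x < ρ → ∀ j, ContinuousOn (H j) (sphere 0 x) := fun x hx hx' j =>
    (hHd j).continuousOn.mono (sphere_subset_ann hx hx')
  obtain ⟨E, hE, e1, e2⟩ := R.glue hK (u := fun a => R.CT r H a)
    (v := fun a => h a + R.CT r' H a) hr0.le h1 (h2.le.trans hρ)
    (R.CT_diffOn_Uo hr0 (hr.trans_le hρ) (hc r hr0 hr))
    ((hh.mono (R.Ui_mono h2.le)).add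
      (R.CT_diffOn_Ui (hr0.trans h1) (h2.trans_le hρ) (hc r' (hr0.trans h1) h2)))
    (by
      intro j w hw
      have := R.CT_jump le_rfl hr0 h2 hρ hHd (i := j) hw
      simp only [hH] at this ⊢
      linear_combination this)
  have hEl : Tendsto E (cobounded ℂ) (𝓝 0) := by
    have h1 := (R.CT_tendsto hr0.le (hr.le.trans hρ) (hc r hr0 hr))
    refine h1.congr' ?_
    filter_upwards [R.Uo_cobounded hK (ρ := r)] with z hz
    exact (e1 hz).symm
  have hconst : ∀ z, E z = 0 := by
    intro z
    exact hE.apply_eq_of_tendsto_cocompact z (by rwa [← Metric.cobounded_eq_cocompact])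
  have h3 := R.CT_tendsto_mul hr0.le (hr.le.trans hρ) (hc r hr0 hr)
  have h4 : Tendsto (fun a => a * R.CT r H a) (cobounded ℂ) (𝓝 0) := by
    refine tendsto_const_nhds.congr' ?_
    filter_upwards [R.Uo_cobounded hK (ρ := r)] with z hz
    have := e1 hz
    rw [hconst] at this
    simp only at this
    rw [← this, mul_zero]
  have := tendsto_nhds_unique h3 h4
  rcases mul_eq_zero.1 this with h | h
  · exact absurd h (inv_ne_zero Complex.two_pi_I_ne_zero)
  · exact h

end RingSys

end ACap

namespace ACap

/-- Existence of a continuous logarithm on a convex open set. -/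
lemma exists_clog {X : Type*} [NormedAddCommGroup X] [NormedSpace ℝ X] {S : Set X}
    (hS : Convex ℝ S) (hne : S.Nonempty) (ho : IsOpen S) {g : X → ℂ} (hg : ContinuousOn g S)
    (h0 : ∀ x ∈ S, g x ≠ 0) : ∃ H : X → ℂ, ContinuousOn H S ∧ ∀ x ∈ S, exp (H x) = g x := by
  have : ContractibleSpace S := hS.contractibleSpace hne
  have hsc : IsSimplyConnected S := by
    unfold IsSimplyConnected
    infer_instance
  obtain ⟨f, hf, hfe⟩ := Complex.exists_continuousOn_eqOn_exp_comp hsc ho hg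
    (by rintro ⟨x, hx, hx0⟩; exact h0 x hx hx0)
  exact ⟨f, hf, fun x hx => hfe hx⟩

lemma differentiableAt_of_exp {H : ℂ → ℂ} {x : ℂ} (hc : ContinuousAt H x)
    (hd : DifferentiableAt ℂ (fun y => exp (H y)) x) : DifferentiableAt ℂ H x := by
  have h1 : DifferentiableAt ℂ (fun y => H x + log (exp (H y) * exp (-H x))) x := by
    refine DifferentiableAt.const_add _ (DifferentiableAt.clog (hd.mul_const _) ?_)
    rw [← Complex.exp_add, add_neg_cancel, Complex.exp_zero]
    exact Complex.one_mem_slitPlane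
  refine h1.congr_of_eventuallyEq ?_
  have : ∀ᶠ y in 𝓝 x, ‖H y - H x‖ < Real.pi := by
    have := Metric.continuousAt_iff.1 hc Real.pi Real.pi_pos
    obtain ⟨δ, hδ, h⟩ := this
    filter_upwards [ball_mem_nhds x hδ] with y hy
    rw [← dist_eq_norm]; exact h hy
  filter_upwards [this] with y hy
  have h2 := (Complex.abs_im_le_norm _).trans_lt hy
  rw [abs_lt] at h2
  rw [← Complex.exp_add, ← sub_eq_add_neg, Complex.log_exp h2.1 h2.2.le]
  ring

lemma eq_const_of_exp_eq_one {X : Type*} [TopologicalSpace X] {S : Set X} (hS : IsPreconnected S)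
    {D : X → ℂ} (hD : ContinuousOn D S) (h1 : ∀ x ∈ S, exp (D x) = 1) :
    ∃ n : ℤ, ∀ x ∈ S, D x = n * (2 * Real.pi * I) := by
  rcases S.eq_empty_or_nonempty with rfl | ⟨x0, hx0⟩
  · exact ⟨0, by simp⟩
  obtain ⟨n, hn⟩ := Complex.exp_eq_one_iff.1 (h1 x0 hx0)
  refine ⟨n, fun x hx => ?_⟩
  rw [← hn]
  choose! m hm using fun x hx => Complex.exp_eq_one_iff.1 (h1 x hx)
  have hmc : ContinuousOn (fun x => (D x / (2 * Real.pi * I)).re) S := by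
    exact Complex.continuous_re.comp_continuousOn (hD.div_const _)
  have hme : ∀ x ∈ S, (D x / (2 * Real.pi * I)).re = m x := by
    intro x hx
    rw [hm x hx, mul_div_assoc, div_self Complex.two_pi_I_ne_zero]
    simp
  have hmi : ContinuousOn m S := by
    have h2 : ContinuousOn (fun x => (m x : ℝ)) S := hmc.congr fun x hx => (hme x hx).symm
    rwa [Int.isClosedEmbedding_coe_real.isInducing.continuousOn_iff]
  have := hS.constant hmi hx hx0
  rw [hm x hx, hm x0 hx0, this]

/-- the strip over an annulus -/
def strip (a b : ℝ) : Set ℂ := {ζ | exp ζ ∈ ann a b}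

lemma isOpen_strip (a b : ℝ) : IsOpen (strip a b) := (isOpen_ann a b).preimage Complex.continuous_exp

lemma convex_strip (a b : ℝ) : Convex ℝ (strip a b) := by
  have h1 : OrdConnected (Real.exp ⁻¹' (Ioo a b)) := ordConnected_Ioo.preimage_mono Real.exp_monotone
  have h2 := h1.convex.linear_preimage Complex.reLm
  convert! h2 using 1
  ext ζ
  simp [strip, ann, Complex.norm_exp]

lemma strip_nonempty {a b : ℝ} (ha : 0 ≤ a) (hab : a < b) : (strip a b).Nonempty := by
  obtain ⟨c, h1, h2⟩ := exists_between hab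
  refine ⟨Real.log c, ?_⟩
  simp only [strip, ann, mem_setOf_eq, Complex.norm_exp, Complex.ofReal_re]
  rw [Real.exp_log (by linarith)]
  exact ⟨h1, h2⟩

lemma strip_add {a b : ℝ} {ζ : ℂ} : ζ + 2 * Real.pi * I ∈ strip a b ↔ ζ ∈ strip a b := by
  simp only [strip, mem_setOf_eq, Complex.exp_periodic ζ]

/-- `h = w ^ n * exp k` on the annulus. -/
def HasW (h : ℂ → ℂ) (a b : ℝ) (n : ℤ) : Prop :=
  ∃ k : ℂ → ℂ, DifferentiableOn ℂ k (ann a b) ∧ ∀ w ∈ ann a b, h w = w ^ n * exp (k w)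

lemma ne_zero_of_mem_ann {a b : ℝ} (ha : 0 ≤ a) {w : ℂ} (hw : w ∈ ann a b) : w ≠ 0 := by
  rintro rfl
  have := hw.1
  simp at this
  linarith

/-- holomorphic functions on annuli from periodic functions on strips -/
lemma descend {a b : ℝ} (ha : 0 ≤ a) {H : ℂ → ℂ} (hH : DifferentiableOn ℂ H (strip a b))
    (hper : ∀ ζ ∈ strip a b, H (ζ + 2 * Real.pi * I) = H ζ) :
    ∃ k : ℂ → ℂ, DifferentiableOn ℂ k (ann a b) ∧ ∀ ζ ∈ strip a b, k (exp ζ) = H ζ := by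
  have hperz : ∀ n : ℕ, ∀ ζ ∈ strip a b, H (ζ + n * (2 * Real.pi * I)) = H ζ ∧
      ζ + n * (2 * Real.pi * I) ∈ strip a b := by
    intro n
    induction n with
    | zero => intro ζ h; simpa using h
    | succ n ih =>
      intro ζ h
      have e : ζ + (n + 1 : ℕ) * (2 * Real.pi * I) = (ζ + n * (2 * Real.pi * I)) + 2 * Real.pi * I := by
        push_cast; ring
      rw [e]
      exact ⟨(hper _ (ih ζ h).2).trans (ih ζ h).1, strip_add.2 (ih ζ h).2⟩
  have hkey : ∀ ζ ∈ strip a b, ∀ ζ' ∈ strip a b, exp ζ = exp ζ' → H ζ = H ζ' := by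
    intro ζ hζ ζ' hζ' he
    obtain ⟨n, hn⟩ := Complex.exp_eq_exp_iff_exists_int.1 he
    obtain ⟨m, rfl | rfl⟩ := n.eq_nat_or_neg
    · rw [hn]; simpa using (hperz m ζ' hζ').1
    · have : ζ' = ζ + m * (2 * Real.pi * I) := by rw [hn]; push_cast; ring
      rw [this]; exact ((hperz m ζ hζ).1).symm
  have hlog : ∀ w ∈ ann a b, log w ∈ strip a b ∧ exp (log w) = w := by
    intro w hw
    have := Complex.exp_log (ne_zero_of_mem_ann ha hw)
    exact ⟨by simpa [strip, this] using hw, this⟩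
  refine ⟨fun w => H (log w), ?_, ?_⟩
  · intro w hw
    have hw0 := ne_zero_of_mem_ann ha hw
    -- local branch
    have h1 : DifferentiableAt ℂ (fun y => log w + log (y / w)) w := by
      refine DifferentiableAt.const_add _ (DifferentiableAt.clog (by fun_prop) ?_)
      rw [div_self hw0]; exact Complex.one_mem_slitPlane
    have e1 : log w + log (w / w) = log w := by rw [div_self hw0]; simp
    have h2 : DifferentiableAt ℂ (fun y => H (log w + log (y / w))) w := by
      refine DifferentiableAt.comp w (f := fun y => log w + log (y / w)) ?_ h1
      rw [e1]
      exact (hH _ (hlog w hw).1).differentiableAt ((isOpen_strip a b).mem_nhds (hlog w hw).1)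
    refine (h2.congr_of_eventuallyEq ?_).differentiableWithinAt
    filter_upwards [(isOpen_ann a b).mem_nhds hw] with y hy
    have hy0 := ne_zero_of_mem_ann ha hy
    have e2 : exp (log w + log (y / w)) = y := by
      rw [Complex.exp_add, Complex.exp_log hw0, Complex.exp_log (div_ne_zero hy0 hw0)]
      field_simp
    refine hkey _ (hlog y hy).1 _ (by simpa [strip, e2] using hy) ?_
    rw [e2, (hlog y hy).2]
  · intro ζ hζ
    exact hkey _ (hlog _ hζ).1 _ hζ (hlog _ hζ).2

/-- Structure of zero-free functions on annuli. -/
lemma exists_hasW {a b : ℝ} (ha : 0 ≤ a) {h : ℂ → ℂ} (hh : DifferentiableOn ℂ h (ann a b))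
    (h0 : ∀ w ∈ ann a b, h w ≠ 0) : ∃ n : ℤ, HasW h a b n := by
  rcases le_or_gt b a with hab | hab
  · have : ∀ w, w ∉ ann a b := fun w hw => by have := hw.1.trans hw.2; linarith
    exact ⟨0, fun _ => 0, fun w hw => absurd hw (this w), fun w hw => absurd hw (this w)⟩
  obtain ⟨H, hHc, hHe⟩ := exists_clog (convex_strip a b) (strip_nonempty ha hab) (isOpen_strip a b)
    (g := fun ζ => h (exp ζ)) (hh.continuousOn.comp Complex.continuous_exp.continuousOn
      (fun ζ hζ => hζ)) (fun ζ hζ => h0 _ hζ)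
  have hHd : DifferentiableOn ℂ H (strip a b) := by
    intro ζ hζ
    have hn := (isOpen_strip a b).mem_nhds hζ
    refine (differentiableAt_of_exp (hHc.continuousAt hn) ?_).differentiableWithinAt
    have : DifferentiableAt ℂ (fun ζ => h (exp ζ)) ζ :=
      DifferentiableAt.comp ζ ((hh _ hζ).differentiableAt ((isOpen_ann a b).mem_nhds hζ))
        Complex.differentiable_exp.differentiableAt
    refine this.congr_of_eventuallyEq ?_
    filter_upwards [hn] with y hy using hHe y hy
  obtain ⟨n, hn⟩ := eq_const_of_exp_eq_one (convex_strip a b).isPreconnected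
    (D := fun ζ => H (ζ + 2 * Real.pi * I) - H ζ)
    (ContinuousOn.sub (hHc.comp (by fun_prop) fun ζ hζ => strip_add.2 hζ) hHc)
    (by
      intro ζ hζ
      rw [Complex.exp_sub, hHe _ hζ, hHe _ (strip_add.2 hζ), Complex.exp_periodic ζ]
      exact div_self (h0 _ hζ))
  obtain ⟨k, hk, hke⟩ := descend ha (H := fun ζ => H ζ - n * ζ) (hHd.sub (by fun_prop))
    (by intro ζ hζ; have := hn ζ hζ; beta_reduce at this; linear_combination this)
  refine ⟨n, k, hk, fun w hw => ?_⟩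
  have hw0 := ne_zero_of_mem_ann ha hw
  have e : exp (log w) = w := Complex.exp_log hw0
  have hs : log w ∈ strip a b := by simpa [strip, e] using hw
  have h1 := hke _ hs
  have h2 := hHe _ hs
  rw [e] at h1
  simp only [e] at h2
  rw [h1, Complex.exp_sub, h2, Complex.exp_int_mul, e]
  field_simp

lemma HasW.mono {h : ℂ → ℂ} {a b a' b' : ℝ} {n : ℤ} (hw : HasW h a b n) (h1 : a ≤ a')
    (h2 : b' ≤ b) : HasW h a' b' n := by
  obtain ⟨k, hk, he⟩ := hw
  exact ⟨k, hk.mono (ann_mono h1 h2), fun w hw => he w (ann_mono h1 h2 hw)⟩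

lemma HasW.congr {h h' : ℂ → ℂ} {a b : ℝ} {n : ℤ} (hw : HasW h a b n)
    (he : ∀ w ∈ ann a b, h' w = h w) : HasW h' a b n := by
  obtain ⟨k, hk, hke⟩ := hw
  exact ⟨k, hk, fun w hw => (he w hw).trans (hke w hw)⟩

lemma HasW.mul {h h' : ℂ → ℂ} {a b : ℝ} {n m : ℤ} (ha : 0 ≤ a) (hw : HasW h a b n)
    (hw' : HasW h' a b m) : HasW (fun w => h w * h' w) a b (n + m) := by
  obtain ⟨k, hk, hke⟩ := hw
  obtain ⟨k', hk', hke'⟩ := hw'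
  refine ⟨fun w => k w + k' w, hk.add hk', fun w hw => ?_⟩
  beta_reduce
  rw [hke w hw, hke' w hw, zpow_add₀ (ne_zero_of_mem_ann ha hw), Complex.exp_add]
  ring

lemma HasW.zpow {h : ℂ → ℂ} {a b : ℝ} {n : ℤ} (hw : HasW h a b n) (m : ℤ) :
    HasW (fun w => h w ^ m) a b (n * m) := by
  obtain ⟨k, hk, hke⟩ := hw
  refine ⟨fun w => m * k w, hk.const_mul _, fun w hw => ?_⟩
  beta_reduce
  rw [hke w hw, mul_zpow, zpow_mul, Complex.exp_int_mul]

/-- The integral of the logarithmic derivative. -/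
lemma HasW.integral {h : ℂ → ℂ} {a b r : ℝ} {n : ℤ} (ha : 0 ≤ a) (h1 : a < r) (h2 : r < b)
    (hw : HasW h a b n) : (∮ w in C(0, r), deriv h w / h w) = 2 * Real.pi * I * n := by
  obtain ⟨k, hk, hke⟩ := hw
  have hr : 0 < r := by linarith
  have hkd : DifferentiableOn ℂ (deriv k) (ann a b) := hk.deriv (isOpen_ann a b)
  have e : ∀ w ∈ sphere (0:ℂ) r, deriv h w / h w = n * (w - 0)⁻¹ + deriv k w := by
    intro w hw
    have hwa := sphere_subset_ann h1 h2 hw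
    have hw0 := ne_zero_of_mem_ann ha hwa
    have hn := (isOpen_ann a b).mem_nhds hwa
    have hd : HasDerivAt (fun w => w ^ n * exp (k w))
        ((n * w ^ (n - 1)) * exp (k w) + w ^ n * (exp (k w) * deriv k w)) w :=
      (hasDerivAt_zpow n w (Or.inl hw0)).mul
        (((hk _ hwa).differentiableAt hn).hasDerivAt.cexp)
    have : deriv h w = (n * w ^ (n - 1)) * exp (k w) + w ^ n * (exp (k w) * deriv k w) := by
      rw [← hd.deriv]
      apply Filter.EventuallyEq.deriv_eq
      filter_upwards [hn] with y hy using hke y hy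
    rw [this, hke w hwa, zpow_sub_one₀ hw0]
    have := Complex.exp_ne_zero (k w)
    have := zpow_ne_zero n hw0
    field_simp
    ring
  rw [circleIntegral.integral_congr hr.le e, circleIntegral.integral_add]
  · rw [circleIntegral.integral_const_mul, circleIntegral.integral_sub_center_inv _ hr.ne']
    have : (∮ w in C(0, r), deriv k w) = 0 := by
      apply circleIntegral.integral_eq_zero_of_hasDerivWithinAt hr.le (f := k)
      intro w hw
      have hwa := sphere_subset_ann h1 h2 hw
      exact ((hk _ hwa).differentiableAt ((isOpen_ann a b).mem_nhds hwa)).hasDerivAt.hasDerivWithinAt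
    rw [this]; ring
  · refine ContinuousOn.circleIntegrable hr.le ?_
    refine ContinuousOn.mul continuousOn_const (ContinuousOn.inv₀ (by fun_prop) fun w hw => ?_)
    simpa using ne_zero_of_mem_ann ha (sphere_subset_ann h1 h2 hw)
  · exact (hkd.continuousOn.mono (sphere_subset_ann h1 h2)).circleIntegrable hr.le

lemma HasW.unique {h : ℂ → ℂ} {a b a' b' r : ℝ} {n m : ℤ} (ha : 0 ≤ a) (ha' : 0 ≤ a') (h1 : a < r)
    (h2 : r < b) (h1' : a' < r) (h2' : r < b')
    (hw : HasW h a b n) (hw' : HasW h a' b' m) : n = m := by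
  have := (hw.integral ha h1 h2).symm.trans (hw'.integral ha' h1' h2')
  have h2 := mul_left_cancel₀ Complex.two_pi_I_ne_zero this
  exact_mod_cast h2

/-- logarithmic means -/
lemma HasW.mean_log {h : ℂ → ℂ} {a b : ℝ} {n : ℤ} (ha : 0 ≤ a) (hw : HasW h a b n) :
    ∃ c : ℝ, ∀ r, a < r → r < b →
      (∫ θ in (0:ℝ)..2 * Real.pi, Real.log ‖h (circleMap 0 r θ)‖) = 2 * Real.pi * n * Real.log r + c := by
  obtain ⟨k, hk, hke⟩ := hw
  rcases le_or_gt b a with hab | hab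
  · exact ⟨0, fun r h1 h2 => by linarith⟩
  obtain ⟨s, hs1, hs2⟩ := exists_between hab
  have hkw : DifferentiableOn ℂ (fun w => k w / w) (ann a b) :=
    hk.div differentiableOn_id fun w hw => ne_zero_of_mem_ann ha hw
  have hInt : ∀ r, a < r → r < b → (∮ w in C(0, r), k w / w) =
      I * ∫ θ in (0:ℝ)..2 * Real.pi, k (circleMap 0 r θ) := by
    intro r h1 h2
    have hr : 0 < r := by linarith
    rw [circleIntegral, ← intervalIntegral.integral_const_mul]
    congr 1; ext θ
    have : circleMap 0 r θ ≠ 0 := circleMap_ne_center hr.ne'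
    simp only [deriv_circleMap, smul_eq_mul]
    field_simp
  refine ⟨(∫ θ in (0:ℝ)..2 * Real.pi, k (circleMap 0 s θ)).re, fun r h1 h2 => ?_⟩
  have hr : 0 < r := by linarith
  have hcont : Continuous fun θ => k (circleMap 0 r θ) :=
    RingSys.cont_circle hr (hk.continuousOn.mono (sphere_subset_ann h1 h2))
  have e1 : ∀ θ : ℝ, Real.log ‖h (circleMap 0 r θ)‖ = n * Real.log r + (k (circleMap 0 r θ)).re := by
    intro θ
    have hwa := circleMap_mem_ann hr h1 h2 θ
    rw [hke _ hwa, norm_mul, norm_zpow, Complex.norm_exp, norm_circleMap_zero, abs_of_pos hr,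
      Real.log_mul (zpow_ne_zero _ hr.ne') (Real.exp_ne_zero _), Real.log_exp, Real.log_zpow]
  have e2 : (∫ θ in (0:ℝ)..2 * Real.pi, (k (circleMap 0 r θ)).re) =
      (∫ θ in (0:ℝ)..2 * Real.pi, k (circleMap 0 r θ)).re := by
    exact Complex.reCLM.intervalIntegral_comp_comm (hcont.intervalIntegrable _ _)
  have hrec : Continuous fun θ => (k (circleMap 0 r θ)).re := Complex.continuous_re.comp hcont
  simp only [e1]
  rw [intervalIntegral.integral_add intervalIntegrable_const
    (hrec.intervalIntegrable _ _), e2]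
  have := circleIntegral_deform ha hs1 hs2 h1 h2 hkw
  rw [hInt r h1 h2, hInt s hs1 hs2] at this
  rw [mul_left_cancel₀ Complex.I_ne_zero this]
  simp
  ring

end ACap

namespace ACap

lemma isPreconnected_ann {a b : ℝ} (ha : 0 ≤ a) : IsPreconnected (ann a b) := by
  have : ann a b = exp '' strip a b := by
    ext w
    constructor
    · intro hw
      have e := Complex.exp_log (ne_zero_of_mem_ann ha hw)
      exact ⟨log w, by simpa [strip, e] using hw, e⟩
    · rintro ⟨ζ, hζ, rfl⟩; exact hζ
  rw [this]
  exact (convex_strip a b).isPreconnected.image _ Complex.continuous_exp.continuousOn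

/-- reflection in the unit circle -/
def rfl' (F : ℂ → ℂ) (w : ℂ) : ℂ := (starRingEnd ℂ) (F (((starRingEnd ℂ) w)⁻¹))

lemma conj_inv_mem_ann {R : ℝ} (hR : 0 < R) {w : ℂ} (hw : w ∈ ann R⁻¹ 1) :
    ((starRingEnd ℂ) w)⁻¹ ∈ ann 1 R := by
  have h1 := hw.1
  have h2 := hw.2
  have h0 : 0 < ‖w‖ := lt_trans (inv_pos.2 hR) h1
  rw [mem_ann, norm_inv, RCLike.norm_conj]
  refine ⟨(one_lt_inv₀ h0).2 h2, inv_lt_of_inv_lt₀ hR h1⟩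

lemma rfl'_diffOn {R : ℝ} (hR : 1 < R) {F : ℂ → ℂ} (hF : DifferentiableOn ℂ F (ann 1 R)) :
    DifferentiableOn ℂ (rfl' F) (ann R⁻¹ 1) := by
  intro w hw
  have hR0 : 0 < R := by linarith
  have hw0 : w ≠ 0 := ne_zero_of_mem_ann (inv_pos.2 hR0).le hw
  have hm := conj_inv_mem_ann hR0 hw
  have h1 : DifferentiableAt ℂ (fun z => F z⁻¹) ((starRingEnd ℂ) w) := by
    refine DifferentiableAt.comp _ (f := fun z : ℂ => z⁻¹)
      ((hF _ hm).differentiableAt ((isOpen_ann _ _).mem_nhds hm)) ?_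
    exact differentiableAt_inv ((map_ne_zero _).2 hw0)
  have h2 := h1.conj_conj
  rw [Complex.conj_conj] at h2
  exact h2.differentiableWithinAt

lemma conj_inv_circleMap {r : ℝ} (θ : ℝ) :
    ((starRingEnd ℂ) (circleMap 0 r⁻¹ θ))⁻¹ = circleMap 0 r θ := by
  simp [circleMap, ← Complex.exp_conj, ← Complex.exp_neg, mul_comm]

lemma circ_cont {F : ℂ → ℂ} {R r : ℝ} (h1 : 1 < r) (h2 : r < R) (hF : DifferentiableOn ℂ F (ann 1 R)) :
    Continuous fun θ => F (circleMap 0 r θ) :=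
  RingSys.cont_circle (by linarith) (hF.continuousOn.mono (sphere_subset_ann h1 h2))

lemma reflect_aux {R : ℝ} {F : ℂ → ℂ} (hF : DifferentiableOn ℂ F (ann 1 R))
    (C : ℝ) {r δ : ℝ} (hδ : 0 < δ) (hr1 : 1 < r) (hr2 : r < R) {w : ℂ} (hw1 : δ ≤ |r - ‖w‖|)
    (hw2 : δ ≤ |r⁻¹ - ‖w‖|)
    (hbd : (∫ θ in (0:ℝ)..2 * Real.pi, ‖F (circleMap 0 r θ)‖) ≤ C) :
    ‖(∮ z in C(0, r), F z / (z - w)) - ∮ z in C(0, r⁻¹), rfl' F z / (z - w)‖ ≤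
      C * (‖w‖ * (r - r⁻¹) / δ ^ 2) +
        (2 / δ) * ∫ θ in (0:ℝ)..2 * Real.pi, |(F (circleMap 0 r θ)).im| := by
  have hr0 : 0 < r := by linarith
  have hri : r⁻¹ < 1 := inv_lt_one_of_one_lt₀ hr1
  have hri0 : 0 < r⁻¹ := inv_pos.2 hr0
  have hFc := circ_cont hr1 hr2 hF
  have hd : ∀ s, 0 < s → δ ≤ |s - ‖w‖| → ∀ θ, δ ≤ ‖circleMap 0 s θ - w‖ := by
    intro s hs h θ
    refine h.trans ?_
    have := abs_norm_sub_norm_le (circleMap 0 s θ) w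
    rwa [norm_circleMap_zero, abs_of_pos hs] at this
  have hd1 := hd r hr0 hw1
  have hd2 := hd r⁻¹ hri0 hw2
  have hn1 : ∀ θ, circleMap 0 r θ - w ≠ 0 := fun θ => norm_pos_iff.1 (hδ.trans_le (hd1 θ))
  have hn2 : ∀ θ, circleMap 0 r⁻¹ θ - w ≠ 0 := fun θ => norm_pos_iff.1 (hδ.trans_le (hd2 θ))
  have hM0 : 0 ≤ ‖w‖ * (r - r⁻¹) / δ ^ 2 := by
    have : 0 ≤ r - r⁻¹ := by linarith
    positivity
  have hci : Continuous fun θ => (F (circleMap 0 r θ)).im := Complex.continuous_im.comp hFc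
  rw [circleIntegral, circleIntegral, ← intervalIntegral.integral_sub]
  · refine (intervalIntegral.norm_integral_le_integral_norm Real.two_pi_pos.le).trans ?_
    have hle : (∫ θ in (0:ℝ)..2 * Real.pi, ‖deriv (circleMap 0 r) θ • (F (circleMap 0 r θ) / (circleMap 0 r θ - w)) -
        deriv (circleMap 0 r⁻¹) θ • (rfl' F (circleMap 0 r⁻¹ θ) / (circleMap 0 r⁻¹ θ - w))‖) ≤
        ∫ θ in (0:ℝ)..2 * Real.pi, (‖F (circleMap 0 r θ)‖ * (‖w‖ * (r - r⁻¹) / δ ^ 2) +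
          (2 / δ) * |(F (circleMap 0 r θ)).im|) := by
      refine intervalIntegral.integral_mono_on Real.two_pi_pos.le ?_ ?_ ?_
      · refine Continuous.intervalIntegrable ?_ _ _
        refine (Continuous.sub ?_ ?_).norm
        · simp only [deriv_circleMap]
          exact ((continuous_circleMap 0 r).mul continuous_const).smul (hFc.div (by fun_prop) hn1)
        · simp only [deriv_circleMap, rfl', conj_inv_circleMap]
          exact ((continuous_circleMap 0 r⁻¹).mul continuous_const).smul
            ((Complex.continuous_conj.comp hFc).div (by fun_prop) hn2)
      · exact Continuous.intervalIntegrable ((hFc.norm.mul continuous_const).add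
          (continuous_const.mul hci.abs)) _ _
      · intro θ _
        simp only [deriv_circleMap, rfl', conj_inv_circleMap, smul_eq_mul]
        set c := circleMap 0 r θ
        set s := circleMap 0 r⁻¹ θ with hs
        have h1 : c - w ≠ 0 := hn1 θ
        have h2 : s - w ≠ 0 := hn2 θ
        have hconj : (starRingEnd ℂ) (F c) = F c - 2 * (F c).im * I := by
          apply Complex.ext <;> simp; ring
        have e : c * I * (F c / (c - w)) - s * I * ((starRingEnd ℂ) (F c) / (s - w)) =
            F c * (I * (w * (s - c) / ((c - w) * (s - w)))) + (F c).im * (2 * I * I * s / (s - w)) := by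
          rw [hconj]; field_simp; ring
        rw [e]
        have hcs : ‖s - c‖ = r - r⁻¹ := by
          have : s - c = ((r⁻¹ - r : ℝ) : ℂ) * exp (θ * I) := by
            simp [s, c, circleMap]; ring
          rw [this, norm_mul, Complex.norm_exp_ofReal_mul_I, Complex.norm_real, mul_one,
            Real.norm_eq_abs, abs_sub_comm, abs_of_pos (by linarith)]
        have hsn : ‖s‖ = r⁻¹ := by simp [s, abs_of_pos hr0]
        refine (norm_add_le _ _).trans (add_le_add ?_ ?_)
        · rw [norm_mul]
          gcongr
          rw [norm_mul, norm_I, one_mul, norm_div, norm_mul, norm_mul, hcs, sq]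
          have : 0 ≤ r - r⁻¹ := by linarith
          gcongr
          · exact hd1 θ
          · exact hd2 θ
        · rw [norm_mul, Complex.norm_real, Real.norm_eq_abs, mul_comm]
          gcongr
          rw [norm_div]
          simp only [norm_mul, norm_I, mul_one, hsn, Complex.norm_ofNat]
          gcongr
          · linarith
          · exact hd2 θ
    refine hle.trans ?_
    rw [intervalIntegral.integral_add ((hFc.norm.intervalIntegrable _ _).mul_const _)
      ((hci.abs.intervalIntegrable _ _).const_mul _), intervalIntegral.integral_const_mul,
      intervalIntegral.integral_mul_const]
    gcongr
  · refine Continuous.intervalIntegrable ?_ _ _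
    simp only [deriv_circleMap]
    exact ((continuous_circleMap 0 r).mul continuous_const).smul (hFc.div (by fun_prop) hn1)
  · refine Continuous.intervalIntegrable ?_ _ _
    simp only [deriv_circleMap, rfl', conj_inv_circleMap]
    exact ((continuous_circleMap 0 r⁻¹).mul continuous_const).smul
            ((Complex.continuous_conj.comp hFc).div (by fun_prop) hn2)

lemma diffOn_div_sub {a b : ℝ} {F : ℂ → ℂ} (hF : DifferentiableOn ℂ F (ann a b)) {w : ℂ}
    (hw : w ∉ ann a b) : DifferentiableOn ℂ (fun z => F z / (z - w)) (ann a b) :=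
  hF.div (by fun_prop) fun z hz h => hw (by rwa [sub_eq_zero.1 h] at hz)

lemma reflect {R : ℝ} (hR : 1 < R) {F : ℂ → ℂ} (hF : DifferentiableOn ℂ F (ann 1 R)) (C : ℝ)
    (hbd : ∀ᶠ r in 𝓝[>] (1:ℝ), (∫ θ in (0:ℝ)..2 * Real.pi, ‖F (circleMap 0 r θ)‖) ≤ C)
    (him : Tendsto (fun r => ∫ θ in (0:ℝ)..2 * Real.pi, |(F (circleMap 0 r θ)).im|)
      (𝓝[>] (1:ℝ)) (𝓝 0)) :
    ∃ ρ, 1 < ρ ∧ ρ < R ∧ ∃ G : ℂ → ℂ, DifferentiableOn ℂ G (ann ρ⁻¹ ρ) ∧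
      (∀ w ∈ ann 1 ρ, G w = F w) ∧ ∀ w ∈ ann ρ⁻¹ 1, G w = rfl' F w := by
  obtain ⟨ρ, h1, h2⟩ := exists_between hR
  have hρ0 : 0 < ρ := by linarith
  have hR0 : 0 < R := by linarith
  have hρi : ρ⁻¹ < 1 := inv_lt_one_of_one_lt₀ h1
  have hρi0 : 0 < ρ⁻¹ := inv_pos.2 hρ0
  have hRρ : R⁻¹ < ρ⁻¹ := inv_strictAnti₀ hρ0 h2
  have hFs := rfl'_diffOn hR hF
  have hRi0 : 0 ≤ R⁻¹ := (inv_pos.2 hR0).le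
  -- the limit
  have hlim : ∀ w : ℂ, ‖w‖ ≠ 1 → Tendsto (fun r : ℝ => (∮ z in C(0, r), F z / (z - w)) -
      ∮ z in C(0, r⁻¹), rfl' F z / (z - w)) (𝓝[>] (1:ℝ)) (𝓝 0) := by
    intro w hw
    obtain ⟨δ, hδ, hδ'⟩ : ∃ δ, 0 < δ ∧ δ < |1 - ‖w‖| :=
      exists_between (abs_pos.2 (sub_ne_zero.2 hw.symm))
    have c1 : ContinuousAt (fun r : ℝ => r⁻¹) 1 := continuousAt_inv₀ one_ne_zero
    have t1 : Tendsto (fun r : ℝ => |r - ‖w‖|) (𝓝[>] (1:ℝ)) (𝓝 (|1 - ‖w‖|)) :=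
      (ContinuousAt.tendsto (by fun_prop)).mono_left nhdsWithin_le_nhds
    have t2 : Tendsto (fun r : ℝ => |r⁻¹ - ‖w‖|) (𝓝[>] (1:ℝ)) (𝓝 (|1 - ‖w‖|)) := by
      have : ContinuousAt (fun r : ℝ => |r⁻¹ - ‖w‖|) 1 := by fun_prop
      simpa using this.tendsto.mono_left nhdsWithin_le_nhds
    refine squeeze_zero_norm' (a := fun r => C * (‖w‖ * (r - r⁻¹) / δ ^ 2) +
        (2 / δ) * ∫ θ in (0:ℝ)..2 * Real.pi, |(F (circleMap 0 r θ)).im|) ?_ ?_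
    · filter_upwards [t1.eventually_const_le hδ', t2.eventually_const_le hδ', hbd,
        Ioo_mem_nhdsGT hR] with r ha hb hc hd
      exact reflect_aux hF C hδ hd.1 hd.2 ha hb hc
    · have t3 : Tendsto (fun r : ℝ => C * (‖w‖ * (r - r⁻¹) / δ ^ 2)) (𝓝[>] (1:ℝ)) (𝓝 0) := by
        have : ContinuousAt (fun r : ℝ => C * (‖w‖ * (r - r⁻¹) / δ ^ 2)) 1 := by fun_prop
        simpa using this.tendsto.mono_left nhdsWithin_le_nhds
      simpa using t3.add (him.const_mul (2 / δ))
  have hFcρ := circ_cont h1 h2 hF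
  refine ⟨ρ, h1, h2, fun w => (2 * Real.pi * I)⁻¹ * ((∮ z in C(0, ρ), F z / (z - w)) -
      ∮ z in C(0, ρ⁻¹), rfl' F z / (z - w)), ?_, ?_, ?_⟩
  · intro w hw
    refine DifferentiableAt.differentiableWithinAt ?_
    refine DifferentiableAt.const_mul (DifferentiableAt.sub ?_ ?_) _
    · have := cauchyInt_hasDerivAt (a := 0) (b := 2 * Real.pi) (z := w)
        (φ := fun θ => circleMap 0 ρ θ * I * F (circleMap 0 ρ θ)) (c := circleMap 0 ρ)
        (((continuous_circleMap 0 ρ).mul continuous_const).mul hFcρ)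
        (by fun_prop) (by
          intro t _ h
          have := hw.2
          rw [← h, norm_circleMap_zero, abs_of_pos hρ0] at this
          exact lt_irrefl _ this)
      refine this.differentiableAt.congr_of_eventuallyEq (Eventually.of_forall fun z => ?_)
      simp only [circleIntegral, deriv_circleMap, smul_eq_mul, mul_div_assoc]
    · have hcc : Continuous fun θ => (starRingEnd ℂ) (F (circleMap 0 ρ θ)) :=
        Complex.continuous_conj.comp hFcρ
      have := cauchyInt_hasDerivAt (a := 0) (b := 2 * Real.pi) (z := w)
        (φ := fun θ => circleMap 0 ρ⁻¹ θ * I * (starRingEnd ℂ) (F (circleMap 0 ρ θ)))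
        (c := circleMap 0 ρ⁻¹) (((continuous_circleMap 0 ρ⁻¹).mul continuous_const).mul hcc)
        (by fun_prop) (by
          intro t _ h
          have := hw.1
          rw [← h, norm_circleMap_zero, abs_of_pos hρi0] at this
          exact lt_irrefl _ this)
      refine this.differentiableAt.congr_of_eventuallyEq (Eventually.of_forall fun z => ?_)
      simp only [circleIntegral, deriv_circleMap, smul_eq_mul, mul_div_assoc, rfl',
        conj_inv_circleMap]
  · intro w hw
    have hl := hlim w hw.1.ne'
    have : Tendsto (fun r : ℝ => (∮ z in C(0, r), F z / (z - w)) -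
      ∮ z in C(0, r⁻¹), rfl' F z / (z - w)) (𝓝[>] (1:ℝ)) (𝓝 ((∮ z in C(0, ρ), F z / (z - w)) -
      (∮ z in C(0, ρ⁻¹), rfl' F z / (z - w)) - 2 * Real.pi * I * F w)) := by
      refine tendsto_const_nhds.congr' ?_
      filter_upwards [Ioo_mem_nhdsGT hw.1] with r hr
      have hr0 : 0 < r := by linarith [hr.1]
      have e1 := annulus_cauchy zero_le_one hr.1 h2 hF (w := w) ⟨hr.2, hw.2⟩
      have e2 := circleIntegral_deform hRi0 (r := ρ⁻¹) (R := r⁻¹) hRρ hρi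
        (inv_strictAnti₀ hr0 (hr.2.trans (hw.2.trans h2)))
        (inv_lt_one_of_one_lt₀ hr.1) (diffOn_div_sub hFs (w := w) fun h => by linarith [h.2, hw.1])
      rw [← e1, e2]; ring
    have h0 := tendsto_nhds_unique this hl
    beta_reduce
    rw [sub_eq_zero.1 h0]
    field_simp
  · intro w hw
    have hl := hlim w hw.2.ne
    have : Tendsto (fun r : ℝ => (∮ z in C(0, r), F z / (z - w)) -
      ∮ z in C(0, r⁻¹), rfl' F z / (z - w)) (𝓝[>] (1:ℝ)) (𝓝 ((∮ z in C(0, ρ), F z / (z - w)) -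
      (∮ z in C(0, ρ⁻¹), rfl' F z / (z - w)) - 2 * Real.pi * I * rfl' F w)) := by
      refine tendsto_const_nhds.congr' ?_
      have hw0 : 0 < ‖w‖ := hρi0.trans hw.1
      have h1w : 1 < ‖w‖⁻¹ := (one_lt_inv₀ hw0).2 hw.2
      filter_upwards [Ioo_mem_nhdsGT h1w] with r hr
      have hr0 : 0 < r := by linarith [hr.1]
      have hrρ : r < ρ := hr.2.trans (inv_lt_of_inv_lt₀ hρ0 hw.1)
      have e1 := annulus_cauchy hRi0 hRρ (inv_lt_one_of_one_lt₀ hr.1) hFs (w := w)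
        ⟨hw.1, by rw [lt_inv_comm₀ hw0 hr0]; exact hr.2⟩
      have e2 := circleIntegral_deform zero_le_one (r := r) (R := ρ) hr.1 (hrρ.trans h2) h1 h2
        (diffOn_div_sub hF (w := w) fun h => by linarith [h.1, hw.2])
      rw [← e1, e2]; ring
    have h0 := tendsto_nhds_unique this hl
    beta_reduce
    rw [sub_eq_zero.1 h0]
    field_simp

end ACap

namespace ACap

lemma posLog_conv {r x : ℝ} (hr : 0 < r) (hx : 0 ≤ x) :
    2 * Real.posLog x ≤ Real.posLog (r⁻¹ * x) + Real.posLog (r * x) := by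
  rcases le_or_gt x 1 with h | h
  · rw [Real.posLog_eq_zero_iff x |>.2 (by rw [abs_of_nonneg hx]; exact h)]
    have := Real.posLog_nonneg (x := r⁻¹ * x)
    have := Real.posLog_nonneg (x := r * x)
    linarith
  · rw [Real.posLog_eq_log (by rw [abs_of_nonneg hx]; exact h.le)]
    have h1 : Real.log (r⁻¹ * x) ≤ Real.posLog (r⁻¹ * x) := le_max_right _ _
    have h2 : Real.log (r * x) ≤ Real.posLog (r * x) := le_max_right _ _
    rw [Real.log_mul (by positivity) (by positivity), Real.log_inv] at h1
    rw [Real.log_mul (by positivity) (by positivity)] at h2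
    linarith

lemma ann_eventually_ne {a b : ℝ} (ha : 0 ≤ a) {G : ℂ → ℂ} (hG : DifferentiableOn ℂ G (ann a b))
    (hne : ∃ w ∈ ann a b, G w ≠ 0) {u : ℂ} (hu : u ∈ ann a b) : ∀ᶠ z in 𝓝[≠] u, G z ≠ 0 := by
  have hA : AnalyticOnNhd ℂ G (ann a b) := hG.analyticOnNhd (isOpen_ann a b)
  by_contra hcon
  rw [Filter.not_eventually] at hcon
  simp only [not_not] at hcon
  obtain ⟨w, hw, hw0⟩ := hne
  exact hw0 (hA.eqOn_zero_of_preconnected_of_frequently_eq_zero (isPreconnected_ann ha) hu hcon hw)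

/-- the logarithmic mean of `G` -/
def lm (G : ℂ → ℂ) (r : ℝ) : ℝ := ∫ θ in (0:ℝ)..2 * Real.pi, Real.log ‖G (circleMap 0 r θ)‖

lemma lm_eq (G : ℂ → ℂ) (r : ℝ) :
    lm G r = 2 * Real.pi * Real.circleAverage (fun z => Real.log ‖G z‖) 0 r := by
  rw [lm, Real.circleAverage, smul_eq_mul]
  field_simp

lemma lm_convex {ρ : ℝ} (hρ : 1 < ρ) {G : ℂ → ℂ} (hG : DifferentiableOn ℂ G (ann ρ⁻¹ ρ))
    (hne : ∃ w ∈ ann ρ⁻¹ ρ, G w ≠ 0) {r : ℝ} (hr : 1 < r) (hrρ : r < ρ) :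
    2 * lm G 1 ≤ lm G r + lm G r⁻¹ := by
  obtain ⟨s, hs1, hs2⟩ := exists_between hrρ
  have hs0 : 0 < s := by linarith
  have hρ0 : 0 < ρ := by linarith
  have hr0 : 0 < r := by linarith
  have hi1 : ρ⁻¹ < s⁻¹ := inv_strictAnti₀ hs0 hs2
  have hi2 : s⁻¹ < r⁻¹ := inv_strictAnti₀ hr0 hs1
  have hi3 : r⁻¹ < 1 := inv_lt_one_of_one_lt₀ hr
  have hρi : 0 ≤ ρ⁻¹ := (inv_pos.2 hρ0).le
  have hsub : cann s⁻¹ s ⊆ ann ρ⁻¹ ρ := cann_subset_ann hi1 hs2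
  have hA : AnalyticOnNhd ℂ G (cann s⁻¹ s) := (hG.analyticOnNhd (isOpen_ann _ _)).mono hsub
  have hM : MeromorphicOn G (cann s⁻¹ s) := hA.meromorphicOn
  have hord : ∀ u : cann s⁻¹ s, meromorphicOrderAt G u ≠ ⊤ := by
    intro u h
    rw [meromorphicOrderAt_eq_top_iff] at h
    obtain ⟨z, hz⟩ := (h.and (ann_eventually_ne hρi hG hne (hsub u.2))).exists
    exact hz.2 hz.1
  have hfin := (MeromorphicOn.divisor G (cann s⁻¹ s)).finiteSupport (isCompact_cann _ _)
  obtain ⟨g, hg, hg0, hge⟩ := hM.extract_zeros_poles hord hfin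
  have hlog := MeromorphicOn.extract_zeros_poles_log hg0 hge
  set D := MeromorphicOn.divisor G (cann s⁻¹ s) with hD
  have hDnn : ∀ u, 0 ≤ D u := fun u => (MeromorphicOn.AnalyticOnNhd.divisor_nonneg hA) u
  obtain ⟨n, hn⟩ := exists_hasW (inv_pos.2 hs0).le (a := s⁻¹) (b := s) (h := g)
    (fun w hw => (hg w (ann_subset_cann _ _ hw)).differentiableAt.differentiableWithinAt)
    (fun w hw => hg0 ⟨w, ann_subset_cann _ _ hw⟩)
  obtain ⟨c, hc⟩ := hn.mean_log (inv_pos.2 hs0).le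
  have key : ∀ t, s⁻¹ < t → t < s → lm G t =
      2 * Real.pi * ∑ u ∈ hfin.toFinset, (D u : ℝ) * (Real.log t + Real.posLog (t⁻¹ * ‖u‖)) +
        (2 * Real.pi * n * Real.log t + c) := by
    intro t ht1 ht2
    have ht0 : 0 < t := (inv_pos.2 hs0).trans ht1
    have hsph : sphere (0:ℂ) |t| ⊆ cann s⁻¹ s := by
      rw [abs_of_pos ht0]; exact (sphere_subset_ann ht1 ht2).trans (ann_subset_cann _ _)
    have e1 : Real.circleAverage (fun z => Real.log ‖G z‖) 0 t = _ :=
      Real.circleAverage_congr_codiscreteWithin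
        (hlog.filter_mono (Filter.codiscreteWithin_mono hsph)) ht0.ne'
    have hsup : Function.support (fun u => ((D u : ℝ) * Real.log ‖· - u‖ : ℂ → ℝ)) ⊆ hfin.toFinset := by
      intro u hu
      simp only [Finite.coe_toFinset, Function.mem_support]
      intro h0
      apply hu
      ext z
      simp [h0]
    rw [finsum_eq_sum_of_support_subset _ hsup] at e1
    have hci : ∀ u ∈ hfin.toFinset, CircleIntegrable (fun z => (D u : ℝ) * Real.log ‖z - u‖) 0 t :=
      fun u _ => (circleIntegrable_log_norm_sub_const (a := u) (c := 0) t).const_mul (D u : ℝ)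
    have hgi : CircleIntegrable (fun z => Real.log ‖g z‖) 0 t :=
      MeromorphicOn.circleIntegrable_log_norm (fun z hz => (hg z (hsph hz)).meromorphicAt)
    rw [Real.circleAverage_add (CircleIntegrable.sum _ hci) hgi, Real.circleAverage_sum hci] at e1
    rw [lm_eq, e1, mul_add]
    congr 1
    · congr 1
      refine Finset.sum_congr rfl fun u _ => ?_
      have := Real.circleAverage_fun_smul (a := (D u : ℝ)) (f := fun z : ℂ => Real.log ‖z - u‖) (c := 0)
        (R := t)
      simp only [smul_eq_mul] at this
      rw [this, circleAverage_log_norm_sub_const_eq_log_radius_add_posLog ht0.ne']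
      simp
    · rw [← hc t ht1 ht2, ← lm_eq]; rfl
  have hi4 : (1:ℝ) < s := by linarith
  rw [key 1 (by linarith) hi4, key r (by linarith) hs1, key r⁻¹ hi2 (by linarith)]
  have hsum : 2 * ∑ u ∈ hfin.toFinset, (D u : ℝ) * (Real.log 1 + Real.posLog (1⁻¹ * ‖u‖)) ≤
     ∑ u ∈ hfin.toFinset, (D u : ℝ) * (Real.log r + Real.posLog (r⁻¹ * ‖u‖)) +
     ∑ u ∈ hfin.toFinset, (D u : ℝ) * (Real.log r⁻¹ + Real.posLog (r⁻¹⁻¹ * ‖u‖)) := by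
    rw [Finset.mul_sum, ← Finset.sum_add_distrib]
    refine Finset.sum_le_sum fun u _ => ?_
    have h1 := posLog_conv hr0 (norm_nonneg u)
    have h2 : (0:ℝ) ≤ D u := by exact_mod_cast hDnn u
    rw [Real.log_inv, Real.log_one, inv_inv, inv_one, one_mul]
    nlinarith
  have := mul_le_mul_of_nonneg_left hsum Real.two_pi_pos.le
  rw [Real.log_inv, Real.log_one] at *
  linarith

end ACap

namespace ACap

lemma ae_ne {a b : ℝ} (ha : 0 ≤ a) (ha1 : a < 1) (hb : 1 < b) {G : ℂ → ℂ}
    (hG : DifferentiableOn ℂ G (ann a b)) (hne : ∃ w ∈ ann a b, G w ≠ 0) :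
    ∀ᵐ θ ∂(volume.restrict (uIoc 0 (2 * Real.pi))), G (circleMap 0 1 θ) ≠ 0 := by
  obtain ⟨w, hw, hw0⟩ := hne
  have h1 : G ⁻¹' {0}ᶜ ∈ codiscreteWithin (ann a b) :=
    (hG.analyticOnNhd (isOpen_ann a b)).preimage_zero_mem_codiscreteWithin hw0 hw
      ⟨⟨w, hw⟩, isPreconnected_ann ha⟩
  have hsub : sphere (0:ℂ) |1| ⊆ ann a b := by rw [abs_one]; exact sphere_subset_ann ha1 hb
  have h2 : (fun z => G z ≠ 0) ∈ codiscreteWithin (sphere (0:ℂ) |1|) :=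
    Filter.codiscreteWithin_mono hsub h1
  have h3 := codiscreteWithin_mono (U₁ := uIoc 0 (2 * Real.pi)) (by tauto)
    (circleMap_preimage_codiscrete one_ne_zero h2)
  exact ae_restrict_le_codiscreteWithin measurableSet_uIoc h3

lemma log_lim {g : ℝ → ℝ} (hg : Continuous g) (h0 : ∀ θ ∈ Icc 0 (2 * Real.pi), 0 ≤ g θ)
    (hae : ∀ᵐ θ ∂(volume.restrict (uIoc 0 (2 * Real.pi))), g θ ≠ 0)
    (hInt : IntervalIntegrable (fun θ => Real.log (g θ)) volume 0 (2 * Real.pi)) {c : ℝ}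
    (hc : ∀ ε > 0, c ≤ ∫ θ in (0:ℝ)..2 * Real.pi, Real.log (g θ + ε)) :
    c ≤ ∫ θ in (0:ℝ)..2 * Real.pi, Real.log (g θ) := by
  obtain ⟨M, hM⟩ := (isCompact_Icc (a := (0:ℝ)) (b := 2 * Real.pi)).exists_bound_of_continuousOn
    hg.continuousOn
  have hIcc : ∀ θ ∈ uIoc 0 (2 * Real.pi), θ ∈ Icc 0 (2 * Real.pi) := by
    intro θ hθ
    rw [uIoc_of_le Real.two_pi_pos.le] at hθ
    exact ⟨hθ.1.le, hθ.2⟩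
  have hM0 : 0 ≤ M := (norm_nonneg _).trans (hM 0 ⟨le_rfl, Real.two_pi_pos.le⟩)
  rw [ae_restrict_iff' measurableSet_uIoc] at hae
  have key : Tendsto (fun ε : ℝ => ∫ θ in (0:ℝ)..2 * Real.pi, Real.log (g θ + ε)) (𝓝[>] 0)
      (𝓝 (∫ θ in (0:ℝ)..2 * Real.pi, Real.log (g θ))) := by
    refine intervalIntegral.tendsto_integral_filter_of_dominated_convergence
      (fun θ => |Real.log (g θ)| + |Real.log (M + 1)|) ?_ ?_ (hInt.abs.add intervalIntegrable_const) ?_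
    · refine Eventually.of_forall fun ε => ?_
      exact (Real.measurable_log.comp (hg.measurable.add_const ε)).aestronglyMeasurable
    · filter_upwards [Ioo_mem_nhdsGT (zero_lt_one (α := ℝ))] with ε hε
      filter_upwards [hae] with θ hθ hmem
      have h1 := h0 θ (hIcc θ hmem)
      have h2 : 0 < g θ := lt_of_le_of_ne h1 (hθ hmem).symm
      have h3 := hM θ (hIcc θ hmem)
      rw [Real.norm_eq_abs, abs_of_pos h2] at h3
      have l1 : Real.log (g θ) ≤ Real.log (g θ + ε) := Real.log_le_log h2 (by linarith [hε.1])
      have l2 : Real.log (g θ + ε) ≤ Real.log (M + 1) :=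
        Real.log_le_log (by linarith [hε.1]) (by linarith [hε.2])
      rw [Real.norm_eq_abs, abs_le]
      have := neg_abs_le (Real.log (g θ))
      have := le_abs_self (Real.log (M + 1))
      have := abs_nonneg (Real.log (g θ))
      have := abs_nonneg (Real.log (M + 1))
      constructor <;> linarith
    · filter_upwards [hae] with θ hθ hmem
      have h2 := hθ hmem
      have : ContinuousAt (fun ε : ℝ => Real.log (g θ + ε)) 0 := by
        refine ContinuousAt.log (by fun_prop) (by simpa using h2)
      have := this.tendsto.mono_left (nhdsWithin_le_nhds (s := Ioi 0))
      simpa using this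
  refine ge_of_tendsto key ?_
  filter_upwards [self_mem_nhdsWithin] with ε hε using hc ε hε

lemma circ_unif {ρ : ℝ} (hρ : 1 < ρ) {G : ℂ → ℂ} (hG : DifferentiableOn ℂ G (ann ρ⁻¹ ρ)) {η : ℝ}
    (hη : 0 < η) : ∀ᶠ r in 𝓝[>] (1:ℝ), ∀ θ, ‖G (circleMap 0 r θ) - G (circleMap 0 1 θ)‖ ≤ η := by
  obtain ⟨s, h1, h2⟩ := exists_between hρ
  have hs0 : 0 < s := by linarith
  have hu := (isCompact_cann s⁻¹ s).uniformContinuousOn_of_continuous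
    (hG.continuousOn.mono (cann_subset_ann (inv_strictAnti₀ hs0 h2) h2))
  rw [Metric.uniformContinuousOn_iff] at hu
  obtain ⟨δ, hδ, hu⟩ := hu η hη
  have h1s : (1:ℝ) < min s (1 + δ) := lt_min h1 (by linarith)
  filter_upwards [Ioo_mem_nhdsGT h1s] with r hr θ
  have hr1 : r < s := hr.2.trans_le (min_le_left _ _)
  have hr2 : r < 1 + δ := hr.2.trans_le (min_le_right _ _)
  have hsi : s⁻¹ < 1 := inv_lt_one_of_one_lt₀ h1
  have := hu (circleMap 0 r θ) (ann_subset_cann _ _ (circleMap_mem_ann (by linarith [hr.1])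
    (by linarith [hr.1]) hr1 θ)) (circleMap 0 1 θ) (ann_subset_cann _ _ (circleMap_mem_ann one_pos
    hsi h1 θ)) (by
      rw [dist_eq_norm]
      have : circleMap 0 r θ - circleMap 0 1 θ = ((r - 1 : ℝ) : ℂ) * exp (θ * I) := by
        simp [circleMap]; ring
      rw [this, norm_mul, Complex.norm_exp_ofReal_mul_I, Complex.norm_real, mul_one,
            Real.norm_eq_abs, abs_of_pos (by linarith [hr.1])]
      linarith)
  rw [← dist_eq_norm]; exact this.le

lemma lemX {R : ℝ} (hR : 1 < R) {f Φ : ℂ → ℂ} (hf : DifferentiableOn ℂ f (ann 1 R))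
    (hΦ : DifferentiableOn ℂ Φ (ann 1 R)) (hf1 : ∀ w ∈ ann 1 R, ‖f w‖ < 1)
    (hne : ∃ w ∈ ann 1 R, f w * Φ w ≠ 0)
    (hlim : Tendsto (fun r => ∫ θ in (0:ℝ)..2 * Real.pi, (‖Φ (circleMap 0 r θ)‖ -
      (f (circleMap 0 r θ) * Φ (circleMap 0 r θ)).re)) (𝓝[>] (1:ℝ)) (𝓝 0)) (C : ℝ)
    (hbd : ∀ᶠ r in 𝓝[>] (1:ℝ), (∫ θ in (0:ℝ)..2 * Real.pi, ‖Φ (circleMap 0 r θ)‖) ≤ C) :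
    ∃ R', 1 < R' ∧ R' ≤ R ∧ ∃ n : ℤ, 1 ≤ n ∧ HasW Φ 1 R' n := by
  have hpi := Real.two_pi_pos
  set F : ℂ → ℂ := fun w => f w * Φ w with hFdef
  have hF : DifferentiableOn ℂ F (ann 1 R) := hf.mul hΦ
  have hFΦ : ∀ w ∈ ann 1 R, ‖F w‖ ≤ ‖Φ w‖ := by
    intro w hw
    rw [hFdef, norm_mul]
    exact mul_le_of_le_one_left (norm_nonneg _) (hf1 w hw).le
  have hcF : ∀ r, 1 < r → r < R → Continuous fun θ => F (circleMap 0 r θ) := fun r h1 h2 =>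
    circ_cont h1 h2 hF
  have hcΦ : ∀ r, 1 < r → r < R → Continuous fun θ => Φ (circleMap 0 r θ) := fun r h1 h2 =>
    circ_cont h1 h2 hΦ
  have hmem : ∀ r, 1 < r → r < R → ∀ θ, circleMap 0 r θ ∈ ann 1 R := fun r h1 h2 θ =>
    circleMap_mem_ann (by linarith) h1 h2 θ
  have hC0 : 0 ≤ C := by
    obtain ⟨r, hr⟩ := hbd.exists
    exact (intervalIntegral.integral_nonneg hpi.le fun θ _ => norm_nonneg _).trans hr
  have hreF : ∀ r, 1 < r → r < R → Continuous fun θ => (F (circleMap 0 r θ)).re :=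
    fun r h1 h2 => Complex.continuous_re.comp (hcF r h1 h2)
  -- imaginary part
  have him : Tendsto (fun r => ∫ θ in (0:ℝ)..2 * Real.pi, |(F (circleMap 0 r θ)).im|)
      (𝓝[>] (1:ℝ)) (𝓝 0) := by
    rw [Metric.tendsto_nhds]
    intro ε hε
    obtain ⟨t, ht0, ht⟩ : ∃ t, 0 < t ∧ t * C < ε / 2 := by
      refine ⟨ε / (4 * (C + 1)), by positivity, ?_⟩
      rw [div_mul_eq_mul_div, div_lt_div_iff₀ (by positivity) (by positivity)]
      nlinarith
    have hev := (Metric.tendsto_nhds.1 hlim) (ε / 2 * t) (by positivity)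
    filter_upwards [hev, hbd, Ioo_mem_nhdsGT hR] with r h1 h2 hr
    have hc := hcΦ r hr.1 hr.2
    have hc2 := hreF r hr.1 hr.2
    have hci : Continuous fun θ => |(F (circleMap 0 r θ)).im| :=
      (Complex.continuous_im.comp (hcF r hr.1 hr.2)).abs
    have hi1 : IntervalIntegrable (fun θ => ‖Φ (circleMap 0 r θ)‖) volume 0 (2 * Real.pi) :=
      hc.norm.intervalIntegrable _ _
    have hi2 : IntervalIntegrable (fun θ => ‖Φ (circleMap 0 r θ)‖ - (F (circleMap 0 r θ)).re)
      volume 0 (2 * Real.pi) := hi1.sub (hc2.intervalIntegrable _ _)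
    have hle : (∫ θ in (0:ℝ)..2 * Real.pi, |(F (circleMap 0 r θ)).im|) ≤
        ∫ θ in (0:ℝ)..2 * Real.pi, (t * ‖Φ (circleMap 0 r θ)‖ +
          t⁻¹ * (‖Φ (circleMap 0 r θ)‖ - (F (circleMap 0 r θ)).re)) := by
      refine intervalIntegral.integral_mono_on hpi.le (hci.intervalIntegrable _ _)
        ((hi1.const_mul t).add (hi2.const_mul t⁻¹)) fun θ _ => ?_
      have hb := hFΦ _ (hmem r hr.1 hr.2 θ)
      set x := F (circleMap 0 r θ)
      set p := ‖Φ (circleMap 0 r θ)‖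
      have hx : x.re ^ 2 + x.im ^ 2 = ‖x‖ ^ 2 := by
        rw [← Complex.normSq_eq_norm_sq, Complex.normSq_apply]; ring
      have hre := (Complex.re_le_norm x).trans hb
      have hre' := (abs_le.1 (Complex.abs_re_le_norm x)).1
      have hxn := norm_nonneg x
      apply abs_le_of_sq_le_sq _ (by
        have : 0 ≤ p - x.re := by linarith
        have : 0 ≤ p := by linarith
        positivity)
      have h4 : t * p * (t⁻¹ * (p - x.re)) = p * (p - x.re) := by field_simp
      have h5 : x.im ^ 2 ≤ 2 * (p * (p - x.re)) := by nlinarith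
      nlinarith [sq_nonneg (t * p), sq_nonneg (t⁻¹ * (p - x.re))]
    have hnn : 0 ≤ ∫ θ in (0:ℝ)..2 * Real.pi, |(F (circleMap 0 r θ)).im| :=
      intervalIntegral.integral_nonneg hpi.le fun θ _ => abs_nonneg _
    rw [intervalIntegral.integral_add (hi1.const_mul t) (hi2.const_mul t⁻¹),
      intervalIntegral.integral_const_mul, intervalIntegral.integral_const_mul] at hle
    rw [Real.dist_eq, sub_zero] at h1 ⊢
    rw [abs_of_nonneg hnn]
    have h6 := mul_le_mul_of_nonneg_left h2 ht0.le
    have h7 := mul_lt_mul_of_pos_left ((le_abs_self _).trans_lt h1) (inv_pos.2 ht0)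
    have h8 : t⁻¹ * (ε / 2 * t) = ε / 2 := by field_simp
    linarith
  have hbdF : ∀ᶠ r in 𝓝[>] (1:ℝ), (∫ θ in (0:ℝ)..2 * Real.pi, ‖F (circleMap 0 r θ)‖) ≤ C := by
    filter_upwards [hbd, Ioo_mem_nhdsGT hR] with r h2 hr
    refine le_trans (intervalIntegral.integral_mono_on hpi.le
      ((hcF r hr.1 hr.2).norm.intervalIntegrable _ _)
      ((hcΦ r hr.1 hr.2).norm.intervalIntegrable _ _) fun θ _ => ?_) h2
    exact hFΦ _ (hmem r hr.1 hr.2 θ)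
  obtain ⟨ρ, hρ1, hρR, G, hG, hGF, hGs⟩ := reflect hR hF C hbdF him
  have hρ0 : 0 < ρ := by linarith
  have hρi : 0 ≤ ρ⁻¹ := (inv_pos.2 hρ0).le
  have hρi1 : ρ⁻¹ < 1 := inv_lt_one_of_one_lt₀ hρ1
  have hGne : ∃ w ∈ ann ρ⁻¹ ρ, G w ≠ 0 := by
    obtain ⟨s, hs1, hs2⟩ := exists_between hρ1
    have hsm : (s : ℂ) ∈ ann 1 ρ := by
      rw [mem_ann, Complex.norm_real, Real.norm_eq_abs, abs_of_pos (by linarith)]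
      exact ⟨hs1, hs2⟩
    have h1 := ann_eventually_ne zero_le_one hF hne (ann_mono le_rfl hρR.le hsm)
    have h2 : ∀ᶠ z in 𝓝[≠] (s:ℂ), z ∈ ann 1 ρ :=
      nhdsWithin_le_nhds ((isOpen_ann 1 ρ).mem_nhds hsm)
    obtain ⟨z, hz1, hz2⟩ := (h1.and h2).exists
    exact ⟨z, ann_mono hρi1.le le_rfl hz2, by rw [hGF z hz2]; exact hz1⟩
  -- continuity on the unit circle
  have hcG : ∀ r, ρ⁻¹ < r → r < ρ → Continuous fun θ => G (circleMap 0 r θ) := fun r h1 h2 =>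
    RingSys.cont_circle (by linarith) (hG.continuousOn.mono (sphere_subset_ann h1 h2))
  have hcG1 := hcG 1 hρi1 hρ1
  have hcG1r : Continuous fun θ => (G (circleMap 0 1 θ)).re := Complex.continuous_re.comp hcG1
  -- positivity
  have hpos : ∀ θ ∈ Icc 0 (2 * Real.pi), ‖G (circleMap 0 1 θ)‖ = (G (circleMap 0 1 θ)).re := by
    by_contra hcon
    push Not at hcon
    obtain ⟨θ0, hθ0, hθn⟩ := hcon
    have hlt : 0 < ‖G (circleMap 0 1 θ0)‖ - (G (circleMap 0 1 θ0)).re :=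
      sub_pos.2 (lt_of_le_of_ne (Complex.re_le_norm _) hθn.symm)
    have hp := intervalIntegral.integral_pos (f := fun θ => ‖G (circleMap 0 1 θ)‖ -
      (G (circleMap 0 1 θ)).re) hpi (hcG1.norm.sub hcG1r).continuousOn
      (fun θ _ => sub_nonneg.2 (Complex.re_le_norm _)) ⟨θ0, hθ0, hlt⟩
    set P := ∫ θ in (0:ℝ)..2 * Real.pi, (‖G (circleMap 0 1 θ)‖ - (G (circleMap 0 1 θ)).re)
    have hη : 0 < P / (16 * Real.pi) := by have := Real.pi_pos; positivity
    have hev := (Metric.tendsto_nhds.1 hlim) (P / 2) (by positivity)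
    obtain ⟨r, h1, h2, hr⟩ := (hev.and ((circ_unif hρ1 hG hη).and (Ioo_mem_nhdsGT hρ1))).exists
    rw [Real.dist_eq, sub_zero] at h1
    have h3 := (le_abs_self _).trans_lt h1
    have hrR : r < R := hr.2.trans hρR
    have hle : P ≤ ∫ θ in (0:ℝ)..2 * Real.pi, ((‖Φ (circleMap 0 r θ)‖ -
      (F (circleMap 0 r θ)).re) + 2 * (P / (16 * Real.pi))) := by
      refine intervalIntegral.integral_mono_on hpi.le
        ((hcG1.norm.sub hcG1r).intervalIntegrable _ _)
        ((((hcΦ r hr.1 hrR).norm.sub (hreF r hr.1 hrR)).intervalIntegrable _ _).add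
        intervalIntegrable_const) fun θ _ => ?_
      have a1 := hFΦ _ (hmem r hr.1 hrR θ)
      have a2 := h2 θ
      rw [hGF _ (circleMap_mem_ann (by linarith [hr.1]) hr.1 hr.2 θ)] at a2
      have a3 := Complex.re_le_norm (F (circleMap 0 r θ) - G (circleMap 0 1 θ))
      have a4 := norm_sub_norm_le (G (circleMap 0 1 θ)) (F (circleMap 0 r θ))
      rw [norm_sub_rev] at a4
      rw [Complex.sub_re] at a3
      linarith
    have hi1 : IntervalIntegrable (fun θ => ‖Φ (circleMap 0 r θ)‖ - (F (circleMap 0 r θ)).re)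
      volume 0 (2 * Real.pi) :=
      ((hcΦ r hr.1 hrR).norm.sub (hreF r hr.1 hrR)).intervalIntegrable _ _
    rw [intervalIntegral.integral_add hi1 intervalIntegrable_const, intervalIntegral.integral_const] at hle
    have : (2 * Real.pi - 0) • (2 * (P / (16 * Real.pi))) = P / 4 := by
      have := Real.pi_pos.ne'
      rw [smul_eq_mul]; field_simp; ring
    rw [this] at hle
    linarith
  -- zero-free collar
  obtain ⟨R', hR1, hR2, hGz⟩ : ∃ R', 1 < R' ∧ R' ≤ ρ ∧ ∀ w ∈ ann 1 R', G w ≠ 0 := by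
    have hset : {w | w ∉ sphere (0:ℂ) 1 → G w ≠ 0} ∈ 𝓝ˢ (sphere (0:ℂ) 1) := by
      rw [mem_nhdsSet_iff_forall]
      intro u hu
      have := ann_eventually_ne hρi hG hGne (sphere_subset_ann hρi1 hρ1 hu)
      rw [eventually_nhdsWithin_iff] at this
      filter_upwards [this] with z hz hzn
      exact hz fun h => hzn (h ▸ hu)
    obtain ⟨δ, hδ, hsub⟩ := (hasBasis_nhdsSet_thickening (isCompact_sphere (0:ℂ) 1)).mem_iff.1 hset
    refine ⟨min ρ (1 + δ), lt_min hρ1 (by linarith), min_le_left _ _, fun w hw => ?_⟩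
    have hw0 : w ≠ 0 := ne_zero_of_mem_ann zero_le_one hw
    have hw1 : ‖w‖ < 1 + δ := hw.2.trans_le (min_le_right _ _)
    refine hsub (Metric.mem_thickening_iff.2 ⟨w / ‖w‖, ?_, ?_⟩) ?_
    · simp [hw0]
    · have hn : (‖w‖:ℂ) ≠ 0 := by simpa using hw0
      have : w - w / ‖w‖ = (w / ‖w‖) * ((‖w‖ - 1 : ℝ) : ℂ) := by push_cast; field_simp
      rw [dist_eq_norm, this, norm_mul, Complex.norm_real, Real.norm_eq_abs,
        abs_of_pos (by linarith [hw.1])]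
      simp [hw0]
      linarith
    · intro h
      have := hw.1
      simp at h
      linarith
  have hFz : ∀ w ∈ ann 1 R', F w ≠ 0 := fun w hw => by
    rw [← hGF w (ann_mono le_rfl hR2 hw)]; exact hGz w hw
  have hΦz : ∀ w ∈ ann 1 R', Φ w ≠ 0 := fun w hw h => hFz w hw (by simp [hFdef, h])
  have hfz : ∀ w ∈ ann 1 R', f w ≠ 0 := fun w hw h => hFz w hw (by simp [hFdef, h])
  have hR'R : R' ≤ R := hR2.trans hρR.le
  obtain ⟨n, hn⟩ := exists_hasW zero_le_one (hΦ.mono (ann_mono le_rfl hR'R)) hΦz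
  obtain ⟨c, hc⟩ := hn.mean_log zero_le_one
  refine ⟨R', hR1, hR'R, n, ?_, hn⟩
  by_contra hn1
  have hn0 : (n : ℝ) ≤ 0 := by exact_mod_cast (by omega : n ≤ 0)
  -- estimate for c
  have hcle : ∀ ε > 0, c ≤ ∫ θ in (0:ℝ)..2 * Real.pi, Real.log ((G (circleMap 0 1 θ)).re + ε) := by
    intro ε hε
    apply le_of_forall_pos_le_add
    intro η' hη'
    set η := η' * ε / (1 + 2 * Real.pi) with hηdef
    have hη : 0 < η := by positivity
    have hev := (Metric.tendsto_nhds.1 hlim) η hη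
    have hten : Tendsto (fun r => 2 * Real.pi * n * Real.log r + c) (𝓝[>] (1:ℝ)) (𝓝 c) := by
      have : ContinuousAt (fun r => 2 * Real.pi * n * Real.log r + c) 1 := by
        refine ContinuousAt.add (ContinuousAt.mul continuousAt_const
          (Real.continuousAt_log one_ne_zero)) continuousAt_const
      simpa using this.tendsto.mono_left (nhdsWithin_le_nhds (s := Ioi 1))
    refine le_of_tendsto hten ?_
    filter_upwards [hev, circ_unif hρ1 hG hη, Ioo_mem_nhdsGT hR1] with r h1 h2 hr
    have hrR : r < R := hr.2.trans_le hR'R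
    rw [Real.dist_eq, sub_zero] at h1
    have h3 := (le_abs_self _).trans_lt h1
    rw [← hc r hr.1 hr.2]
    have hcy : ContinuousOn (fun θ => Real.log ((G (circleMap 0 1 θ)).re + ε)) (uIcc 0 (2 * Real.pi)) := by
      rw [uIcc_of_le hpi.le]
      refine ContinuousOn.log (hcG1r.add continuous_const).continuousOn fun θ hθ => ?_
      have := hpos θ hθ
      have := norm_nonneg (G (circleMap 0 1 θ))
      linarith
    have hcl : Continuous fun θ => Real.log ‖Φ (circleMap 0 r θ)‖ := by
      refine Continuous.log (hcΦ r hr.1 hrR).norm fun θ => ?_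
      exact norm_ne_zero_iff.2 (hΦz _ (circleMap_mem_ann (by linarith [hr.1]) hr.1 hr.2 θ))
    have hi1 : IntervalIntegrable (fun θ => ‖Φ (circleMap 0 r θ)‖ - (F (circleMap 0 r θ)).re)
      volume 0 (2 * Real.pi) := ((hcΦ r hr.1 hrR).norm.sub (hreF r hr.1 hrR)).intervalIntegrable _ _
    have hi2 : IntervalIntegrable (fun θ => ε⁻¹ * (‖Φ (circleMap 0 r θ)‖ - (F (circleMap 0 r θ)).re) + ε⁻¹ * η)
      volume 0 (2 * Real.pi) := (hi1.const_mul _).add intervalIntegrable_const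
    have hle : (∫ θ in (0:ℝ)..2 * Real.pi, Real.log ‖Φ (circleMap 0 r θ)‖) ≤
        ∫ θ in (0:ℝ)..2 * Real.pi, (Real.log ((G (circleMap 0 1 θ)).re + ε) +
          (ε⁻¹ * (‖Φ (circleMap 0 r θ)‖ - (F (circleMap 0 r θ)).re) + ε⁻¹ * η)) := by
      refine intervalIntegral.integral_mono_on hpi.le (hcl.intervalIntegrable _ _)
        (hcy.intervalIntegrable.add hi2) fun θ hθ => ?_
      have b1 := hpos θ hθ
      have b2 := norm_nonneg (G (circleMap 0 1 θ))
      have b3 := hFΦ _ (hmem r hr.1 hrR θ)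
      have a2 := h2 θ
      rw [hGF _ (circleMap_mem_ann (by linarith [hr.1]) hr.1 (hr.2.trans_le hR2) θ)] at a2
      have a3 := Complex.re_le_norm (F (circleMap 0 r θ) - G (circleMap 0 1 θ))
      rw [Complex.sub_re] at a3
      have a4 := Complex.re_le_norm (F (circleMap 0 r θ))
      have hΦp : 0 < ‖Φ (circleMap 0 r θ)‖ :=
        norm_pos_iff.2 (hΦz _ (circleMap_mem_ann (by linarith [hr.1]) hr.1 hr.2 θ))
      set y := (G (circleMap 0 1 θ)).re + ε with hy
      have hyε : ε ≤ y := by linarith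
      have hy0 : 0 < y := by linarith
      have c1 := Real.log_le_sub_one_of_pos (div_pos hΦp hy0)
      rw [Real.log_div hΦp.ne' hy0.ne'] at c1
      have c2 : ‖Φ (circleMap 0 r θ)‖ / y - 1 ≤
          ((‖Φ (circleMap 0 r θ)‖ - (F (circleMap 0 r θ)).re) + η) / y := by
        rw [div_sub_one hy0.ne']
        gcongr
        linarith
      have c3 : ((‖Φ (circleMap 0 r θ)‖ - (F (circleMap 0 r θ)).re) + η) / y ≤
          ((‖Φ (circleMap 0 r θ)‖ - (F (circleMap 0 r θ)).re) + η) / ε := by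
        gcongr
        linarith
      rw [← mul_add, ← div_eq_inv_mul]
      linarith
    rw [intervalIntegral.integral_add hcy.intervalIntegrable hi2,
      intervalIntegral.integral_add (hi1.const_mul _) intervalIntegrable_const,
      intervalIntegral.integral_const_mul, intervalIntegral.integral_const] at hle
    refine hle.trans ?_
    gcongr
    have h4 : ε⁻¹ * (∫ θ in (0:ℝ)..2 * Real.pi, (‖Φ (circleMap 0 r θ)‖ - (F (circleMap 0 r θ)).re)) ≤ ε⁻¹ * η := by
      gcongr
    rw [smul_eq_mul, sub_zero]
    have h5 : ε⁻¹ * η + 2 * Real.pi * (ε⁻¹ * η) = η' := by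
      rw [hηdef]; field_simp
    linarith
  have hlog1 : (∫ θ in (0:ℝ)..2 * Real.pi, Real.log ((G (circleMap 0 1 θ)).re)) = lm G 1 := by
    refine intervalIntegral.integral_congr fun θ hθ => ?_
    rw [uIcc_of_le hpi.le] at hθ
    beta_reduce
    rw [← hpos θ hθ]
  have hcle1 : c ≤ lm G 1 := by
    rw [← hlog1]
    refine log_lim hcG1r (fun θ hθ => by rw [← hpos θ hθ]; exact norm_nonneg _) ?_ ?_ hcle
    · filter_upwards [ae_ne hρi hρi1 hρ1 hG hGne, ae_restrict_mem measurableSet_uIoc] with θ h1 h2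
      rw [uIoc_of_le hpi.le] at h2
      rw [← hpos θ ⟨h2.1.le, h2.2⟩]
      exact norm_ne_zero_iff.2 h1
    · have : CircleIntegrable (fun z => Real.log ‖G z‖) 0 1 :=
        MeromorphicOn.circleIntegrable_log_norm (fun z hz => by
          rw [abs_one] at hz
          exact (hG.analyticAt ((isOpen_ann _ _).mem_nhds
            (sphere_subset_ann hρi1 hρ1 hz))).meromorphicAt)
      refine IntervalIntegrable.congr ?_ this
      intro θ h2
      rw [uIoc_of_le hpi.le] at h2
      beta_reduce
      rw [← hpos θ ⟨h2.1.le, h2.2⟩]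
  -- final comparison
  obtain ⟨r, hr1, hr2⟩ := exists_between hR1
  have hrρ : r < ρ := hr2.trans_le hR2
  have hrR : r < R := hrρ.trans hρR
  have hr0 : 0 < r := by linarith
  have hconv := lm_convex hρ1 hG hGne hr1 hrρ
  have hsym : lm G r⁻¹ = lm G r := by
    unfold lm
    congr 1
    ext θ
    rw [hGF _ (circleMap_mem_ann hr0 hr1 hrρ θ), hGs _ (circleMap_mem_ann (inv_pos.2 hr0)
      (inv_strictAnti₀ hr0 hrρ) (inv_lt_one_of_one_lt₀ hr1) θ), rfl', conj_inv_circleMap,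
      RCLike.norm_conj]
  have hlt : lm G r < lm Φ r := by
    unfold lm
    have hz : ∀ θ, circleMap 0 r θ ∈ ann 1 R' := circleMap_mem_ann hr0 hr1 hr2
    refine intervalIntegral.integral_lt_integral_of_continuousOn_of_le_of_exists_lt hpi ?_ ?_ ?_ ?_
    · refine (Continuous.log (hcG r (hρi1.trans hr1) hrρ).norm fun θ => ?_).continuousOn
      exact norm_ne_zero_iff.2 (hGz _ (hz θ))
    · refine (Continuous.log (hcΦ r hr1 hrR).norm fun θ => ?_).continuousOn
      exact norm_ne_zero_iff.2 (hΦz _ (hz θ))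
    · intro θ _
      rw [hGF _ (circleMap_mem_ann hr0 hr1 hrρ θ)]
      exact Real.log_le_log (norm_pos_iff.2 (hFz _ (hz θ))) (hFΦ _ (hmem r hr1 hrR θ))
    · refine ⟨0, ⟨le_rfl, hpi.le⟩, ?_⟩
      rw [hGF _ (circleMap_mem_ann hr0 hr1 hrρ 0)]
      refine Real.log_lt_log (norm_pos_iff.2 (hFz _ (hz 0))) ?_
      rw [hFdef, norm_mul]
      exact mul_lt_of_lt_one_left (norm_pos_iff.2 (hΦz _ (hz 0))) (hf1 _ (hmem r hr1 hrR 0))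
  have hΦr : lm Φ r = 2 * Real.pi * n * Real.log r + c := hc r hr1 hr2
  have hlr := Real.log_pos hr1
  have : 2 * Real.pi * n * Real.log r ≤ 0 := by
    have : 2 * Real.pi * n ≤ 0 := mul_nonpos_of_nonneg_of_nonpos hpi.le hn0
    exact mul_nonpos_of_nonpos_of_nonneg this hlr.le
  linarith

end ACap

namespace ACap

/-- Behaviour at infinity of a bounded holomorphic function. -/
lemma laurent_inf {f : ℂ → ℂ} {U : Set ℂ} {M : ℝ} (hU : U ∈ cobounded ℂ) (hUo : IsOpen U)
    (hf : DifferentiableOn ℂ f U) (hb : ∀ z ∈ U, ‖f z‖ ≤ M) :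
    ∃ l w : ℂ, Tendsto f (cobounded ℂ) (𝓝 l) ∧
      Tendsto (fun z => z * (f z - l)) (cobounded ℂ) (𝓝 w) := by
  have h1 : ∀ᶠ u : ℂ in 𝓝[≠] 0, u⁻¹ ∈ U := Filter.tendsto_inv₀_nhdsNE_zero.eventually hU
  rw [eventually_nhdsWithin_iff, Metric.eventually_nhds_iff_ball] at h1
  obtain ⟨ε, hε, h1⟩ := h1
  have hd : DifferentiableOn ℂ (fun u => f u⁻¹) (ball (0:ℂ) ε \ {0}) := by
    intro u hu
    have hu0 : u ≠ 0 := hu.2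
    have : DifferentiableAt ℂ f u⁻¹ := hf.differentiableAt (hUo.mem_nhds (h1 u hu.1 hu0))
    exact (this.comp u (differentiableAt_inv hu0)).differentiableWithinAt
  have hbd : BddAbove (norm ∘ (fun u => f u⁻¹) '' (ball (0:ℂ) ε \ {0})) := by
    refine ⟨M, ?_⟩
    rintro _ ⟨u, hu, rfl⟩
    exact hb _ (h1 u hu.1 hu.2)
  have hG := Complex.differentiableOn_update_limUnder_of_bddAbove (ball_mem_nhds 0 hε) hd hbd
  set l := limUnder (𝓝[≠] (0:ℂ)) (fun u => f u⁻¹)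
  set G := Function.update (fun u => f u⁻¹) 0 l with hGdef
  have hGd : DifferentiableAt ℂ G 0 := hG.differentiableAt (ball_mem_nhds 0 hε)
  have hinv : Tendsto (fun z : ℂ => z⁻¹) (cobounded ℂ) (𝓝[≠] 0) := by
    rw [tendsto_nhdsWithin_iff]
    refine ⟨tendsto_inv₀_cobounded, ?_⟩
    filter_upwards [eventually_ne_cobounded (0:ℂ)] with z hz
    simpa using hz
  have hG0 : G 0 = l := by simp [hGdef]
  have hGz : ∀ z : ℂ, z ≠ 0 → G z⁻¹ = f z := fun z hz => by simp [hGdef, hz]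
  refine ⟨l, deriv G 0, ?_, ?_⟩
  · have := (hGd.continuousAt.tendsto.mono_left nhdsWithin_le_nhds).comp hinv
    rw [hG0] at this
    refine this.congr' ?_
    filter_upwards [eventually_ne_cobounded (0:ℂ)] with z hz
    exact hGz z hz
  · have := (hasDerivAt_iff_tendsto_slope.1 hGd.hasDerivAt).comp hinv
    refine this.congr' ?_
    filter_upwards [eventually_ne_cobounded (0:ℂ)] with z hz
    simp [slope_def_field, hGz z hz, hG0]
    field_simp

/-- derivative at infinity as a contour integral -/
lemma circle_inf {f : ℂ → ℂ} {R r : ℝ} {l w : ℂ} (hR : 0 ≤ R) (hr : R < r)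
    (hf : DifferentiableOn ℂ f {z | R < ‖z‖})
    (hd : Tendsto (fun z => z * (f z - l)) (cobounded ℂ) (𝓝 w)) :
    (∮ z in C(0, r), f z) = 2 * Real.pi * I * w := by
  have hr0 : 0 < r := by linarith
  have key : ∀ s, R < s → (∮ z in C(0, s), f z) = ∮ z in C(0, r), f z := by
    intro s hs
    refine circleIntegral_deform (b := max r s + 1) hR hr
      (by linarith [le_max_left r s]) hs (by linarith [le_max_right r s])
      (hf.mono fun z hz => hz.1)
  refine eq_of_forall_dist_le fun ε hε => ?_
  have hε' : 0 < ε / (2 * Real.pi) := by have := Real.pi_pos; positivity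
  have h1 := Metric.tendsto_nhds.1 hd _ hε'
  obtain ⟨S, -, hS⟩ := (hasBasis_cobounded_norm (E := ℂ)).eventually_iff.1 h1
  set s := max R S + 1 with hs
  have hsR : R < s := by linarith [le_max_left R S]
  have hsS : S ≤ s := by linarith [le_max_right R S]
  have hs0 : 0 < s := by linarith
  rw [← key s hsR]
  have hz0 : ∀ z ∈ sphere (0:ℂ) s, z ≠ 0 := fun z hz h => by
    rw [h] at hz; simp at hz; linarith
  have hfc : ContinuousOn f (sphere 0 s) := hf.continuousOn.mono fun z hz => by
    have : ‖z‖ = s := by simpa using hz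
    change R < ‖z‖; rw [this]; exact hsR
  have hic : ContinuousOn (fun z : ℂ => w * (z - 0)⁻¹) (sphere 0 s) := by
    refine continuousOn_const.mul (ContinuousOn.inv₀ (by fun_prop) fun z hz => ?_)
    rw [sub_zero]; exact hz0 z hz
  have e1 : (∮ z in C(0, s), l) = 0 := by
    refine circleIntegral.integral_eq_zero_of_hasDerivWithinAt (f := fun z => l * z) hs0.le
      fun z _ => ?_
    simpa using ((hasDerivAt_id z).const_mul l).hasDerivWithinAt
  have e2 : (∮ z in C(0, s), w * (z - 0)⁻¹) = 2 * Real.pi * I * w := by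
    rw [circleIntegral.integral_const_mul, circleIntegral.integral_sub_inv_of_mem_ball
      (mem_ball_self hs0)]
    ring
  have e3 : (∮ z in C(0, s), (f z - l - w * (z - 0)⁻¹)) =
      (∮ z in C(0, s), f z) - 2 * Real.pi * I * w := by
    have hfi : CircleIntegrable f 0 s := hfc.circleIntegrable hs0.le
    have hli : CircleIntegrable (fun _ => l) 0 s := continuousOn_const.circleIntegrable hs0.le
    have hsi : CircleIntegrable (fun z => f z - l) 0 s := hfi.sub hli
    rw [circleIntegral.integral_sub hsi (hic.circleIntegrable hs0.le),
      circleIntegral.integral_sub hfi hli, e1, e2, sub_zero]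
  rw [dist_eq_norm, ← e3]
  refine (circleIntegral.norm_integral_le_of_norm_le_const hs0.le
    (C := ε / (2 * Real.pi) / s) fun z hz => ?_).trans (le_of_eq ?_)
  · have hzn : ‖z‖ = s := by simpa using hz
    have h2 := hS (show z ∈ {x | S ≤ ‖x‖} by rw [mem_setOf_eq, hzn]; exact hsS)
    rw [dist_eq_norm] at h2
    have : f z - l - w * (z - 0)⁻¹ = (z * (f z - l) - w) / z := by
      have := hz0 z hz
      rw [sub_zero]; field_simp
    rw [this, norm_div, hzn]
    gcongr
  · have := Real.pi_pos.ne'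
    field_simp

/-- Montel's theorem along an ultrafilter, with varying domains. -/
lemma montel {f : ℕ → ℂ → ℂ} {U : ℕ → Set ℂ} {V : Set ℂ} (hVo : IsOpen V)
    (hV : ∀ z ∈ V, ∃ δ > 0, ∀ᶠ n in atTop, ball z δ ⊆ U n)
    (hf : ∀ n, DifferentiableOn ℂ (f n) (U n)) (hb : ∀ n, ∀ z ∈ U n, ‖f n z‖ ≤ 1)
    (𝒰 : Ultrafilter ℕ) (h𝒰 : (𝒰 : Filter ℕ) ≤ atTop) :
    ∃ F : ℂ → ℂ, DifferentiableOn ℂ F V ∧ (∀ z ∈ V, ‖F z‖ ≤ 1) ∧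
      TendstoLocallyUniformlyOn f F (𝒰 : Filter ℕ) V := by
  have hp : ∀ z ∈ V, ∃ y : ℂ, ‖y‖ ≤ 1 ∧ Tendsto (fun n => f n z) (𝒰 : Filter ℕ) (𝓝 y) := by
    intro z hz
    obtain ⟨δ, hδ, h⟩ := hV z hz
    have : ∀ᶠ n in (𝒰 : Filter ℕ), f n z ∈ closedBall (0:ℂ) 1 := by
      filter_upwards [h𝒰 h] with n hn
      simpa using hb n z (hn (mem_ball_self hδ))
    obtain ⟨y, hy, hle⟩ := (isCompact_closedBall (0:ℂ) 1).ultrafilter_le_nhds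
      (𝒰.map fun n => f n z) (le_principal_iff.2 this)
    exact ⟨y, by simpa using hy, hle⟩
  choose! F hF1 hFt using hp
  have hlip : ∀ z ∈ V, ∃ δ > 0, ball z δ ⊆ V ∧ (∀ᶠ n in (𝒰 : Filter ℕ), ball z δ ⊆ U n) ∧
      (∀ᶠ n in (𝒰 : Filter ℕ), ∀ y ∈ ball z δ, dist (f n y) (f n z) ≤ 3 / δ * dist y z) ∧
      ∀ y ∈ ball z δ, dist (F y) (F z) ≤ 3 / δ * dist y z := by
    intro z hz
    obtain ⟨δ₁, hδ₁, h⟩ := hV z hz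
    obtain ⟨δ₂, hδ₂, h2⟩ := Metric.isOpen_iff.1 hVo z hz
    set δ := min δ₁ δ₂
    have hδ : 0 < δ := lt_min hδ₁ hδ₂
    have hs : ∀ᶠ n in (𝒰 : Filter ℕ), ball z δ ⊆ U n := by
      filter_upwards [h𝒰 h] with n hn using (ball_subset_ball (min_le_left _ _)).trans hn
    have hl : ∀ᶠ n in (𝒰 : Filter ℕ), ∀ y ∈ ball z δ,
        dist (f n y) (f n z) ≤ 3 / δ * dist y z := by
      filter_upwards [hs] with n hn y hy
      refine Complex.dist_le_div_mul_dist_of_mapsTo_ball ((hf n).mono hn) (fun x hx => ?_) hy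
      rw [mem_closedBall, dist_eq_norm]
      have a1 := hb n x (hn hx)
      have a2 := hb n z (hn (mem_ball_self hδ))
      have := norm_sub_le (f n x) (f n z)
      linarith
    have hVb : ball z δ ⊆ V := (ball_subset_ball (min_le_right _ _)).trans h2
    refine ⟨δ, hδ, hVb, hs, hl, fun y hy => ?_⟩
    refine le_of_tendsto ((hFt y (hVb hy)).dist (hFt z hz)) ?_
    filter_upwards [hl] with n hn using hn y hy
  have hloc : TendstoLocallyUniformlyOn f F (𝒰 : Filter ℕ) V := by
    rw [Metric.tendstoLocallyUniformlyOn_iff]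
    intro ε hε z hz
    obtain ⟨δ, hδ, hVb, hs, hl, hFl⟩ := hlip z hz
    refine ⟨ball z (min δ (δ * ε / 9)), mem_nhdsWithin_of_mem_nhds
      (ball_mem_nhds z (lt_min hδ (by positivity))), ?_⟩
    filter_upwards [hl, Metric.tendsto_nhds.1 (hFt z hz) (ε / 3) (by positivity)] with n h1 h2 y hy
    have hyδ : y ∈ ball z δ := ball_subset_ball (min_le_left _ _) hy
    have hy3 : 3 / δ * dist y z < ε / 3 := by
      have : dist y z < δ * ε / 9 := lt_of_lt_of_le hy (min_le_right _ _)
      calc 3 / δ * dist y z < 3 / δ * (δ * ε / 9) := by gcongr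
        _ = ε / 3 := by field_simp; norm_num
    have a1 := h1 y hyδ
    have a2 := hFl y hyδ
    have b1 := dist_triangle (F y) (F z) (f n y)
    have b2 := dist_triangle (F z) (f n z) (f n y)
    rw [dist_comm (F z) (f n z), dist_comm (f n z) (f n y)] at b2
    linarith
  refine ⟨F, fun z hz => ?_, hF1, hloc⟩
  obtain ⟨δ, hδ, hVb, hs, -, -⟩ := hlip z hz
  have : DifferentiableOn ℂ F (ball z δ) :=
    (hloc.mono hVb).differentiableOn (by filter_upwards [hs] with n hn using (hf n).mono hn)
      isOpen_ball
  exact (this.differentiableAt (ball_mem_nhds z hδ)).differentiableWithinAt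

/-- Montel with convergence of the derivative at infinity. -/
lemma montel_inf {f : ℕ → ℂ → ℂ} {U : ℕ → Set ℂ} {V : Set ℂ} (hVo : IsOpen V)
    (hV : ∀ z ∈ V, ∃ δ > 0, ∀ᶠ n in atTop, ball z δ ⊆ U n) {R : ℝ} (hR : 0 ≤ R)
    (hUR : ∀ n, {z | R < ‖z‖} ⊆ U n) (hVR : {z | R < ‖z‖} ⊆ V)
    (hf : ∀ n, DifferentiableOn ℂ (f n) (U n)) (hb : ∀ n, ∀ z ∈ U n, ‖f n z‖ ≤ 1)
    {l w : ℕ → ℂ}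
    (hd : ∀ n, Tendsto (fun z => z * (f n z - l n)) (cobounded ℂ) (𝓝 (w n))) :
    ∃ (F : ℂ → ℂ) (l' w' : ℂ), DifferentiableOn ℂ F V ∧ (∀ z ∈ V, ‖F z‖ ≤ 1) ∧
      Tendsto F (cobounded ℂ) (𝓝 l') ∧
      Tendsto (fun z => z * (F z - l')) (cobounded ℂ) (𝓝 w') ∧
      MapClusterPt w' atTop w := by
  set 𝒰 : Ultrafilter ℕ := Filter.hyperfilter ℕ
  have h𝒰 : (𝒰 : Filter ℕ) ≤ atTop := Nat.hyperfilter_le_atTop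
  obtain ⟨F, hF, hF1, hloc⟩ := montel hVo hV hf hb 𝒰 h𝒰
  have hVc : V ∈ cobounded ℂ := by
    filter_upwards [eventually_norm_gt R] with z hz using hVR hz
  obtain ⟨l', w', hl, hw⟩ := laurent_inf hVc hVo hF hF1
  refine ⟨F, l', w', hF, hF1, hl, hw, ?_⟩
  have hRr : R < R + 1 := by linarith
  have hsV : sphere (0:ℂ) (R + 1) ⊆ V := fun z hz => hVR (by
    have : ‖z‖ = R + 1 := by simpa using hz
    change R < ‖z‖; linarith)
  have e1 := circle_inf hR hRr (hF.mono hVR) hw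
  have e2 := fun n => circle_inf hR hRr ((hf n).mono (hUR n)) (hd n)
  have hunif : TendstoUniformlyOn f F (𝒰 : Filter ℕ) (sphere 0 (R + 1)) :=
    (tendstoLocallyUniformlyOn_iff_tendstoUniformlyOn_of_compact (isCompact_sphere _ _)).1
      (hloc.mono hsV)
  have hpi : (2 * Real.pi * I : ℂ) ≠ 0 := by simp [Real.pi_ne_zero]
  have ht : Tendsto (fun n => ∮ z in C(0, R + 1), f n z) (𝒰 : Filter ℕ)
      (𝓝 (∮ z in C(0, R + 1), F z)) := by
    rw [Metric.tendsto_nhds]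
    intro ε hε
    have hη : 0 < ε / (2 * Real.pi * (R + 1) + 1) := by have := Real.pi_pos; positivity
    filter_upwards [Metric.tendstoUniformlyOn_iff.1 hunif _ hη] with n hn
    have hci : ∀ {g : ℂ → ℂ}, DifferentiableOn ℂ g {z | R < ‖z‖} →
        CircleIntegrable g 0 (R + 1) := fun hg =>
      (hg.continuousOn.mono fun z hz => by
        have : ‖z‖ = R + 1 := by simpa using hz
        change R < ‖z‖; linarith).circleIntegrable (by linarith)
    rw [dist_eq_norm, ← circleIntegral.integral_sub (hci ((hf n).mono (hUR n)))
      (hci (hF.mono hVR))]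
    refine (circleIntegral.norm_integral_le_of_norm_le_const (by linarith)
      (C := ε / (2 * Real.pi * (R + 1) + 1)) fun z hz => ?_).trans_lt ?_
    · rw [← dist_eq_norm, dist_comm]; exact (hn z hz).le
    · have hpp := Real.pi_pos
      rw [mul_div_assoc', div_lt_iff₀ (by positivity)]
      nlinarith
  have ht2 : Tendsto w (𝒰 : Filter ℕ) (𝓝 w') := by
    have := ht.const_mul (2 * Real.pi * I : ℂ)⁻¹
    simp only [e1, e2] at this
    simpa [hpi, ← mul_assoc, inv_mul_cancel₀ hpi] using this
  exact MapClusterPt.mono (ht2.mapClusterPt) h𝒰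

/-- Möbius normalisation at infinity. -/
lemma mobius_inf {f : ℂ → ℂ} {U : Set ℂ} {l w : ℂ} (hf : DifferentiableOn ℂ f U)
    (hU : U ∈ cobounded ℂ) (hb : ∀ z ∈ U, ‖f z‖ ≤ 1) (hl : Tendsto f (cobounded ℂ) (𝓝 l))
    (hw : Tendsto (fun z => z * (f z - l)) (cobounded ℂ) (𝓝 w)) {c : ℝ} (hc0 : 0 < c)
    (hc1 : c < 1) :
    ∃ (g : ℂ → ℂ) (w' : ℂ), DifferentiableOn ℂ g U ∧ (∀ z ∈ U, ‖g z‖ ≤ 1) ∧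
      Tendsto g (cobounded ℂ) (𝓝 0) ∧ Tendsto (fun z => z * (g z - 0)) (cobounded ℂ) (𝓝 w') ∧
      ‖w'‖ * (1 - c ^ 2 * ‖l‖ ^ 2) = c * ‖w‖ := by
  have hl1 : ‖l‖ ≤ 1 := le_of_tendsto hl.norm (by filter_upwards [hU] with z hz using hb z hz)
  set b : ℂ := c * l with hbdef
  have hbn : ‖b‖ = c * ‖l‖ := by rw [hbdef, norm_mul, Complex.norm_real, Real.norm_of_nonneg hc0.le]
  have hb1 : ‖b‖ < 1 := by rw [hbn]; nlinarith [norm_nonneg l]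
  have hden : ∀ a : ℂ, ‖a‖ ≤ 1 → 1 - (starRingEnd ℂ) b * a ≠ 0 := by
    intro a ha h
    have h1 : ‖(starRingEnd ℂ) b * a‖ = 1 := by
      rw [← sub_eq_zero.1 h]; simp
    rw [norm_mul, RCLike.norm_conj] at h1
    nlinarith [norm_nonneg a, norm_nonneg b]
  have hle : ∀ a : ℂ, ‖a‖ ≤ 1 → ‖(a - b) / (1 - (starRingEnd ℂ) b * a)‖ ≤ 1 := by
    intro a ha
    rw [norm_div, div_le_one (norm_pos_iff.2 (hden a ha))]
    apply le_of_sq_le_sq _ (norm_nonneg _)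
    have e : ‖1 - (starRingEnd ℂ) b * a‖ ^ 2 - ‖a - b‖ ^ 2 = (1 - ‖a‖ ^ 2) * (1 - ‖b‖ ^ 2) := by
      simp only [Complex.sq_norm, Complex.normSq_apply, Complex.sub_re, Complex.sub_im,
        Complex.mul_re, Complex.mul_im, Complex.conj_re, Complex.conj_im, Complex.one_re,
        Complex.one_im]
      ring
    have : 0 ≤ (1 - ‖a‖ ^ 2) * (1 - ‖b‖ ^ 2) :=
      mul_nonneg (by nlinarith [norm_nonneg a]) (by nlinarith [norm_nonneg b])
    linarith
  have hcf : ∀ z ∈ U, ‖(c:ℂ) * f z‖ ≤ 1 := fun z hz => by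
    rw [norm_mul, Complex.norm_real, Real.norm_of_nonneg hc0.le]
    nlinarith [hb z hz, norm_nonneg (f z)]
  have hbb : (1 : ℂ) - (starRingEnd ℂ) b * b = ((1 - c ^ 2 * ‖l‖ ^ 2 : ℝ) : ℂ) := by
    rw [Complex.conj_mul', hbn]; push_cast; ring
  have hpos : 0 < 1 - c ^ 2 * ‖l‖ ^ 2 := by
    have : (c * ‖l‖) ^ 2 < 1 := by rw [← hbn]; nlinarith [norm_nonneg b]
    linarith [mul_pow c ‖l‖ 2]
  have hlim : Tendsto (fun z => (1 : ℂ) - (starRingEnd ℂ) b * (c * f z)) (cobounded ℂ)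
      (𝓝 (((1 - c ^ 2 * ‖l‖ ^ 2 : ℝ) : ℂ))) := by
    rw [← hbb]
    exact tendsto_const_nhds.sub ((hl.const_mul (c:ℂ)).const_mul _)
  have hne : ((1 - c ^ 2 * ‖l‖ ^ 2 : ℝ) : ℂ) ≠ 0 := by exact_mod_cast hpos.ne'
  have hT : Tendsto (fun z => z * ((c * f z - b) / (1 - (starRingEnd ℂ) b * (c * f z))))
      (cobounded ℂ) (𝓝 (c * w / ((1 - c ^ 2 * ‖l‖ ^ 2 : ℝ) : ℂ))) := by
    refine ((hw.const_mul (c:ℂ)).div hlim hne).congr fun z => ?_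
    rw [hbdef]; simp only [Pi.div_apply]; ring
  refine ⟨fun z => (c * f z - b) / (1 - (starRingEnd ℂ) b * (c * f z)),
    c * w / ((1 - c ^ 2 * ‖l‖ ^ 2 : ℝ) : ℂ), ?_, fun z hz => hle _ (hcf z hz), ?_, ?_, ?_⟩
  · exact ((hf.const_mul _).sub_const _).div ((hf.const_mul _).const_mul _ |>.const_sub _)
      fun z hz => hden _ (hcf z hz)
  · have := ((hl.const_mul (c:ℂ)).sub_const b).div hlim hne
    rw [hbdef, sub_self, zero_div] at this
    exact this
  · simpa using hT
  · rw [norm_div, norm_mul, Complex.norm_real, Complex.norm_real, Real.norm_of_nonneg hc0.le,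
      Real.norm_of_nonneg hpos.le]
    field_simp

/-- joint continuity of difference quotients, single function, on the diagonal -/
lemma dslope_tendsto_diag {f : ℂ → ℂ} {u : ℂ} (hf : AnalyticAt ℂ f u) :
    Tendsto (fun p : ℂ × ℂ => dslope f p.1 p.2) (𝓝 (u, u)) (𝓝 (deriv f u)) := by
  have hs := hf.hasStrictDerivAt
  have hd : ContinuousAt (deriv f) u := hf.deriv.continuousAt
  rw [Metric.tendsto_nhds]
  intro ε hε
  have h1 : ∀ᶠ p : ℂ × ℂ in 𝓝 (u, u), dist (deriv f p.1) (deriv f u) < ε :=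
    (hd.tendsto.comp continuousAt_fst.tendsto).eventually (ball_mem_nhds _ hε)
  have h2 := (hasStrictDerivAt_iff_hasStrictFDerivAt.1 hs).isLittleO.def (half_pos hε)
  filter_upwards [h1, h2] with p hp1 hp2
  by_cases h : p.2 = p.1
  · rw [h, dslope_same]; exact hp1
  · rw [dslope_of_ne _ h, slope_def_field, dist_eq_norm]
    have hne : p.2 - p.1 ≠ 0 := sub_ne_zero.2 h
    have : (f p.2 - f p.1) / (p.2 - p.1) - deriv f u =
      (f p.1 - f p.2 - (p.1 - p.2) * deriv f u) / (p.1 - p.2) := by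
      have : p.1 - p.2 ≠ 0 := sub_ne_zero.2 (Ne.symm h)
      field_simp; ring
    rw [this, norm_div, div_lt_iff₀ (norm_pos_iff.2 (sub_ne_zero.2 (Ne.symm h)))]
    have hp : 0 < ‖p.1 - p.2‖ := norm_pos_iff.2 (sub_ne_zero.2 (Ne.symm h))
    simp at hp2
    nlinarith

/-- joint continuity of difference quotients with a parameter. -/
lemma dslope_cont {X : Type*} [TopologicalSpace X] {s : Set X} {U : Set ℂ} (hU : IsOpen U)
    {g : X → ℂ → ℂ} (hg : ContinuousOn (fun p : X × ℂ => g p.1 p.2) (s ×ˢ U))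
    (hd : ∀ x ∈ s, DifferentiableOn ℂ (g x) U) :
    ContinuousOn (fun p : X × ℂ × ℂ => dslope (g p.1) p.2.1 p.2.2) (s ×ˢ U ×ˢ U) := by
  rintro ⟨x0, u0, v0⟩ ⟨hx0, hu0, hv0⟩
  dsimp at hx0 hu0 hv0
  by_cases h : v0 = u0
  · subst h
    obtain ⟨ρ, hρ, hρU⟩ := Metric.nhds_basis_closedBall.mem_iff.1 (hU.mem_nhds hu0)
    have hat : AnalyticAt ℂ (g x0) v0 := (hd x0 hx0).analyticAt (hU.mem_nhds hu0)
    rw [ContinuousWithinAt, Metric.tendsto_nhds]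
    intro ε hε
    dsimp only
    rw [dslope_same]
    have h1 : ∀ᶠ p : X × ℂ × ℂ in 𝓝[s ×ˢ U ×ˢ U] (x0, v0, v0),
        dist (dslope (g x0) p.2.1 p.2.2) (deriv (g x0) v0) < ε / 2 := by
      have : Tendsto (fun p : X × ℂ × ℂ => dslope (g x0) p.2.1 p.2.2)
          (𝓝[s ×ˢ U ×ˢ U] (x0, v0, v0)) (𝓝 (deriv (g x0) v0)) :=
        ((dslope_tendsto_diag hat).comp (continuousAt_snd (p := (x0, v0, v0))).tendsto).mono_left
          nhdsWithin_le_nhds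
      exact this.eventually (ball_mem_nhds _ (half_pos hε))
    set η := ε * ρ / 24 with hη
    have hηp : 0 < η := by positivity
    obtain ⟨v, hv, hvx⟩ := (isCompact_closedBall v0 ρ).mem_uniformity_of_prod (f := g)
      (hg.mono (prod_mono_right hρU)) hx0 (dist_mem_uniformity hηp)
    have h2 : ∀ᶠ p : X × ℂ × ℂ in 𝓝[s ×ˢ U ×ˢ U] (x0, v0, v0), p.1 ∈ v := by
      rw [nhdsWithin_prod_eq]
      exact (tendsto_fst (g := 𝓝[U ×ˢ U] (v0, v0))).eventually hv
    have h3 : ∀ᶠ p : X × ℂ × ℂ in 𝓝[s ×ˢ U ×ˢ U] (x0, v0, v0), p.2.1 ∈ ball v0 (ρ / 4) ∧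
        p.2.2 ∈ ball v0 (ρ / 4) := by
      apply nhdsWithin_le_nhds
      have c1 : ContinuousAt (fun p : X × ℂ × ℂ => p.2.1) (x0, v0, v0) := by fun_prop
      have c2 : ContinuousAt (fun p : X × ℂ × ℂ => p.2.2) (x0, v0, v0) := by fun_prop
      exact (c1.eventually (ball_mem_nhds _ (by positivity))).and
        (c2.eventually (ball_mem_nhds _ (by positivity)))
    filter_upwards [h1, h2, h3, self_mem_nhdsWithin] with ⟨x, a, b⟩ k1 k2 k3 k4
    dsimp only at k1 k2 k3 ⊢
    obtain ⟨k3a, k3b⟩ := k3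
    have hx : x ∈ s := k4.1
    have hsub : ball a (ρ / 2) ⊆ closedBall v0 ρ := by
      intro y hy
      rw [mem_closedBall]; rw [mem_ball] at hy k3a
      linarith [dist_triangle y a v0]
    have hbb : b ∈ ball a (ρ / 2) := by
      rw [mem_ball] at *
      have := dist_triangle b v0 a
      rw [dist_comm v0 a] at this
      linarith
    set hh : ℂ → ℂ := fun y => g x y - g x0 y
    have hsm : ∀ y ∈ closedBall v0 ρ, ‖hh y‖ < η := fun y hy => by
      have := hvx x k2 y hy
      rw [← dist_eq_norm]; exact this
    have haU : a ∈ U := hρU (hsub (mem_ball_self (by positivity)))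
    have hdd : DifferentiableOn ℂ hh (ball a (ρ / 2)) :=
      ((hd x hx).sub (hd x0 hx0)).mono (hsub.trans hρU)
    have hmap : MapsTo hh (ball a (ρ / 2)) (ball (hh a) (2 * η)) := by
      intro y hy
      rw [mem_ball, dist_eq_norm]
      have := norm_sub_le (hh y) (hh a)
      have := hsm y (hsub hy)
      have := hsm a (hsub (mem_ball_self (by positivity)))
      linarith
    have hle := Complex.norm_dslope_le_div_of_mapsTo_ball hdd (hmap.mono_right
      (ball_subset_closedBall)) hbb
    have heq : dslope hh a b = dslope (g x) a b - dslope (g x0) a b := by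
      by_cases hab : b = a
      · subst hab
        simp only [dslope_same]
        exact deriv_fun_sub ((hd x hx).differentiableAt (hU.mem_nhds haU))
          ((hd x0 hx0).differentiableAt (hU.mem_nhds haU))
      · simp only [dslope_of_ne _ hab, slope_def_field, hh]; ring
    rw [heq, ← dist_eq_norm] at hle
    have : 2 * η / (ρ / 2) = ε / 6 := by rw [hη]; field_simp; norm_num
    rw [this] at hle
    have := dist_triangle (dslope (g x) a b) (dslope (g x0) a b) (deriv (g x0) v0)
    linarith
  · have hw : ContinuousWithinAt (fun p : X × ℂ × ℂ => (g p.1 p.2.2 - g p.1 p.2.1) /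
        (p.2.2 - p.2.1)) (s ×ˢ U ×ˢ U) (x0, u0, v0) := by
      have e1 : ContinuousWithinAt (fun p : X × ℂ × ℂ => g p.1 p.2.2) (s ×ˢ U ×ˢ U) (x0, u0, v0) :=
        ContinuousWithinAt.comp (t := s ×ˢ U) (g := fun p : X × ℂ => g p.1 p.2)
          (f := fun p : X × ℂ × ℂ => (p.1, p.2.2)) (hg _ ⟨hx0, hv0⟩) (by fun_prop)
          (fun p hp => ⟨hp.1, hp.2.2⟩)
      have e2 : ContinuousWithinAt (fun p : X × ℂ × ℂ => g p.1 p.2.1) (s ×ˢ U ×ˢ U) (x0, u0, v0) :=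
        ContinuousWithinAt.comp (t := s ×ˢ U) (g := fun p : X × ℂ => g p.1 p.2)
          (f := fun p : X × ℂ × ℂ => (p.1, p.2.1)) (hg _ ⟨hx0, hu0⟩) (by fun_prop)
          (fun p hp => ⟨hp.1, hp.2.1⟩)
      exact (e1.sub e2).div (by fun_prop) (sub_ne_zero.2 h)
    refine hw.congr_of_eventuallyEq ?_ ?_
    · apply nhdsWithin_le_nhds
      have : ∀ᶠ p : X × ℂ × ℂ in 𝓝 (x0, u0, v0), p.2.2 ≠ p.2.1 :=
        by
        have hc : ContinuousAt (fun p : X × ℂ × ℂ => p.2.2 - p.2.1) (x0, u0, v0) := by fun_prop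
        filter_upwards [hc.eventually_ne (sub_ne_zero.2 h)] with p hp
        exact sub_ne_zero.1 hp
      filter_upwards [this] with p hp
      rw [dslope_of_ne _ hp, slope_def_field]
    · dsimp only; rw [dslope_of_ne _ h, slope_def_field]

end ACap

namespace ACap

namespace RingSys

variable {K : Set ℂ} (R : RingSys K)

/-- winding integral of the `i`-th curve of radius `r` about `a` -/
def NN (i : Fin R.n) (r : ℝ) (a : ℂ) : ℂ := ∮ w in C(0, r), deriv (R.Z i) w / (R.Z i w - a)

lemma NN_eq (i : Fin R.n) (r : ℝ) : R.NN i r = fun a =>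
    ∫ θ in (0:ℝ)..2 * Real.pi, (deriv (circleMap 0 r) θ * ((fun _ => (1:ℂ)) (circleMap 0 r θ) *
      deriv (R.Z i) (circleMap 0 r θ))) / (R.Z i (circleMap 0 r θ) - a) := by
  ext a
  rw [← R.CT_term_eq (h := fun _ => (1:ℂ))]
  simp [NN]

lemma circleMap_cann {r : ℝ} (h1 : R.r0 ≤ r) (h2 : r ≤ R.r1) (θ : ℝ) :
    circleMap 0 r θ ∈ cann R.r0 R.r1 :=
  R.sphere_sub h1 h2 (circleMap_mem_sphere 0 (R.h0.le.trans h1) θ)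

lemma NN_hasDerivAt {i : Fin R.n} {r : ℝ} (h1 : R.r0 ≤ r) (h2 : r ≤ R.r1) {a : ℂ}
    (ha : ∀ w ∈ sphere (0:ℂ) r, R.Z i w ≠ a) : HasDerivAt (R.NN i r) 0 a := by
  have hr0 : 0 ≤ r := R.h0.le.trans h1
  have hd := cauchyInt_hasDerivAt (a := 0) (b := 2 * Real.pi) (z := a)
    (R.CT_cont1 h1 h2 i (h := fun _ => (1:ℂ)) continuousOn_const) (R.CT_cont2 h1 h2 i)
    (fun t _ => ha _ (circleMap_mem_sphere 0 hr0 t))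
  rw [NN_eq]
  convert! hd using 1
  have : (∮ w in C(0, r), deriv (R.Z i) w / (R.Z i w - a) ^ 2) = 0 := by
    refine circleIntegral.integral_eq_zero_of_hasDerivWithinAt
      (f := fun w => -(R.Z i w - a)⁻¹) hr0 fun w hw => ?_
    have hw0 : w ≠ 0 := R.ne_zero_of_mem_cann (R.sphere_sub h1 h2 hw)
    have := (((R.diffAt i hw0).hasDerivAt.sub_const a).inv (sub_ne_zero.2 (ha w hw))).neg
    convert! this.hasDerivWithinAt using 1
    ring
  refine this.symm.trans ?_
  rw [circleIntegral]
  refine intervalIntegral.integral_congr fun θ _ => ?_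
  simp only [smul_eq_mul]
  ring

lemma NN_tendsto {i : Fin R.n} {r : ℝ} (h1 : R.r0 ≤ r) (h2 : r ≤ R.r1) :
    Tendsto (R.NN i r) (cobounded ℂ) (𝓝 0) := by
  rw [NN_eq]
  exact tendsto_zero_of_tendsto_mul le_rfl (cauchyInt_tendsto_mul
    (R.CT_cont1 h1 h2 i (h := fun _ => (1:ℂ)) continuousOn_const) (R.CT_cont2 h1 h2 i))

lemma NN_const {i : Fin R.n} {r : ℝ} (h1 : R.r0 ≤ r) (h2 : r ≤ R.r1) {s : Set ℂ} (hs : IsOpen s)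
    (hs' : IsPreconnected s) (h : ∀ a ∈ s, ∀ w ∈ sphere (0:ℂ) r, R.Z i w ≠ a) {x y : ℂ}
    (hx : x ∈ s) (hy : y ∈ s) : R.NN i r x = R.NN i r y :=
  hs.is_const_of_deriv_eq_zero hs'
    (fun a ha => (R.NN_hasDerivAt h1 h2 (h a ha)).differentiableAt.differentiableWithinAt)
    (fun a ha => (R.NN_hasDerivAt h1 h2 (h a ha)).deriv) hx hy

lemma NN_zero_compl (hK : IsCompact K) (hconn : IsPreconnected Kᶜ) {i : Fin R.n} {r : ℝ}
    (h1 : R.r0 ≤ r) (h2 : r ≤ R.ρ0) {a : ℂ} (ha : a ∈ Kᶜ) : R.NN i r a = 0 := by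
  have h3 : r ≤ R.r1 := by linarith [R.hρ1, R.h11]
  have hc : ∀ y ∈ Kᶜ, R.NN i r y = R.NN i r a := fun y hy =>
    R.NN_const h1 h3 hK.isClosed.isOpen_compl hconn (fun b hb w hw e => by
      have hwn : ‖w‖ = r := by simpa using hw
      have := R.inn i w ⟨hwn ▸ h1, hwn ▸ h2⟩
      rw [e] at this
      exact hb (interior_subset this)) hy ha
  have hKc : Kᶜ ∈ cobounded ℂ := hK.isBounded
  have h4 : Tendsto (R.NN i r) (cobounded ℂ) (𝓝 (R.NN i r a)) :=
    tendsto_const_nhds.congr' (by filter_upwards [hKc] with y hy using (hc y hy).symm)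
  exact tendsto_nhds_unique h4 (R.NN_tendsto h1 h3)

lemma NN_zero_small (hK : IsCompact K) (hconn : IsPreconnected Kᶜ) {i j : Fin R.n} {r : ℝ}
    (h1 : R.r0 ≤ r) (h2 : r ≤ R.ρ0) {w : ℂ} (hw : w ∈ ann r R.r1) : R.NN i r (R.Z j w) = 0 := by
  have h3 : r ≤ R.r1 := by linarith [R.hρ1, R.h11]
  have hr1 : r < 1 := by linarith [R.hρ1]
  obtain ⟨s, hs1, hs2⟩ := exists_between R.h11
  have hsn : ‖(s:ℂ)‖ = s := by
    rw [Complex.norm_real, Real.norm_of_nonneg (by linarith)]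
  have hsm : (s:ℂ) ∈ ann r R.r1 := by rw [mem_ann, hsn]; exact ⟨by linarith, hs2⟩
  rw [← R.NN_zero_compl hK hconn (i := i) h1 h2 (R.out j s (by rw [mem_cann, hsn]; exact ⟨hs1.le, hs2.le⟩))]
  refine R.NN_const h1 h3 (R.isOpen_image j h1 le_rfl) ((isPreconnected_ann (R.h0.le.trans h1)).image _
    (R.continuousOn_Z j (R.ann_sub h1 le_rfl))) ?_ (mem_image_of_mem _ hw) (mem_image_of_mem _ hsm)
  rintro _ ⟨w', hw', rfl⟩ u hu e
  obtain ⟨-, rfl⟩ := R.inj _ _ _ _ (R.sphere_sub h1 h3 hu) (R.ann_sub h1 le_rfl hw') e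
  have := hw'.1
  simp at hu
  linarith

lemma CT_single (i : Fin R.n) (r : ℝ) (a : ℂ) :
    R.CT r (fun j _ => if j = i then 1 else 0) a = -(2 * Real.pi * I)⁻¹ * R.NN i r a := by
  rw [CT, NN]
  congr 1
  rw [Finset.sum_eq_single i]
  · simp
  · intro j _ hj
    simp [hj, circleIntegral]
  · simp

lemma NN_inside (hK : IsCompact K) (hconn : IsPreconnected Kᶜ) {i j : Fin R.n} {r : ℝ}
    (h2 : r < R.r1) {w : ℂ} (hw : w ∈ ann R.r0 r) :
    R.NN i r (R.Z j w) = if j = i then 2 * Real.pi * I else 0 := by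
  obtain ⟨t, ht1, ht2⟩ := exists_between (lt_min hw.1 R.h0ρ)
  have hpi : (2 * Real.pi * I : ℂ) ≠ 0 := by simp [Real.pi_ne_zero]
  have hj := R.CT_jump (s := R.r0) (s' := R.r1) le_rfl ht1 h2 le_rfl
    (h := fun j _ => if j = i then 1 else 0) (fun _ => differentiableOn_const _) (i := j) (w0 := w)
    ⟨ht2.trans_le (min_le_left _ _), hw.2⟩
  rw [CT_single, CT_single, R.NN_zero_small hK hconn ht1.le (ht2.trans_le (min_le_right _ _)).le
    ⟨ht2.trans_le (min_le_left _ _), hw.2.trans h2⟩] at hj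
  have e : R.NN i r (R.Z j w) = (2 * Real.pi * I) * (if j = i then 1 else 0) := by
    rw [← hj]; field_simp; ring
  rw [e]; split_ifs <;> simp

/-- the collar functions `Z_j - b_i` wind correctly -/
lemma hasW_sub (hK : IsCompact K) (hconn : IsPreconnected Kᶜ) {i j : Fin R.n} {c : ℝ} {w : ℂ}
    (hc : c < R.r1) (hw : w ∈ ann R.r0 c) :
    HasW (fun u => R.Z i u - R.Z j w) c R.r1 (if j = i then 1 else 0) := by
  have hc0 : 0 ≤ c := (norm_nonneg w).trans hw.2.le
  have hcr : R.r0 < c := hw.1.trans hw.2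
  have hne : ∀ u ∈ ann c R.r1, R.Z i u - R.Z j w ≠ 0 := by
    intro u hu h
    obtain ⟨-, rfl⟩ := R.inj _ _ _ _ (R.ann_sub hcr.le le_rfl hu) (R.ann_sub le_rfl hc.le hw)
      (sub_eq_zero.1 h)
    exact absurd hw.2 (not_lt.2 hu.1.le)
  obtain ⟨n, hn⟩ := exists_hasW hc0 (h := fun u => R.Z i u - R.Z j w)
    (((R.holo i).mono (R.sub_ne (R.ann_sub hcr.le le_rfl))).sub_const _) hne
  obtain ⟨r, hr1, hr2⟩ := exists_between hc
  have hi := hn.integral hc0 hr1 hr2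
  have hN := R.NN_inside hK hconn (i := i) (j := j) hr2 ⟨hw.1, hw.2.trans hr1⟩
  have e : (∮ u in C(0, r), deriv (fun u => R.Z i u - R.Z j w) u / (R.Z i u - R.Z j w)) =
      R.NN i r (R.Z j w) := by
    rw [NN]; congr 1; ext u; rw [deriv_sub_const]
  rw [e, hN] at hi
  have hpi : (2 * Real.pi * I : ℂ) ≠ 0 := by simp [Real.pi_ne_zero]
  have : n = if j = i then 1 else 0 := by
    split_ifs at hi ⊢
    · have : (n:ℂ) = 1 := mul_left_cancel₀ hpi (by rw [← hi, mul_one])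
      exact_mod_cast this
    · rcases mul_eq_zero.1 hi.symm with h | h
      · exact absurd h hpi
      · exact_mod_cast h
  rw [← this]; exact hn

/-- the difference quotient -/
lemma q_ne {j : Fin R.n} {w w' : ℂ} (hw : w ∈ cann R.r0 R.r1) (hw' : w' ∈ cann R.r0 R.r1) :
    dslope (R.Z j) w' w ≠ 0 := by
  by_cases h : w = w'
  · rw [h, dslope_same]; exact R.dne j w' hw'
  · rw [dslope_of_ne _ h, slope_def_field]
    refine div_ne_zero (sub_ne_zero.2 fun e => h (R.inj _ _ _ _ hw hw' e).2) (sub_ne_zero.2 h)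

lemma q_diff {j : Fin R.n} {w' : ℂ} (hw' : w' ≠ 0) :
    DifferentiableOn ℂ (dslope (R.Z j) w') {0}ᶜ :=
  (Complex.differentiableOn_dslope (isOpen_compl_singleton.mem_nhds hw')).2 (R.holo j)

lemma q_symm {j : Fin R.n} (w w' : ℂ) : dslope (R.Z j) w' w = dslope (R.Z j) w w' := by
  by_cases h : w = w'
  · rw [h]
  · rw [dslope_of_ne _ h, dslope_of_ne _ (Ne.symm h), slope_comm]

lemma q_hasW (hK : IsCompact K) (hconn : IsPreconnected Kᶜ) {j : Fin R.n} {w' : ℂ}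
    (hw' : w' ∈ ann R.r0 R.r1) : HasW (dslope (R.Z j) w') R.r0 R.r1 0 := by
  have h0 := R.h0.le
  have hw'0 : w' ≠ 0 := R.ne_zero_of_mem_cann (ann_subset_cann _ _ hw')
  obtain ⟨n, hn⟩ := exists_hasW h0 ((R.q_diff (j := j) hw'0).mono (R.sub_ne (R.ann_sub le_rfl le_rfl)))
    (fun w hw => R.q_ne (ann_subset_cann _ _ hw) (ann_subset_cann _ _ hw'))
  obtain ⟨c, hc1, hc2⟩ := exists_between hw'.2
  have hc0 : 0 ≤ c := (norm_nonneg w').trans hc1.le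
  have hrc : R.r0 < c := hw'.1.trans hc1
  obtain ⟨r, hr1, hr2⟩ := exists_between hc2
  have hr0 : 0 < r := by linarith
  have h1 := R.hasW_sub hK hconn (i := j) (j := j) hc2 (w := w') ⟨hw'.1, hc1⟩
  rw [if_pos rfl] at h1
  have hne : ∀ u ∈ ann c R.r1, u - w' ≠ 0 := fun u hu h => by
    have := hu.1; rw [sub_eq_zero.1 h] at this; linarith
  obtain ⟨m, hm⟩ := exists_hasW hc0 (h := fun u => u - w') (a := c) (b := R.r1) (by fun_prop) hne
  have hm1 : m = 1 := by
    have hi := hm.integral hc0 hr1 hr2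
    have e : (∮ u in C(0, r), deriv (fun u => u - w') u / (u - w')) = 2 * Real.pi * I := by
      rw [← circleIntegral.integral_sub_inv_of_mem_ball (c := 0) (R := r) (w := w')
        (by rw [mem_ball_zero_iff]; linarith)]
      congr 1; ext u; simp
    rw [e] at hi
    have hpi : (2 * Real.pi * I : ℂ) ≠ 0 := by simp [Real.pi_ne_zero]
    have : (m:ℂ) = 1 := mul_left_cancel₀ hpi (by rw [← hi, mul_one])
    exact_mod_cast this
  have h2 := (hn.mono hrc.le le_rfl).mul hc0 hm
  have h3 := h2.congr (h' := fun u => R.Z j u - R.Z j w') fun u hu => by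
    have : u ≠ w' := sub_ne_zero.1 (hne u hu)
    rw [dslope_of_ne _ this, slope_def_field, div_mul_cancel₀ _ (hne u hu)]
  have := HasW.unique hc0 hc0 hr1 hr2 hr1 hr2 h1 h3
  have hn0 : n = 0 := by omega
  rw [← hn0]; exact hn

lemma log_periodic {a b : ℝ} (ha : 0 ≤ a) {h : ℂ → ℂ} {H : ℂ → ℂ} {n : ℤ} (hw : HasW h a b n)
    (hH : ContinuousOn H (strip a b)) (he : ∀ ζ ∈ strip a b, exp (H ζ) = h (exp ζ)) {ζ : ℂ}
    (hζ : ζ ∈ strip a b) : H (ζ + 2 * Real.pi * I) = H ζ + n * (2 * Real.pi * I) := by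
  obtain ⟨k, hk, hkw⟩ := hw
  have hc : ContinuousOn (fun ζ => H ζ - (n * ζ + k (exp ζ))) (strip a b) :=
    hH.sub ((by fun_prop : ContinuousOn (fun ζ : ℂ => (n:ℂ) * ζ) (strip a b)).add
      (hk.continuousOn.comp (by fun_prop) (fun ζ hζ => hζ)))
  obtain ⟨m, hm⟩ := eq_const_of_exp_eq_one (convex_strip a b).isPreconnected hc (fun ζ hζ => by
    rw [Complex.exp_sub, he ζ hζ, hkw _ hζ, Complex.exp_add, ← Complex.exp_int_mul]
    exact div_self (mul_ne_zero (Complex.exp_ne_zero _) (Complex.exp_ne_zero _)))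
  have h1 := hm ζ hζ
  have h2 := hm _ (strip_add.2 hζ)
  rw [Complex.exp_periodic] at h2
  linear_combination h2 - h1

lemma hasW_deriv (hK : IsCompact K) (hconn : IsPreconnected Kᶜ) (j : Fin R.n) :
    HasW (deriv (R.Z j)) R.r0 R.r1 0 := by
  have h0 := R.h0.le
  have hsub : ann R.r0 R.r1 ⊆ cann R.r0 R.r1 := ann_subset_cann _ _
  obtain ⟨n, hn⟩ := exists_hasW h0 ((R.diffOn_deriv j).mono (R.sub_ne hsub))
    (fun w hw => R.dne j w (hsub hw))
  set S := strip R.r0 R.r1 with hS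
  have hSc : Convex ℝ S := convex_strip _ _
  obtain ⟨ζ0, hζ0⟩ : S.Nonempty := strip_nonempty h0 R.h0r1
  have hq : ContinuousOn (fun p : ℂ × ℂ => dslope (R.Z j) (exp p.1) (exp p.2)) (S ×ˢ S) := by
    have := dslope_cont (X := Unit) (s := univ) (U := {0}ᶜ) isOpen_compl_singleton
      (g := fun _ => R.Z j) ((R.holo j).continuousOn.comp continuousOn_snd fun p hp => hp.2)
      (fun _ _ => R.holo j)
    refine this.comp (f := fun p : ℂ × ℂ => ((), exp p.1, exp p.2)) (by fun_prop) fun p hp => ?_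
    exact ⟨mem_univ _, R.sub_ne hsub hp.1, R.sub_ne hsub hp.2⟩
  obtain ⟨H, hH, hHe⟩ := exists_clog (hSc.prod hSc) ⟨(ζ0, ζ0), hζ0, hζ0⟩
    ((isOpen_strip _ _).prod (isOpen_strip _ _)) hq
    (fun p hp => R.q_ne (hsub hp.2) (hsub hp.1))
  have hp2 : ∀ x ∈ S, ∀ y ∈ S, H (x, y + 2 * Real.pi * I) = H (x, y) := by
    intro x hx y hy
    have := log_periodic h0 (R.q_hasW hK hconn (j := j) hx) (H := fun y => H (x, y))
      (hH.comp (by fun_prop) fun y hy => ⟨hx, hy⟩) (fun y hy => hHe (x, y) ⟨hx, hy⟩) hy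
    simpa using this
  have hp1 : ∀ x ∈ S, ∀ y ∈ S, H (x + 2 * Real.pi * I, y) = H (x, y) := by
    intro x hx y hy
    have := log_periodic h0 (R.q_hasW hK hconn (j := j) hy) (H := fun x => H (x, y))
      (hH.comp (by fun_prop) fun x hx => ⟨hx, hy⟩)
      (fun x hx => by rw [hHe (x, y) ⟨hx, hy⟩, q_symm]) hx
    simpa using this
  have hd := log_periodic h0 hn (H := fun x => H (x, x)) (hH.comp (by fun_prop) fun x hx => ⟨hx, hx⟩)
    (fun x hx => by rw [hHe (x, x) ⟨hx, hx⟩, dslope_same]) hζ0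
  rw [hp1 _ hζ0 _ (strip_add.2 hζ0), hp2 _ hζ0 _ hζ0] at hd
  have hpi : (2 * Real.pi * I : ℂ) ≠ 0 := by simp [Real.pi_ne_zero]
  have : (n:ℂ) = 0 := by
    have : (n:ℂ) * (2 * Real.pi * I) = 0 := by linear_combination -hd
    exact (mul_eq_zero.1 this).resolve_right hpi
  have hn0 : n = 0 := by exact_mod_cast this
  rw [← hn0]; exact hn

/-- connectedness of the outer domain -/
lemma isPreconnected_Uo (hK : IsCompact K) (hconn : IsPreconnected Kᶜ) :
    IsPreconnected (R.Uo 1) := by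
  classical
  rw [isPreconnected_iff_subset_of_disjoint]
  intro A B hA hB hcov hdis
  have hr1 : R.r0 ≤ 1 := by linarith [R.h0ρ, R.hρ1]
  have hUo : IsOpen (R.Uo 1) := R.isOpen_Uo hK hr1 R.h11
  have hcol : ∀ j, R.Z j '' ann 1 R.r1 ⊆ R.Uo 1 := fun j => by
    rintro _ ⟨w, hw, rfl⟩; exact Or.inr (R.Z_mem_AA hw)
  have hAB : ∀ z ∈ R.Uo 1, z ∈ A → z ∈ B → False := fun z h1 h2 h3 => by
    have : z ∈ R.Uo 1 ∩ (A ∩ B) := ⟨h1, h2, h3⟩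
    rw [hdis] at this; exact this
  have hone : ∀ j, ¬ (R.Z j '' ann 1 R.r1 ⊆ A) → R.Z j '' ann 1 R.r1 ⊆ B := by
    intro j hj
    have hpre : IsPreconnected (R.Z j '' ann 1 R.r1) :=
      (isPreconnected_ann zero_le_one).image _ (R.continuousOn_Z j (R.ann_sub hr1 le_rfl))
    rcases isPreconnected_iff_subset_of_disjoint.1 hpre A B hA hB ((hcol j).trans hcov) (by
      apply Set.eq_empty_of_subset_empty
      rw [← hdis]; exact inter_subset_inter_left _ (hcol j)) with h | h
    · exact absurd h hj
    · exact h
  set A' : Set ℂ := (A ∩ R.Uo 1) ∪ ⋃ (j) (_ : R.Z j '' ann 1 R.r1 ⊆ A), R.Z j '' ann R.r0 R.r1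
    with hA'
  set B' : Set ℂ := (B ∩ R.Uo 1) ∪ ⋃ (j) (_ : ¬ R.Z j '' ann 1 R.r1 ⊆ A), R.Z j '' ann R.r0 R.r1
    with hB'
  have mA : ∀ z, z ∈ A' ↔ (z ∈ A ∧ z ∈ R.Uo 1) ∨ ∃ j, R.Z j '' ann 1 R.r1 ⊆ A ∧
      ∃ w ∈ ann R.r0 R.r1, R.Z j w = z := fun z => by
    simp only [hA', mem_union, mem_inter_iff, mem_iUnion, mem_image, exists_prop]
  have mB : ∀ z, z ∈ B' ↔ (z ∈ B ∧ z ∈ R.Uo 1) ∨ ∃ j, ¬ R.Z j '' ann 1 R.r1 ⊆ A ∧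
      ∃ w ∈ ann R.r0 R.r1, R.Z j w = z := fun z => by
    simp only [hB', mem_union, mem_inter_iff, mem_iUnion, mem_image, exists_prop]
  have oA' : IsOpen A' := (hA.inter hUo).union
    (isOpen_iUnion fun j => isOpen_iUnion fun _ => R.isOpen_image j le_rfl le_rfl)
  have oB' : IsOpen B' := (hB.inter hUo).union
    (isOpen_iUnion fun j => isOpen_iUnion fun _ => R.isOpen_image j le_rfl le_rfl)
  have hin : ∀ j w, w ∈ ann R.r0 R.r1 → R.Z j w ∈ R.Uo 1 → R.Z j w ∈ R.Z j '' ann 1 R.r1 :=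
    fun j w hw h => mem_image_of_mem _ ⟨(R.Z_mem_Uo_iff hr1 hw).1 h, hw.2⟩
  have hdis' : Kᶜ ∩ (A' ∩ B') = ∅ := by
    apply Set.eq_empty_of_forall_notMem
    rintro z ⟨-, hzA, hzB⟩
    rcases (mA z).1 hzA with ⟨a1, a2⟩ | ⟨j, hj, w, hw, rfl⟩
    · rcases (mB z).1 hzB with ⟨b1, -⟩ | ⟨i, hi, w, hw, rfl⟩
      · exact hAB z a2 a1 b1
      · exact hAB _ a2 a1 (hone i hi (hin i w hw a2))
    · rcases (mB _).1 hzB with ⟨b1, b2⟩ | ⟨i, hi, w', hw', e⟩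
      · exact hAB _ b2 (hj (hin j w hw b2)) b1
      · obtain ⟨rfl, -⟩ := R.inj _ _ _ _ (ann_subset_cann _ _ hw') (ann_subset_cann _ _ hw) e
        exact hi hj
  have hcov' : Kᶜ ⊆ A' ∪ B' := by
    intro z hz
    by_cases hzA : z ∈ R.AA R.r0 R.r1
    · obtain ⟨j, w, hw, rfl⟩ := R.mem_AA.1 hzA
      by_cases hj : R.Z j '' ann 1 R.r1 ⊆ A
      · exact Or.inl ((mA _).2 (Or.inr ⟨j, hj, w, hw, rfl⟩))
      · exact Or.inr ((mB _).2 (Or.inr ⟨j, hj, w, hw, rfl⟩))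
    · have hzU : z ∈ R.Uo 1 := Or.inl ⟨hz, hzA⟩
      rcases hcov hzU with h | h
      · exact Or.inl ((mA _).2 (Or.inl ⟨h, hzU⟩))
      · exact Or.inr ((mB _).2 (Or.inl ⟨h, hzU⟩))
  rcases isPreconnected_iff_subset_of_disjoint.1 hconn A' B' oA' oB' hcov' hdis' with h | h
  · left
    intro z hz
    rcases (mA z).1 (h (R.Uo_one_subset hz)) with ⟨a, -⟩ | ⟨j, hj, w, hw, rfl⟩
    · exact a
    · exact hj (hin j w hw hz)
  · right
    intro z hz
    rcases (mB z).1 (h (R.Uo_one_subset hz)) with ⟨a, -⟩ | ⟨j, hj, w, hw, rfl⟩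
    · exact a
    · exact hone j hj (hin j w hw hz)

end RingSys

end ACap

namespace ACap

/-- values `|f'(∞)|` of admissible functions on `U` -/
def capSet (U : Set ℂ) : Set ℝ := {r | ∃ (f : ℂ → ℂ) (l w : ℂ), DifferentiableOn ℂ f U ∧
  (∀ z ∈ U, ‖f z‖ ≤ 1) ∧ Tendsto f (cobounded ℂ) (𝓝 l) ∧
  Tendsto (fun z => z * (f z - l)) (cobounded ℂ) (𝓝 w) ∧ r = ‖w‖}

/-- capacity associated with the outer domain `U` -/
def cap (U : Set ℂ) : ℝ := sSup (capSet U)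

lemma exists_radius {U : Set ℂ} (hU : U ∈ cobounded ℂ) : ∃ R : ℝ, 0 ≤ R ∧ {z | R < ‖z‖} ⊆ U := by
  obtain ⟨S, -, hS⟩ := (hasBasis_cobounded_norm (E := ℂ)).mem_iff.1 hU
  exact ⟨max S 0, le_max_right _ _, fun z hz => hS ((le_max_left S 0).trans (le_of_lt hz))⟩

lemma capSet_le {U : Set ℂ} {R : ℝ} (hR : 0 ≤ R) (hU : {z | R < ‖z‖} ⊆ U) :
    ∀ x ∈ capSet U, x ≤ R + 1 := by
  rintro _ ⟨f, l, w, hf, hb, hl, hw, rfl⟩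
  have h1 := circle_inf hR (by linarith : R < R + 1) (hf.mono hU) hw
  have h2 := circleIntegral.norm_integral_le_of_norm_le_const (f := f) (c := 0) (R := R + 1)
    (C := 1) (by linarith) (fun z hz => hb z (hU (by
      have : ‖z‖ = R + 1 := by simpa using hz
      change R < ‖z‖; linarith)))
  rw [h1, norm_mul, norm_mul, norm_mul, Complex.norm_real, Complex.norm_I,
    Real.norm_of_nonneg Real.pi_pos.le] at h2
  simp at h2
  nlinarith [Real.pi_pos]

lemma capSet_bdd {U : Set ℂ} (hU : U ∈ cobounded ℂ) : BddAbove (capSet U) := by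
  obtain ⟨R, hR, h⟩ := exists_radius hU
  exact ⟨R + 1, fun x hx => capSet_le hR h x hx⟩

lemma zero_mem_capSet (U : Set ℂ) : 0 ∈ capSet U :=
  ⟨fun _ => 0, 0, 0, differentiableOn_const _, by simp, tendsto_const_nhds, by simp, by simp⟩

lemma cap_nonneg {U : Set ℂ} (hU : U ∈ cobounded ℂ) : 0 ≤ cap U :=
  le_csSup (capSet_bdd hU) (zero_mem_capSet U)

lemma le_cap {U : Set ℂ} (hU : U ∈ cobounded ℂ) {f : ℂ → ℂ} {l w : ℂ}
    (hf : DifferentiableOn ℂ f U) {M : ℝ} (hM : 0 < M) (hb : ∀ z ∈ U, ‖f z‖ ≤ M)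
    (hl : Tendsto f (cobounded ℂ) (𝓝 l))
    (hw : Tendsto (fun z => z * (f z - l)) (cobounded ℂ) (𝓝 w)) : ‖w‖ ≤ M * cap U := by
  have : ‖(M:ℂ)⁻¹ * w‖ ≤ cap U := by
    refine le_csSup (capSet_bdd hU) ⟨fun z => (M:ℂ)⁻¹ * f z, (M:ℂ)⁻¹ * l, (M:ℂ)⁻¹ * w,
      hf.const_mul _, fun z hz => ?_, hl.const_mul _, ?_, rfl⟩
    · rw [norm_mul, norm_inv, Complex.norm_real, Real.norm_of_nonneg hM.le, inv_mul_le_iff₀ hM]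
      simpa using hb z hz
    · exact (hw.const_mul _).congr fun z => by ring
  rwa [norm_mul, norm_inv, Complex.norm_real, Real.norm_of_nonneg hM.le, inv_mul_le_iff₀ hM] at this

/-- existence of a (normalised) Ahlfors function -/
lemma exists_extremal {U : Set ℂ} (hUo : IsOpen U) (hU : U ∈ cobounded ℂ) :
    ∃ f : ℂ → ℂ, DifferentiableOn ℂ f U ∧ (∀ z ∈ U, ‖f z‖ ≤ 1) ∧ Tendsto f (cobounded ℂ) (𝓝 0) ∧
      Tendsto (fun z => z * (f z - 0)) (cobounded ℂ) (𝓝 (cap U : ℂ)) := by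
  rcases (cap_nonneg hU).eq_or_lt with h0 | hpos
  · refine ⟨fun _ => 0, differentiableOn_const _, by simp, tendsto_const_nhds, ?_⟩
    rw [← h0]; simp
  obtain ⟨R, hR, hRU⟩ := exists_radius hU
  obtain ⟨x, -, hx, hxm⟩ := exists_seq_tendsto_sSup ⟨0, zero_mem_capSet U⟩ (capSet_bdd hU)
  choose f l w hf hb hl hw hxw using hxm
  obtain ⟨F, l', w', hF, hF1, hFl, hFw, hcl⟩ := montel_inf (U := fun _ => U) hUo (fun z hz => by
    obtain ⟨δ, hδ, h⟩ := Metric.isOpen_iff.1 hUo z hz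
    exact ⟨δ, hδ, Eventually.of_forall fun _ => h⟩) hR (fun _ => hRU) hRU hf hb hw
  have hnw : ‖w'‖ = cap U := by
    have h1 : MapClusterPt ‖w'‖ atTop x := by
      have := hcl.continuousAt_comp (f := fun z : ℂ => ‖z‖) continuous_norm.continuousAt
      have e : (fun z : ℂ => ‖z‖) ∘ w = x := by ext n; exact (hxw n).symm
      rwa [e] at this
    have h2 : ClusterPt ‖w'‖ (𝓝 (cap U)) := ClusterPt.mono h1 hx
    exact eq_of_nhds_neBot h2
  have hl0 : l' = 0 := by
    have hc : ∀ c : ℝ, 0 < c → c < 1 → c ≤ 1 - c ^ 2 * ‖l'‖ ^ 2 := by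
      intro c h1 h2
      obtain ⟨g, v, hg, hg1, hgl, hgv, e⟩ := mobius_inf hF hU hF1 hFl hFw h1 h2
      have hv : ‖v‖ ≤ cap U := by simpa using le_cap hU hg one_pos hg1 hgl hgv
      rw [hnw] at e
      have hl1 : ‖l'‖ ≤ 1 := le_of_tendsto hFl.norm
        (by filter_upwards [hU] with z hz using hF1 z hz)
      have : 0 ≤ 1 - c ^ 2 * ‖l'‖ ^ 2 := by
        have : (c * ‖l'‖) ^ 2 ≤ 1 := by
          have : c * ‖l'‖ ≤ 1 := by nlinarith [norm_nonneg l']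
          have : 0 ≤ c * ‖l'‖ := by positivity
          nlinarith
        nlinarith
      have h3 : c * cap U ≤ cap U * (1 - c ^ 2 * ‖l'‖ ^ 2) := by
        rw [← e]; gcongr
      nlinarith
    have hlim : Tendsto (fun c : ℝ => 1 - c ^ 2 * ‖l'‖ ^ 2) (𝓝[<] 1) (𝓝 (1 - 1 ^ 2 * ‖l'‖ ^ 2)) :=
      (Continuous.tendsto (by fun_prop) 1).mono_left nhdsWithin_le_nhds
    have hid : Tendsto (fun c : ℝ => c) (𝓝[<] 1) (𝓝 1) :=
      (continuous_id.tendsto 1).mono_left nhdsWithin_le_nhds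
    have := le_of_tendsto_of_tendsto hid hlim (by
      filter_upwards [Ioo_mem_nhdsLT (zero_lt_one' ℝ)] with c h using hc c h.1 h.2)
    have h4 : ‖l'‖ ^ 2 = 0 := le_antisymm (by linarith) (by positivity)
    simpa using h4
  subst hl0
  have hw0 : w' ≠ 0 := by rw [← norm_pos_iff, hnw]; exact hpos
  set c : ℂ := (starRingEnd ℂ) w' / ‖w'‖ with hc
  have hnn : (‖w'‖:ℂ) ≠ 0 := by simpa using hw0
  have hcn : ‖c‖ = 1 := by
    rw [hc, norm_div, RCLike.norm_conj, Complex.norm_real, norm_norm]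
    exact div_self (norm_ne_zero_iff.2 hw0)
  have hcw : c * w' = (cap U : ℂ) := by
    rw [hc, div_mul_eq_mul_div, Complex.conj_mul', ← hnw]; field_simp
  refine ⟨fun z => c * F z, hF.const_mul _, fun z hz => ?_, by simpa using hFl.const_mul c, ?_⟩
  · rw [norm_mul, hcn, one_mul]; exact hF1 z hz
  · rw [← hcw]; exact (hFw.const_mul c).congr fun z => by ring

namespace RingSys

variable {K : Set ℂ} (R : RingSys K)

/-- The compact parameter space of the boundary circles. -/
abbrev XX : Type := Fin R.n × sphere (0:ℂ) 1

lemma one_mem : R.r0 ≤ 1 ∧ 1 ≤ R.r1 := ⟨by linarith [R.h0ρ, R.hρ1], R.h11.le⟩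

lemma X_mem (p : R.XX) : (p.2 : ℂ) ∈ cann R.r0 R.r1 := R.sphere_sub R.one_mem.1 R.one_mem.2 p.2.2

/-- the coordinate function on the boundary -/
def zz : C(R.XX, ℂ) := ⟨fun p => R.Z p.1 p.2, by
  rw [continuous_prod_of_discrete_left]
  intro j
  exact (R.continuousOn_Z j (R.sphere_sub R.one_mem.1 R.one_mem.2)).restrict⟩

@[simp] lemma zz_apply (p : R.XX) : R.zz p = R.Z p.1 p.2 := rfl

lemma mem_resolventSet {a : ℂ} (ha : ∀ j, ∀ w ∈ sphere (0:ℂ) 1, R.Z j w ≠ a) :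
    a ∈ resolventSet ℂ R.zz := by
  rw [← Set.notMem_compl_iff]
  change a ∉ spectrum ℂ R.zz
  rw [ContinuousMap.spectrum_eq_range]
  rintro ⟨p, hp⟩
  exact ha p.1 p.2 p.2.2 hp

lemma resolvent_apply {a : ℂ} (ha : a ∈ resolventSet ℂ R.zz) (p : R.XX) :
    resolvent R.zz a p = (a - R.Z p.1 p.2)⁻¹ := by
  have h1 : IsUnit (algebraMap ℂ C(R.XX, ℂ) a - R.zz) := ha
  have h2 := Ring.inverse_mul_cancel _ h1
  have h3 := congrArg (fun g : C(R.XX, ℂ) => g p) h2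
  simp only [ContinuousMap.mul_apply, ContinuousMap.sub_apply, zz_apply, ContinuousMap.one_apply]
    at h3
  have h4 : (algebraMap ℂ C(R.XX, ℂ) a) p = a := rfl
  rw [h4] at h3
  exact eq_inv_of_mul_eq_one_left h3

/-- boundary values of functions holomorphic across the boundary circles -/
def EE : Submodule ℂ C(R.XX, ℂ) where
  carrier := {φ | ∃ ρ, R.r0 ≤ ρ ∧ ρ < 1 ∧ ∃ (u : ℂ → ℂ) (l : ℂ), DifferentiableOn ℂ u (R.Uo ρ) ∧
    Tendsto u (cobounded ℂ) (𝓝 l) ∧ ∀ p : R.XX, φ p = u (R.Z p.1 p.2)}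
  zero_mem' := ⟨R.ρ0, R.h0ρ.le, R.hρ1, fun _ => 0, 0, differentiableOn_const _, tendsto_const_nhds,
    fun _ => rfl⟩
  add_mem' := by
    rintro φ φ' ⟨ρ, h1, h2, u, l, hu, hl, he⟩ ⟨ρ', h1', h2', u', l', hu', hl', he'⟩
    refine ⟨max ρ ρ', h1.trans (le_max_left _ _), max_lt h2 h2', fun z => u z + u' z, l + l',
      (hu.mono (R.Uo_mono (le_max_left _ _))).add (hu'.mono (R.Uo_mono (le_max_right _ _))),
      hl.add hl', fun p => ?_⟩
    rw [ContinuousMap.add_apply, he, he']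
  smul_mem' := by
    rintro c φ ⟨ρ, h1, h2, u, l, hu, hl, he⟩
    refine ⟨ρ, h1, h2, fun z => c * u z, c * l, hu.const_mul _, hl.const_mul _, fun p => ?_⟩
    rw [ContinuousMap.smul_apply, he, smul_eq_mul]

/-- a point on the unit circle -/
def pt (θ : ℝ) : sphere (0:ℂ) 1 := ⟨circleMap 0 1 θ, circleMap_mem_sphere 0 zero_le_one θ⟩

lemma continuous_pt : Continuous pt := (continuous_circleMap 0 1).subtype_mk _

lemma pt_cont (j : Fin R.n) (φ : C(R.XX, ℂ)) : Continuous fun θ =>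
    deriv (circleMap 0 1) θ * (φ (j, pt θ) * deriv (R.Z j) (circleMap 0 1 θ)) := by
  have h1 : Continuous fun θ => φ (j, pt θ) := φ.continuous.comp (continuous_const.prodMk continuous_pt)
  have h2 : Continuous fun θ => deriv (R.Z j) (circleMap 0 1 θ) :=
    cont_circle one_pos (R.continuousOn_dZ j (R.sphere_sub R.one_mem.1 R.one_mem.2))
  have h3 : Continuous (deriv (circleMap 0 1)) := by
    have : deriv (circleMap 0 1) = fun θ => circleMap 0 1 θ * I := by ext θ; simp [deriv_circleMap]
    rw [this]; exact (continuous_circleMap 0 1).mul continuous_const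
  exact h3.mul (h1.mul h2)

/-- the functional `φ ↦ (1/2πi) ∫ φ dζ` -/
def ell : C(R.XX, ℂ) →ₗ[ℂ] ℂ where
  toFun φ := (2 * Real.pi * I)⁻¹ * ∑ j, ∫ θ in (0:ℝ)..2 * Real.pi,
    deriv (circleMap 0 1) θ * (φ (j, pt θ) * deriv (R.Z j) (circleMap 0 1 θ))
  map_add' φ φ' := by
    rw [← mul_add, ← Finset.sum_add_distrib]
    congr 1
    refine Finset.sum_congr rfl fun j _ => ?_
    rw [← intervalIntegral.integral_add ((R.pt_cont j φ).intervalIntegrable _ _)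
      ((R.pt_cont j φ').intervalIntegrable _ _)]
    refine intervalIntegral.integral_congr fun θ _ => ?_
    simp only [ContinuousMap.add_apply]; ring
  map_smul' c φ := by
    rw [RingHom.id_apply, smul_eq_mul, mul_left_comm]
    congr 1
    rw [Finset.mul_sum]
    refine Finset.sum_congr rfl fun j _ => ?_
    rw [← intervalIntegral.integral_const_mul]
    refine intervalIntegral.integral_congr fun θ _ => ?_
    simp only [ContinuousMap.smul_apply, smul_eq_mul]; ring

lemma ell_eq {φ : C(R.XX, ℂ)} {u : ℂ → ℂ} (h : ∀ p : R.XX, φ p = u (R.Z p.1 p.2)) :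
    R.ell φ = (2 * Real.pi * I)⁻¹ * R.CI 1 (fun j w => u (R.Z j w)) := by
  have h0 : R.ell φ = (2 * Real.pi * I)⁻¹ * ∑ j, ∫ θ in (0:ℝ)..2 * Real.pi,
    deriv (circleMap 0 1) θ * (φ (j, pt θ) * deriv (R.Z j) (circleMap 0 1 θ)) := rfl
  rw [h0, CI]
  congr 1
  refine Finset.sum_congr rfl fun j _ => ?_
  rw [circleIntegral]
  refine intervalIntegral.integral_congr fun θ _ => ?_
  simp only [h, smul_eq_mul, pt]

lemma CT_bound {a : ℂ} (ha : ∀ j, ∀ w ∈ sphere (0:ℂ) 1, R.Z j w ≠ a) :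
    ∃ C : ℝ, 0 ≤ C ∧ ∀ (h : Fin R.n → ℂ → ℂ) (M : ℝ), 0 ≤ M → (∀ j, ∀ w ∈ sphere (0:ℂ) 1, ‖h j w‖ ≤ M) →
      ‖R.CT 1 h a‖ ≤ C * M := by
  have hb : ∀ j, ∃ B : ℝ, ∀ w ∈ sphere (0:ℂ) 1, ‖deriv (R.Z j) w / (R.Z j w - a)‖ ≤ B := by
    intro j
    have hs := R.sphere_sub R.one_mem.1 R.one_mem.2
    exact (isCompact_sphere (0:ℂ) 1).exists_bound_of_continuousOn ((R.continuousOn_dZ j hs).div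
      ((R.continuousOn_Z j hs).sub continuousOn_const) fun w hw => sub_ne_zero.2 (ha j w hw))
  choose B hB using hb
  have hB0 : ∀ j, 0 ≤ B j := fun j => (norm_nonneg _).trans (hB j 1 (by simp))
  refine ⟨∑ j, B j, Finset.sum_nonneg fun j _ => hB0 j, fun h M hM hh => ?_⟩
  have h1 : ∀ j, ‖∮ w in C(0, 1), h j w * deriv (R.Z j) w / (R.Z j w - a)‖ ≤ 2 * Real.pi * 1 * (M * B j) := by
    intro j
    refine circleIntegral.norm_integral_le_of_norm_le_const zero_le_one fun w hw => ?_
    rw [mul_div_assoc, norm_mul]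
    exact mul_le_mul (hh j w hw) (hB j w hw) (norm_nonneg _) hM
  rw [CT, norm_mul, norm_neg, norm_inv]
  have h2 : ‖(2 * Real.pi * I : ℂ)‖ = 2 * Real.pi := by
    simp [abs_of_pos Real.pi_pos]
  rw [h2, inv_mul_le_iff₀ (by have := Real.pi_pos; positivity)]
  refine (norm_sum_le _ _).trans ((Finset.sum_le_sum fun j _ => h1 j).trans (le_of_eq ?_))
  rw [← Finset.mul_sum, ← Finset.mul_sum]; ring

/-- the maximum principle on the outer domain -/
lemma max_principle (hK : IsCompact K) {ρ : ℝ} (h1 : R.r0 ≤ ρ) (h2 : ρ < 1) {u : ℂ → ℂ} {l : ℂ}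
    (hu : DifferentiableOn ℂ u (R.Uo ρ)) (hl : Tendsto u (cobounded ℂ) (𝓝 l)) {M : ℝ} (hM : 0 < M)
    (hb : ∀ j, ∀ w ∈ sphere (0:ℂ) 1, ‖u (R.Z j w)‖ ≤ M) {a : ℂ} (ha : a ∈ R.Uo 1) : ‖u a‖ ≤ M := by
  have hr01 : R.r0 < 1 := h1.trans_lt h2
  set j0 : Fin R.n := ⟨0, R.npos⟩
  set b := R.Z j0 (R.ρ0 : ℂ)
  have hρ : ‖(R.ρ0:ℂ)‖ = R.ρ0 := by
    rw [Complex.norm_real, Real.norm_of_nonneg (by linarith [R.h0, R.h0ρ])]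
  have hbU : b ∈ R.Ui 1 := by
    rw [R.Z_mem_Ui_iff R.h11.le ⟨by rw [hρ]; exact R.h0ρ, by rw [hρ]; linarith [R.hρ1, R.h11]⟩, hρ]
    exact R.hρ1
  obtain ⟨C1, hC1, hC1'⟩ := R.CT_bound (a := a) fun j w hw => R.not_mem_sphere_of_Uo hr01 R.h11 ha j hw
  obtain ⟨C2, hC2, hC2'⟩ := R.CT_bound (a := b) fun j w hw => R.not_mem_sphere_of_Ui hr01 R.h11 hbU j hw
  have key : ∀ m : ℕ, (‖u a‖ / M) ^ m ≤ C1 + C2 := by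
    intro m
    have hum : DifferentiableOn ℂ (fun z => u z ^ m) (R.Uo ρ) := hu.pow m
    have hlm : Tendsto (fun z => u z ^ m) (cobounded ℂ) (𝓝 (l ^ m)) := hl.pow m
    have e1 := R.RS1 hK h1 h2 R.h11 hum hlm ha
    have e2 := R.RS1_in hK h1 h2 R.h11 hum hlm hbU
    have hbm : ∀ j, ∀ w ∈ sphere (0:ℂ) 1, ‖(fun j w => u (R.Z j w) ^ m) j w‖ ≤ M ^ m := by
      intro j w hw
      rw [norm_pow]
      exact pow_le_pow_left₀ (norm_nonneg _) (hb j w hw) m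
    have n1 := hC1' _ _ (by positivity) hbm
    have n2 := hC2' _ _ (by positivity) hbm
    rw [div_pow, div_le_iff₀ (by positivity), ← norm_pow]
    have e3 : u a ^ m = R.CT 1 (fun j w => u (R.Z j w) ^ m) a - R.CT 1 (fun j w => u (R.Z j w) ^ m) b := by
      linear_combination e1 - e2
    rw [e3]
    refine (norm_sub_le _ _).trans ?_
    linarith
  by_contra hcon
  push Not at hcon
  have : 1 < ‖u a‖ / M := (one_lt_div hM).2 hcon
  obtain ⟨m, hm⟩ := ((tendsto_pow_atTop_atTop_of_one_lt this).eventually_gt_atTop (C1 + C2)).exists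
  exact absurd (key m) (not_le.2 hm)

lemma ell_bound (hK : IsCompact K) {φ : C(R.XX, ℂ)} (hφ : φ ∈ R.EE) :
    ‖R.ell φ‖ ≤ cap (R.Uo 1) * ‖φ‖ := by
  obtain ⟨ρ, h1, h2, u, l, hu, hl, he⟩ := hφ
  have hU1 : R.Uo 1 ⊆ R.Uo ρ := R.Uo_mono h2.le
  have hUc : R.Uo 1 ∈ cobounded ℂ := R.Uo_cobounded hK
  have hUo : IsOpen (R.Uo 1) := R.isOpen_Uo hK R.one_mem.1 R.h11
  have hpi : (2 * Real.pi * I : ℂ) ≠ 0 := by simp [Real.pi_ne_zero]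
  have key : ∀ M : ℝ, ‖φ‖ < M → ‖R.ell φ‖ ≤ M * cap (R.Uo 1) := by
    intro M hM
    have hM0 : 0 < M := (norm_nonneg φ).trans_lt hM
    have hbd : ∀ z ∈ R.Uo 1, ‖u z‖ ≤ M := fun z hz => R.max_principle hK h1 h2 hu hl hM0
      (fun j w hw => by
        have := he (j, ⟨w, hw⟩)
        dsimp only at this
        rw [← this]
        exact (φ.norm_coe_le_norm _).trans hM.le) hz
    obtain ⟨l', w', hl', hw'⟩ := laurent_inf hUc hUo (hu.mono hU1) hbd
    have e := R.RS2 hK h1 h2 R.h11 hu hl' hw'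
    rw [R.ell_eq he, e, inv_mul_cancel_left₀ hpi]
    exact le_cap hUc (hu.mono hU1) hM0 hbd hl' hw'
  refine le_of_tendsto_of_tendsto (f := fun _ => ‖R.ell φ‖) (g := fun M => M * cap (R.Uo 1))
    (b := 𝓝[>] ‖φ‖) tendsto_const_nhds ?_ ?_
  · rw [mul_comm]
    exact (Continuous.tendsto (by fun_prop) ‖φ‖).mono_left nhdsWithin_le_nhds
  · filter_upwards [self_mem_nhdsWithin] with M hM using key M hM

/-- The extended functional. -/
lemma exists_Lam (hK : IsCompact K) : ∃ L : C(R.XX, ℂ) →L[ℂ] ℂ, (∀ φ ∈ R.EE, L φ = R.ell φ) ∧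
    ‖L‖ ≤ cap (R.Uo 1) := by
  have hd := cap_nonneg (R.Uo_cobounded hK (ρ := 1))
  set f : R.EE →L[ℂ] ℂ := (R.ell.comp R.EE.subtype).mkContinuous (cap (R.Uo 1))
    (fun x => R.ell_bound hK x.2) with hf
  obtain ⟨g, hg, hgn⟩ := exists_extension_norm_eq R.EE f
  refine ⟨g, fun φ hφ => hg ⟨φ, hφ⟩, ?_⟩
  rw [hgn]
  exact LinearMap.mkContinuous_norm_le _ hd _

lemma Lam_inner (hK : IsCompact K) {L : C(R.XX, ℂ) →L[ℂ] ℂ} (hL : ∀ φ ∈ R.EE, L φ = R.ell φ)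
    {i : Fin R.n} {w : ℂ} (hw : w ∈ ann R.r0 1) : 1 + L (resolvent R.zz (R.Z i w)) = 0 := by
  have hwm : w ∈ ann R.r0 R.r1 := ann_mono le_rfl R.h11.le hw
  have hb : R.Z i w ∈ R.Ui 1 := (R.Z_mem_Ui_iff R.h11.le hwm).2 hw.2
  have hr01 : R.r0 < 1 := hw.1.trans hw.2
  have hres := R.mem_resolventSet fun j w' hw' => R.not_mem_sphere_of_Ui hr01 R.h11 hb j hw'
  set b := R.Z i w
  have hne : ∀ z ∈ R.Uo ‖w‖, b - z ≠ 0 := fun z hz h => by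
    rw [← sub_eq_zero.1 h, R.Z_mem_Uo_iff hw.1.le hwm] at hz
    exact lt_irrefl _ hz
  have hd : DifferentiableOn ℂ (fun z => (b - z)⁻¹) (R.Uo ‖w‖) :=
    DifferentiableOn.inv (by fun_prop) hne
  have hmul : Tendsto (fun z => z * ((b - z)⁻¹ - 0)) (cobounded ℂ) (𝓝 (-1)) := by
    have h1 : Tendsto (fun z : ℂ => b * z⁻¹ - 1) (cobounded ℂ) (𝓝 (b * 0 - 1)) :=
      (tendsto_inv₀_cobounded.const_mul b).sub_const 1
    have h2 := h1.inv₀ (by simp)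
    simp only [mul_zero, zero_sub] at h2
    have h3 : (-1 : ℂ)⁻¹ = -1 := by norm_num
    rw [h3] at h2
    refine h2.congr' ?_
    filter_upwards [eventually_ne_cobounded (0:ℂ)] with z hz
    have : b * z⁻¹ - 1 = (b - z) / z := by field_simp
    rw [this, inv_div, sub_zero, div_eq_mul_inv]
  have ht : Tendsto (fun z => (b - z)⁻¹) (cobounded ℂ) (𝓝 0) := by
    refine tendsto_zero_of_tendsto_mul le_rfl (l := -1) ?_
    simpa using hmul
  have he := fun p => R.resolvent_apply hres p
  rw [hL _ ⟨‖w‖, hw.1.le, hw.2, fun z => (b - z)⁻¹, 0, hd, ht, he⟩,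
    R.ell_eq (u := fun z => (b - z)⁻¹) he, R.RS2 hK hw.1.le hw.2 R.h11 hd ht hmul]
  have hpi : (2 * Real.pi * I : ℂ) ≠ 0 := by simp [Real.pi_ne_zero]
  rw [inv_mul_cancel_left₀ hpi]; ring

end RingSys

end ACap

namespace ACap

lemma dual_bound {X : Type*} [TopologicalSpace X] [CompactSpace X] {n : ℕ} {a b : ℝ} (hab : a ≤ b)
    (L : C(X, ℂ) →L[ℂ] ℂ) {Ψ : Fin n → ℝ → C(X, ℂ)} (hΨ : ∀ i, Continuous (Ψ i)) {M : ℝ} (hM : 0 ≤ M)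
    (hb : ∀ x, ∑ i, ∫ θ in a..b, ‖Ψ i θ x‖ ≤ M) :
    ∑ i, ∫ θ in a..b, ‖L (Ψ i θ)‖ ≤ ‖L‖ * M := by
  have hΛ : ∀ i, Continuous fun θ => L (Ψ i θ) := fun i => L.continuous.comp (hΨ i)
  have key : ∀ η : ℝ, 0 < η → ∑ i, ∫ θ in a..b, (‖L (Ψ i θ)‖ - η) ≤ ‖L‖ * M := by
    intro η hη
    set τ : Fin n → ℝ → ℂ := fun i θ => (starRingEnd ℂ) (L (Ψ i θ)) / ((‖L (Ψ i θ)‖ + η : ℝ) : ℂ) with hτ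
    have hpos : ∀ i θ, 0 < ‖L (Ψ i θ)‖ + η := fun i θ => by positivity
    have hτc : ∀ i, Continuous (τ i) := fun i =>
      (Complex.continuous_conj.comp (hΛ i)).div
        (Complex.continuous_ofReal.comp ((hΛ i).norm.add continuous_const))
        fun θ => by exact_mod_cast (hpos i θ).ne'
    have hτn : ∀ i θ, ‖τ i θ‖ ≤ 1 := fun i θ => by
      rw [hτ]; dsimp only
      rw [norm_div, RCLike.norm_conj, Complex.norm_real, Real.norm_of_nonneg (hpos i θ).le,
        div_le_one (hpos i θ)]
      linarith
    have hτL : ∀ i θ, ‖L (Ψ i θ)‖ - η ≤ (τ i θ * L (Ψ i θ)).re := fun i θ => by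
      have : τ i θ * L (Ψ i θ) = ((‖L (Ψ i θ)‖ ^ 2 / (‖L (Ψ i θ)‖ + η) : ℝ) : ℂ) := by
        rw [hτ]; dsimp only
        rw [div_mul_eq_mul_div, Complex.conj_mul']; push_cast; rfl
      rw [this, Complex.ofReal_re, le_div_iff₀ (hpos i θ)]
      nlinarith [sq_nonneg η]
    have hκ : ∀ i, Continuous fun θ => τ i θ • Ψ i θ := fun i => (hτc i).smul (hΨ i)
    set V : C(X, ℂ) := ∑ i, ∫ θ in a..b, τ i θ • Ψ i θ with hV
    have hVL : L V = ∑ i, ∫ θ in a..b, τ i θ * L (Ψ i θ) := by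
      rw [hV, map_sum]
      refine Finset.sum_congr rfl fun i _ => ?_
      rw [← ContinuousLinearMap.intervalIntegral_comp_comm L ((hκ i).intervalIntegrable _ _)]
      refine intervalIntegral.integral_congr fun θ _ => ?_
      simp
    have hVn : ‖V‖ ≤ M := by
      rw [ContinuousMap.norm_le _ hM]
      intro x
      have e : V x = ∑ i, ∫ θ in a..b, τ i θ * Ψ i θ x := by
        have : V x = ContinuousMap.evalCLM ℂ x V := rfl
        rw [this, hV, map_sum]
        refine Finset.sum_congr rfl fun i _ => ?_
        rw [← ContinuousLinearMap.intervalIntegral_comp_comm _ ((hκ i).intervalIntegrable _ _)]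
        refine intervalIntegral.integral_congr fun θ _ => ?_
        simp
      rw [e]
      refine (norm_sum_le _ _).trans ((Finset.sum_le_sum fun i _ => ?_).trans (hb x))
      have hc : Continuous fun θ => Ψ i θ x := (ContinuousMap.evalCLM ℂ x).continuous.comp (hΨ i)
      refine intervalIntegral.norm_integral_le_of_norm_le hab (Eventually.of_forall fun θ _ => ?_)
        (hc.norm.intervalIntegrable _ _)
      rw [norm_mul]
      exact mul_le_of_le_one_left (norm_nonneg _) (hτn i θ)
    have h1 : ∑ i, ∫ θ in a..b, (‖L (Ψ i θ)‖ - η) ≤ (L V).re := by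
      rw [hVL, Complex.re_sum]
      refine Finset.sum_le_sum fun i _ => ?_
      have hc : Continuous fun θ => τ i θ * L (Ψ i θ) := (hτc i).mul (hΛ i)
      have e := Complex.reCLM.intervalIntegral_comp_comm (μ := volume) (hc.intervalIntegrable a b)
      simp only [Complex.reCLM_apply] at e
      rw [← e]
      have hcn : Continuous fun θ => ‖L (Ψ i θ)‖ - η := (hΛ i).norm.sub continuous_const
      exact intervalIntegral.integral_mono_on hab (hcn.intervalIntegrable _ _)
        ((Complex.continuous_re.comp hc).intervalIntegrable _ _) fun θ _ => hτL i θ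
    calc _ ≤ (L V).re := h1
      _ ≤ ‖L V‖ := Complex.re_le_norm _
      _ ≤ ‖L‖ * ‖V‖ := L.le_opNorm V
      _ ≤ ‖L‖ * M := by gcongr
  have e2 : ∀ η : ℝ, ∑ i, ∫ θ in a..b, (‖L (Ψ i θ)‖ - η) =
      (∑ i, ∫ θ in a..b, ‖L (Ψ i θ)‖) - n * ((b - a) * η) := by
    intro η
    have : ∀ i, ∫ θ in a..b, (‖L (Ψ i θ)‖ - η) = (∫ θ in a..b, ‖L (Ψ i θ)‖) - (b - a) * η := fun i => by
      rw [intervalIntegral.integral_sub ((hΛ i).norm.intervalIntegrable _ _)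
        (continuous_const.intervalIntegrable _ _)]
      simp
    simp [this, Finset.sum_sub_distrib]
  have ht : Tendsto (fun η : ℝ => (∑ i, ∫ θ in a..b, ‖L (Ψ i θ)‖) - n * ((b - a) * η)) (𝓝[>] 0)
      (𝓝 (∑ i, ∫ θ in a..b, ‖L (Ψ i θ)‖)) := by
    have : Continuous (fun η : ℝ => (∑ i, ∫ θ in a..b, ‖L (Ψ i θ)‖) - n * ((b - a) * η)) := by fun_prop
    have := this.tendsto 0
    simp only [mul_zero, sub_zero] at this
    exact this.mono_left nhdsWithin_le_nhds
  refine le_of_tendsto ht ?_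
  filter_upwards [self_mem_nhdsWithin] with η hη
  rw [← e2]; exact key η hη

/-- reflected point -/
def star' (w : ℂ) : ℂ := ((starRingEnd ℂ) w)⁻¹

lemma star'_circleMap {r : ℝ} (hr : 0 < r) (θ : ℝ) : star' (circleMap 0 r θ) = circleMap 0 r⁻¹ θ := by
  simp only [star', circleMap, zero_add, map_mul, Complex.conj_ofReal, mul_inv, ofReal_inv,
    ← Complex.exp_conj, ← Complex.exp_neg, Complex.conj_I]
  ring_nf

/-- Poisson kernel -/
def PP (w x : ℂ) : ℂ := w / (w - x) - star' w / (star' w - x)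

lemma PP_eq {w x : ℂ} (hw : 1 < ‖w‖) (hx : ‖x‖ = 1) : PP w x = (((‖w‖ ^ 2 - 1) / ‖w - x‖ ^ 2 : ℝ) : ℂ) := by
  have hw0 : w ≠ 0 := by rintro rfl; simp at hw; linarith
  have hwx : w - x ≠ 0 := sub_ne_zero.2 (by rintro rfl; linarith)
  have hcw : (starRingEnd ℂ) w ≠ 0 := by simpa using hw0
  have hx0 : x ≠ 0 := by rintro rfl; simp at hx
  have hxc : x * (starRingEnd ℂ) x = 1 := by rw [Complex.mul_conj', hx]; simp
  have hcwx : (starRingEnd ℂ) (w - x) ≠ 0 := by simpa [-map_sub] using hwx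
  have h1 : star' w / (star' w - x) = - (starRingEnd ℂ) x / (starRingEnd ℂ) (w - x) := by
    have h2 : star' w - x ≠ 0 := by
      intro h
      have : ‖star' w‖ = 1 := by rw [sub_eq_zero.1 h, hx]
      rw [star', norm_inv, RCLike.norm_conj] at this
      have := inv_eq_one.1 this
      linarith
    rw [div_eq_div_iff h2 hcwx]
    simp only [star', map_sub]
    field_simp
    linear_combination (-(starRingEnd ℂ) w) * hxc
  rw [PP, h1]
  push_cast
  rw [← Complex.mul_conj' (w - x), ← Complex.mul_conj' w]
  field_simp
  simp only [map_sub]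
  linear_combination -hxc

lemma PP_norm {w x : ℂ} (hw : 1 < ‖w‖) (hx : ‖x‖ = 1) : (‖PP w x‖ : ℂ) = PP w x := by
  rw [PP_eq hw hx, Complex.norm_real, Real.norm_of_nonneg]
  have : 1 ≤ ‖w‖ ^ 2 := by nlinarith
  exact div_nonneg (by linarith) (by positivity)

lemma kern_cont {s : ℝ} {x : ℂ} (hs : 0 < s) (h : ‖x‖ ≠ s) :
    Continuous fun θ => circleMap 0 s θ / (circleMap 0 s θ - x) := by
  refine (continuous_circleMap 0 s).div ((continuous_circleMap 0 s).sub continuous_const) fun θ e => h ?_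
  rw [← sub_eq_zero.1 e, norm_circleMap_zero, abs_of_pos hs]

lemma circ_int {s : ℝ} {x : ℂ} : (∮ w in C(0, s), (w - x)⁻¹) =
    I * ∫ θ in (0:ℝ)..2 * Real.pi, circleMap 0 s θ / (circleMap 0 s θ - x) := by
  rw [circleIntegral, ← intervalIntegral.integral_const_mul]
  refine intervalIntegral.integral_congr fun θ _ => ?_
  simp only [deriv_circleMap, smul_eq_mul]; ring

lemma PP_int {r : ℝ} (hr : 1 < r) {x : ℂ} (hx : ‖x‖ = 1) :
    ∫ θ in (0:ℝ)..2 * Real.pi, ‖PP (circleMap 0 r θ) x‖ = 2 * Real.pi := by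
  have hr0 : 0 < r := by linarith
  have hri : r⁻¹ < 1 := inv_lt_one_of_one_lt₀ hr
  have h1 : (∮ w in C(0, r), (w - x)⁻¹) = 2 * Real.pi * I :=
    circleIntegral.integral_sub_inv_of_mem_ball (by simp [hx, hr])
  have h2 : (∮ w in C(0, r⁻¹), (w - x)⁻¹) = 0 := by
    refine DiffContOnCl.circleIntegral_eq_zero (by positivity) (DifferentiableOn.diffContOnCl (fun w hw => ?_))
    have hw1 : ‖w‖ ≤ r⁻¹ := by
      have := closure_ball_subset_closedBall hw
      simpa using this
    have : w - x ≠ 0 := sub_ne_zero.2 (by rintro rfl; linarith)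
    exact ((differentiableAt_id.sub_const x).inv this).differentiableWithinAt
  rw [circ_int] at h1 h2
  have c1 := kern_cont (x := x) hr0 (by rw [hx]; exact hr.ne)
  have c2 := kern_cont (x := x) (inv_pos.2 hr0) (by rw [hx]; exact hri.ne')
  have e : ((∫ θ in (0:ℝ)..2 * Real.pi, ‖PP (circleMap 0 r θ) x‖ : ℝ) : ℂ) = 2 * Real.pi := by
    rw [← intervalIntegral.integral_ofReal]
    have : ∀ θ : ℝ, ((‖PP (circleMap 0 r θ) x‖ : ℝ) : ℂ) = circleMap 0 r θ / (circleMap 0 r θ - x) -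
        circleMap 0 r⁻¹ θ / (circleMap 0 r⁻¹ θ - x) := by
      intro θ
      rw [PP_norm (by rw [norm_circleMap_zero, abs_of_pos hr0]; exact hr) hx, PP, star'_circleMap hr0]
    simp only [this]
    rw [intervalIntegral.integral_sub (c1.intervalIntegrable _ _) (c2.intervalIntegrable _ _)]
    have := mul_left_cancel₀ I_ne_zero (h1.trans (mul_comm _ _))
    have h3 := (mul_eq_zero.1 h2).resolve_left I_ne_zero
    rw [this, h3, sub_zero]
  exact_mod_cast e

namespace RingSys

variable {K : Set ℂ} (R : RingSys K)

/-- regular part of the kernel -/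
def GG (i j : Fin R.n) (w x : ℂ) : ℂ :=
  if j = i then w * (dslope (dslope (R.Z i) w) w x / dslope (R.Z i) w x) else
    w * deriv (R.Z i) w / (R.Z i w - R.Z j x)

lemma GG_eq (i j : Fin R.n) {w x : ℂ} (hw : w ∈ cann R.r0 R.r1) (hx : x ∈ cann R.r0 R.r1) (h : w ≠ x) :
    w * deriv (R.Z i) w / (R.Z i w - R.Z j x) = (if j = i then w / (w - x) else 0) + R.GG i j w x := by
  unfold GG
  split_ifs with hji
  · subst hji
    have hq : dslope (R.Z j) w x ≠ 0 := R.q_ne hx hw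
    have hwx : w - x ≠ 0 := sub_ne_zero.2 h
    have hxw : x - w ≠ 0 := sub_ne_zero.2 h.symm
    have e1 : R.Z j w - R.Z j x = dslope (R.Z j) w x * (w - x) := by
      rw [dslope_of_ne _ h.symm, slope_def_field]; field_simp; ring
    have e2 : dslope (dslope (R.Z j) w) w x * (w - x) = deriv (R.Z j) w - dslope (R.Z j) w x := by
      rw [dslope_of_ne _ h.symm, slope_def_field, dslope_same]; field_simp; ring
    rw [e1]
    field_simp
    rw [mul_comm (w - x), e2]; ring
  · rw [zero_add]

lemma GG_cont (i j : Fin R.n) : ContinuousOn (fun p : ℂ × ℂ => R.GG i j p.1 p.2)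
    (cann R.r0 R.r1 ×ˢ cann R.r0 R.r1) := by
  unfold GG
  have hsub : cann R.r0 R.r1 ⊆ ({0}ᶜ : Set ℂ) := R.sub_ne subset_rfl
  split_ifs with hji
  · have hq : ContinuousOn (fun p : ℂ × ℂ => dslope (R.Z i) p.1 p.2) ({0}ᶜ ×ˢ {0}ᶜ) := by
      have := dslope_cont (X := Unit) (s := univ) (U := {0}ᶜ) (g := fun _ => R.Z i)
        isOpen_compl_singleton ((R.holo i).continuousOn.comp continuousOn_snd fun p hp => hp.2)
        fun _ _ => R.holo i
      exact this.comp (f := fun p : ℂ × ℂ => ((), p.1, p.2)) (by fun_prop) fun p hp => ⟨trivial, hp⟩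
    have hq2 : ContinuousOn (fun p : ℂ × ℂ => dslope (dslope (R.Z i) p.1) p.1 p.2) ({0}ᶜ ×ˢ {0}ᶜ) := by
      have := dslope_cont (X := ℂ) (s := {0}ᶜ) (U := {0}ᶜ) (g := fun w => dslope (R.Z i) w)
        isOpen_compl_singleton hq fun w hw => R.q_diff hw
      exact this.comp (f := fun p : ℂ × ℂ => (p.1, p.1, p.2)) (by fun_prop) fun p hp => ⟨hp.1, hp⟩
    refine continuousOn_fst.mul ((hq2.mono (prod_mono hsub hsub)).div (hq.mono (prod_mono hsub hsub)) ?_)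
    exact fun p hp => R.q_ne hp.2 hp.1
  · refine (continuousOn_fst.mul ((R.continuousOn_dZ i subset_rfl).comp continuousOn_fst fun p hp => hp.1)).div
      (((R.continuousOn_Z i subset_rfl).comp continuousOn_fst fun p hp => hp.1).sub
        ((R.continuousOn_Z j subset_rfl).comp continuousOn_snd fun p hp => hp.2)) fun p hp => ?_
    exact sub_ne_zero.2 fun e => hji (R.inj _ _ _ _ hp.1 hp.2 e).1.symm

/-- uniform smallness of jumps of continuous functions across the unit circle -/
lemma unif_jump {a b : ℝ} (ha : 0 < a) (ha1 : a < 1) (hb : 1 < b) {F : ℂ × ℂ → ℂ}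
    (hF : ContinuousOn F (cann a b ×ˢ cann a b)) {ε : ℝ} (hε : 0 < ε) :
    ∀ᶠ r in 𝓝[>] (1:ℝ), ∀ θ : ℝ, ∀ x ∈ cann a b,
      ‖F (circleMap 0 r θ, x) - F (circleMap 0 r⁻¹ θ, x)‖ ≤ ε := by
  have huc := ((isCompact_cann a b).prod (isCompact_cann a b)).uniformContinuousOn_of_continuous hF
  obtain ⟨δ, hδ, h⟩ := Metric.uniformContinuousOn_iff.1 huc ε hε
  have h1 : ∀ᶠ r in 𝓝[>] (1:ℝ), r - r⁻¹ < δ := by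
    have : ContinuousAt (fun r : ℝ => r - r⁻¹) 1 := by fun_prop (disch := norm_num)
    have := this.tendsto.eventually_lt_const (u := δ) (by simpa using hδ)
    exact this.filter_mono nhdsWithin_le_nhds
  have h2 : ∀ᶠ r in 𝓝[>] (1:ℝ), a < r⁻¹ := by
    have : ContinuousAt (fun r : ℝ => r⁻¹) 1 := by fun_prop (disch := norm_num)
    have := this.tendsto.eventually_const_lt (u := a) (by simpa using ha1)
    exact this.filter_mono nhdsWithin_le_nhds
  filter_upwards [h1, h2, Ioo_mem_nhdsGT hb] with r h1 h2 hr θ x hx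
  have hr0 : 0 < r := by linarith [hr.1]
  have hri : r⁻¹ < 1 := inv_lt_one_of_one_lt₀ hr.1
  have m1 : circleMap 0 r θ ∈ cann a b := by
    rw [mem_cann, norm_circleMap_zero, abs_of_pos hr0]
    exact ⟨by linarith [hr.1], hr.2.le⟩
  have m2 : circleMap 0 r⁻¹ θ ∈ cann a b := by
    rw [mem_cann, norm_circleMap_zero, abs_of_pos (inv_pos.2 hr0)]
    exact ⟨by linarith [hr.1], by linarith⟩
  have := h (circleMap 0 r θ, x) ⟨m1, hx⟩ (circleMap 0 r⁻¹ θ, x) ⟨m2, hx⟩ (by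
    rw [Prod.dist_eq, dist_self, max_eq_left dist_nonneg, dist_eq_norm]
    have : circleMap 0 r θ - circleMap 0 r⁻¹ θ = ((r - r⁻¹ : ℝ) : ℂ) * exp (θ * I) := by
      simp [circleMap]; ring
    rw [this, norm_mul, Complex.norm_exp_ofReal_mul_I, mul_one, Complex.norm_real,
      Real.norm_of_nonneg (by linarith [hr.1])]
    exact h1)
  rw [dist_eq_norm] at this
  exact this.le

lemma psi_exists (hK : IsCompact K) : ∃ ψ : ℂ → ℂ, DifferentiableOn ℂ ψ (R.Uo 1) ∧
    Tendsto ψ (cobounded ℂ) (𝓝 1) ∧ ∀ ε : ℝ, 0 < ε → ∀ᶠ r in 𝓝[>] (1:ℝ),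
      ∑ i, ∫ θ in (0:ℝ)..2 * Real.pi, ‖ψ (R.Z i (circleMap 0 r θ)) *
        (circleMap 0 r θ * deriv (R.Z i) (circleMap 0 r θ))‖ ≤ 2 * Real.pi * cap (R.Uo 1) + ε := by
  obtain ⟨L, hL, hLn⟩ := R.exists_Lam hK
  have hr01 : R.r0 < 1 := R.h0ρ.trans R.hρ1
  have hres : ∀ a ∈ R.Uo 1, a ∈ resolventSet ℂ R.zz := fun a ha =>
    R.mem_resolventSet fun j w hw => R.not_mem_sphere_of_Uo hr01 R.h11 ha j hw
  have hres' : ∀ a ∈ R.Ui 1, a ∈ resolventSet ℂ R.zz := fun a ha =>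
    R.mem_resolventSet fun j w hw => R.not_mem_sphere_of_Ui hr01 R.h11 ha j hw
  refine ⟨fun a => 1 + L (resolvent R.zz a), fun a ha => ?_, ?_, ?_⟩
  · have h1 := (spectrum.hasDerivAt_resolvent_const_left (hres a ha)).differentiableAt
    exact ((L.differentiableAt.comp a h1).const_add 1).differentiableWithinAt
  · have := (L.continuous.tendsto 0).comp (spectrum.resolvent_tendsto_cobounded (𝕜 := ℂ) R.zz)
    simpa using this.const_add 1
  intro ε hε
  have hpi := Real.pi_pos
  set d := cap (R.Uo 1) with hd
  have hd0 : 0 ≤ d := cap_nonneg (R.Uo_cobounded hK (ρ := 1))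
  set N : ℝ := (R.n : ℝ) with hNdef
  have hN : 0 ≤ N := Nat.cast_nonneg _
  set ε' : ℝ := ε / (2 * Real.pi * N * (1 + d) + 1) with hε'
  have hε'0 : 0 < ε' := by positivity
  have hε'1 : 2 * Real.pi * N * (1 + d) * ε' ≤ ε := by
    rw [hε', ← mul_div_assoc, div_le_iff₀ (by positivity)]
    nlinarith
  have ev1 : ∀ᶠ r in 𝓝[>] (1:ℝ), ∀ i j, ∀ θ : ℝ, ∀ x ∈ cann R.r0 R.r1,
      ‖R.GG i j (circleMap 0 r θ) x - R.GG i j (circleMap 0 r⁻¹ θ) x‖ ≤ ε' := by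
    rw [eventually_all]; intro i
    rw [eventually_all]; intro j
    exact unif_jump R.h0 hr01 R.h11 (R.GG_cont i j) hε'0
  have ev2 : ∀ᶠ r in 𝓝[>] (1:ℝ), ∀ i, ∀ θ : ℝ, ∀ x ∈ cann R.r0 R.r1,
      ‖circleMap 0 r θ * deriv (R.Z i) (circleMap 0 r θ) -
        circleMap 0 r⁻¹ θ * deriv (R.Z i) (circleMap 0 r⁻¹ θ)‖ ≤ ε' := by
    rw [eventually_all]; intro i
    have hF : ContinuousOn (fun p : ℂ × ℂ => p.1 * deriv (R.Z i) p.1) (cann R.r0 R.r1 ×ˢ cann R.r0 R.r1) :=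
      continuousOn_fst.mul ((R.continuousOn_dZ i subset_rfl).comp continuousOn_fst fun p hp => hp.1)
    exact unif_jump R.h0 hr01 R.h11 hF hε'0
  have ev3 : ∀ᶠ r in 𝓝[>] (1:ℝ), R.r0 < r⁻¹ := by
    have : ContinuousAt (fun r : ℝ => r⁻¹) 1 := by fun_prop (disch := norm_num)
    have := this.tendsto.eventually_const_lt (u := R.r0) (by simpa using hr01)
    exact this.filter_mono nhdsWithin_le_nhds
  filter_upwards [ev1, ev2, ev3, Ioo_mem_nhdsGT R.h11] with r h1 h2 h3 hr
  have hr0 : 0 < r := by linarith [hr.1]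
  have hri0 : 0 < r⁻¹ := inv_pos.2 hr0
  have hri : r⁻¹ < 1 := inv_lt_one_of_one_lt₀ hr.1
  have one_in : (1:ℂ) ∈ cann R.r0 R.r1 := by simp [mem_cann, hr01.le, R.h11.le]
  have mo : ∀ θ, circleMap 0 r θ ∈ ann R.r0 R.r1 := fun θ =>
    circleMap_mem_ann hr0 (by linarith [hr.1]) hr.2 θ
  have mi : ∀ θ, circleMap 0 r⁻¹ θ ∈ ann R.r0 R.r1 := fun θ =>
    circleMap_mem_ann hri0 h3 (by linarith [hr.1, hr.2]) θ
  have no : ∀ θ, ‖circleMap 0 r θ‖ = r := fun θ => by rw [norm_circleMap_zero, abs_of_pos hr0]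
  have ni : ∀ θ, ‖circleMap 0 r⁻¹ θ‖ = r⁻¹ := fun θ => by rw [norm_circleMap_zero, abs_of_pos hri0]
  have reso : ∀ i θ, R.Z i (circleMap 0 r θ) ∈ resolventSet ℂ R.zz := fun i θ =>
    hres _ ((R.Z_mem_Uo_iff hr01.le (mo θ)).2 (by rw [no]; exact hr.1))
  have resi : ∀ i θ, R.Z i (circleMap 0 r⁻¹ θ) ∈ resolventSet ℂ R.zz := fun i θ =>
    hres' _ ((R.Z_mem_Ui_iff R.h11.le (mi θ)).2 (by rw [ni]; exact hri))
  have cZ : ∀ (s : ℝ), (∀ θ, circleMap 0 s θ ∈ ann R.r0 R.r1) → ∀ i,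
      Continuous fun θ => R.Z i (circleMap 0 s θ) := fun s hs i =>
    ((R.continuousOn_Z i subset_rfl).comp_continuous (continuous_circleMap 0 s)
      fun θ => ann_subset_cann _ _ (hs θ))
  have cD : ∀ (s : ℝ), (∀ θ, circleMap 0 s θ ∈ ann R.r0 R.r1) → ∀ i,
      Continuous fun θ => circleMap 0 s θ * deriv (R.Z i) (circleMap 0 s θ) := fun s hs i =>
    (continuous_circleMap 0 s).mul ((R.continuousOn_dZ i subset_rfl).comp_continuous
      (continuous_circleMap 0 s) fun θ => ann_subset_cann _ _ (hs θ))
  have cR : ∀ (s : ℝ), (∀ θ, circleMap 0 s θ ∈ ann R.r0 R.r1) → ∀ i,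
      (∀ θ, R.Z i (circleMap 0 s θ) ∈ resolventSet ℂ R.zz) →
      Continuous fun θ => resolvent R.zz (R.Z i (circleMap 0 s θ)) := fun s hs i hh => by
    rw [continuous_iff_continuousAt]
    intro θ
    exact ((spectrum.hasDerivAt_resolvent_const_left (hh θ)).continuousAt).comp
      (f := fun θ => R.Z i (circleMap 0 s θ)) (cZ s hs i).continuousAt
  set Ψ : Fin R.n → ℝ → C(R.XX, ℂ) := fun i θ =>
    (circleMap 0 r θ * deriv (R.Z i) (circleMap 0 r θ)) • resolvent R.zz (R.Z i (circleMap 0 r θ)) -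
    (circleMap 0 r⁻¹ θ * deriv (R.Z i) (circleMap 0 r⁻¹ θ)) • resolvent R.zz (R.Z i (circleMap 0 r⁻¹ θ))
    with hΨ
  have hΨc : ∀ i, Continuous (Ψ i) := fun i =>
    ((cD r mo i).smul (cR r mo i (reso i))).sub ((cD _ mi i).smul (cR _ mi i (resi i)))
  have hΨe : ∀ i θ (p : R.XX), Ψ i θ p = (if p.1 = i then PP (circleMap 0 r θ) p.2 else 0) +
      (R.GG i p.1 (circleMap 0 r θ) p.2 - R.GG i p.1 (circleMap 0 r⁻¹ θ) p.2) := by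
    intro i θ p
    have hp : ‖(p.2 : ℂ)‖ = 1 := by simpa using p.2.2
    have n1 : circleMap 0 r θ ≠ p.2 := fun e => by
      have := no θ; rw [e, hp] at this; linarith [hr.1]
    have n2 : circleMap 0 r⁻¹ θ ≠ p.2 := fun e => by
      have := ni θ; rw [e, hp] at this; linarith
    have e1 := R.GG_eq i p.1 (ann_subset_cann _ _ (mo θ)) (R.X_mem p) n1
    have e2 := R.GG_eq i p.1 (ann_subset_cann _ _ (mi θ)) (R.X_mem p) n2
    rw [hΨ]
    dsimp only
    rw [ContinuousMap.sub_apply, ContinuousMap.smul_apply, ContinuousMap.smul_apply,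
      R.resolvent_apply (reso i θ), R.resolvent_apply (resi i θ), smul_eq_mul, smul_eq_mul,
      ← div_eq_mul_inv, ← div_eq_mul_inv, e1, e2, PP, star'_circleMap hr0]
    split_ifs <;> ring
  have hPc : ∀ x : ℂ, ‖x‖ = 1 → Continuous fun θ => ‖PP (circleMap 0 r θ) x‖ := fun x hx => by
    have : (fun θ => PP (circleMap 0 r θ) x) = fun θ => circleMap 0 r θ / (circleMap 0 r θ - x) -
        circleMap 0 r⁻¹ θ / (circleMap 0 r⁻¹ θ - x) := by
      ext θ; rw [PP, star'_circleMap hr0]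
    have h := (kern_cont hr0 (by rw [hx]; exact hr.1.ne)).sub
      (kern_cont (x := x) hri0 (by rw [hx]; exact hri.ne'))
    have h' : Continuous fun θ => PP (circleMap 0 r θ) x := by rw [this]; exact h
    exact h'.norm
  have hΨb : ∀ p : R.XX, ∑ i, ∫ θ in (0:ℝ)..2 * Real.pi, ‖Ψ i θ p‖ ≤
      2 * Real.pi + 2 * Real.pi * N * ε' := by
    intro p
    have hp : ‖(p.2 : ℂ)‖ = 1 := by simpa using p.2.2
    have hcc : ∀ i, Continuous fun θ => ‖Ψ i θ p‖ := fun i =>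
      ((ContinuousMap.evalCLM ℂ p).continuous.comp (hΨc i)).norm
    have hi : ∀ i, ∫ θ in (0:ℝ)..2 * Real.pi, ‖Ψ i θ p‖ ≤
        (if p.1 = i then 2 * Real.pi else 0) + 2 * Real.pi * ε' := by
      intro i
      split_ifs with hpi'
      · have hle : ∀ θ, ‖Ψ i θ p‖ ≤ ‖PP (circleMap 0 r θ) p.2‖ + ε' := fun θ => by
          rw [hΨe, if_pos hpi']
          exact (norm_add_le _ _).trans (by gcongr; exact h1 i p.1 θ _ (R.X_mem p))
        have hc2 : Continuous fun θ => ‖PP (circleMap 0 r θ) p.2‖ + ε' := (hPc _ hp).add continuous_const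
        refine (intervalIntegral.integral_mono_on (by positivity) ((hcc i).intervalIntegrable _ _)
          (hc2.intervalIntegrable _ _) fun θ _ => hle θ).trans (le_of_eq ?_)
        rw [intervalIntegral.integral_add ((hPc _ hp).intervalIntegrable _ _)
          (continuous_const.intervalIntegrable _ _), PP_int hr.1 hp]
        simp
      · have hle : ∀ θ, ‖Ψ i θ p‖ ≤ ε' := fun θ => by
          rw [hΨe, if_neg hpi', zero_add]
          exact h1 i p.1 θ _ (R.X_mem p)
        refine (intervalIntegral.integral_mono_on (by positivity) ((hcc i).intervalIntegrable _ _)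
          (continuous_const.intervalIntegrable _ _) fun θ _ => hle θ).trans (le_of_eq ?_)
        simp
    refine (Finset.sum_le_sum fun i _ => hi i).trans (le_of_eq ?_)
    rw [Finset.sum_add_distrib, Finset.sum_ite_eq]
    simp [N]; ring
  have hdb := dual_bound (by positivity : (0:ℝ) ≤ 2 * Real.pi) L hΨc (by positivity) hΨb
  have hΦ : ∀ i θ, (1 + L (resolvent R.zz (R.Z i (circleMap 0 r θ)))) *
        (circleMap 0 r θ * deriv (R.Z i) (circleMap 0 r θ)) =
      (circleMap 0 r θ * deriv (R.Z i) (circleMap 0 r θ) -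
        circleMap 0 r⁻¹ θ * deriv (R.Z i) (circleMap 0 r⁻¹ θ)) + L (Ψ i θ) := by
    intro i θ
    have := R.Lam_inner hK hL (i := i) (w := circleMap 0 r⁻¹ θ)
      ⟨(mi θ).1, by rw [ni]; exact hri⟩
    rw [hΨ]
    dsimp only
    rw [map_sub, map_smul, map_smul, smul_eq_mul, smul_eq_mul]
    linear_combination (circleMap 0 r⁻¹ θ * deriv (R.Z i) (circleMap 0 r⁻¹ θ)) * this
  have hLc : ∀ i, Continuous fun θ => ‖L (Ψ i θ)‖ := fun i => (L.continuous.comp (hΨc i)).norm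
  have hfin : ∀ i, ∫ θ in (0:ℝ)..2 * Real.pi, ‖(1 + L (resolvent R.zz (R.Z i (circleMap 0 r θ)))) *
        (circleMap 0 r θ * deriv (R.Z i) (circleMap 0 r θ))‖ ≤
      2 * Real.pi * ε' + ∫ θ in (0:ℝ)..2 * Real.pi, ‖L (Ψ i θ)‖ := by
    intro i
    have hc1 : Continuous fun θ => ‖(1 + L (resolvent R.zz (R.Z i (circleMap 0 r θ)))) *
        (circleMap 0 r θ * deriv (R.Z i) (circleMap 0 r θ))‖ :=
      ((continuous_const.add (L.continuous.comp (cR r mo i (reso i)))).mul (cD r mo i)).norm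
    have hc2 : Continuous fun θ => ε' + ‖L (Ψ i θ)‖ := continuous_const.add (hLc i)
    refine (intervalIntegral.integral_mono_on (by positivity) (hc1.intervalIntegrable _ _)
      (hc2.intervalIntegrable _ _) fun θ _ => ?_).trans (le_of_eq ?_)
    · rw [hΦ]
      exact (norm_add_le _ _).trans (by gcongr; exact h2 i θ 1 one_in)
    · rw [intervalIntegral.integral_add (continuous_const.intervalIntegrable _ _)
        ((hLc i).intervalIntegrable _ _)]
      simp
  refine (Finset.sum_le_sum fun i _ => hfin i).trans ?_
  rw [Finset.sum_add_distrib]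
  have e3 : ∑ _i : Fin R.n, 2 * Real.pi * ε' = 2 * Real.pi * N * ε' := by
    simp [N]; ring
  rw [e3]
  have : ‖L‖ * (2 * Real.pi + 2 * Real.pi * N * ε') ≤ d * (2 * Real.pi + 2 * Real.pi * N * ε') := by gcongr
  nlinarith

end RingSys

end ACap

namespace ACap

lemma HasW.prod {ι : Type*} (s : Finset ι) {h : ι → ℂ → ℂ} {a b : ℝ} {n : ι → ℤ} (ha : 0 ≤ a)
    (hw : ∀ i ∈ s, HasW (h i) a b (n i)) : HasW (fun w => ∏ i ∈ s, h i w) a b (∑ i ∈ s, n i) := by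
  classical
  induction s using Finset.induction_on with
  | empty => exact ⟨fun _ => 0, differentiableOn_const _, fun w _ => by simp⟩
  | insert i s hi ih =>
    rw [Finset.sum_insert hi]
    refine (HasW.mul ha (hw i (Finset.mem_insert_self _ _))
      (ih fun j hj => hw j (Finset.mem_insert_of_mem hj))).congr fun w _ => ?_
    rw [Finset.prod_insert hi]

lemma HasW.div {h h' : ℂ → ℂ} {a b : ℝ} {n m : ℤ} (ha : 0 ≤ a) (hw : HasW h a b n)
    (hw' : HasW h' a b m) : HasW (fun w => h w / h' w) a b (n - m) := by
  have := HasW.mul ha hw (hw'.zpow (-1))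
  rw [sub_eq_add_neg]
  have e : m * -1 = -m := by ring
  rw [e] at this
  refine this.congr fun w _ => ?_
  rw [zpow_neg_one, div_eq_mul_inv]

namespace RingSys

variable {K : Set ℂ} (R : RingSys K)

/-- an inner reference point lying close to the `j`-th boundary curve -/
def bb (j : Fin R.n) : ℂ := R.Z j (R.ρ0 : ℂ)

lemma norm_ρ0 : ‖(R.ρ0 : ℂ)‖ = R.ρ0 := by
  rw [Complex.norm_real, Real.norm_of_nonneg (by linarith [R.h0, R.h0ρ])]

lemma rho0_mem : (R.ρ0 : ℂ) ∈ ann R.r0 1 := ⟨by rw [norm_ρ0]; exact R.h0ρ, by rw [norm_ρ0]; exact R.hρ1⟩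

lemma bb_mem (j : Fin R.n) : R.bb j ∈ R.Ui 1 :=
  (R.Z_mem_Ui_iff R.h11.le (ann_mono le_rfl R.h11.le R.rho0_mem)).2 R.rho0_mem.2

lemma bb_ne {j : Fin R.n} {z : ℂ} {ρ : ℝ} (h : R.ρ0 ≤ ρ) (hz : z ∈ R.Uo ρ) : z - R.bb j ≠ 0 := by
  intro e
  rw [sub_eq_zero.1 e, bb, R.Z_mem_Uo_iff (R.h0ρ.le.trans h) (ann_mono le_rfl R.h11.le R.rho0_mem),
    norm_ρ0] at hz
  linarith

lemma r01 : R.r0 < 1 := R.h0ρ.trans R.hρ1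

/-- the outer product `∏ (z - b_j)^{m_j}` -/
def BB (m : Fin R.n → ℤ) (z : ℂ) : ℂ := ∏ j, (z - R.bb j) ^ m j

lemma BB_hasW (hK : IsCompact K) (hconn : IsPreconnected Kᶜ) (m : Fin R.n → ℤ) (i : Fin R.n) :
    HasW (fun u => R.BB m (R.Z i u)) 1 R.r1 (m i) := by
  have h1 : ∀ j, HasW (fun u => (R.Z i u - R.bb j) ^ m j) 1 R.r1 ((if j = i then 1 else 0) * m j) :=
    fun j => (R.hasW_sub hK hconn R.h11 R.rho0_mem).zpow _
  have h2 := HasW.prod Finset.univ zero_le_one fun j _ => h1 j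
  simp only [ite_mul, one_mul, zero_mul, Finset.sum_ite_eq', Finset.mem_univ, if_true] at h2
  exact h2

lemma BB_ne {m : Fin R.n → ℤ} {z : ℂ} (hz : z ∈ R.Uo 1) : R.BB m z ≠ 0 :=
  Finset.prod_ne_zero_iff.2 fun _ _ => zpow_ne_zero _ (R.bb_ne R.hρ1.le hz)

lemma BB_diff (hK : IsCompact K) {m : Fin R.n → ℤ} : DifferentiableOn ℂ (R.BB m) (R.Uo 1) := by
  refine DifferentiableOn.fun_finsetProd fun j _ => ?_
  exact DifferentiableOn.zpow (by fun_prop) (Or.inl fun z hz => R.bb_ne R.hρ1.le hz)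

lemma BB_large {m : Fin R.n → ℤ} (hm : ∀ j, 0 ≤ m j) {j0 : Fin R.n} (h0 : 1 ≤ m j0) :
    Tendsto (fun z => (R.BB m z)⁻¹) (cobounded ℂ) (𝓝 0) := by
  have hge : ∀ᶠ z in cobounded ℂ, ∀ j, 1 ≤ ‖z - R.bb j‖ := by
    rw [eventually_all]; intro j
    filter_upwards [eventually_norm_gt (1 + ‖R.bb j‖)] with z hz
    have := norm_sub_norm_le z (R.bb j)
    linarith
  have hj0 : Tendsto (fun z => (z - R.bb j0)⁻¹) (cobounded ℂ) (𝓝 0) :=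
    tendsto_inv₀_cobounded.comp (tendsto_sub_const_cobounded _)
  refine squeeze_zero_norm' ?_ (tendsto_zero_iff_norm_tendsto_zero.1 hj0)
  filter_upwards [hge] with z hz
  rw [norm_inv, norm_inv]
  refine inv_anti₀ (zero_lt_one.trans_le (hz j0)) ?_
  rw [BB, norm_prod, ← Finset.mul_prod_erase _ _ (Finset.mem_univ j0), norm_zpow]
  have h1 : ‖z - R.bb j0‖ ≤ ‖z - R.bb j0‖ ^ m j0 := by
    simpa using zpow_le_zpow_right₀ (hz j0) h0
  have h2 : 1 ≤ ∏ j ∈ Finset.univ.erase j0, ‖(z - R.bb j) ^ m j‖ := by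
    refine Finset.one_le_prod fun j _ => ?_
    rw [norm_zpow]; exact one_le_zpow₀ (hz j) (hm j)
  calc ‖z - R.bb j0‖ ≤ ‖z - R.bb j0‖ ^ m j0 * 1 := by rw [mul_one]; exact h1
    _ ≤ _ := by gcongr

/-- existence of a holomorphic root -/
lemma root (hK : IsCompact K) (hconn : IsPreconnected Kᶜ) {ψ : ℂ → ℂ}
    (hψ : DifferentiableOn ℂ ψ (R.Uo 1)) (hψ1 : Tendsto ψ (cobounded ℂ) (𝓝 1)) {Rm : ℝ} (hRm : 1 < Rm)
    (hRm1 : Rm ≤ R.r1) {m : Fin R.n → ℤ} (hm : ∀ j, 0 ≤ m j)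
    (hW : ∀ j, HasW (fun w => ψ (R.Z j w)) 1 Rm (m j)) {r : ℝ} (hr : 1 < r) (hr' : r < Rm) :
    ∃ g : ℂ → ℂ, DifferentiableOn ℂ g (R.Uo r) ∧ Tendsto g (cobounded ℂ) (𝓝 1) ∧
      ∀ z ∈ R.Uo r, g z ^ 2 = ψ z := by
  obtain ⟨r', hrr', hr'R⟩ := exists_between hr'
  have hq : ∀ j, HasW (fun w => ψ (R.Z j w) / R.BB m (R.Z j w)) 1 Rm 0 := fun j => by
    have := HasW.div zero_le_one (hW j) ((R.BB_hasW hK hconn m j).mono le_rfl hRm1)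
    rwa [sub_self] at this
  choose k hk hke using hq
  have hkc : ∀ s, 1 < s → s < Rm → ∀ j, ContinuousOn (k j) (sphere 0 s) := fun s h1 h2 j =>
    (hk j).continuousOn.mono (sphere_subset_ann h1 h2)
  have r01 := R.r01
  have hsub : R.Uo r ⊆ R.Uo 1 := R.Uo_mono hr.le
  have dCo := R.CT_diffOn_Uo (r01.trans hr) (hr'.trans_le hRm1) (hkc r hr hr')
  have dCi := R.CT_diffOn_Ui (r01.trans (hr.trans hrr')) (hr'R.trans_le hRm1) (hkc r' (hr.trans hrr') hr'R)
  obtain ⟨E, hE, hEo, hEi⟩ := R.glue hK (r01.trans hr).le hrr' (hr'R.le.trans hRm1)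
    (u := fun z => ψ z / R.BB m z * cexp (-R.CT r k z)) (v := fun z => cexp (-R.CT r' k z))
    (((hψ.mono hsub).div ((R.BB_diff hK).mono hsub) fun z hz => R.BB_ne (hsub hz)).mul dCo.neg.cexp)
    dCi.neg.cexp (fun j w hw => by
      have e := R.CT_jump r01.le hr hr'R hRm1 hk (i := j) hw
      have := hke j w (ann_mono hr.le hr'R.le hw)
      dsimp only at this
      rw [this, zpow_zero, one_mul, ← Complex.exp_add]
      congr 1
      linear_combination -e)
  have hCT : Tendsto (fun z => cexp (-R.CT r k z)) (cobounded ℂ) (𝓝 1) := by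
    have := (R.CT_tendsto (r01.trans hr).le (hr'.le.trans hRm1) (hkc r hr hr')).neg
    simpa [Function.comp_def] using (Complex.continuous_exp.tendsto _).comp this
  have hUr : R.Uo r ∈ cobounded ℂ := R.Uo_cobounded hK
  set j0 : Fin R.n := ⟨0, R.npos⟩
  have hbi : R.bb j0 ∈ R.Ui r' := R.Ui_mono (hr.trans hrr').le (R.bb_mem j0)
  have hEb : E (R.bb j0) ≠ 0 := by rw [hEi hbi]; exact Complex.exp_ne_zero _
  have hm0 : ∀ j, m j = 0 := by
    by_contra hcon
    push Not at hcon
    obtain ⟨j, hj⟩ := hcon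
    have h1 := R.BB_large hm (j0 := j) (by have := hm j; omega)
    have h2 : Tendsto E (cobounded ℂ) (𝓝 0) := by
      have h3 : Tendsto (fun z => ψ z * (R.BB m z)⁻¹ * cexp (-R.CT r k z)) (cobounded ℂ) (𝓝 (1 * 0 * 1)) :=
        (hψ1.mul h1).mul hCT
      simp only [mul_zero, zero_mul] at h3
      refine h3.congr' ?_
      filter_upwards [hUr] with z hz
      rw [hEo hz]; dsimp only; rw [div_eq_mul_inv]
    rw [Metric.cobounded_eq_cocompact] at h2
    exact hEb (hE.apply_eq_of_tendsto_cocompact _ h2)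
  have hB1 : ∀ z, R.BB m z = 1 := fun z => by simp [BB, hm0]
  have hE1 : ∀ z, E z = 1 := by
    have h2 : Tendsto E (cobounded ℂ) (𝓝 1) := by
      have h3 : Tendsto (fun z => ψ z * cexp (-R.CT r k z)) (cobounded ℂ) (𝓝 (1 * 1)) := hψ1.mul hCT
      rw [mul_one] at h3
      refine h3.congr' ?_
      filter_upwards [hUr] with z hz
      rw [hEo hz]; dsimp only; rw [hB1]; simp
    rw [Metric.cobounded_eq_cocompact] at h2
    exact fun z => hE.apply_eq_of_tendsto_cocompact _ h2
  refine ⟨fun z => cexp (R.CT r k z / 2), (dCo.div_const 2).cexp, ?_, fun z hz => ?_⟩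
  · have := (R.CT_tendsto (r01.trans hr).le (hr'.le.trans hRm1) (hkc r hr hr')).div_const 2
    simpa [Function.comp_def] using (Complex.continuous_exp.tendsto _).comp this
  · have h := hEo hz
    simp only [hE1, hB1, div_one] at h
    rw [← Complex.exp_nat_mul]
    have e : ((2:ℕ):ℂ) * (R.CT r k z / 2) = R.CT r k z := by push_cast; ring
    rw [e]
    have h5 : cexp (R.CT r k z) * cexp (-R.CT r k z) = 1 := by rw [← Complex.exp_add]; simp
    linear_combination cexp (R.CT r k z) * h + ψ z * h5

/-- the circle integral expressed through angles -/
lemma CI_eq (r : ℝ) (h : Fin R.n → ℂ → ℂ) : R.CI r h = I * ∑ j, ∫ θ in (0:ℝ)..2 * Real.pi,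
    h j (circleMap 0 r θ) * (circleMap 0 r θ * deriv (R.Z j) (circleMap 0 r θ)) := by
  rw [CI, Finset.mul_sum]
  refine Finset.sum_congr rfl fun j _ => ?_
  rw [circleIntegral, ← intervalIntegral.integral_const_mul]
  refine intervalIntegral.integral_congr fun θ _ => ?_
  simp only [deriv_circleMap, smul_eq_mul]; ring

end RingSys

end ACap

namespace ACap

lemma sum_cauchy_schwarz {n : ℕ} {l u : ℝ} (hlu : l ≤ u) {a b p : Fin n → ℝ → ℝ}
    (ha : ∀ i, Continuous (a i)) (hb : ∀ i, Continuous (b i)) (hp : ∀ i, Continuous (p i))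
    (hp0 : ∀ i t, 0 ≤ p i t) :
    (∑ i, ∫ t in l..u, a i t * b i t * p i t) ^ 2 ≤
      (∑ i, ∫ t in l..u, a i t ^ 2 * p i t) * ∑ i, ∫ t in l..u, b i t ^ 2 * p i t := by
  set X := ∑ i, ∫ t in l..u, a i t * b i t * p i t
  set P := ∑ i, ∫ t in l..u, a i t ^ 2 * p i t
  set Q := ∑ i, ∫ t in l..u, b i t ^ 2 * p i t
  have key : ∀ x : ℝ, 0 ≤ P * (x * x) + (-2 * X) * x + Q := by
    intro x
    have h1 : ∀ i, 0 ≤ ∫ t in l..u, (x * a i t - b i t) ^ 2 * p i t := fun i =>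
      intervalIntegral.integral_nonneg hlu fun t _ => mul_nonneg (sq_nonneg _) (hp0 i t)
    have h2 : ∀ i, ∫ t in l..u, (x * a i t - b i t) ^ 2 * p i t =
        (x * x) * (∫ t in l..u, a i t ^ 2 * p i t) + (-2 * x) * (∫ t in l..u, a i t * b i t * p i t) +
          ∫ t in l..u, b i t ^ 2 * p i t := by
      intro i
      have c1 : Continuous fun t => (x * x) * (a i t ^ 2 * p i t) :=
        continuous_const.mul (((ha i).pow 2).mul (hp i))
      have c2 : Continuous fun t => (-2 * x) * (a i t * b i t * p i t) :=
        continuous_const.mul (((ha i).mul (hb i)).mul (hp i))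
      have c3 : Continuous fun t => b i t ^ 2 * p i t := ((hb i).pow 2).mul (hp i)
      have c12 : Continuous fun t => (x * x) * (a i t ^ 2 * p i t) +
        (-2 * x) * (a i t * b i t * p i t) := c1.add c2
      rw [← intervalIntegral.integral_const_mul, ← intervalIntegral.integral_const_mul,
        ← intervalIntegral.integral_add (c1.intervalIntegrable _ _) (c2.intervalIntegrable _ _),
        ← intervalIntegral.integral_add (c12.intervalIntegrable _ _) (c3.intervalIntegrable _ _)]
      refine intervalIntegral.integral_congr fun t _ => ?_
      ring
    have h3 := Finset.sum_nonneg fun i (_ : i ∈ Finset.univ) => h1 i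
    simp only [h2] at h3
    rw [Finset.sum_add_distrib, Finset.sum_add_distrib, ← Finset.mul_sum, ← Finset.mul_sum] at h3
    linarith
  have := discrim_le_zero key
  rw [discrim] at this
  nlinarith

namespace RingSys

variable {K : Set ℂ} (R : RingSys K)

lemma pos_of_cap (hK : IsCompact K) {ψ : ℂ → ℂ} (hψ : DifferentiableOn ℂ ψ (R.Uo 1))
    (hψ1 : Tendsto ψ (cobounded ℂ) (𝓝 1)) (hb : ∀ ε : ℝ, 0 < ε → ∀ᶠ r in 𝓝[>] (1:ℝ),
      ∑ i, ∫ θ in (0:ℝ)..2 * Real.pi, ‖ψ (R.Z i (circleMap 0 r θ)) *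
        (circleMap 0 r θ * deriv (R.Z i) (circleMap 0 r θ))‖ ≤ 2 * Real.pi * cap (R.Uo 1) + ε) :
    0 < cap (R.Uo 1) := by
  have r01 := R.r01
  by_contra hcon
  have hd0 : cap (R.Uo 1) = 0 := le_antisymm (not_lt.1 hcon) (cap_nonneg (R.Uo_cobounded hK (ρ := 1)))
  set j0 : Fin R.n := ⟨0, R.npos⟩
  set a := R.bb j0
  have hne : ∀ j, ∀ w ∈ cann 1 R.r1, R.Z j w - a ≠ 0 := fun j w hw e => by
    have h := R.inj j j0 w (R.ρ0:ℂ) ⟨by linarith [hw.1], hw.2⟩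
      (ann_subset_cann _ _ (ann_mono le_rfl R.h11.le R.rho0_mem)) (sub_eq_zero.1 e)
    have h1 := hw.1
    rw [h.2] at h1
    exact absurd R.rho0_mem.2 (not_lt.2 h1)
  have hB : ∀ j, ∃ B : ℝ, ∀ w ∈ cann 1 R.r1, ‖(R.Z j w - a)⁻¹‖ ≤ B := fun j => by
    refine (isCompact_cann 1 R.r1).exists_bound_of_continuousOn (ContinuousOn.inv₀ ?_ (hne j))
    exact (R.continuousOn_Z j fun w hw => ⟨by linarith [hw.1], hw.2⟩).sub continuousOn_const
  choose B hB using hB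
  set M := ∑ j, |B j| + 1 with hM
  have hM0 : 0 < M := by positivity
  have hBM : ∀ j, ∀ w ∈ cann 1 R.r1, ‖(R.Z j w - a)⁻¹‖ ≤ M := fun j w hw => by
    refine (hB j w hw).trans ((le_abs_self _).trans ?_)
    have := Finset.single_le_sum (fun i _ => abs_nonneg (B i)) (Finset.mem_univ j)
    linarith
  obtain ⟨r, hr, hr1⟩ := ((hb (M⁻¹) (by positivity)).and (Ioo_mem_nhdsGT R.h11)).exists
  rw [hd0, mul_zero, zero_add] at hr
  have hr0 : 0 < r := by linarith [hr1.1]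
  have e := R.RS1_in hK r01.le hr1.1 hr1.2 hψ hψ1 (R.Ui_mono hr1.1.le (R.bb_mem j0))
  have hn : ‖R.CT r (fun j w => ψ (R.Z j w)) a‖ = 1 := by
    have : R.CT r (fun j w => ψ (R.Z j w)) a = -1 := by linear_combination -e
    rw [this]; simp
  have hcm : ∀ θ, circleMap 0 r θ ∈ ann 1 R.r1 := fun θ => circleMap_mem_ann hr0 hr1.1 hr1.2 θ
  have hΦc : ∀ i, Continuous fun θ => ψ (R.Z i (circleMap 0 r θ)) *
        (circleMap 0 r θ * deriv (R.Z i) (circleMap 0 r θ)) := fun i =>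
    ((R.comp_Z_diffOn_o r01.le R.h11 hK hψ i).continuousOn.comp_continuous (continuous_circleMap 0 r)
      hcm).mul ((continuous_circleMap 0 r).mul ((R.continuousOn_dZ i subset_rfl).comp_continuous
      (continuous_circleMap 0 r) fun θ => ⟨by linarith [(hcm θ).1], (hcm θ).2.le⟩))
  have hterm : ∀ j, ‖∮ w in C(0, r), ψ (R.Z j w) * deriv (R.Z j) w / (R.Z j w - a)‖ ≤
      M * ∫ θ in (0:ℝ)..2 * Real.pi, ‖ψ (R.Z j (circleMap 0 r θ)) *
        (circleMap 0 r θ * deriv (R.Z j) (circleMap 0 r θ))‖ := by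
    intro j
    rw [circleIntegral, ← intervalIntegral.integral_const_mul]
    refine intervalIntegral.norm_integral_le_of_norm_le Real.two_pi_pos.le
      (Eventually.of_forall fun θ _ => ?_) ((continuous_const.mul (hΦc j).norm).intervalIntegrable _ _)
    have e : deriv (circleMap 0 r) θ • (ψ (R.Z j (circleMap 0 r θ)) * deriv (R.Z j) (circleMap 0 r θ) /
        (R.Z j (circleMap 0 r θ) - a)) = I * (R.Z j (circleMap 0 r θ) - a)⁻¹ *
        (ψ (R.Z j (circleMap 0 r θ)) * (circleMap 0 r θ * deriv (R.Z j) (circleMap 0 r θ))) := by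
      simp only [deriv_circleMap, smul_eq_mul, div_eq_mul_inv]; ring
    rw [e, norm_mul, norm_mul, norm_I, one_mul]
    gcongr
    exact hBM j _ (ann_subset_cann _ _ (hcm θ))
  have hle : ‖R.CT r (fun j w => ψ (R.Z j w)) a‖ ≤ (2 * Real.pi)⁻¹ * (M * M⁻¹) := by
    rw [CT, norm_mul, norm_neg, norm_inv]
    have h2 : ‖(2 * Real.pi * I : ℂ)‖ = 2 * Real.pi := by
      simp [abs_of_pos Real.pi_pos]
    rw [h2]
    have := Real.pi_pos
    gcongr
    refine (norm_sum_le _ _).trans ((Finset.sum_le_sum fun j _ => hterm j).trans ?_)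
    rw [← Finset.mul_sum]
    gcongr
  rw [hn, mul_inv_cancel₀ hM0.ne', mul_one] at hle
  have h4 : (2 * Real.pi)⁻¹ < 1 := inv_lt_one_of_one_lt₀ (by linarith [Real.pi_gt_three])
  linarith

lemma psi_hasW (hK : IsCompact K) (hconn : IsPreconnected Kᶜ) {ψ : ℂ → ℂ}
    (hψ : DifferentiableOn ℂ ψ (R.Uo 1))
    (hψ1 : Tendsto ψ (cobounded ℂ) (𝓝 1)) (hb : ∀ ε : ℝ, 0 < ε → ∀ᶠ r in 𝓝[>] (1:ℝ),
      ∑ i, ∫ θ in (0:ℝ)..2 * Real.pi, ‖ψ (R.Z i (circleMap 0 r θ)) *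
        (circleMap 0 r θ * deriv (R.Z i) (circleMap 0 r θ))‖ ≤ 2 * Real.pi * cap (R.Uo 1) + ε) :
    ∃ Rm, 1 < Rm ∧ Rm ≤ R.r1 ∧ ∃ m : Fin R.n → ℤ, (∀ j, 0 ≤ m j) ∧
      ∀ j, HasW (fun w => ψ (R.Z j w)) 1 Rm (m j) := by
  have r01 := R.r01
  have hd := R.pos_of_cap hK hψ hψ1 hb
  have hUo : IsOpen (R.Uo 1) := R.isOpen_Uo hK r01.le R.h11
  have hUc : R.Uo 1 ∈ cobounded ℂ := R.Uo_cobounded hK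
  have hUp := R.isPreconnected_Uo hK hconn
  obtain ⟨f, hf, hf1, hf0, hfd⟩ := exists_extremal hUo hUc
  set d := cap (R.Uo 1) with hdd
  -- strict inequality
  have hflt : ∀ z ∈ R.Uo 1, ‖f z‖ < 1 := by
    intro z hz
    refine lt_of_le_of_ne (hf1 z hz) fun e => ?_
    have h1 := Complex.eqOn_of_isPreconnected_of_isMaxOn_norm hUp hUo hf hz
      (fun y hy => by simp only [Set.mem_setOf_eq, Function.comp_apply]; rw [e]; exact hf1 y hy)
    have h2 : Tendsto f (cobounded ℂ) (𝓝 (f z)) := by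
      refine tendsto_const_nhds.congr' ?_
      filter_upwards [hUc] with y hy using (h1 hy).symm
    have := tendsto_nhds_unique h2 hf0
    rw [this] at e; simp at e
  have hfψ : DifferentiableOn ℂ (fun z => f z * ψ z) (R.Uo 1) := hf.mul hψ
  have hfψ0 : Tendsto (fun z => f z * ψ z) (cobounded ℂ) (𝓝 0) := by simpa using hf0.mul hψ1
  have hfψd : Tendsto (fun z => z * (f z * ψ z - 0)) (cobounded ℂ) (𝓝 (d:ℂ)) := by
    have := hfd.mul hψ1
    rw [mul_one] at this
    exact this.congr fun z => by ring
  set Φ : Fin R.n → ℂ → ℂ := fun i w => ψ (R.Z i w) * (w * deriv (R.Z i) w) with hΦ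
  have hann : ∀ w ∈ ann 1 R.r1, w ∈ cann R.r0 R.r1 := fun w hw => ⟨by linarith [hw.1], hw.2.le⟩
  have hΦd : ∀ i, DifferentiableOn ℂ (Φ i) (ann 1 R.r1) := fun i =>
    (R.comp_Z_diffOn_o r01.le R.h11 hK hψ i).mul
      (differentiableOn_id.mul ((R.diffOn_deriv i).mono (R.sub_ne hann)))
  have hfZ : ∀ i, DifferentiableOn ℂ (fun w => f (R.Z i w)) (ann 1 R.r1) := fun i =>
    R.comp_Z_diffOn_o r01.le R.h11 hK hf i
  have hZU : ∀ i, ∀ w ∈ ann 1 R.r1, R.Z i w ∈ R.Uo 1 := fun i w hw =>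
    (R.Z_mem_Uo_iff r01.le (ann_mono r01.le le_rfl hw)).2 hw.1
  have hne : ∀ i, ∃ w ∈ ann 1 R.r1, f (R.Z i w) * Φ i w ≠ 0 := by
    intro i
    by_contra hcon
    push Not at hcon
    obtain ⟨s, hs1, hs2⟩ := exists_between R.h11
    have hs : (s:ℂ) ∈ ann 1 R.r1 := by
      rw [mem_ann, Complex.norm_real, Real.norm_of_nonneg (by linarith)]; exact ⟨hs1, hs2⟩
    have hzero : ∀ w ∈ ann 1 R.r1, f (R.Z i w) * ψ (R.Z i w) = 0 := fun w hw => by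
      have h := hcon w hw
      have h1 : f (R.Z i w) * ψ (R.Z i w) * (w * deriv (R.Z i) w) = 0 := by
        rw [← h, hΦ]; ring
      exact (mul_eq_zero.1 h1).resolve_right (mul_ne_zero (R.ne_zero_of_mem_cann (hann w hw))
        (R.dne i w (hann w hw)))
    have hev : (fun z => f z * ψ z) =ᶠ[𝓝 (R.Z i s)] 0 := by
      filter_upwards [(R.isOpen_image i r01.le le_rfl).mem_nhds (mem_image_of_mem _ hs)] with z hz
      obtain ⟨w, hw, rfl⟩ := hz
      exact hzero w hw
    have hz := (hfψ.analyticOnNhd hUo).eqOn_zero_of_preconnected_of_eventuallyEq_zero hUp (hZU i s hs) hev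
    have h2 : Tendsto (fun z => z * (f z * ψ z - 0)) (cobounded ℂ) (𝓝 0) := by
      refine tendsto_const_nhds.congr' ?_
      filter_upwards [hUc] with y hy
      have := hz hy
      simp only [Pi.zero_apply] at this
      rw [this]; simp
    have := tendsto_nhds_unique h2 hfψd
    exact hd.ne (by exact_mod_cast this)
  have hcm : ∀ r, 1 < r → r < R.r1 → ∀ θ, circleMap 0 r θ ∈ ann 1 R.r1 := fun r h1 h2 θ =>
    circleMap_mem_ann (by linarith) h1 h2 θ
  have cΦ : ∀ r, 1 < r → r < R.r1 → ∀ i, Continuous fun θ => Φ i (circleMap 0 r θ) := fun r h1 h2 i =>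
    (hΦd i).continuousOn.comp_continuous (continuous_circleMap 0 r) (hcm r h1 h2)
  have cF : ∀ r, 1 < r → r < R.r1 → ∀ i,
      Continuous fun θ => (f (R.Z i (circleMap 0 r θ)) * Φ i (circleMap 0 r θ)) := fun r h1 h2 i =>
    ((hfZ i).continuousOn.comp_continuous (continuous_circleMap 0 r) (hcm r h1 h2)).mul (cΦ r h1 h2 i)
  have cD : ∀ r, 1 < r → r < R.r1 → ∀ i, Continuous fun θ => ‖Φ i (circleMap 0 r θ)‖ -
      (f (R.Z i (circleMap 0 r θ)) * Φ i (circleMap 0 r θ)).re := fun r h1 h2 i =>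
    (cΦ r h1 h2 i).norm.sub (Complex.continuous_re.comp (cF r h1 h2 i))
  have hnn : ∀ r, 1 < r → r < R.r1 → ∀ i θ, 0 ≤ ‖Φ i (circleMap 0 r θ)‖ -
      (f (R.Z i (circleMap 0 r θ)) * Φ i (circleMap 0 r θ)).re := fun r h1 h2 i θ => by
    have e1 := Complex.re_le_norm (f (R.Z i (circleMap 0 r θ)) * Φ i (circleMap 0 r θ))
    rw [norm_mul] at e1
    have e2 := mul_le_of_le_one_left (norm_nonneg (Φ i (circleMap 0 r θ)))
      (hf1 _ (hZU i _ (hcm r h1 h2 θ)))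
    linarith
  have hsum : ∀ r, 1 < r → r < R.r1 → ∑ i, ∫ θ in (0:ℝ)..2 * Real.pi,
      (f (R.Z i (circleMap 0 r θ)) * Φ i (circleMap 0 r θ)).re = 2 * Real.pi * d := by
    intro r h1 h2
    have e := R.RS2 hK r01.le h1 h2 hfψ hfψ0 hfψd
    rw [CI_eq] at e
    have e2 : ∑ i, ∫ θ in (0:ℝ)..2 * Real.pi, f (R.Z i (circleMap 0 r θ)) * Φ i (circleMap 0 r θ) =
        2 * Real.pi * d := by
      refine mul_left_cancel₀ I_ne_zero (Eq.trans ?_ (e.trans (by ring)))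
      congr 1
      refine Finset.sum_congr rfl fun i _ => intervalIntegral.integral_congr fun θ _ => ?_
      rw [hΦ]; ring
    have e3 := congrArg Complex.re e2
    rw [Complex.re_sum] at e3
    have e4 : (2 * Real.pi * d : ℂ).re = 2 * Real.pi * d := by
      have : (2 * Real.pi * d : ℂ) = ((2 * Real.pi * d : ℝ) : ℂ) := by push_cast; ring
      rw [this, Complex.ofReal_re]
    rw [e4] at e3
    rw [← e3]
    refine Finset.sum_congr rfl fun i _ => ?_
    have e5 := Complex.reCLM.intervalIntegral_comp_comm (μ := volume)
      ((cF r h1 h2 i).intervalIntegrable 0 (2 * Real.pi))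
    simpa only [Complex.reCLM_apply] using e5
  have hdef : ∀ r, 1 < r → r < R.r1 → ∀ i, ∫ θ in (0:ℝ)..2 * Real.pi, (‖Φ i (circleMap 0 r θ)‖ -
      (f (R.Z i (circleMap 0 r θ)) * Φ i (circleMap 0 r θ)).re) ≤
      (∑ i, ∫ θ in (0:ℝ)..2 * Real.pi, ‖Φ i (circleMap 0 r θ)‖) - 2 * Real.pi * d := by
    intro r h1 h2 i
    rw [← hsum r h1 h2, ← Finset.sum_sub_distrib]
    have e : ∀ i, (∫ θ in (0:ℝ)..2 * Real.pi, ‖Φ i (circleMap 0 r θ)‖) - ∫ θ in (0:ℝ)..2 * Real.pi,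
        (f (R.Z i (circleMap 0 r θ)) * Φ i (circleMap 0 r θ)).re = ∫ θ in (0:ℝ)..2 * Real.pi,
        (‖Φ i (circleMap 0 r θ)‖ - (f (R.Z i (circleMap 0 r θ)) * Φ i (circleMap 0 r θ)).re) := fun i =>
      (intervalIntegral.integral_sub ((cΦ r h1 h2 i).norm.intervalIntegrable _ _)
        ((Complex.continuous_re.comp (cF r h1 h2 i)).intervalIntegrable _ _)).symm
    simp only [e]
    exact Finset.single_le_sum (f := fun i => ∫ θ in (0:ℝ)..2 * Real.pi,
        (‖Φ i (circleMap 0 r θ)‖ - (f (R.Z i (circleMap 0 r θ)) * Φ i (circleMap 0 r θ)).re))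
      (fun j _ => intervalIntegral.integral_nonneg Real.two_pi_pos.le
      fun θ _ => hnn r h1 h2 j θ) (Finset.mem_univ i)
  have hlim : ∀ i, Tendsto (fun r => ∫ θ in (0:ℝ)..2 * Real.pi, (‖Φ i (circleMap 0 r θ)‖ -
      (f (R.Z i (circleMap 0 r θ)) * Φ i (circleMap 0 r θ)).re)) (𝓝[>] (1:ℝ)) (𝓝 0) := by
    intro i
    rw [Metric.tendsto_nhds]
    intro ε hε
    filter_upwards [hb (ε / 2) (by positivity), Ioo_mem_nhdsGT R.h11] with r hr hr1
    have e1 := hdef r hr1.1 hr1.2 i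
    have e2 := intervalIntegral.integral_nonneg (μ := volume) Real.two_pi_pos.le
      fun θ (_ : θ ∈ Icc (0:ℝ) (2 * Real.pi)) => hnn r hr1.1 hr1.2 i θ
    rw [Real.dist_eq, sub_zero, abs_of_nonneg e2]
    linarith
  have hbd : ∀ i, ∀ᶠ r in 𝓝[>] (1:ℝ), (∫ θ in (0:ℝ)..2 * Real.pi, ‖Φ i (circleMap 0 r θ)‖) ≤
      2 * Real.pi * d + 1 := by
    intro i
    filter_upwards [hb 1 one_pos] with r hr
    refine (Finset.single_le_sum (f := fun i => ∫ θ in (0:ℝ)..2 * Real.pi, ‖Φ i (circleMap 0 r θ)‖)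
      (fun j _ => intervalIntegral.integral_nonneg Real.two_pi_pos.le
      fun θ _ => norm_nonneg _) (Finset.mem_univ i)).trans hr
  have hX := fun i => lemX R.h11 (hfZ i) (hΦd i) (fun w hw => hflt _ (hZU i w hw)) (hne i) (hlim i) _ (hbd i)
  choose R' hR1 hR2 n hn hW using hX
  have hNe : (Finset.univ : Finset (Fin R.n)).Nonempty := ⟨⟨0, R.npos⟩, Finset.mem_univ _⟩
  set Rm := Finset.univ.inf' hNe R' with hRm
  have hRmle : ∀ i, Rm ≤ R' i := fun i => Finset.inf'_le _ (Finset.mem_univ i)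
  have hRmr : Rm ≤ R.r1 := (hRmle ⟨0, R.npos⟩).trans (hR2 _)
  refine ⟨Rm, (Finset.lt_inf'_iff _).2 fun i _ => hR1 i, hRmr,
    fun i => n i - 1 - 0, fun i => by have := hn i; show 0 ≤ n i - 1 - 0; omega, fun i => ?_⟩
  have w1 : HasW (fun w => w) 1 Rm 1 := ⟨fun _ => 0, differentiableOn_const _, fun w _ => by simp⟩
  have w2 : HasW (deriv (R.Z i)) 1 Rm 0 := (R.hasW_deriv hK hconn i).mono r01.le hRmr
  refine (HasW.div zero_le_one (HasW.div zero_le_one ((hW i).mono le_rfl (hRmle i)) w1) w2).congr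
    fun w hw => ?_
  have hw' := hann w (ann_mono le_rfl hRmr hw)
  have h1 := R.ne_zero_of_mem_cann hw'
  have h2 := R.dne i w hw'
  simp only [hΦ]
  field_simp

/-- The key inequality on a ring system. -/
lemma ring_ineq (hK : IsCompact K) (hconn : IsPreconnected Kᶜ) {L : ℂ → ℂ} {lam : ℂ}
    (hL : DifferentiableOn ℂ L Kᶜ) (hL0 : Tendsto L (cobounded ℂ) (𝓝 0))
    (hLd : Tendsto (fun z => z * L z) (cobounded ℂ) (𝓝 lam)) {A : ℝ}
    (hA : ∀ᶠ s in 𝓝[>] (1:ℝ), ∑ i, ∫ θ in (0:ℝ)..2 * Real.pi, ‖L (R.Z i (circleMap 0 s θ))‖ ^ 2 *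
      ‖circleMap 0 s θ * deriv (R.Z i) (circleMap 0 s θ)‖ ≤ A) :
    2 * Real.pi * ‖lam‖ ^ 2 ≤ A * cap (R.Uo 1) := by
  have r01 := R.r01
  obtain ⟨ψ, hψ, hψ1, hb⟩ := R.psi_exists hK
  obtain ⟨Rm, hRm1, hRm, m, hm, hW⟩ := R.psi_hasW hK hconn hψ hψ1 hb
  have hd0 := cap_nonneg (R.Uo_cobounded hK (ρ := 1))
  set d := cap (R.Uo 1)
  have hpi := Real.pi_pos
  have hA0 : 0 ≤ A := by
    obtain ⟨s, hs⟩ := hA.exists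
    refine le_trans (Finset.sum_nonneg fun i _ => intervalIntegral.integral_nonneg Real.two_pi_pos.le
      fun θ _ => by positivity) hs
  have key : ∀ ε : ℝ, 0 < ε → (2 * Real.pi * ‖lam‖) ^ 2 ≤ A * (2 * Real.pi * d + ε) := by
    intro ε hε
    obtain ⟨s, ⟨hs1, hs2⟩, hs3⟩ := ((hA.and (hb ε hε)).and (Ioo_mem_nhdsGT hRm1)).exists
    obtain ⟨r, hr1, hr2⟩ := exists_between hs3.1
    have hs0 : 0 < s := by linarith [hs3.1]
    obtain ⟨g, hg, hg1, hg2⟩ := R.root hK hconn hψ hψ1 hRm1 hRm hm hW hr1 (hr2.trans hs3.2)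
    have hsr : s < R.r1 := hs3.2.trans_le hRm
    have hUsub : R.Uo r ⊆ Kᶜ := (R.Uo_mono hr1.le).trans R.Uo_one_subset
    have hLg : DifferentiableOn ℂ (fun z => L z * g z) (R.Uo r) := (hL.mono hUsub).mul hg
    have hLg0 : Tendsto (fun z => L z * g z) (cobounded ℂ) (𝓝 0) := by simpa using hL0.mul hg1
    have hLgd : Tendsto (fun z => z * (L z * g z - 0)) (cobounded ℂ) (𝓝 lam) := by
      have := hLd.mul hg1
      rw [mul_one] at this
      exact this.congr fun z => by ring
    have e := R.RS2 hK (r01.trans hr1).le hr2 hsr hLg hLg0 hLgd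
    rw [CI_eq] at e
    have hcm : ∀ θ, circleMap 0 s θ ∈ ann r R.r1 := fun θ => circleMap_mem_ann hs0 hr2 hsr θ
    have cL : ∀ i, Continuous fun θ => L (R.Z i (circleMap 0 s θ)) := fun i =>
      (R.comp_Z_diffOn_o (r01.trans hr1).le (hr2.trans hsr) hK (hL.mono hUsub) i).continuousOn.comp_continuous
        (continuous_circleMap 0 s) hcm
    have cg : ∀ i, Continuous fun θ => g (R.Z i (circleMap 0 s θ)) := fun i =>
      (R.comp_Z_diffOn_o (r01.trans hr1).le (hr2.trans hsr) hK hg i).continuousOn.comp_continuous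
        (continuous_circleMap 0 s) hcm
    have cp : ∀ i, Continuous fun θ => circleMap 0 s θ * deriv (R.Z i) (circleMap 0 s θ) := fun i =>
      (continuous_circleMap 0 s).mul ((R.continuousOn_dZ i subset_rfl).comp_continuous
      (continuous_circleMap 0 s) fun θ => ⟨by linarith [(hcm θ).1], (hcm θ).2.le⟩)
    have cs := sum_cauchy_schwarz Real.two_pi_pos.le (fun i => (cL i).norm) (fun i => (cg i).norm)
      (fun i => (cp i).norm) (fun i t => norm_nonneg _)
    have e2 : 2 * Real.pi * ‖lam‖ ≤ ∑ i, ∫ θ in (0:ℝ)..2 * Real.pi, ‖L (R.Z i (circleMap 0 s θ))‖ *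
        ‖g (R.Z i (circleMap 0 s θ))‖ * ‖circleMap 0 s θ * deriv (R.Z i) (circleMap 0 s θ)‖ := by
      have h1 := congrArg norm e
      rw [norm_mul, norm_I, one_mul] at h1
      have h2 : ‖(2 * Real.pi * I * lam : ℂ)‖ = 2 * Real.pi * ‖lam‖ := by
        simp [abs_of_pos Real.pi_pos]
      rw [h2] at h1
      rw [← h1]
      refine (norm_sum_le _ _).trans (Finset.sum_le_sum fun i _ => ?_)
      refine (intervalIntegral.norm_integral_le_integral_norm Real.two_pi_pos.le).trans (le_of_eq ?_)
      refine intervalIntegral.integral_congr fun θ _ => ?_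
      simp only [norm_mul]
    have e3 : ∑ i, ∫ θ in (0:ℝ)..2 * Real.pi, ‖g (R.Z i (circleMap 0 s θ))‖ ^ 2 *
        ‖circleMap 0 s θ * deriv (R.Z i) (circleMap 0 s θ)‖ ≤ 2 * Real.pi * d + ε := by
      refine le_trans (le_of_eq ?_) hs2
      refine Finset.sum_congr rfl fun i _ => intervalIntegral.integral_congr fun θ _ => ?_
      rw [norm_mul (ψ _), ← hg2 _ ((R.Z_mem_Uo_iff (r01.trans hr1).le
        (ann_mono (r01.trans hr1).le le_rfl (hcm θ))).2 (hcm θ).1), norm_pow]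
    calc (2 * Real.pi * ‖lam‖) ^ 2 ≤ _ := pow_le_pow_left₀ (by positivity) e2 2
      _ ≤ _ := cs
      _ ≤ A * (2 * Real.pi * d + ε) := by
        refine mul_le_mul hs1 e3 (Finset.sum_nonneg fun i _ => intervalIntegral.integral_nonneg
          Real.two_pi_pos.le fun θ _ => by positivity) hA0
  have hfin : (2 * Real.pi * ‖lam‖) ^ 2 ≤ A * (2 * Real.pi * d) := by
    have ht : Tendsto (fun ε : ℝ => A * (2 * Real.pi * d + ε)) (𝓝[>] 0) (𝓝 (A * (2 * Real.pi * d))) := by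
      have : Continuous fun ε : ℝ => A * (2 * Real.pi * d + ε) := by fun_prop
      have := this.tendsto 0
      rw [add_zero] at this
      exact this.mono_left nhdsWithin_le_nhds
    refine ge_of_tendsto ht ?_
    filter_upwards [self_mem_nhdsWithin] with ε hε using key ε hε
  have : (2 * Real.pi) * (2 * Real.pi * ‖lam‖ ^ 2) ≤ (2 * Real.pi) * (A * d) := by nlinarith
  exact le_of_mul_le_mul_left this (by positivity)

end RingSys

end ACap

namespace ACap

section Curves

variable {K : Set ℂ} (B : SmoothBoundary K)

lemma cv_diff (i : Fin B.n) (t : ℝ) : HasDerivAt (B.curve i) (deriv (B.curve i) t) t :=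
  ((B.smooth i).differentiable (by simp) t).hasDerivAt

lemma cv_cont (i : Fin B.n) : Continuous (B.curve i) := (B.smooth i).continuous

lemma cv_dsmooth (i : Fin B.n) : ContDiff ℝ (⊤ : ℕ∞) (deriv (B.curve i)) :=
  ((contDiff_infty_iff_deriv (f := B.curve i)).1 (B.smooth i)).2

lemma cv_dcont (i : Fin B.n) : Continuous (deriv (B.curve i)) := (cv_dsmooth B i).continuous

lemma periodic_deriv {f : ℝ → ℂ} (h : Function.Periodic f 1) : Function.Periodic (deriv f) 1 := by
  intro t
  rw [← deriv_comp_add_const]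
  congr 1
  funext s; exact h s

lemma cv_dper (i : Fin B.n) : Function.Periodic (deriv (B.curve i)) 1 := periodic_deriv (B.periodic i)

lemma cv_mem (i : Fin B.n) (t : ℝ) : B.curve i t ∈ frontier K := by
  rw [← B.boundary]; exact mem_iUnion.2 ⟨i, t, rfl⟩

lemma cv_eq {i j : Fin B.n} {s t : ℝ} (h : B.curve i s = B.curve j t) : i = j ∧ ∃ k : ℤ, s = t + k := by
  have hij : i = j := by
    by_contra hne
    exact (disjoint_left.1 (B.disjointCurves i j hne)) ⟨s, rfl⟩ ⟨t, h.symm⟩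
  subst hij
  refine ⟨rfl, ⌊s⌋ - ⌊t⌋, ?_⟩
  have hf : ∀ u, B.curve i (Int.fract u) = B.curve i u := fun u => by
    have := (B.periodic i).sub_int_mul_eq (x := u) ⌊u⌋
    rwa [mul_one] at this
  have := B.injOn i ⟨Int.fract_nonneg s, Int.fract_lt_one s⟩ ⟨Int.fract_nonneg t, Int.fract_lt_one t⟩
    (by rw [hf, hf, h])
  unfold Int.fract at this
  push_cast
  linarith

/-- The total winding integral. -/
def Wn (a : ℂ) : ℂ := ∑ i, ∫ t in (0:ℝ)..1, deriv (B.curve i) t / (B.curve i t - a)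

lemma notMem_frontier (hK : IsCompact K) {a : ℂ} (ha : a ∉ frontier K) : a ∈ interior K ∨ a ∈ Kᶜ := by
  by_cases h : a ∈ K
  · left
    by_contra h2
    exact ha ⟨subset_closure h, h2⟩
  · right; exact h

lemma compl_notMem_frontier (hK : IsCompact K) {a : ℂ} (ha : a ∈ Kᶜ) : a ∉ frontier K :=
  fun h => ha (hK.isClosed.frontier_subset h)

lemma int_notMem_frontier {a : ℂ} (ha : a ∈ interior K) : a ∉ frontier K := fun h => h.2 ha

lemma Wn_compl (hK : IsCompact K) (hconn : IsConnected Kᶜ) {a : ℂ} (ha : a ∈ Kᶜ) : Wn B a = 0 := by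
  have hne : ∀ z ∈ Kᶜ, ∀ i t, B.curve i t ≠ z := fun z hz i t h =>
    compl_notMem_frontier hK hz (h ▸ cv_mem B i t)
  have hd : ∀ z ∈ Kᶜ, HasDerivAt (Wn B) 0 z := by
    intro z hz
    have h1 : HasDerivAt (Wn B)
        (∑ i, ∫ t in (0:ℝ)..1, deriv (B.curve i) t / (B.curve i t - z) ^ 2) z :=
      HasDerivAt.fun_sum fun i _ =>
        cauchyInt_hasDerivAt (cv_dcont B i) (cv_cont B i) fun t _ => hne z hz i t
    convert! h1
    symm
    refine Finset.sum_eq_zero fun i _ => ?_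
    have hd2 : ∀ t, HasDerivAt (fun t => -(B.curve i t - z)⁻¹)
        (deriv (B.curve i) t / (B.curve i t - z) ^ 2) t := fun t => by
      have := (((cv_diff B i t).sub_const z).inv (sub_ne_zero.2 (hne z hz i t))).neg
      convert! this using 1
      ring
    rw [intervalIntegral.integral_eq_sub_of_hasDerivAt (fun t _ => hd2 t)]
    · have := B.periodic i 0
      rw [zero_add] at this
      rw [this]; ring
    · refine Continuous.intervalIntegrable ?_ _ _
      exact (cv_dcont B i).div (((cv_cont B i).sub continuous_const).pow 2)
        fun t => pow_ne_zero 2 (sub_ne_zero.2 (hne z hz i t))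
  have hc : ∀ z ∈ Kᶜ, Wn B z = Wn B a := fun z hz =>
    hK.isClosed.isOpen_compl.is_const_of_deriv_eq_zero hconn.isPreconnected
      (fun z hz => (hd z hz).differentiableAt.differentiableWithinAt)
      (fun z hz => (hd z hz).deriv) hz ha
  have hlim : Tendsto (Wn B) (cobounded ℂ) (𝓝 0) := by
    have : Tendsto (Wn B) (cobounded ℂ) (𝓝 (∑ i : Fin B.n, (0:ℂ))) :=
      tendsto_finset_sum _ fun i _ =>
        tendsto_zero_of_tendsto_mul le_rfl
          (cauchyInt_tendsto_mul (a := 0) (b := 1) (cv_dcont B i) (cv_cont B i))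
    simpa using this
  have : Tendsto (Wn B) (cobounded ℂ) (𝓝 (Wn B a)) := by
    refine tendsto_const_nhds.congr' ?_
    have : Kᶜ ∈ cobounded ℂ := by rw [Metric.cobounded_eq_cocompact]; exact hK.compl_mem_cocompact
    filter_upwards [this] with z hz using (hc z hz).symm
  exact tendsto_nhds_unique this hlim

/-- The integral over the boundary away from the point `curve j t0`. -/
def Far (j : Fin B.n) (t0 η : ℝ) (a : ℂ) : ℂ :=
  (∑ i ∈ Finset.univ.erase j, ∫ t in (0:ℝ)..1, deriv (B.curve i) t / (B.curve i t - a)) +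
    ∫ t in (t0 + η)..(t0 + 1 - η), deriv (B.curve j) t / (B.curve j t - a)

lemma far_ne {j : Fin B.n} {t0 η t : ℝ} (h0 : 0 < η) (h1 : η < 1 / 2)
    (ht : t ∈ uIcc (t0 + η) (t0 + 1 - η)) : B.curve j t ≠ B.curve j t0 := by
  rw [uIcc_of_le (by linarith)] at ht
  intro h
  obtain ⟨-, k, hk⟩ := cv_eq B h
  have h2 : (0:ℝ) < k := by linarith [ht.1]
  have h3 : (k:ℝ) < 1 := by linarith [ht.2]
  norm_cast at h2 h3
  omega

lemma other_ne {i j : Fin B.n} (h : i ≠ j) (t t0 : ℝ) : B.curve i t ≠ B.curve j t0 :=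
  fun e => h (cv_eq B e).1

lemma Far_cont {j : Fin B.n} {t0 η : ℝ} (h0 : 0 < η) (h1 : η < 1 / 2) :
    ContinuousAt (Far B j t0 η) (B.curve j t0) := by
  refine ContinuousAt.add ?_ ?_
  · refine tendsto_finset_sum _ fun i hi => ?_
    exact (cauchyInt_hasDerivAt (cv_dcont B i) (cv_cont B i) fun t _ =>
      other_ne B (Finset.ne_of_mem_erase hi) t t0).continuousAt
  · exact (cauchyInt_hasDerivAt (cv_dcont B j) (cv_cont B j) fun t ht => far_ne B h0 h1 ht).continuousAt

lemma Wn_split {j : Fin B.n} {t0 η : ℝ} {a : ℂ}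
    (ha : ∀ i t, B.curve i t ≠ a) :
    Wn B a = Far B j t0 η a +
      ∫ t in (t0 - η)..(t0 + η), deriv (B.curve j) t / (B.curve j t - a) := by
  have hc : Continuous fun t => deriv (B.curve j) t / (B.curve j t - a) :=
    (cv_dcont B j).div ((cv_cont B j).sub continuous_const) fun t => sub_ne_zero.2 (ha j t)
  have hp : Function.Periodic (fun t => deriv (B.curve j) t / (B.curve j t - a)) 1 := fun t => by
    simp only [B.periodic j t, cv_dper B j t]
  have h1 := hp.intervalIntegral_add_eq 0 (t0 - η)
  rw [zero_add] at h1
  have h2 := intervalIntegral.integral_add_adjacent_intervals (hc.intervalIntegrable (μ := volume) (t0 - η) (t0 + η))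
    (hc.intervalIntegrable (t0 + η) (t0 - η + 1))
  rw [Wn, Far, ← Finset.sum_erase_add _ _ (Finset.mem_univ j), h1, ← h2,
    show t0 + 1 - η = t0 - η + 1 by ring]
  ring

/-- Normalised curve at a boundary point. -/
def qq (j : Fin B.n) (t0 v : ℝ) : ℂ := (B.curve j (t0 + v) - B.curve j t0) / deriv (B.curve j) t0

lemma qq_deriv (j : Fin B.n) (t0 v : ℝ) :
    HasDerivAt (qq B j t0) (deriv (B.curve j) (t0 + v) / deriv (B.curve j) t0) v := by
  have h := (cv_diff B j (t0 + v)).comp_const_add t0 v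
  exact (h.sub_const _).div_const _

lemma qq_zero (j : Fin B.n) (t0 : ℝ) : qq B j t0 0 = 0 := by simp [qq]

lemma qq_re (j : Fin B.n) (t0 : ℝ) : ∃ δ, 0 < δ ∧ δ < 1 / 2 ∧
    (∀ v, 0 < v → v ≤ δ → 0 < (qq B j t0 v).re) ∧ (∀ v, v < 0 → -δ ≤ v → (qq B j t0 v).re < 0) := by
  have hc : Continuous fun v => (deriv (B.curve j) (t0 + v) / deriv (B.curve j) t0).re :=
    continuous_re.comp (((cv_dcont B j).comp (continuous_const.add continuous_id)).div_const _)
  have h0 : ∀ᶠ v in 𝓝 (0:ℝ), 0 < (deriv (B.curve j) (t0 + v) / deriv (B.curve j) t0).re := by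
    refine hc.continuousAt.eventually_const_lt ?_
    beta_reduce
    rw [add_zero, div_self (B.regular j t0)]; simp
  obtain ⟨ε, hε, h⟩ := Metric.eventually_nhds_iff.1 h0
  have hmono : StrictMonoOn (fun v => (qq B j t0 v).re) (Icc (-(min (ε / 2) (1 / 4))) (min (ε / 2) (1 / 4))) := by
    have hd : ∀ v, HasDerivAt (fun v => (qq B j t0 v).re)
        (deriv (B.curve j) (t0 + v) / deriv (B.curve j) t0).re v := fun v =>
      (reCLM.hasFDerivAt.comp_hasDerivAt v (qq_deriv B j t0 v))
    refine strictMonoOn_of_deriv_pos (convex_Icc _ _)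
      (fun v _ => (hd v).continuousAt.continuousWithinAt) fun v hv => ?_
    rw [(hd v).deriv]
    apply h
    rw [interior_Icc] at hv
    rw [Real.dist_0_eq_abs, abs_lt]
    have := min_le_left (ε / 2) (1 / 4)
    constructor <;> linarith [hv.1, hv.2]
  set δ := min (ε / 2) (1 / 4) with hδ
  have hδ0 : 0 < δ := lt_min (by linarith) (by norm_num)
  refine ⟨δ, hδ0, by linarith [min_le_right (ε / 2) (1 / 4)], fun v hv hv2 => ?_, fun v hv hv2 => ?_⟩
  · have := hmono ⟨by linarith, hδ0.le⟩ ⟨by linarith, hv2⟩ hv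
    simpa [qq_zero] using this
  · have := hmono ⟨hv2, by linarith⟩ ⟨by linarith, hδ0.le⟩ hv
    simpa [qq_zero] using this

/-- the approach points -/
def app (j : Fin B.n) (t0 s : ℝ) : ℂ := B.curve j t0 + I * s * deriv (B.curve j) t0

lemma app_sub (j : Fin B.n) (t0 s v : ℝ) :
    B.curve j (t0 + v) - app B j t0 s = deriv (B.curve j) t0 * (qq B j t0 v - I * s) := by
  have := B.regular j t0
  rw [qq, app]; field_simp; ring

lemma slit {δ s v e : ℝ} {j : Fin B.n} {t0 : ℝ} (he : e = 1 ∨ e = -1) (hs : 0 < e * s)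
    (h1 : ∀ v, 0 < v → v ≤ δ → 0 < (qq B j t0 v).re)
    (h2 : ∀ v, v < 0 → -δ ≤ v → (qq B j t0 v).re < 0) (hv1 : -δ ≤ v) (hv2 : v ≤ δ) :
    (e * I * (qq B j t0 v - I * s) : ℂ) ∈ slitPlane := by
  have hr : (e * I * (qq B j t0 v - I * s) : ℂ).re = e * s - e * (qq B j t0 v).im := by
    simp; ring
  have hi : (e * I * (qq B j t0 v - I * s) : ℂ).im = e * (qq B j t0 v).re := by
    simp
  have he0 : e ≠ 0 := by rcases he with rfl | rfl <;> norm_num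
  rw [mem_slitPlane_iff, hr, hi]
  rcases lt_trichotomy v 0 with h | h | h
  · right; exact mul_ne_zero he0 (h2 v h hv1).ne
  · left; rw [h, qq_zero]; simpa using hs
  · right; exact mul_ne_zero he0 (h1 v h hv2).ne'

lemma near_int {δ s η e : ℝ} {j : Fin B.n} {t0 : ℝ} (he : e = 1 ∨ e = -1) (hs : 0 < e * s)
    (h1 : ∀ v, 0 < v → v ≤ δ → 0 < (qq B j t0 v).re)
    (h2 : ∀ v, v < 0 → -δ ≤ v → (qq B j t0 v).re < 0) (h0 : 0 < η) (hη : η ≤ δ) :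
    ∫ t in (t0 - η)..(t0 + η), deriv (B.curve j) t / (B.curve j t - app B j t0 s) =
      log (e * I * (qq B j t0 η - I * s)) - log (e * I * (qq B j t0 (-η) - I * s)) := by
  have hsub := intervalIntegral.integral_comp_add_left (a := -η) (b := η)
    (fun t => deriv (B.curve j) t / (B.curve j t - app B j t0 s)) t0
  rw [sub_eq_add_neg, ← hsub]
  have hsl : ∀ v ∈ uIcc (-η) η, (e * I * (qq B j t0 v - I * s) : ℂ) ∈ slitPlane := by
    intro v hv
    rw [uIcc_of_le (by linarith)] at hv
    exact slit B he hs h1 h2 (by linarith [hv.1]) (by linarith [hv.2])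
  have he0 : (e : ℂ) ≠ 0 := by rcases he with rfl | rfl <;> simp
  have hne : ∀ v ∈ uIcc (-η) η, B.curve j (t0 + v) - app B j t0 s ≠ 0 := by
    intro v hv h
    rw [app_sub, mul_eq_zero, or_iff_right (B.regular j t0)] at h
    have := slitPlane_ne_zero (hsl v hv)
    rw [h, mul_zero] at this
    exact this rfl
  rw [intervalIntegral.integral_eq_sub_of_hasDerivAt
    (f := fun v => log (e * I * (qq B j t0 v - I * s)))]
  · intro v hv
    have := (((qq_deriv B j t0 v).sub_const (I * s)).const_mul (e * I : ℂ)).clog_real (hsl v hv)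
    convert! this using 1
    have h3 := hne v hv
    rw [app_sub] at h3 ⊢
    have h4 := right_ne_zero_of_mul h3
    have := B.regular j t0
    field_simp
  · refine ContinuousOn.intervalIntegrable ?_
    refine ContinuousOn.div ?_ ?_ hne
    · exact ((cv_dcont B j).comp (continuous_const.add continuous_id)).continuousOn
    · exact (((cv_cont B j).comp (continuous_const.add continuous_id)).sub continuous_const).continuousOn

lemma app_tendsto (j : Fin B.n) (t0 : ℝ) : Tendsto (app B j t0) (𝓝 0) (𝓝 (B.curve j t0)) := by
  have : Continuous (app B j t0) := by
    unfold app
    fun_prop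
  have h := this.tendsto 0
  simpa [app] using h

lemma app_off {δ e : ℝ} {j : Fin B.n} {t0 : ℝ} (he : e = 1 ∨ e = -1) 
    (h1 : ∀ v, 0 < v → v ≤ δ → 0 < (qq B j t0 v).re)
    (h2 : ∀ v, v < 0 → -δ ≤ v → (qq B j t0 v).re < 0) (h0 : 0 < δ) (h3 : δ < 1 / 2) :
    ∀ᶠ s in 𝓝[>] (0:ℝ), ∀ i t, B.curve i t ≠ app B j t0 (e * s) := by
  have hcl : IsClosed ((⋃ i ∈ {i | i ≠ j}, B.curve i '' Icc 0 1) ∪ B.curve j '' Icc (t0 + δ) (t0 + 1 - δ)) := by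
    refine IsClosed.union ((toFinite _).isClosed_biUnion fun i _ => ?_) ?_
    · exact (isCompact_Icc.image (cv_cont B i)).isClosed
    · exact (isCompact_Icc.image (cv_cont B j)).isClosed
  have hp : B.curve j t0 ∉ ((⋃ i ∈ {i | i ≠ j}, B.curve i '' Icc 0 1) ∪ B.curve j '' Icc (t0 + δ) (t0 + 1 - δ)) := by
    rintro (h | ⟨t, ht, h⟩)
    · simp only [mem_iUnion] at h
      obtain ⟨i, hi, t, -, h⟩ := h
      exact other_ne B hi t t0 h
    · exact far_ne B h0 h3 (by rwa [uIcc_of_le (by linarith)]) h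
  have ht : Tendsto (fun s => app B j t0 (e * s)) (𝓝[>] (0:ℝ)) (𝓝 (B.curve j t0)) := by
    refine (app_tendsto B j t0).comp (tendsto_nhdsWithin_of_tendsto_nhds ?_)
    exact (continuous_const.mul continuous_id).tendsto' _ _ (by simp)
  filter_upwards [ht.eventually (hcl.isOpen_compl.mem_nhds hp), self_mem_nhdsWithin] with s hs hs0 i t h
  have hs0 : 0 < s := hs0
  rw [mem_union, not_or] at hs
  by_cases hij : i = j
  · subst hij
    -- reduce t to [t0-δ, t0-δ+1)
    obtain ⟨u, hu, hu2⟩ : ∃ u ∈ Ico (t0 - δ) (t0 - δ + 1), B.curve i t = B.curve i u := by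
      obtain ⟨u, hu, hu2⟩ := (B.periodic i).exists_mem_Ico zero_lt_one t (t0 - δ)
      exact ⟨u, hu, hu2⟩
    rw [hu2] at h
    by_cases hu3 : u ≤ t0 + δ
    · have hsl := slit B (s := e * s) (v := u - t0) he (by rcases he with rfl | rfl <;> simpa using hs0) h1 h2
        (by linarith [hu.1]) (by linarith)
      have h5 := app_sub B i t0 (e * s) (u - t0)
      rw [add_sub_cancel, h, sub_self] at h5
      have h6 := (mul_eq_zero.1 h5.symm).resolve_left (B.regular i t0)
      rw [h6, mul_zero] at hsl
      exact slitPlane_ne_zero hsl rfl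
    · exact hs.2 ⟨u, ⟨by linarith, by linarith [hu.2]⟩, h⟩
  · apply hs.1
    simp only [mem_iUnion]
    obtain ⟨u, hu, hu2⟩ := (B.periodic i).exists_mem_Ico₀ zero_lt_one t
    exact ⟨i, hij, u, ⟨hu.1, hu.2.le⟩, by rw [← hu2, h]⟩

lemma log_sub_log_neg {z : ℂ} (hz : 0 < z.im) : log z - log (-z) = Real.pi * I := by
  rw [log, log, arg_neg_eq_arg_sub_pi_of_im_pos hz, norm_neg]
  push_cast; ring

lemma log_sub_log_neg' {z : ℂ} (hz : z.im < 0) : log z - log (-z) = -(Real.pi * I) := by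
  rw [log, log, arg_neg_eq_arg_add_pi_of_im_neg hz, norm_neg]
  push_cast; ring

lemma sides_aux (hK : IsCompact K) (hconn : IsConnected Kᶜ) {δ η : ℝ} {j : Fin B.n} {t0 : ℝ}
    (h1 : ∀ v, 0 < v → v ≤ δ → 0 < (qq B j t0 v).re)
    (h2 : ∀ v, v < 0 → -δ ≤ v → (qq B j t0 v).re < 0) (h0 : 0 < δ) (h3 : δ < 1 / 2)
    (hη : 0 < η) (hηδ : η ≤ δ) :
    (Far B j t0 η (B.curve j t0) + (log (I * qq B j t0 η) - log (I * qq B j t0 (-η))) = 2 * Real.pi * I) ∧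
    (∀ᶠ s in 𝓝[>] (0:ℝ), app B j t0 s ∈ interior K) ∧ (∀ᶠ s in 𝓝[>] (0:ℝ), app B j t0 (-s) ∈ Kᶜ) := by
  have key : ∀ e : ℝ, (e = 1 ∨ e = -1) → Tendsto (fun s => Wn B (app B j t0 (e * s))) (𝓝[>] 0)
      (𝓝 (Far B j t0 η (B.curve j t0) + (log (e * (I * qq B j t0 η)) - log (e * (I * qq B j t0 (-η)))))) := by
    intro e he
    have he0 : e ≠ 0 := by rcases he with rfl | rfl <;> norm_num
    have ht : Tendsto (fun s : ℝ => e * s) (𝓝[>] (0:ℝ)) (𝓝 0) :=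
      tendsto_nhdsWithin_of_tendsto_nhds ((continuous_const.mul continuous_id).tendsto' _ _ (by simp))
    have hfar := (Far_cont B (j := j) (t0 := t0) hη (hηδ.trans_lt h3)).tendsto.comp ((app_tendsto B j t0).comp ht)
    have hlog : ∀ v, (qq B j t0 v).re ≠ 0 → Tendsto (fun s : ℝ => log (e * I * (qq B j t0 v - I * (e * s : ℝ)))) (𝓝[>] (0:ℝ))
        (𝓝 (log (e * (I * qq B j t0 v)))) := by
      intro v hv
      have hc : Tendsto (fun s : ℝ => (e * I * (qq B j t0 v - I * (e * s : ℝ)) : ℂ)) (𝓝[>] (0:ℝ))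
          (𝓝 (e * (I * qq B j t0 v))) := by
        refine tendsto_nhdsWithin_of_tendsto_nhds (Continuous.tendsto' (by fun_prop) _ _ ?_)
        simp; ring
      refine hc.clog ?_
      rw [mem_slitPlane_iff]; right
      simpa using ⟨he0, hv⟩
    refine (hfar.add ((hlog η (h1 η hη hηδ).ne').sub (hlog (-η) (h2 (-η) (by linarith) (by linarith)).ne))).congr' ?_
    filter_upwards [app_off B he h1 h2 h0 h3, self_mem_nhdsWithin] with s hs hs0
    have hs0 : 0 < s := hs0
    rw [Wn_split B (j := j) (t0 := t0) (η := η) hs, near_int B he ?_ h1 h2 hη hηδ]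
    · simp [Function.comp]
    · rcases he with rfl | rfl <;> simpa using hs0
  have hval : ∀ a, (∀ i t, B.curve i t ≠ a) → (a ∈ interior K ∧ Wn B a = 2 * Real.pi * I) ∨ (a ∈ Kᶜ ∧ Wn B a = 0) := by
    intro a ha
    have : a ∉ frontier K := by
      rw [← B.boundary]
      simpa using ha
    rcases notMem_frontier hK this with h | h
    · exact Or.inl ⟨h, B.orientation a h⟩
    · exact Or.inr ⟨h, Wn_compl B hK hconn h⟩
  have hpi : (2 * Real.pi * I : ℂ) ≠ 0 := by simp [Real.pi_ne_zero]
  have hmem : ∀ e : ℝ, (e = 1 ∨ e = -1) →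
      Far B j t0 η (B.curve j t0) + (log (e * (I * qq B j t0 η)) - log (e * (I * qq B j t0 (-η)))) ∈
        ({2 * Real.pi * I, 0} : Set ℂ) := by
    intro e he
    refine (toFinite ({2 * Real.pi * I, 0} : Set ℂ)).isClosed.mem_of_tendsto (key e he) ?_
    filter_upwards [app_off B he h1 h2 h0 h3] with s hs
    rcases hval _ hs with h | h
    · left; exact h.2
    · right; exact h.2
  have k1 := key 1 (Or.inl rfl)
  have k2 := key (-1) (Or.inr rfl)
  have m1 := hmem 1 (Or.inl rfl)
  have m2 := hmem (-1) (Or.inr rfl)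
  simp only [ofReal_one, one_mul, ofReal_neg, neg_mul] at k1 k2 m1 m2
  have l1 := log_sub_log_neg (z := I * qq B j t0 η) (by simpa using h1 η hη hηδ)
  have l2 := log_sub_log_neg' (z := I * qq B j t0 (-η)) (by simpa using h2 (-η) (by linarith) (by linarith))
  set P := Far B j t0 η (B.curve j t0) + (log (I * qq B j t0 η) - log (I * qq B j t0 (-η))) with hP
  set Q := Far B j t0 η (B.curve j t0) + (log (-(I * qq B j t0 η)) - log (-(I * qq B j t0 (-η)))) with hQ
  have hPQ : P - Q = 2 * Real.pi * I := by rw [hP, hQ]; linear_combination l1 - l2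
  have hPv : P = 2 * Real.pi * I ∧ Q = 0 := by
    rcases m1 with m1 | m1 <;> rcases m2 with m2 | m2
    · rw [m1, m2, sub_self] at hPQ; exact absurd hPQ.symm hpi
    · exact ⟨m1, m2⟩
    · rw [mem_singleton_iff] at m1
      rw [m1, m2] at hPQ
      have : (2 * Real.pi * I : ℂ) = 0 := by linear_combination -(1/2) * hPQ
      exact absurd this hpi
    · rw [mem_singleton_iff] at m1 m2
      rw [m1, m2, sub_self] at hPQ; exact absurd hPQ.symm hpi
  refine ⟨hPv.1, ?_, ?_⟩
  · have h5 := k1.eventually_ne (hPv.1 ▸ hpi)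
    have h6 := app_off B (Or.inl rfl) h1 h2 h0 h3
    simp only [one_mul] at h6
    filter_upwards [h5, h6] with s hs hs2
    exact ((hval _ hs2).resolve_right fun h => hs h.2).1
  · have h5 := k2.eventually_ne (hPv.2 ▸ hpi.symm)
    have h6 := app_off B (Or.inr rfl) h1 h2 h0 h3
    simp only [neg_mul, one_mul] at h6
    filter_upwards [h5, h6] with s hs hs2
    exact ((hval _ hs2).resolve_left fun h => hs h.2).1

lemma sides (hK : IsCompact K) (hconn : IsConnected Kᶜ) (j : Fin B.n) (t0 : ℝ) :
    (∀ᶠ s in 𝓝[>] (0:ℝ), app B j t0 s ∈ interior K) ∧ (∀ᶠ s in 𝓝[>] (0:ℝ), app B j t0 (-s) ∈ Kᶜ) := by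
  obtain ⟨δ, h0, h3, h1, h2⟩ := qq_re B j t0
  exact (sides_aux B hK hconn h1 h2 h0 h3 h0 le_rfl).2

/-- Principal value of the Cauchy integral of `1`. -/
lemma far_tendsto (hK : IsCompact K) (hconn : IsConnected Kᶜ) (j : Fin B.n) (t0 : ℝ) :
    Tendsto (fun η => Far B j t0 η (B.curve j t0)) (𝓝[>] 0) (𝓝 (Real.pi * I)) := by
  obtain ⟨δ, h0, h3, h1, h2⟩ := qq_re B j t0
  have hq := qq_deriv B j t0 0
  rw [add_zero, div_self (B.regular j t0), hasDerivAt_iff_tendsto_slope_zero] at hq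
  simp only [zero_add, qq_zero, sub_zero] at hq
  have hp : Tendsto (fun η : ℝ => η⁻¹ • qq B j t0 η) (𝓝[>] 0) (𝓝 1) :=
    hq.mono_left (nhdsWithin_mono _ fun x hx => (ne_of_gt hx))
  have hm : Tendsto (fun η : ℝ => (-η)⁻¹ • qq B j t0 (-η)) (𝓝[>] 0) (𝓝 1) := by
    refine hq.comp (tendsto_nhdsWithin_iff.2 ⟨?_, ?_⟩)
    · exact tendsto_nhdsWithin_of_tendsto_nhds (continuous_neg.tendsto' _ _ (by simp))
    · filter_upwards [self_mem_nhdsWithin] with s hs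
      exact (neg_lt_zero.2 hs).ne
  have lp : Tendsto (fun η : ℝ => log (I * (η⁻¹ • qq B j t0 η))) (𝓝[>] 0) (𝓝 (log I)) := by
    have := (hp.const_mul I).clog (by simp [mem_slitPlane_iff])
    rwa [mul_one] at this
  have lm : Tendsto (fun η : ℝ => log (-I * ((-η)⁻¹ • qq B j t0 (-η)))) (𝓝[>] 0) (𝓝 (log (-I))) := by
    have := (hm.const_mul (-I)).clog (by simp [mem_slitPlane_iff])
    rwa [mul_one] at this
  have hfin := (tendsto_const_nhds (x := (2 * Real.pi * I : ℂ))).sub (lp.sub lm)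
  rw [log_I, log_neg_I, show (2 * Real.pi * I - (Real.pi / 2 * I - -(Real.pi / 2) * I) : ℂ) = Real.pi * I by ring] at hfin
  refine hfin.congr' ?_
  filter_upwards [Ioo_mem_nhdsGT h0] with η hη
  have h := (sides_aux B hK hconn h1 h2 h0 h3 hη.1 hη.2.le).1
  have e1 : log (I * qq B j t0 η) = Real.log η + log (I * (η⁻¹ • qq B j t0 η)) := by
    rw [← log_ofReal_mul hη.1]
    · congr 1
      have : (η:ℂ) ≠ 0 := by exact_mod_cast hη.1.ne'
      rw [real_smul]; push_cast; field_simp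
    · have := h1 η hη.1 hη.2.le
      intro h0
      have hz : qq B j t0 η = 0 := by simpa [hη.1.ne'] using h0
      rw [hz] at this; simp at this
  have e2 : log (I * qq B j t0 (-η)) = Real.log η + log (-I * ((-η)⁻¹ • qq B j t0 (-η))) := by
    rw [← log_ofReal_mul hη.1]
    · congr 1
      have : (η:ℂ) ≠ 0 := by exact_mod_cast hη.1.ne'
      rw [real_smul]; push_cast; field_simp
    · have := h2 (-η) (by linarith [hη.1]) (by linarith [hη.2])
      intro h0
      have hz : qq B j t0 (-η) = 0 := by simpa [hη.1.ne'] using h0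
      rw [hz] at this; simp at this
  rw [e1, e2] at h
  linear_combination -h

end Curves

end ACap

namespace ACap

lemma contDiff_param (n : ℕ) : ∀ {G : Type} [NormedAddCommGroup G] [NormedSpace ℝ G]
    {F : (ℝ × ℝ) × ℝ → G}, ContDiff ℝ (⊤ : ℕ∞) F →
    ContDiff ℝ n (fun p => ∫ x in (0:ℝ)..1, F (p, x)) := by
  induction n with
  | zero =>
    intro G _ _ F hF
    rw [Nat.cast_zero, contDiff_zero]
    exact intervalIntegral.continuous_parametric_intervalIntegral_of_continuous' (f := fun p x => F (p, x))
      hF.continuous 0 1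
  | succ n ih =>
    intro G _ _ F hF
    have hF1 : ContDiff ℝ (⊤ : ℕ∞) (fun y => (fderiv ℝ F y).comp (ContinuousLinearMap.inl ℝ (ℝ × ℝ) ℝ)) :=
      (hF.fderiv_right (by simp)).clm_comp contDiff_const
    push_cast
    rw [contDiff_succ_iff_hasFDerivAt]
    refine ⟨_, ih hF1, fun p => ?_⟩
    obtain ⟨C, hC⟩ := ((isCompact_closedBall p 1).prod (isCompact_Icc (a := (0:ℝ)) (b := 1))).exists_bound_of_continuousOn
      hF1.continuous.continuousOn
    refine intervalIntegral.hasFDerivAt_integral_of_dominated_of_fderiv_le (𝕜 := ℝ) (bound := fun _ => C)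
      (F := fun p x => F (p, x)) (F' := fun p x => (fderiv ℝ F (p, x)).comp (ContinuousLinearMap.inl ℝ (ℝ × ℝ) ℝ))
      (closedBall_mem_nhds p one_pos) ?_ ?_ ?_ ?_ ?_ ?_
    · exact Eventually.of_forall fun p =>
        (hF.continuous.comp (continuous_const.prodMk continuous_id)).aestronglyMeasurable
    · exact (hF.continuous.comp (continuous_const.prodMk continuous_id)).intervalIntegrable _ _
    · exact (hF1.continuous.comp (continuous_const.prodMk continuous_id)).aestronglyMeasurable
    · refine Eventually.of_forall fun t ht q hq => hC (q, t) ⟨hq, ?_⟩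
      rw [uIoc_of_le zero_le_one] at ht
      exact ⟨ht.1.le, ht.2⟩
    · exact intervalIntegrable_const
    · refine Eventually.of_forall fun t ht q hq => ?_
      have h1 : HasFDerivAt F (fderiv ℝ F (q, t)) (q, t) :=
        (hF.differentiable (by simp) _).hasFDerivAt
      have h2 : HasFDerivAt (fun q : ℝ × ℝ => (q, t)) (ContinuousLinearMap.inl ℝ (ℝ × ℝ) ℝ) q :=
        hasFDerivAt_prodMk_left q t
      exact h1.comp q h2

lemma contDiff_param' {G : Type} [NormedAddCommGroup G] [NormedSpace ℝ G]
    {F : (ℝ × ℝ) × ℝ → G} (hF : ContDiff ℝ (⊤ : ℕ∞) F) :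
    ContDiff ℝ (⊤ : ℕ∞) (fun p => ∫ x in (0:ℝ)..1, F (p, x)) :=
  contDiff_infty.2 fun n => contDiff_param n hF

/-- Hadamard: difference as an integral of the derivative along the segment. -/
lemma hadamard {f f' : ℝ → ℂ} (hf : ∀ t, HasDerivAt f (f' t) t) (hc : Continuous f') (t u : ℝ) :
    f u - f t = (u - t) * ∫ x in (0:ℝ)..1, f' (t + x * (u - t)) := by
  have hd : ∀ x : ℝ, HasDerivAt (fun x : ℝ => f (t + x * (u - t))) ((u - t : ℝ) • f' (t + x * (u - t))) x := by
    intro x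
    have h1 : HasDerivAt (fun x : ℝ => t + x * (u - t)) (u - t) x := by
      simpa using ((hasDerivAt_id x).mul_const (u - t)).const_add t
    exact (hf _).scomp x h1
  have h2 := intervalIntegral.integral_eq_sub_of_hasDerivAt (a := 0) (b := 1) (fun x _ => hd x)
    (Continuous.intervalIntegrable (by fun_prop) _ _)
  rw [intervalIntegral.integral_smul, real_smul] at h2
  push_cast at h2
  rw [h2]
  simp

section Curves

variable {K : Set ℂ} (B : SmoothBoundary K)

/-- Difference quotient of the curve. -/
def QQ (j : Fin B.n) (p : ℝ × ℝ) : ℂ := ∫ x in (0:ℝ)..1, deriv (B.curve j) (p.1 + x * (p.2 - p.1))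

lemma QQ_smooth (j : Fin B.n) : ContDiff ℝ (⊤ : ℕ∞) (QQ B j) := by
  refine contDiff_param' (F := fun y => deriv (B.curve j) (y.1.1 + y.2 * (y.1.2 - y.1.1))) ?_
  refine (cv_dsmooth B j).comp ?_
  fun_prop

lemma QQ_mul (j : Fin B.n) (t u : ℝ) : B.curve j u - B.curve j t = (u - t) * QQ B j (t, u) :=
  hadamard (cv_diff B j) (cv_dcont B j) t u

lemma QQ_ne (j : Fin B.n) {t u : ℝ} (h : |u - t| < 1) : QQ B j (t, u) ≠ 0 := by
  intro h0
  have h1 := QQ_mul B j t u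
  rw [h0, mul_zero, sub_eq_zero] at h1
  obtain ⟨-, k, hk⟩ := cv_eq B h1
  have h2 : u - t = k := by linarith
  rw [h2] at h
  have h3 : k = 0 := by
    have : |k| < 1 := by exact_mod_cast h
    rwa [Int.abs_lt_one_iff] at this
  have h4 : u = t := by rw [hk, h3]; simp
  subst h4
  apply B.regular j u
  simpa [QQ] using h0

lemma per_int (j : Fin B.n) (t : ℝ) (k : ℤ) : B.curve j (t + k) = B.curve j t := by
  have := (B.periodic j).int_mul k t
  rwa [mul_one] at this

lemma dper_int (j : Fin B.n) (t : ℝ) (k : ℤ) : deriv (B.curve j) (t + k) = deriv (B.curve j) t := by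
  have := (cv_dper B j).int_mul k t
  rwa [mul_one] at this

lemma QQ_shift (j : Fin B.n) (t u : ℝ) (k : ℤ) : QQ B j (t + k, u + k) = QQ B j (t, u) := by
  unfold QQ
  refine intervalIntegral.integral_congr fun x _ => ?_
  dsimp only
  rw [← dper_int B j (t + x * (u - t)) k]
  congr 1; ring

lemma QQ_lower : ∃ c > 0, ∀ j t u, |u - t| ≤ 3 / 4 → c ≤ ‖QQ B j (t, u)‖ := by
  have h : ∀ j, ∃ c > 0, ∀ t u, |u - t| ≤ 3 / 4 → c ≤ ‖QQ B j (t, u)‖ := by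
    intro j
    have hcomp : IsCompact ((Icc (0:ℝ) 1 ×ˢ Icc (-1:ℝ) 2) ∩ {p : ℝ × ℝ | |p.2 - p.1| ≤ 3 / 4}) :=
      (isCompact_Icc.prod isCompact_Icc).inter_right
        (isClosed_le (by fun_prop) continuous_const)
    obtain ⟨p, hp, hmin⟩ := hcomp.exists_isMinOn ⟨((0:ℝ), (0:ℝ)), by simp; norm_num⟩
      (QQ_smooth B j).continuous.norm.continuousOn
    refine ⟨‖QQ B j p‖, norm_pos_iff.2 (QQ_ne B j (hp.2.trans_lt (by norm_num))), fun t u htu => ?_⟩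
    have := QQ_shift B j t u (-⌊t⌋)
    rw [← this]
    refine hmin ⟨⟨⟨?_, ?_⟩, ?_, ?_⟩, ?_⟩
    all_goals simp only [mem_setOf_eq]; push_cast
    · linarith [Int.floor_le t]
    · linarith [Int.lt_floor_add_one t]
    · linarith [Int.floor_le t, (abs_le.1 htu).1]
    · linarith [Int.lt_floor_add_one t, (abs_le.1 htu).2]
    · rwa [add_sub_add_right_eq_sub]
  choose c hc h using h
  have hNe : (Finset.univ : Finset (Fin B.n)).Nonempty := ⟨⟨0, B.npos⟩, Finset.mem_univ _⟩
  exact ⟨Finset.univ.inf' hNe c, (Finset.lt_inf'_iff _).2 fun i _ => hc i, fun j t u htu =>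
    (Finset.inf'_le _ (Finset.mem_univ j)).trans (h j t u htu)⟩

lemma chord : ∃ c > 0, ∀ j t u, |u - t| ≤ 3 / 4 → c * |u - t| ≤ ‖B.curve j u - B.curve j t‖ := by
  obtain ⟨c, hc, h⟩ := QQ_lower B
  refine ⟨c, hc, fun j t u htu => ?_⟩
  rw [QQ_mul, norm_mul, mul_comm, ← ofReal_sub, norm_real]
  exact mul_le_mul_of_nonneg_left (h j t u htu) (abs_nonneg _)

lemma per_bound {f : ℝ → ℂ} (hf : Continuous f) (hp : Function.Periodic f 1) : ∃ M, ∀ t, ‖f t‖ ≤ M := by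
  obtain ⟨M, hM⟩ := (hp.compact_of_continuous one_ne_zero hf).isBounded.exists_norm_le
  exact ⟨M, fun t => hM _ ⟨t, rfl⟩⟩

lemma cv_bounds : ∃ M > 0, ∀ j t, ‖deriv (B.curve j) t‖ ≤ M ∧
    (∀ u, ‖deriv (B.curve j) u - deriv (B.curve j) t‖ ≤ M * |u - t|) ∧
    (∀ u, ‖B.curve j u - B.curve j t‖ ≤ M * |u - t|) := by
  have h : ∀ j, ∃ M > 0, ∀ t, ‖deriv (B.curve j) t‖ ≤ M ∧
      (∀ u, ‖deriv (B.curve j) u - deriv (B.curve j) t‖ ≤ M * |u - t|) ∧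
      (∀ u, ‖B.curve j u - B.curve j t‖ ≤ M * |u - t|) := by
    intro j
    obtain ⟨M1, h1⟩ := per_bound (cv_dcont B j) (cv_dper B j)
    have hd2 := ((contDiff_infty_iff_deriv (f := deriv (B.curve j))).1 (cv_dsmooth B j))
    obtain ⟨M2, h2⟩ := per_bound hd2.2.continuous (periodic_deriv (cv_dper B j))
    refine ⟨max (max M1 M2) 1, by positivity, fun t => ⟨(h1 t).trans (by simp), fun u => ?_, fun u => ?_⟩⟩
    · exact Convex.norm_image_sub_le_of_norm_deriv_le (s := univ) (fun x _ => hd2.1 x)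
        (fun x _ => (h2 x).trans (by simp)) convex_univ trivial trivial
    · exact Convex.norm_image_sub_le_of_norm_deriv_le (s := univ) (fun x _ => (cv_diff B j x).differentiableAt)
        (fun x _ => (h1 x).trans (by simp)) convex_univ trivial trivial
  choose M hM h using h
  have hNe : (Finset.univ : Finset (Fin B.n)).Nonempty := ⟨⟨0, B.npos⟩, Finset.mem_univ _⟩
  have hle : ∀ j, M j ≤ Finset.univ.sup' hNe M := fun j => Finset.le_sup' _ (Finset.mem_univ j)
  refine ⟨Finset.univ.sup' hNe M, (hM ⟨0, B.npos⟩).trans_le (hle _), fun j t => ⟨((h j t).1).trans (hle j),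
    fun u => ((h j t).2.1 u).trans (mul_le_mul_of_nonneg_right (hle j) (abs_nonneg _)),
    fun u => ((h j t).2.2 u).trans (mul_le_mul_of_nonneg_right (hle j) (abs_nonneg _))⟩⟩

lemma cv_dlower : ∃ m > 0, ∀ j t, m ≤ ‖deriv (B.curve j) t‖ := by
  obtain ⟨c, hc, h⟩ := QQ_lower B
  refine ⟨c, hc, fun j t => ?_⟩
  have := h j t t (by norm_num)
  simpa [QQ] using this

lemma cv_sep : ∃ d > 0, ∀ i j, i ≠ j → ∀ s t, d ≤ ‖B.curve i s - B.curve j t‖ := by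
  have h : ∀ i j : Fin B.n, ∃ d > 0, i ≠ j → ∀ s t, d ≤ ‖B.curve i s - B.curve j t‖ := by
    intro i j
    by_cases hij : i = j
    · exact ⟨1, one_pos, fun h => absurd hij h⟩
    have hc : ∀ i, IsCompact (range (B.curve i)) := fun i =>
      (B.periodic i).compact_of_continuous one_ne_zero (cv_cont B i)
    obtain ⟨p, hp, hmin⟩ := ((hc i).prod (hc j)).exists_isMinOn ⟨(_, _), ⟨⟨0, rfl⟩, ⟨0, rfl⟩⟩⟩
      (f := fun p : ℂ × ℂ => ‖p.1 - p.2‖) (by fun_prop)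
    refine ⟨‖p.1 - p.2‖, norm_pos_iff.2 (sub_ne_zero.2 fun e => ?_), fun _ s t => hmin (a := (B.curve i s, B.curve j t)) ⟨⟨s, rfl⟩, ⟨t, rfl⟩⟩⟩
    exact disjoint_left.1 (B.disjointCurves i j hij) hp.1 (e ▸ hp.2)
  choose d hd h using h
  have hNe : (Finset.univ : Finset (Fin B.n × Fin B.n)).Nonempty := ⟨(⟨0, B.npos⟩, ⟨0, B.npos⟩), Finset.mem_univ _⟩
  exact ⟨Finset.univ.inf' hNe (fun p => d p.1 p.2), (Finset.lt_inf'_iff _).2 fun i _ => hd _ _, fun i j hij s t =>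
    (Finset.inf'_le (fun p : Fin B.n × Fin B.n => d p.1 p.2) (Finset.mem_univ (i, j))).trans (h i j hij s t)⟩

end Curves

end ACap

namespace ACap

/-- Fourier coefficients of a `1`-periodic function. -/
def fc (f : ℝ → ℂ) (k : ℤ) : ℂ := ∫ t in (0:ℝ)..1, exp (-(2 * Real.pi * I * k * t)) * f t

lemma fc_deriv {f f' : ℝ → ℂ} (hf : ∀ t, HasDerivAt f (f' t) t) (hc : Continuous f')
    (hp : Function.Periodic f 1) (k : ℤ) : fc f' k = 2 * Real.pi * I * k * fc f k := by
  have hfc : Continuous f := continuous_iff_continuousAt.2 fun t => (hf t).continuousAt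
  have he : ∀ t : ℝ, HasDerivAt (fun t : ℝ => exp (-(2 * Real.pi * I * k * t)))
      (exp (-(2 * Real.pi * I * k * t)) * (-(2 * Real.pi * I * k))) t := fun t => by
    have h1 : HasDerivAt (fun t : ℝ => (-(2 * Real.pi * I * k * t) : ℂ)) (-(2 * Real.pi * I * k)) t := by
      have := (((hasDerivAt_id t).ofReal_comp).const_mul (2 * Real.pi * I * k : ℂ)).fun_neg
      simpa using this
    exact h1.cexp
  have hd : ∀ t : ℝ, HasDerivAt (fun t : ℝ => exp (-(2 * Real.pi * I * k * t)) * f t)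
      (exp (-(2 * Real.pi * I * k * t)) * (-(2 * Real.pi * I * k)) * f t + exp (-(2 * Real.pi * I * k * t)) * f' t) t :=
    fun t => (he t).mul (hf t)
  have hce : Continuous fun t : ℝ => exp (-(2 * Real.pi * I * k * t)) := by fun_prop
  have c1 : Continuous fun t : ℝ => exp (-(2 * Real.pi * I * k * t)) * (-(2 * Real.pi * I * k)) * f t := by fun_prop
  have c2 : Continuous fun t : ℝ => exp (-(2 * Real.pi * I * k * t)) * f' t := by fun_prop
  have h2 := intervalIntegral.integral_eq_sub_of_hasDerivAt (a := 0) (b := 1) (fun t _ => hd t)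
    (Continuous.intervalIntegrable (by fun_prop) _ _)
  rw [intervalIntegral.integral_add (c1.intervalIntegrable _ _) (c2.intervalIntegrable _ _)] at h2
  have h3 : exp (-(2 * Real.pi * I * k * (1:ℝ))) = 1 := by
    rw [exp_eq_one_iff]; exact ⟨-k, by push_cast; ring⟩
  have h4 : f 1 = f 0 := by simpa using hp 0
  have h5 : (∫ t in (0:ℝ)..1, exp (-(2 * Real.pi * I * k * t)) * (-(2 * Real.pi * I * k)) * f t) =
      -(2 * Real.pi * I * k) * fc f k := by
    rw [fc, ← intervalIntegral.integral_const_mul]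
    exact intervalIntegral.integral_congr fun t _ => by ring
  rw [h5, h3, h4] at h2
  simp only [ofReal_zero, mul_zero, neg_zero, exp_zero, sub_self] at h2
  rw [fc]
  linear_combination h2

lemma fc_bound {f : ℝ → ℂ} {M : ℝ} (hM : ∀ t, ‖f t‖ ≤ M) (k : ℤ) : ‖fc f k‖ ≤ M := by
  have := intervalIntegral.norm_integral_le_of_norm_le_const (a := 0) (b := 1) (C := M)
    (f := fun t : ℝ => exp (-(2 * Real.pi * I * k * t)) * f t) (fun t _ => by
      rw [norm_mul, norm_exp]
      simpa using hM t)
  simpa [fc] using this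

lemma fc_hasSum {f : ℝ → ℂ} (hf : Continuous f) (hp : Function.Periodic f 1) (hs : Summable (fc f)) (t : ℝ) :
    HasSum (fun k : ℤ => fc f k * exp (2 * Real.pi * I * k * t)) (f t) := by
  let F : C(AddCircle (1:ℝ), ℂ) := ⟨hp.lift, continuous_coinduced_dom.mpr hf⟩
  have hF : ∀ t : ℝ, F t = f t := fun t => hp.lift_coe t
  haveI : Fact ((0:ℝ) < 1) := ⟨one_pos⟩
  have hco : fourierCoeff F = fc f := by
    funext k
    rw [fourierCoeff_eq_intervalIntegral F k 0, fc]
    simp only [zero_add, div_one, one_smul]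
    refine intervalIntegral.integral_congr fun t _ => ?_
    rw [hF, fourier_coe_apply, smul_eq_mul]
    congr 2; push_cast; ring
  have := has_pointwise_sum_fourier_series_of_summable (f := F) (hco ▸ hs) (t : AddCircle (1:ℝ))
  rw [hF, hco] at this
  refine this.congr_fun ?_
  intro k
  rw [fourier_coe_apply, smul_eq_mul]
  congr 2; push_cast; ring

lemma fc_summable {f : ℝ → ℂ} (hf : ContDiff ℝ (⊤ : ℕ∞) f) (hp : Function.Periodic f 1) :
    Summable fun k : ℤ => (k:ℝ) ^ 2 * ‖fc f k‖ := by
  have step : ∀ g : ℝ → ℂ, ContDiff ℝ (⊤ : ℕ∞) g → Function.Periodic g 1 →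
      ContDiff ℝ (⊤ : ℕ∞) (deriv g) ∧ Function.Periodic (deriv g) 1 ∧ ∀ k : ℤ, fc (deriv g) k = 2 * Real.pi * I * k * fc g k := by
    intro g hg hgp
    have h1 := contDiff_infty_iff_deriv.1 hg
    exact ⟨h1.2, periodic_deriv hgp, fun k => fc_deriv (fun t => (h1.1 t).hasDerivAt) h1.2.continuous hgp k⟩
  obtain ⟨s1, p1, e1⟩ := step f hf hp
  obtain ⟨s2, p2, e2⟩ := step _ s1 p1
  obtain ⟨s3, p3, e3⟩ := step _ s2 p2
  obtain ⟨s4, p4, e4⟩ := step _ s3 p3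
  obtain ⟨M, hM⟩ := per_bound s4.continuous p4
  have hsum : Summable fun k : ℤ => M * (1 / (k:ℝ) ^ 2) :=
    (Real.summable_one_div_int_pow.2 one_lt_two).mul_left M
  refine Summable.of_nonneg_of_le (fun k => by positivity) (fun k => ?_) hsum
  have hb := fc_bound hM k
  rw [e4, e3, e2, e1] at hb
  by_cases hk : k = 0
  · simp [hk]
  have hk' : (0:ℝ) < (k:ℝ) ^ 2 := by positivity
  have h2 : (k:ℝ) ^ 4 * ‖fc f k‖ ≤ M := by
    refine le_trans ?_ hb
    simp only [norm_mul, norm_I, norm_real, Complex.norm_ofNat, norm_intCast, mul_one]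
    have : |(k:ℝ)| * (|(k:ℝ)| * (|(k:ℝ)| * (|(k:ℝ)| * ‖fc f k‖))) = (k:ℝ) ^ 4 * ‖fc f k‖ := by
      rw [← Even.pow_abs (by decide : Even 4)]; ring
    have hpi : 1 ≤ 2 * ‖Real.pi‖ := by
      rw [Real.norm_of_nonneg Real.pi_pos.le]; linarith [Real.pi_gt_three]
    calc _ = 1 ^ 4 * ((k:ℝ) ^ 4 * ‖fc f k‖) := by ring
      _ ≤ (2 * ‖Real.pi‖) ^ 4 * ((k:ℝ) ^ 4 * ‖fc f k‖) := by gcongr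
      _ = _ := by rw [← this]; ring
  rw [mul_one_div, le_div_iff₀ hk']
  nlinarith

lemma fourier_approx {f : ℝ → ℂ} (hf : ContDiff ℝ (⊤ : ℕ∞) f) (hp : Function.Periodic f 1) :
    ∃ C > 0, ∀ N : ℕ, 1 ≤ N → ∃ E : ℂ → ℂ, (∀ w ≠ 0, DifferentiableAt ℂ E w) ∧
      ∀ t s : ℝ, |s| ≤ 2 / N →
        ‖E (exp (2 * Real.pi * I * (t + I * s))) - (f t + I * s * deriv f t)‖ ≤ C / N ^ 2 ∧
        ‖2 * Real.pi * I * exp (2 * Real.pi * I * (t + I * s)) *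
          deriv E (exp (2 * Real.pi * I * (t + I * s))) - deriv f t‖ ≤ C / N := by
  have hS := fc_summable hf hp
  have hd := contDiff_infty_iff_deriv.1 hf
  have hfd := fc_deriv (fun t => (hd.1 t).hasDerivAt) hd.2.continuous hp
  have hk1 : ∀ k : ℤ, |(k:ℝ)| ≤ (k:ℝ) ^ 2 := by
    intro k
    have : |k| ≤ k ^ 2 := by
      rw [← sq_abs]; nlinarith [abs_nonneg k, mul_self_nonneg (|k| - 1), sq_nonneg (|k|), Int.le_self_sq |k|]
    exact_mod_cast this
  have s0 : Summable (fc f) := by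
    refine Summable.of_norm_bounded (g := fun k : ℤ => (k:ℝ) ^ 2 * ‖fc f k‖ + if k = 0 then ‖fc f 0‖ else 0)
      (hS.add (hasSum_ite_eq 0 _).summable) fun k => ?_
    by_cases hk : k = 0
    · simp [hk]
    · have : (1:ℝ) ≤ (k:ℝ) ^ 2 := by
        have : 0 < k ^ 2 := by positivity
        have : 1 ≤ k ^ 2 := this
        exact_mod_cast this
      simp only [hk, if_false, add_zero]
      nlinarith [norm_nonneg (fc f k)]
  have s1 : Summable (fc (deriv f)) := by
    refine Summable.of_norm_bounded (hS.mul_left (2 * Real.pi)) fun k => ?_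
    rw [hfd]
    simp only [norm_mul, norm_I, norm_real, Complex.norm_ofNat, norm_intCast, mul_one]
    rw [Real.norm_of_nonneg Real.pi_pos.le]
    calc _ = 2 * Real.pi * (|(k:ℝ)| * ‖fc f k‖) := by ring
      _ ≤ _ := by have := hk1 k; gcongr
  set S := ∑' k : ℤ, (k:ℝ) ^ 2 * ‖fc f k‖ with hSdef
  have hS0 : 0 ≤ S := tsum_nonneg fun k => by positivity
  set D : ℝ := 16 * Real.pi ^ 2 * Real.exp (4 * Real.pi) + 2 * Real.pi + 4 * Real.pi + 1 with hD
  have hpi := Real.pi_pos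
  have he1 : 0 < Real.exp (4 * Real.pi) := Real.exp_pos _
  have hD0 : 0 < D := by positivity
  refine ⟨D * S + 1, by positivity, fun N hN => ?_⟩
  have hN0 : (0:ℝ) < N := by exact_mod_cast hN
  refine ⟨fun w => ∑ k ∈ Finset.Icc (-(N:ℤ)) N, fc f k * w ^ k, ?_, ?_⟩
  · intro w hw
    refine DifferentiableAt.fun_sum fun k _ => ?_
    exact (differentiableAt_zpow.2 (Or.inl hw)).const_mul _
  intro t s hs
  set w := exp (2 * Real.pi * I * (t + I * s)) with hw
  have hw0 : w ≠ 0 := exp_ne_zero _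
  have hwk : ∀ k : ℤ, w ^ k = exp (2 * Real.pi * I * k * t) * exp (-(2 * Real.pi * k * s : ℝ)) := by
    intro k
    rw [hw, ← exp_int_mul, ← exp_add]
    congr 1
    push_cast
    linear_combination (2 * Real.pi * k * s : ℂ) * I_sq
  have hn1 : ∀ k : ℤ, ‖exp (2 * Real.pi * I * k * t)‖ = 1 := fun k => by
    rw [norm_exp]; simp
  have hx : ∀ k ∈ Finset.Icc (-(N:ℤ)) N, ‖(-(2 * Real.pi * k * s : ℝ) : ℂ)‖ ≤ 4 * Real.pi := by
    intro k hk
    rw [Finset.mem_Icc] at hk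
    have hk' : |(k:ℝ)| ≤ N := abs_le.2 ⟨by exact_mod_cast hk.1, by exact_mod_cast hk.2⟩
    rw [norm_neg, norm_real, Real.norm_eq_abs, abs_mul, abs_mul, abs_of_pos (by positivity)]
    calc 2 * Real.pi * |(k:ℝ)| * |s| ≤ 2 * Real.pi * N * (2 / N) := by gcongr
      _ = _ := by field_simp; ring
  have hxk : ∀ k : ℤ, ‖(-(2 * Real.pi * k * s : ℝ) : ℂ)‖ ≤ 4 * Real.pi * (|(k:ℝ)| / N) := by
    intro k
    rw [norm_neg, norm_real, Real.norm_eq_abs, abs_mul, abs_mul, abs_of_pos (by positivity : (0:ℝ) < 2 * Real.pi)]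
    calc 2 * Real.pi * |(k:ℝ)| * |s| ≤ 2 * Real.pi * |(k:ℝ)| * (2 / N) := by gcongr
      _ = _ := by ring
  have hout : ∀ k ∉ Finset.Icc (-(N:ℤ)) N, 1 ≤ |(k:ℝ)| / N := by
    intro k hk
    rw [le_div_iff₀ hN0, one_mul]
    rw [Finset.mem_Icc] at hk
    have : (N:ℤ) ≤ |k| := by
      by_contra hlt
      push Not at hlt
      exact hk ⟨by linarith [(abs_lt.1 hlt).1], by linarith [(abs_lt.1 hlt).2]⟩
    exact_mod_cast this
  have hsq : ∀ k : ℤ, |(k:ℝ)| / N * (|(k:ℝ)| / N) = (k:ℝ) ^ 2 / N ^ 2 := fun k => by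
    rw [div_mul_div_comm, ← sq, ← sq, sq_abs]
  constructor
  · have h1 : HasSum (fun k : ℤ => (if k ∈ Finset.Icc (-(N:ℤ)) N then fc f k * w ^ k else 0))
        (∑ k ∈ Finset.Icc (-(N:ℤ)) N, fc f k * w ^ k) := by
      have := hasSum_sum_of_ne_finset_zero (L := SummationFilter.unconditional ℤ) (f := fun k : ℤ => (if k ∈ Finset.Icc (-(N:ℤ)) N then fc f k * w ^ k else 0))
        (s := Finset.Icc (-(N:ℤ)) N) (fun k hk => if_neg hk)
      rwa [Finset.sum_congr rfl fun k hk => if_pos hk] at this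
    have h2 := h1.sub ((fc_hasSum hd.1.continuous hp s0 t).add
      ((fc_hasSum hd.2.continuous (periodic_deriv hp) s1 t).mul_left (I * s)))
    have hb : HasSum (fun k : ℤ => D / N ^ 2 * ((k:ℝ) ^ 2 * ‖fc f k‖)) (D / N ^ 2 * S) := hS.hasSum.mul_left _
    rw [← h2.tsum_eq]
    refine (tsum_of_norm_bounded hb fun k => ?_).trans ?_
    · have e1 : fc f k * exp (2 * Real.pi * I * k * t) + I * s * (fc (deriv f) k * exp (2 * Real.pi * I * k * t)) =
          fc f k * exp (2 * Real.pi * I * k * t) * (1 + (-(2 * Real.pi * k * s : ℝ) : ℂ)) := by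
        rw [hfd]; push_cast
        linear_combination (2 * Real.pi * k * s * fc f k * exp (2 * Real.pi * I * k * t) : ℂ) * I_sq
      rw [e1]
      set x : ℂ := (-(2 * Real.pi * k * s : ℝ) : ℂ) with hxd
      have hxx := hxk k
      by_cases hk : k ∈ Finset.Icc (-(N:ℤ)) N
      · rw [if_pos hk, hwk, ← mul_assoc, ← mul_sub, norm_mul, norm_mul, hn1, mul_one]
        have h3 := norm_exp_sub_sum_le_norm_mul_exp x 2
        simp only [Finset.sum_range_succ, Finset.sum_range_zero, zero_add, pow_zero, Nat.factorial_zero,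
          Nat.cast_one, div_one, pow_one, Nat.factorial_one] at h3
        calc ‖fc f k‖ * ‖exp x - (1 + x)‖ ≤ ‖fc f k‖ * (‖x‖ ^ 2 * Real.exp ‖x‖) := by gcongr
          _ ≤ ‖fc f k‖ * ((4 * Real.pi * (|(k:ℝ)| / N)) ^ 2 * Real.exp (4 * Real.pi)) := by
            have := hx k hk
            gcongr
          _ = (16 * Real.pi ^ 2 * Real.exp (4 * Real.pi)) * ((k:ℝ) ^ 2 / N ^ 2 * ‖fc f k‖) := by
            rw [← hsq]; ring
          _ ≤ D * ((k:ℝ) ^ 2 / N ^ 2 * ‖fc f k‖) := by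
            gcongr; rw [hD]; linarith
          _ = _ := by ring
      · rw [if_neg hk, zero_sub, norm_neg, norm_mul, norm_mul, hn1, mul_one]
        have ho := hout k hk
        calc ‖fc f k‖ * ‖1 + x‖ ≤ ‖fc f k‖ * (1 + 4 * Real.pi * (|(k:ℝ)| / N)) := by
              gcongr
              refine (norm_add_le _ _).trans ?_
              rw [norm_one]; gcongr
          _ ≤ ‖fc f k‖ * (|(k:ℝ)| / N * (|(k:ℝ)| / N) + 4 * Real.pi * (|(k:ℝ)| / N * (|(k:ℝ)| / N))) := by
            gcongr
            · nlinarith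
            · nlinarith
          _ = (4 * Real.pi + 1) * ((k:ℝ) ^ 2 / N ^ 2 * ‖fc f k‖) := by rw [hsq]; ring
          _ ≤ D * ((k:ℝ) ^ 2 / N ^ 2 * ‖fc f k‖) := by
            gcongr; rw [hD]
            have : 0 < 16 * Real.pi ^ 2 * Real.exp (4 * Real.pi) := by positivity
            linarith
          _ = _ := by ring
    · rw [div_mul_eq_mul_div]; gcongr; linarith
  · have hder : 2 * Real.pi * I * w * deriv (fun w => ∑ k ∈ Finset.Icc (-(N:ℤ)) N, fc f k * w ^ k) w =
        ∑ k ∈ Finset.Icc (-(N:ℤ)) N, fc (deriv f) k * w ^ k := by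
      have : HasDerivAt (fun w => ∑ k ∈ Finset.Icc (-(N:ℤ)) N, fc f k * w ^ k)
          (∑ k ∈ Finset.Icc (-(N:ℤ)) N, fc f k * (k * w ^ (k - 1))) w :=
        HasDerivAt.fun_sum fun k _ => (hasDerivAt_zpow k w (Or.inl hw0)).const_mul _
      rw [this.deriv, Finset.mul_sum]
      refine Finset.sum_congr rfl fun k _ => ?_
      rw [hfd, zpow_sub_one₀ hw0]
      field_simp
    rw [hder]
    have h1 : HasSum (fun k : ℤ => (if k ∈ Finset.Icc (-(N:ℤ)) N then fc (deriv f) k * w ^ k else 0))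
        (∑ k ∈ Finset.Icc (-(N:ℤ)) N, fc (deriv f) k * w ^ k) := by
      have := hasSum_sum_of_ne_finset_zero (L := SummationFilter.unconditional ℤ) (f := fun k : ℤ => (if k ∈ Finset.Icc (-(N:ℤ)) N then fc (deriv f) k * w ^ k else 0))
        (s := Finset.Icc (-(N:ℤ)) N) (fun k hk => if_neg hk)
      rwa [Finset.sum_congr rfl fun k hk => if_pos hk] at this
    have h2 := h1.sub (fc_hasSum hd.2.continuous (periodic_deriv hp) s1 t)
    have hb : HasSum (fun k : ℤ => D / N * ((k:ℝ) ^ 2 * ‖fc f k‖)) (D / N * S) := hS.hasSum.mul_left _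
    have hnd : ∀ k : ℤ, ‖fc (deriv f) k‖ = 2 * Real.pi * (|(k:ℝ)| * ‖fc f k‖) := fun k => by
      rw [hfd]
      simp only [norm_mul, norm_I, norm_real, Complex.norm_ofNat, norm_intCast, mul_one]
      rw [Real.norm_of_nonneg Real.pi_pos.le]; ring
    rw [← h2.tsum_eq]
    refine (tsum_of_norm_bounded hb fun k => ?_).trans ?_
    · set x : ℂ := (-(2 * Real.pi * k * s : ℝ) : ℂ) with hxd
      have hxx := hxk k
      by_cases hk : k ∈ Finset.Icc (-(N:ℤ)) N
      · rw [if_pos hk, hwk, ← mul_assoc, ← mul_sub_one, norm_mul, norm_mul, hn1, mul_one, hnd]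
        have h3 := norm_exp_sub_sum_le_norm_mul_exp x 1
        simp only [Finset.sum_range_succ, Finset.sum_range_zero, zero_add, pow_zero, Nat.factorial_zero,
          Nat.cast_one, div_one, pow_one] at h3
        calc 2 * Real.pi * (|(k:ℝ)| * ‖fc f k‖) * ‖exp x - 1‖
            ≤ 2 * Real.pi * (|(k:ℝ)| * ‖fc f k‖) * ((4 * Real.pi * (|(k:ℝ)| / N)) * Real.exp (4 * Real.pi)) := by
              have := hx k hk
              refine mul_le_mul_of_nonneg_left (h3.trans ?_) (by positivity)
              gcongr
          _ = (8 * Real.pi ^ 2 * Real.exp (4 * Real.pi)) * ((k:ℝ) ^ 2 / N * ‖fc f k‖) := by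
            rw [← sq_abs (k:ℝ)]; ring
          _ ≤ D * ((k:ℝ) ^ 2 / N * ‖fc f k‖) := by
            gcongr; rw [hD]
            have : 0 < Real.pi ^ 2 * Real.exp (4 * Real.pi) := by positivity
            linarith
          _ = _ := by ring
      · rw [if_neg hk, zero_sub, norm_neg, norm_mul, hn1, mul_one, hnd]
        have ho := hout k hk
        calc 2 * Real.pi * (|(k:ℝ)| * ‖fc f k‖) ≤ 2 * Real.pi * ((|(k:ℝ)| * (|(k:ℝ)| / N)) * ‖fc f k‖) := by
              gcongr
              exact le_mul_of_one_le_right (abs_nonneg _) ho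
          _ = (2 * Real.pi) * ((k:ℝ) ^ 2 / N * ‖fc f k‖) := by rw [← sq_abs (k:ℝ)]; ring
          _ ≤ D * ((k:ℝ) ^ 2 / N * ‖fc f k‖) := by
            gcongr; rw [hD]
            have : 0 < 16 * Real.pi ^ 2 * Real.exp (4 * Real.pi) := by positivity
            linarith
          _ = _ := by ring
    · rw [div_mul_eq_mul_div]; gcongr; linarith

end ACap

namespace ACap

section Rings

variable {K : Set ℂ} (B : SmoothBoundary K)

/-- Holomorphic approximate collars in strip coordinates. -/
structure Strip (F F' : Fin B.n → ℂ → ℂ) (C M m c d h : ℝ) : Prop where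
  hd : ∀ j τ, HasDerivAt (F j) (F' j τ) τ
  per : ∀ j τ (k : ℤ), F j (τ + k) = F j τ
  e0 : ∀ j (t s : ℝ), |s| ≤ 2 * h → ‖F j (t + I * s) - (B.curve j t + I * s * deriv (B.curve j) t)‖ ≤ C * h ^ 2
  e1 : ∀ j (t s : ℝ), |s| ≤ 2 * h → ‖F' j (t + I * s) - deriv (B.curve j) t‖ ≤ C * h
  hC : 0 < C
  hM : 0 < M
  hm : 0 < m
  hc : 0 < c
  hh : 0 < h
  h1 : h ≤ 1
  b1 : ∀ j t, ‖deriv (B.curve j) t‖ ≤ M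
  b2 : ∀ j t u, ‖deriv (B.curve j) u - deriv (B.curve j) t‖ ≤ M * |u - t|
  b3 : ∀ j t, m ≤ ‖deriv (B.curve j) t‖
  b4 : ∀ j t u, |u - t| ≤ 3 / 4 → c * |u - t| ≤ ‖B.curve j u - B.curve j t‖
  b5 : ∀ i j, i ≠ j → ∀ s t, d ≤ ‖B.curve i s - B.curve j t‖
  p1 : 2 * (C + 2 * M) * h < d
  p2 : (C + M * (2 * (C + 2 * M) / c)) * h < m
  p3 : (C + M) * h ≤ m / 2
  p4 : C * h < m / 16

namespace Strip

variable {B} {F F' : Fin B.n → ℂ → ℂ} {C M m c d h : ℝ}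

lemma close (S : Strip B F F' C M m c d h) (j : Fin B.n) (t s : ℝ) (hs : |s| ≤ 2 * h) : ‖F j (t + I * s) - B.curve j t‖ ≤ (C + 2 * M) * h := by
  have h0 := S.e0 j t s hs
  have h1 := S.b1 j t
  have : F j (t + I * s) - B.curve j t = (F j (t + I * s) - (B.curve j t + I * s * deriv (B.curve j) t)) +
    I * s * deriv (B.curve j) t := by ring
  rw [this]
  refine (norm_add_le _ _).trans ?_
  have h2 : ‖I * s * deriv (B.curve j) t‖ ≤ 2 * h * M := by
    rw [norm_mul, norm_mul, norm_I, one_mul, norm_real]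
    have := S.hh
    exact mul_le_mul hs h1 (norm_nonneg _) (by positivity)
  have h3 : C * h ^ 2 ≤ C * h := by
    have := S.hC; have := S.hh; have := S.h1
    gcongr; nlinarith
  linarith

lemma lin (S : Strip B F F' C M m c d h) (j : Fin B.n) (t0 L : ℝ) {τ τ' : ℂ} (hτ : |τ.im| ≤ 2 * h) (hτ' : |τ'.im| ≤ 2 * h)
    (hL : |τ.re - t0| ≤ L) (hL' : |τ'.re - t0| ≤ L) :
    ‖F j τ - F j τ' - deriv (B.curve j) t0 * (τ - τ')‖ ≤ (C * h + M * L) * ‖τ - τ'‖ := by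
  have hconv : Convex ℝ ({z : ℂ | |z.im| ≤ 2 * h} ∩ {z : ℂ | |z.re - t0| ≤ L}) := by
    have e1 : {z : ℂ | |z.im| ≤ 2 * h} = imCLM ⁻¹' (Icc (-(2 * h)) (2 * h)) := by
      ext z; simp [abs_le]
    have e2 : {z : ℂ | |z.re - t0| ≤ L} = reCLM ⁻¹' (Icc (t0 - L) (t0 + L)) := by
      ext z; simp only [mem_setOf_eq, abs_le, mem_preimage, reCLM_apply, mem_Icc]
      constructor <;> rintro ⟨h1, h2⟩ <;> constructor <;> linarith
    rw [e1, e2]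
    exact ((convex_Icc _ _).linear_preimage imCLM.toLinearMap).inter
      ((convex_Icc _ _).linear_preimage reCLM.toLinearMap)
  have := hconv.norm_image_sub_le_of_norm_hasDerivWithin_le (𝕜 := ℂ) (f := fun z => F j z - deriv (B.curve j) t0 * z)
    (f' := fun z => F' j z - deriv (B.curve j) t0 * 1) (C := C * h + M * L) (x := τ') (y := τ)
    (fun z _ => ((S.hd j z).sub ((hasDerivAt_id z).const_mul _)).hasDerivWithinAt) (fun z hz => ?_)
    ⟨hτ', hL'⟩ ⟨hτ, hL⟩
  · convert! this using 2
    ring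
  · have h1 := S.e1 j z.re z.im hz.1
    rw [mul_comm I, re_add_im] at h1
    have h2 := S.b2 j t0 z.re
    rw [mul_one]
    calc ‖F' j z - deriv (B.curve j) t0‖ ≤ ‖F' j z - deriv (B.curve j) z.re‖ + ‖deriv (B.curve j) z.re - deriv (B.curve j) t0‖ :=
          norm_sub_le_norm_sub_add_norm_sub _ _ _
      _ ≤ C * h + M * L := by
        have := mul_le_mul_of_nonneg_left hz.2 S.hM.le
        linarith

lemma inj (S : Strip B F F' C M m c d h) {i j : Fin B.n} {τ τ' : ℂ} (hτ : |τ.im| ≤ 2 * h) (hτ' : |τ'.im| ≤ 2 * h) (e : F i τ = F j τ') :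
    i = j ∧ ∃ k : ℤ, τ = τ' + k := by
  have hc1 := S.close i τ.re τ.im hτ
  rw [mul_comm I, re_add_im] at hc1
  have hij : i = j := by
    by_contra hne
    have hc2 := S.close j τ'.re τ'.im hτ'
    rw [mul_comm I, re_add_im] at hc2
    have h5 := S.b5 i j hne τ.re τ'.re
    have : B.curve i τ.re - B.curve j τ'.re = (F j τ' - B.curve j τ'.re) - (F i τ - B.curve i τ.re) := by
      rw [e]; ring
    rw [this] at h5
    linarith [norm_sub_le (F j τ' - B.curve j τ'.re) (F i τ - B.curve i τ.re), S.p1]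
  subst hij
  refine ⟨rfl, round (τ.re - τ'.re), ?_⟩
  set σ := τ' + (round (τ.re - τ'.re) : ℤ) with hσ
  have eσ : F i τ = F i σ := by rw [e, hσ, S.per]
  have hσi : |σ.im| ≤ 2 * h := by simpa [hσ] using hτ'
  have hσr : |σ.re - τ.re| ≤ 1 / 2 := by
    have := abs_sub_round (τ.re - τ'.re)
    rw [abs_sub_comm] at this
    rw [hσ]; simp only [add_re, intCast_re]
    rwa [show τ'.re + (round (τ.re - τ'.re) : ℝ) - τ.re = (round (τ.re - τ'.re) : ℝ) - (τ.re - τ'.re) by ring]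
  have hc2 := S.close i σ.re σ.im hσi
  rw [mul_comm I, re_add_im] at hc2
  have h4 := S.b4 i τ.re σ.re (by linarith)
  have : B.curve i σ.re - B.curve i τ.re = (F i τ - B.curve i τ.re) - (F i σ - B.curve i σ.re) := by
    rw [eσ]; ring
  rw [this] at h4
  have h5 := norm_sub_le (F i τ - B.curve i τ.re) (F i σ - B.curve i σ.re)
  have h6 : |σ.re - τ.re| ≤ 2 * (C + 2 * M) / c * h := by
    rw [div_mul_eq_mul_div, le_div_iff₀ S.hc]; linarith
  have hpos : 0 ≤ 2 * (C + 2 * M) / c * h := (abs_nonneg _).trans h6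
  have h7 := S.lin i τ.re _ hσi hτ h6 (by simpa using hpos)
  rw [eσ, sub_self, zero_sub, norm_neg, norm_mul] at h7
  by_contra hne
  have h8 : 0 < ‖σ - τ‖ := norm_pos_iff.2 (sub_ne_zero.2 fun e => hne e.symm)
  have h9 := S.b3 i τ.re
  have h10 := le_of_mul_le_mul_right h7 h8
  linarith [S.p2]

lemma dne (S : Strip B F F' C M m c d h) (j : Fin B.n) {τ : ℂ} (hτ : |τ.im| ≤ 2 * h) : F' j τ ≠ 0 := by
  intro h0
  have h1 := S.e1 j τ.re τ.im hτ
  rw [mul_comm I, re_add_im, h0, zero_sub, norm_neg] at h1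
  linarith [S.b3 j τ.re, S.p4, S.hm]

lemma surj (S : Strip B F F' C M m c d h) (j : Fin B.n) (t s : ℝ) (hs : |s| ≤ 3 / 2 * h) :
    ∃ τ ∈ closedBall (t + I * s : ℂ) (h / 4), F j τ = B.curve j t + I * s * deriv (B.curve j) t := by
  have hh := S.hh
  set τ0 : ℂ := t + I * s with hτ0
  have him : τ0.im = s := by simp [hτ0]
  have hre : τ0.re = t := by simp [hτ0]
  have h1 := DiffContOnCl.ball_subset_image_closedBall (f := F j) (z₀ := τ0) (r := h / 4) (ε := m / 2 * (h / 4))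
    (Differentiable.diffContOnCl fun z => (S.hd j z).differentiableAt) (by positivity) ?_ ?_
  · obtain ⟨τ, hτ, e⟩ := h1 (a := B.curve j t + I * s * deriv (B.curve j) t) (by
      rw [mem_ball, dist_comm, dist_eq]
      refine (S.e0 j t s (by linarith)).trans_lt ?_
      have := mul_lt_mul_of_pos_right S.p4 hh
      nlinarith)
    exact ⟨τ, hτ, e⟩
  · intro z hz
    rw [mem_sphere, dist_eq] at hz
    have hzi : |z.im - s| ≤ h / 4 := by
      rw [← hz, ← him, ← sub_im]; exact abs_im_le_norm _
    have hzr : |z.re - t| ≤ h / 4 := by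
      rw [← hz, ← hre, ← sub_re]; exact abs_re_le_norm _
    have h2 := S.lin j t (h / 4) (τ := z) (τ' := τ0) (by
        have := abs_add_le (z.im - s) s
        rw [sub_add_cancel] at this; linarith) (by rw [him]; linarith) hzr (by rw [hre]; simp; positivity)
    rw [hz] at h2
    have h3 : ‖deriv (B.curve j) t * (z - τ0)‖ ≤ ‖F j z - F j τ0‖ + ‖F j z - F j τ0 - deriv (B.curve j) t * (z - τ0)‖ := by
      have := norm_sub_le (F j z - F j τ0) (F j z - F j τ0 - deriv (B.curve j) t * (z - τ0))
      rwa [sub_sub_cancel] at this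
    rw [norm_mul, hz] at h3
    have h4 := mul_le_mul_of_nonneg_right (S.b3 j t) (by positivity : 0 ≤ h / 4)
    have h5 : (C * h + M * (h / 4)) * (h / 4) ≤ m / 2 * (h / 4) := by
      refine mul_le_mul_of_nonneg_right ?_ (by positivity)
      have := S.p3; have := S.hM
      nlinarith
    linarith
  · exact ((S.hd j τ0).eventually_ne (S.dne j (by rw [him]; linarith))).frequently.filter_mono nhdsWithin_le_nhds

lemma off (S : Strip B F F' C M m c d h) (j : Fin B.n) {τ : ℂ} (hτ : |τ.im| ≤ 2 * h) (hτ2 : h ≤ |τ.im|) : F j τ ∉ frontier K := by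
  have hh := S.hh
  rw [← B.boundary]
  intro hmem
  obtain ⟨i, t, e⟩ := mem_iUnion.1 hmem
  obtain ⟨σ, hσ, e2⟩ := S.surj i t 0 (by simp; positivity)
  rw [mem_closedBall, dist_eq] at hσ
  have hσi : |σ.im| ≤ h / 4 := by
    have := (abs_im_le_norm (σ - (t + I * (0:ℝ)))).trans hσ
    simpa using this
  have e3 : F j τ = F i σ := by rw [e2, ← e]; simp
  obtain ⟨-, k, hk⟩ := S.inj hτ (by linarith) e3
  rw [hk] at hτ2
  simp at hτ2
  linarith

lemma side_out (S : Strip B F F' C M m c d h) (hK : IsCompact K) (j : Fin B.n) (hs : app B j 0 (-(3 / 2 * h)) ∈ Kᶜ) {τ : ℂ}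
    (h1 : -(2 * h) ≤ τ.im) (h2 : τ.im ≤ -h) : F j τ ∈ Kᶜ := by
  have hh := S.hh
  have hpre : IsPreconnected (F j '' (imCLM ⁻¹' Icc (-(2 * h)) (-h))) := by
    refine IsPreconnected.image ?_ _ fun z _ => (S.hd j z).continuousAt.continuousWithinAt
    exact ((convex_Icc _ _).linear_preimage imCLM.toLinearMap).isPreconnected
  have hsub : F j '' (imCLM ⁻¹' Icc (-(2 * h)) (-h)) ⊆ Kᶜ ∪ interior K := by
    rintro _ ⟨z, hz, rfl⟩
    rw [mem_preimage, imCLM_apply, mem_Icc] at hz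
    rw [union_comm]
    refine notMem_frontier hK (S.off j (abs_le.2 ⟨hz.1, by linarith⟩) ?_)
    rw [abs_of_neg (by linarith)]; linarith
  refine hpre.subset_left_of_subset_union hK.isClosed.isOpen_compl isOpen_interior
    (disjoint_compl_left.mono_right interior_subset) hsub ?_ ⟨τ, ⟨h1, h2⟩, rfl⟩
  obtain ⟨σ, hσ, e⟩ := S.surj j 0 (-(3 / 2 * h)) (by rw [abs_neg, abs_of_pos (by positivity)])
  rw [mem_closedBall, dist_eq] at hσ
  have hσi := abs_le.1 ((abs_im_le_norm _).trans hσ)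
  simp at hσi
  refine ⟨F j σ, ⟨σ, ⟨?_, ?_⟩, rfl⟩, ?_⟩
  · simp; linarith
  · simp; linarith
  · rw [e]; exact hs

lemma side_in (S : Strip B F F' C M m c d h) (hK : IsCompact K) (j : Fin B.n) (hs : app B j 0 (3 / 2 * h) ∈ interior K) {τ : ℂ}
    (h1 : h ≤ τ.im) (h2 : τ.im ≤ 2 * h) : F j τ ∈ interior K := by
  have hh := S.hh
  have hpre : IsPreconnected (F j '' (imCLM ⁻¹' Icc h (2 * h))) := by
    refine IsPreconnected.image ?_ _ fun z _ => (S.hd j z).continuousAt.continuousWithinAt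
    exact ((convex_Icc _ _).linear_preimage imCLM.toLinearMap).isPreconnected
  have hsub : F j '' (imCLM ⁻¹' Icc h (2 * h)) ⊆ interior K ∪ Kᶜ := by
    rintro _ ⟨z, hz, rfl⟩
    rw [mem_preimage, imCLM_apply, mem_Icc] at hz
    refine notMem_frontier hK (S.off j (abs_le.2 ⟨by linarith, hz.2⟩) ?_)
    rw [abs_of_pos (by linarith)]; linarith
  refine hpre.subset_left_of_subset_union isOpen_interior hK.isClosed.isOpen_compl
    (disjoint_compl_right.mono_left interior_subset) hsub ?_ ⟨τ, ⟨h1, h2⟩, rfl⟩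
  obtain ⟨σ, hσ, e⟩ := S.surj j 0 (3 / 2 * h) (by rw [abs_of_pos (by positivity)])
  rw [mem_closedBall, dist_eq] at hσ
  have hσi := abs_le.1 ((abs_im_le_norm _).trans hσ)
  simp at hσi
  refine ⟨F j σ, ⟨σ, ⟨?_, ?_⟩, rfl⟩, ?_⟩
  · simp; linarith
  · simp; linarith
  · rw [e]; exact hs

end Strip

lemma exp_coord {h : ℝ} {w : ℂ} (hw : w ≠ 0) : ∃ t s : ℝ,
    w * Real.exp (2 * Real.pi * h) = exp (2 * Real.pi * I * (t + I * s)) ∧ ‖w‖ = Real.exp (-(2 * Real.pi * (s + h))) := by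
  have hpi := Real.pi_pos
  have hpi' : (Real.pi : ℂ) ≠ 0 := by exact_mod_cast hpi.ne'
  refine ⟨arg w / (2 * Real.pi), -Real.log ‖w‖ / (2 * Real.pi) - h, ?_, ?_⟩
  · have e : (2 * Real.pi * I * ((arg w / (2 * Real.pi) : ℝ) + I * (-Real.log ‖w‖ / (2 * Real.pi) - h : ℝ)) : ℂ) =
        log w + (2 * Real.pi * h : ℝ) := by
      rw [log]; push_cast
      field_simp
      linear_combination (-(Real.log ‖w‖) - 2 * Real.pi * h : ℂ) * I_sq
    rw [e, exp_add, exp_log hw, ofReal_exp]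
  · have e : -(2 * Real.pi * (-Real.log ‖w‖ / (2 * Real.pi) - h + h)) = Real.log ‖w‖ := by
      field_simp; ring
    rw [e, Real.exp_log (norm_pos_iff.2 hw)]

lemma Strip.ring {B : SmoothBoundary K} (hK : IsCompact K) {F' : Fin B.n → ℂ → ℂ} {C M m c d h : ℝ}
    {E : Fin B.n → ℂ → ℂ} (hE : ∀ j, ∀ w ≠ 0, DifferentiableAt ℂ (E j) w)
    (S : Strip B (fun j τ => E j (exp (2 * Real.pi * I * τ))) F' C M m c d h)
    (hF' : ∀ j τ, F' j τ = 2 * Real.pi * I * exp (2 * Real.pi * I * τ) * deriv (E j) (exp (2 * Real.pi * I * τ)))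
    (hs : ∀ j, app B j 0 (3 / 2 * h) ∈ interior K ∧ app B j 0 (-(3 / 2 * h)) ∈ Kᶜ) :
    ∃ R : RingSys K, ∃ e : Fin R.n ≃ Fin B.n, ∀ j (t r : ℝ), R.r0 ≤ r → r ≤ R.r1 →
      ‖R.Z j (circleMap 0 r (2 * Real.pi * t)) - B.curve (e j) t‖ ≤ (C + 2 * M) * h ∧
      ‖2 * Real.pi * I * (circleMap 0 r (2 * Real.pi * t) * deriv (R.Z j) (circleMap 0 r (2 * Real.pi * t))) -
        deriv (B.curve (e j)) t‖ ≤ C * h := by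
  have hh := S.hh
  have hpi := Real.pi_pos
  have hph : 0 < Real.pi * h := by positivity
  have hα : ((Real.exp (2 * Real.pi * h) : ℝ) : ℂ) ≠ 0 := by exact_mod_cast (Real.exp_pos _).ne'
  have hZd : ∀ j w, w ≠ 0 → HasDerivAt (fun w => E j (w * Real.exp (2 * Real.pi * h)))
      (deriv (E j) (w * Real.exp (2 * Real.pi * h)) * Real.exp (2 * Real.pi * h)) w := by
    intro j w hw
    have h1 := (hE j (w * Real.exp (2 * Real.pi * h)) (mul_ne_zero hw hα)).hasDerivAt
    have h2 : HasDerivAt (fun w : ℂ => w * (Real.exp (2 * Real.pi * h) : ℂ)) (Real.exp (2 * Real.pi * h) : ℂ) w := by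
      simpa using (hasDerivAt_id w).mul_const (Real.exp (2 * Real.pi * h) : ℂ)
    exact h1.comp w h2
  have coord : ∀ {a b : ℝ} {w : ℂ}, w ∈ cann (Real.exp (-(2 * Real.pi * (a + h)))) (Real.exp (-(2 * Real.pi * (b + h)))) →
      w ≠ 0 ∧ ∃ t s : ℝ, w * Real.exp (2 * Real.pi * h) = exp (2 * Real.pi * I * (t + I * s)) ∧ b ≤ s ∧ s ≤ a := by
    intro a b w hw
    rw [mem_cann] at hw
    have hw0 : w ≠ 0 := norm_pos_iff.1 ((Real.exp_pos _).trans_le hw.1)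
    obtain ⟨t, s, e1, e2⟩ := exp_coord (h := h) hw0
    rw [e2, Real.exp_le_exp, Real.exp_le_exp] at hw
    refine ⟨hw0, t, s, e1, ?_, ?_⟩ <;> nlinarith
  have eone : (1:ℝ) = Real.exp (-(2 * Real.pi * (-h + h))) := by simp
  let R : RingSys K :=
    { n := B.n
      npos := B.npos
      Z := fun j w => E j (w * Real.exp (2 * Real.pi * h))
      r0 := Real.exp (-(2 * Real.pi * (2 * h + h)))
      ρ0 := Real.exp (-(2 * Real.pi * (h + h)))
      r1 := Real.exp (-(2 * Real.pi * (-(2 * h) + h)))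
      h0 := Real.exp_pos _
      h0ρ := by rw [Real.exp_lt_exp]; nlinarith
      hρ1 := by rw [Real.exp_lt_one_iff]; nlinarith
      h11 := by rw [Real.one_lt_exp_iff]; nlinarith
      holo := fun j w hw => (hZd j w hw).differentiableAt.differentiableWithinAt
      inj := by
        intro i j w w' hw hw' e
        obtain ⟨hw0, t, s, e1, a1, a2⟩ := coord hw
        obtain ⟨hw0', t', s', e1', a1', a2'⟩ := coord hw'
        rw [e1, e1'] at e
        obtain ⟨hij, k, hk⟩ := S.inj (i := i) (j := j) (τ := t + I * s) (τ' := t' + I * s')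
          (by simp [abs_le]; exact ⟨a1, a2⟩) (by simp [abs_le]; exact ⟨a1', a2'⟩) e
        refine ⟨hij, mul_right_cancel₀ hα ?_⟩
        rw [e1, e1', hk, mul_add, exp_add, show (2 * Real.pi * I * k : ℂ) = k * (2 * Real.pi * I) by ring,
          exp_int_mul_two_pi_mul_I, mul_one]
      dne := by
        intro j w hw
        obtain ⟨hw0, t, s, e1, a1, a2⟩ := coord hw
        rw [(hZd j w hw0).deriv, e1]
        have := S.dne j (τ := t + I * s) (by simp [abs_le]; exact ⟨a1, a2⟩)
        rw [hF'] at this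
        exact mul_ne_zero (right_ne_zero_of_mul this) hα
      front := by
        rw [← B.boundary]
        refine iUnion_subset fun j => ?_
        rintro _ ⟨t, rfl⟩
        refine mem_iUnion.2 ⟨j, ?_⟩
        obtain ⟨σ, hσ, e2⟩ := S.surj j t 0 (by simp; positivity)
        rw [mem_closedBall, dist_eq] at hσ
        have hσi : |σ.im| ≤ h / 4 := by
          have := (abs_im_le_norm (σ - (t + I * (0:ℝ)))).trans hσ
          simpa using this
        rw [abs_le] at hσi
        refine ⟨exp (2 * Real.pi * I * σ - (2 * Real.pi * h : ℝ)), ?_, ?_⟩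
        · rw [mem_ann, norm_exp]
          have : (2 * Real.pi * I * σ - (2 * Real.pi * h : ℝ)).re = -(2 * Real.pi * (σ.im + h)) := by
            simp; ring
          rw [this, Real.exp_lt_exp, Real.exp_lt_one_iff]
          constructor <;> nlinarith
        · dsimp only
          rw [ofReal_exp, ← exp_add, sub_add_cancel, e2]
          simp
      out := by
        intro j w hw
        rw [eone] at hw
        obtain ⟨hw0, t, s, e1, a1, a2⟩ := coord hw
        have := S.side_out hK j (hs j).2 (τ := t + I * s) (by simpa using a1) (by simpa using a2)
        rwa [← e1] at this
      inn := by
        intro j w hw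
        obtain ⟨hw0, t, s, e1, a1, a2⟩ := coord hw
        have := S.side_in hK j (hs j).1 (τ := t + I * s) (by simpa using a1) (by simpa using a2)
        rwa [← e1] at this }
  refine ⟨R, Equiv.refl _, fun j t r hr0 hr1 => ?_⟩
  have hrpos : 0 < r := (Real.exp_pos _).trans_le hr0
  have hw0 : circleMap 0 r (2 * Real.pi * t) ≠ 0 := circleMap_ne_center hrpos.ne'
  set s : ℝ := -Real.log r / (2 * Real.pi) - h with hsdef
  have hls : Real.log r = -(2 * Real.pi * (s + h)) := by rw [hsdef]; field_simp; ring
  have hsb : |s| ≤ 2 * h := by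
    have h1 : -(2 * Real.pi * (2 * h + h)) ≤ Real.log r := by
      rw [← Real.log_exp (-(2 * Real.pi * (2 * h + h)))]
      exact Real.log_le_log (Real.exp_pos _) hr0
    have h2 : Real.log r ≤ -(2 * Real.pi * (-(2 * h) + h)) := by
      rw [← Real.log_exp (-(2 * Real.pi * (-(2 * h) + h)))]
      exact Real.log_le_log hrpos hr1
    rw [hls] at h1 h2
    rw [abs_le]; constructor <;> nlinarith
  have hexp : circleMap 0 r (2 * Real.pi * t) * Real.exp (2 * Real.pi * h) = exp (2 * Real.pi * I * (t + I * s)) := by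
    have : (r : ℂ) = exp (-(2 * Real.pi * (s + h)) : ℝ) := by
      rw [← ofReal_exp, ← hls, Real.exp_log hrpos]
    rw [circleMap, zero_add, this, ofReal_exp, ← exp_add, ← exp_add]
    congr 1
    push_cast
    linear_combination (-2 * Real.pi * s : ℂ) * I_sq
  constructor
  · have := S.close j t s hsb
    rw [← hexp] at this
    exact this
  · have := S.e1 j t s hsb
    rw [hF', ← hexp] at this
    have hd : deriv (R.Z j) (circleMap 0 r (2 * Real.pi * t)) = _ := (hZd j _ hw0).deriv
    rw [hd]
    convert! this using 2
    rw [Equiv.refl_apply]; ring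

lemma ring_exists (hK : IsCompact K) (hconn : IsConnected Kᶜ) {ε : ℝ} (hε : 0 < ε) :
    ∃ R : RingSys K, ∃ e : Fin R.n ≃ Fin B.n, ∀ j (t r : ℝ), R.r0 ≤ r → r ≤ R.r1 →
      ‖R.Z j (circleMap 0 r (2 * Real.pi * t)) - B.curve (e j) t‖ ≤ ε ∧
      ‖2 * Real.pi * I * (circleMap 0 r (2 * Real.pi * t) * deriv (R.Z j) (circleMap 0 r (2 * Real.pi * t))) -
        deriv (B.curve (e j)) t‖ ≤ ε := by
  choose C0 hC0 hC using fun j => fourier_approx (B.smooth j) (B.periodic j)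
  have hNe : (Finset.univ : Finset (Fin B.n)).Nonempty := ⟨⟨0, B.npos⟩, Finset.mem_univ _⟩
  set C := Finset.univ.sup' hNe C0 with hCdef
  have hle : ∀ j, C0 j ≤ C := fun j => Finset.le_sup' _ (Finset.mem_univ j)
  have hCpos : 0 < C := (hC0 ⟨0, B.npos⟩).trans_le (hle _)
  obtain ⟨M, hM, hMb⟩ := cv_bounds B
  obtain ⟨m, hm, hmb⟩ := cv_dlower B
  obtain ⟨c, hc, hcb⟩ := chord B
  obtain ⟨d, hd, hdb⟩ := cv_sep B
  have ht : Tendsto (fun N : ℕ => 1 / (N:ℝ)) atTop (𝓝 0) := tendsto_one_div_atTop_nhds_zero_nat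
  have hev : ∀ A b : ℝ, 0 < b → ∀ᶠ N : ℕ in atTop, A * (1 / (N:ℝ)) < b := fun A b hb => by
    have := ht.const_mul A
    rw [mul_zero] at this
    exact this.eventually_lt_const hb
  have hside : ∀ᶠ N : ℕ in atTop, ∀ j, app B j 0 (3 / 2 * (1 / N)) ∈ interior K ∧ app B j 0 (-(3 / 2 * (1 / N))) ∈ Kᶜ := by
    rw [eventually_all]
    intro j
    have h1 : Tendsto (fun N : ℕ => 3 / 2 * (1 / (N:ℝ))) atTop (𝓝[>] 0) := by
      refine tendsto_nhdsWithin_iff.2 ⟨by simpa using ht.const_mul (3 / 2), ?_⟩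
      filter_upwards [eventually_ge_atTop 1] with N hN
      have : (0:ℝ) < N := by exact_mod_cast hN
      show (0:ℝ) < 3 / 2 * (1 / N)
      positivity
    have := sides B hK hconn j 0
    exact (h1.eventually this.1).and (h1.eventually this.2)
  obtain ⟨N, q1, q2, q3, q4, q5, q6, q7, hN⟩ := ((hev (2 * (C + 2 * M)) d hd).and
    ((hev (C + M * (2 * (C + 2 * M) / c)) m hm).and ((hev (C + M) (m / 2) (by positivity)).and
    ((hev C (m / 16) (by positivity)).and ((hev (C + 2 * M) ε hε).and ((hev C ε hε).and
    (hside.and (eventually_ge_atTop 1)))))))).exists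
  have hN0 : (0:ℝ) < N := by exact_mod_cast hN
  have hN1 : (1:ℝ) ≤ N := by exact_mod_cast hN
  choose E hE1 hE2 using fun j => hC j N hN
  have hdE : ∀ j τ, HasDerivAt (fun τ => E j (exp (2 * Real.pi * I * τ)))
      (2 * Real.pi * I * exp (2 * Real.pi * I * τ) * deriv (E j) (exp (2 * Real.pi * I * τ))) τ := by
    intro j τ
    have h1 := (hE1 j (exp (2 * Real.pi * I * τ)) (exp_ne_zero _)).hasDerivAt
    have h2 : HasDerivAt (fun τ => exp (2 * Real.pi * I * τ)) (exp (2 * Real.pi * I * τ) * (2 * Real.pi * I)) τ := by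
      have : HasDerivAt (fun τ : ℂ => 2 * Real.pi * I * τ) (2 * Real.pi * I) τ := by
        simpa using (hasDerivAt_id τ).const_mul (2 * Real.pi * I : ℂ)
      exact this.cexp
    convert! h1.comp τ h2 using 1
    ring
  have S : Strip B (fun j τ => E j (exp (2 * Real.pi * I * τ)))
      (fun j τ => 2 * Real.pi * I * exp (2 * Real.pi * I * τ) * deriv (E j) (exp (2 * Real.pi * I * τ)))
      C M m c d (1 / N) :=
    { hd := hdE
      per := fun j τ k => by
        rw [mul_add, exp_add, show (2 * Real.pi * I * k : ℂ) = k * (2 * Real.pi * I) by ring,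
          exp_int_mul_two_pi_mul_I, mul_one]
      e0 := fun j t s hs => ((hE2 j t s (by rwa [mul_one_div] at hs)).1).trans (by
        rw [div_eq_mul_one_div, one_div_pow]; have := hle j; gcongr)
      e1 := fun j t s hs => ((hE2 j t s (by rwa [mul_one_div] at hs)).2).trans (by
        rw [div_eq_mul_one_div]; have := hle j; gcongr)
      hC := hCpos, hM := hM, hm := hm, hc := hc, hh := by positivity
      h1 := by rw [div_le_one hN0]; exact hN1
      b1 := fun j t => (hMb j t).1
      b2 := fun j t u => (hMb j t).2.1 u
      b3 := hmb, b4 := hcb, b5 := hdb, p1 := q1, p2 := q2, p3 := q3.le, p4 := q4 }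
  obtain ⟨R, e, hR⟩ := Strip.ring hK hE1 S (fun j τ => rfl) q7
  exact ⟨R, e, fun j t r h0 h1 => ⟨((hR j t r h0 h1).1).trans q5.le, ((hR j t r h0 h1).2).trans q6.le⟩⟩

end Rings

end ACap

namespace ACap

/-- Second kind integral equation with a bounded Hermitian kernel. -/
lemma fredholm {X : Type*} [MeasurableSpace X] {μ : Measure X} [IsFiniteMeasure μ] {k : X → X → ℂ}
    (hk : Measurable (fun p : X × X => k p.1 p.2)) {M : ℝ} (hM : ∀ x y, ‖k x y‖ ≤ M)
    (hsym : ∀ x y, k y x = (starRingEnd ℂ) (k x y)) :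
    ∃ s : X → ℂ, Integrable s μ ∧ ∀ x, s x = 1 + I * ∫ y, k x y * s y ∂μ := by
  have hInt : ∀ f : Lp ℂ 2 μ, Integrable f μ := fun f => (Lp.memLp f).integrable (by norm_num)
  have hki : ∀ (f : Lp ℂ 2 μ) x, Integrable (fun y => k x y * f y) μ := fun f x =>
    (hInt f).bdd_mul (hk.comp measurable_prodMk_left).aestronglyMeasurable (ae_of_all _ (hM x))
  have hprod : ∀ f : Lp ℂ 2 μ, AEStronglyMeasurable (fun p : X × X => k p.1 p.2 * f p.2) (μ.prod μ) := fun f =>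
    hk.aestronglyMeasurable.mul (Lp.memLp f).1.comp_snd
  have hT : ∀ f : Lp ℂ 2 μ, MemLp (fun x => ∫ y, k x y * f y ∂μ) 2 μ := fun f => by
    refine MemLp.of_bound (hprod f).integral_prod_right' (M * ∫ y, ‖f y‖ ∂μ) (ae_of_all _ fun x => ?_)
    rw [← integral_const_mul]
    refine norm_integral_le_of_norm_le ((hInt f).norm.const_mul M) (ae_of_all _ fun y => ?_)
    rw [norm_mul]
    exact mul_le_mul_of_nonneg_right (hM x y) (norm_nonneg _)
  let A : Lp ℂ 2 μ →ₗ[ℂ] Lp ℂ 2 μ :=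
    { toFun := fun f => (hT f).toLp _
      map_add' := fun f g => by
        rw [← MemLp.toLp_add, MemLp.toLp_eq_toLp_iff]
        refine ae_of_all _ fun x => ?_
        rw [Pi.add_apply, ← integral_add (hki f x) (hki g x)]
        refine integral_congr_ae ?_
        filter_upwards [Lp.coeFn_add f g] with y hy
        rw [hy, Pi.add_apply, mul_add]
      map_smul' := fun c f => by
        rw [RingHom.id_apply, ← MemLp.toLp_const_smul, MemLp.toLp_eq_toLp_iff]
        refine ae_of_all _ fun x => ?_
        rw [Pi.smul_apply, smul_eq_mul, ← integral_const_mul]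
        refine integral_congr_ae ?_
        filter_upwards [Lp.coeFn_smul c f] with y hy
        rw [hy, Pi.smul_apply, smul_eq_mul]; ring }
  have hAe : ∀ f, A f =ᵐ[μ] fun x => ∫ y, k x y * f y ∂μ := fun f => (hT f).coeFn_toLp
  have hA : A.IsSymmetric := by
    intro f g
    rw [L2.inner_def, L2.inner_def]
    have e1 : ∫ a, inner ℂ ((A f) a) (g a) ∂μ = ∫ x, ∫ y, g x * ((starRingEnd ℂ) (k x y) * (starRingEnd ℂ) (f y)) ∂μ ∂μ := by
      refine integral_congr_ae ?_
      filter_upwards [hAe f] with x hx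
      rw [hx, RCLike.inner_apply, ← integral_conj, ← integral_const_mul]
      simp only [map_mul]
    have e2 : ∫ a, inner ℂ (f a) ((A g) a) ∂μ = ∫ y, ∫ x, g x * ((starRingEnd ℂ) (k x y) * (starRingEnd ℂ) (f y)) ∂μ ∂μ := by
      refine integral_congr_ae ?_
      filter_upwards [hAe g] with y hy
      rw [hy, RCLike.inner_apply, mul_comm, ← integral_const_mul]
      refine integral_congr_ae (ae_of_all _ fun x => ?_)
      simp only [← hsym x y]; ring
    rw [e1, e2]
    refine integral_integral_swap ?_
    have h1 : Integrable (fun p : X × X => g p.1 * (starRingEnd ℂ) (f p.2)) (μ.prod μ) :=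
      (hInt g).mul_prod (Complex.conjCLE.toContinuousLinearMap.integrable_comp (hInt f))
    have h2 := h1.bdd_mul (c := M) (f := fun p : X × X => (starRingEnd ℂ) (k p.1 p.2))
      (Complex.continuous_conj.measurable.comp hk).aestronglyMeasurable
      (ae_of_all _ fun p => by rw [RCLike.norm_conj]; exact hM _ _)
    refine h2.congr (ae_of_all _ fun p => ?_)
    simp only [Function.uncurry]; ring
  let A' := hA.toSelfAdjoint
  have hA' : ∀ f, A'.1 f = A f := fun f => rfl
  have hu : IsUnit (algebraMap ℂ (Lp ℂ 2 μ →L[ℂ] Lp ℂ 2 μ) (-I) - A'.1) := by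
    by_contra h
    have := IsSelfAdjoint.mem_spectrum_eq_re A'.2 (spectrum.mem_iff.2 h)
    have h2 := congrArg Complex.im this
    simp at h2
  obtain ⟨u, hu⟩ := hu
  let one : Lp ℂ 2 μ := (memLp_const (1:ℂ)).toLp _
  obtain ⟨f, hf⟩ : ∃ f : Lp ℂ 2 μ, (algebraMap ℂ (Lp ℂ 2 μ →L[ℂ] Lp ℂ 2 μ) (-I) - A'.1) f = (-I) • one :=
    ⟨u⁻¹.1 ((-I) • one), by
      rw [← hu]
      exact congrArg (fun T : Lp ℂ 2 μ →L[ℂ] Lp ℂ 2 μ => T ((-I) • one)) u.mul_inv⟩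
  replace hf : (-I) • f - A f = (-I) • one := by
    simpa [Algebra.algebraMap_eq_smul_one, hA'] using hf
  have hfe : f =ᵐ[μ] fun x => 1 + I * ∫ y, k x y * f y ∂μ := by
    have h1 : f = one + I • A f := by
      have := congrArg (fun v => I • v) hf
      simp only [smul_sub, smul_smul, mul_neg, I_mul_I, neg_neg, one_smul] at this
      rw [← this]; abel
    have h2 : (⇑f : X → ℂ) = ⇑(one + I • A f) := congrArg (fun v : Lp ℂ 2 μ => (⇑v : X → ℂ)) h1
    filter_upwards [Lp.coeFn_add one (I • A f), Lp.coeFn_smul I (A f), hAe f,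
      (memLp_const (p := 2) (μ := μ) (1:ℂ)).coeFn_toLp] with x e1 e2 e3 e4
    rw [congrFun h2 x, e1, Pi.add_apply, e2, Pi.smul_apply, e3, e4, smul_eq_mul]
  refine ⟨fun x => 1 + I * ∫ y, k x y * f y ∂μ, (hInt f).congr hfe, fun x => ?_⟩
  refine congrArg (fun v => 1 + I * v) (integral_congr_ae ?_)
  filter_upwards [hfe] with y hy
  rw [← hy]

end ACap

namespace ACap

lemma cdiv {E : Type*} [NormedAddCommGroup E] [NormedSpace ℝ E] {n : WithTop ℕ∞} {f g : E → ℂ} {x : E}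
    (hf : ContDiffAt ℝ n f x) (hg : ContDiffAt ℝ n g x) (h : g x ≠ 0) :
    ContDiffAt ℝ n (fun x => f x / g x) x := by
  simp_rw [div_eq_mul_inv]; exact hf.mul (hg.inv h)

lemma lipK {F : ℝ × ℝ → ℂ} (hF : ∀ p : ℝ × ℝ, |p.2 - p.1| < 1 → ContDiffAt ℝ 1 F p) :
    ∃ C : ℝ, ∀ t t' u : ℝ, t ∈ Icc (-2:ℝ) 3 → t' ∈ Icc (-2:ℝ) 3 → |u - t| ≤ 3 / 4 → |u - t'| ≤ 3 / 4 →
      ‖F (t, u)‖ ≤ C ∧ ‖F (t, u) - F (t', u)‖ ≤ C * |t - t'| := by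
  have hcd : ContDiffOn ℝ 1 (fun p : ℝ × ℝ => F (p.1, p.1 + p.2)) (Icc (-2:ℝ) 3 ×ˢ Icc (-(3/4):ℝ) (3/4)) := by
    intro p hp
    refine ContDiffAt.contDiffWithinAt ?_
    refine ContDiffAt.comp p (g := F) (hF _ ?_) (by fun_prop)
    have h2 := hp.2
    rw [mem_Icc] at h2
    simp only [add_sub_cancel_left]
    rw [abs_lt]; constructor <;> linarith
  have hcp : IsCompact (Icc (-2:ℝ) 3 ×ˢ Icc (-(3/4):ℝ) (3/4)) := isCompact_Icc.prod isCompact_Icc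
  obtain ⟨C, hC⟩ := hcd.exists_lipschitzOnWith one_ne_zero ((convex_Icc _ _).prod (convex_Icc _ _)) hcp
  obtain ⟨D, hD⟩ := hcp.exists_bound_of_continuousOn hcd.continuousOn
  have key : ∀ t u : ℝ, t ∈ Icc (-2:ℝ) 3 → |u - t| ≤ 3 / 4 →
      (t, u - t) ∈ Icc (-2:ℝ) 3 ×ˢ Icc (-(3/4):ℝ) (3/4) := fun t u h1 h2 => ⟨h1, abs_le.1 h2⟩
  refine ⟨max C D, fun t t' u ht ht' h h' => ⟨?_, ?_⟩⟩
  · have := hD _ (key t u ht h)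
    simp only [add_sub_cancel] at this
    exact this.trans (le_max_right _ _)
  · have := hC.dist_le_mul _ (key t u ht h) _ (key t' u ht' h')
    simp only [add_sub_cancel] at this
    rw [dist_eq_norm, Prod.dist_eq, Real.dist_eq, Real.dist_eq,
      show u - t - (u - t') = -(t - t') by ring, abs_neg, max_self] at this
    exact this.trans (mul_le_mul_of_nonneg_right (le_max_left _ _) (abs_nonneg _))

variable {K : Set ℂ} (B : SmoothBoundary K)

/-- unit tangent -/
def Tn (i : Fin B.n) (t : ℝ) : ℂ := deriv (B.curve i) t / ‖deriv (B.curve i) t‖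

lemma Tn_smooth (i : Fin B.n) : ContDiff ℝ (⊤ : ℕ∞) (Tn B i) := by
  have h := cv_dsmooth B i
  refine contDiff_iff_contDiffAt.2 fun t => cdiv h.contDiffAt
    (ofRealCLM.contDiff.comp (h.norm ℝ (B.regular i))).contDiffAt ?_
  exact ofReal_ne_zero.2 (norm_ne_zero_iff.2 (B.regular i t))

lemma Tn_per (i : Fin B.n) (t : ℝ) (k : ℤ) : Tn B i (t + k) = Tn B i t := by
  rw [Tn, dper_int, ← Tn]

lemma Tn_mul (i : Fin B.n) (t : ℝ) : Tn B i t * ‖deriv (B.curve i) t‖ = deriv (B.curve i) t :=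
  div_mul_cancel₀ _ (ofReal_ne_zero.2 (norm_ne_zero_iff.2 (B.regular i t)))

lemma Tn_conj (i : Fin B.n) (t : ℝ) : Tn B i t * (starRingEnd ℂ) (Tn B i t) = 1 := by
  have : ‖Tn B i t‖ = 1 := by
    rw [Tn, norm_div, norm_real, norm_norm, div_self (norm_ne_zero_iff.2 (B.regular i t))]
  rw [mul_conj', this]; simp

/-- the Kerzman–Stein kernel -/
def kk (x y : Fin B.n × ℝ) : ℂ :=
  (Tn B y.1 y.2 / (B.curve y.1 y.2 - B.curve x.1 x.2) -
    (starRingEnd ℂ) (Tn B x.1 x.2 / (B.curve y.1 y.2 - B.curve x.1 x.2))) / (2 * Real.pi)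

lemma kk_sym (x y : Fin B.n × ℝ) : kk B y x = (starRingEnd ℂ) (kk B x y) := by
  simp only [kk, map_div₀, map_sub, conj_conj, map_mul, conj_ofReal, map_ofNat]
  rw [← neg_sub (B.curve y.1 y.2), div_neg, ← neg_sub ((starRingEnd ℂ) (B.curve y.1 y.2)), div_neg]
  ring

lemma kk_meas : Measurable (fun p : (Fin B.n × ℝ) × (Fin B.n × ℝ) => kk B p.1 p.2) := by
  have h1 : Measurable fun x : Fin B.n × ℝ => B.curve x.1 x.2 :=
    measurable_from_prod_countable_right fun i => (cv_cont B i).measurable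
  have h2 : Measurable fun x : Fin B.n × ℝ => Tn B x.1 x.2 :=
    measurable_from_prod_countable_right fun i => (Tn_smooth B i).continuous.measurable
  have h3 := (h1.comp measurable_snd).sub (h1.comp (measurable_fst (α := Fin B.n × ℝ) (β := Fin B.n × ℝ)))
  exact (((h2.comp measurable_snd).div h3).sub
    (continuous_conj.measurable.comp ((h2.comp measurable_fst).div h3))).div_const _

lemma kk_per1 (i j : Fin B.n) (t u : ℝ) (k : ℤ) : kk B (i, t + k) (j, u) = kk B (i, t) (j, u) := by
  simp only [kk, per_int, Tn_per]

lemma kk_per2 (i j : Fin B.n) (t u : ℝ) (k : ℤ) : kk B (i, t) (j, u + k) = kk B (i, t) (j, u) := by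
  simp only [kk, per_int, Tn_per]

lemma kk_model (i j : Fin B.n) : ∃ F : ℝ × ℝ → ℂ, (∀ p : ℝ × ℝ, |p.2 - p.1| < 1 → ContDiffAt ℝ 1 F p) ∧
    ∀ t u, |u - t| < 1 → B.curve i t ≠ B.curve j u → kk B (i, t) (j, u) = F (t, u) := by
  have hconj : ContDiff ℝ (⊤ : ℕ∞) (starRingEnd ℂ) := conjCLE.contDiff
  have hle : (1 : WithTop ℕ∞) ≤ ((⊤ : ℕ∞) : WithTop ℕ∞) := by exact_mod_cast le_top
  by_cases hij : i = j
  · subst hij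
    set m : ℝ × ℝ → ℂ := fun p => Tn B i p.2 * (starRingEnd ℂ) (QQ B i p) - (starRingEnd ℂ) (Tn B i p.1) * QQ B i p with hm
    have hT := Tn_smooth B i
    have hQ := QQ_smooth B i
    have hms : ContDiff ℝ (⊤ : ℕ∞) m :=
      ((hT.comp contDiff_snd).mul (hconj.comp hQ)).sub ((hconj.comp (hT.comp contDiff_fst)).mul hQ)
    have hfd : ContDiff ℝ (⊤ : ℕ∞) (fun p : ℝ × ℝ => fderiv ℝ m p (0, 1)) :=
      (hms.fderiv_right (m := (⊤ : ℕ∞)) (by simp)).clm_apply contDiff_const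
    set H : ℝ × ℝ → ℂ := fun p => ∫ x in (0:ℝ)..1, fderiv ℝ m (p.1, p.1 + x * (p.2 - p.1)) (0, 1) with hH
    have hHs : ContDiff ℝ (⊤ : ℕ∞) H :=
      contDiff_param' (F := fun q : (ℝ × ℝ) × ℝ => fderiv ℝ m (q.1.1, q.1.1 + q.2 * (q.1.2 - q.1.1)) (0, 1))
        (hfd.comp (by fun_prop : ContDiff ℝ (⊤ : ℕ∞) fun q : (ℝ × ℝ) × ℝ => (q.1.1, q.1.1 + q.2 * (q.1.2 - q.1.1))))
    have hmH : ∀ t u, m (t, u) = (u - t) * H (t, u) := by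
      intro t u
      have h0 : m (t, t) = 0 := by
        have : QQ B i (t, t) = deriv (B.curve i) t := by simp [QQ]
        simp only [hm, this]
        rw [← Tn_mul B i t]; simp only [map_mul, conj_ofReal]; ring
      have := hadamard (f := fun u => m (t, u)) (f' := fun u => fderiv ℝ m (t, u) (0, 1)) (fun v => by
        have h1 := (hms.differentiable (by simp) (t, v)).hasFDerivAt
        exact h1.comp_hasDerivAt v ((hasDerivAt_const v t).prodMk (hasDerivAt_id v)))
        (hfd.continuous.comp (by fun_prop)) t u
      simpa [h0] using this
    refine ⟨fun p => H p / (QQ B i p * (starRingEnd ℂ) (QQ B i p)) / (2 * Real.pi), fun p hp => ?_, fun t u h hne => ?_⟩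
    · have hq : QQ B i p ≠ 0 := QQ_ne B i hp
      exact (cdiv (hHs.of_le hle).contDiffAt ((hQ.mul (hconj.comp hQ)).of_le hle).contDiffAt
        (mul_ne_zero hq ((map_ne_zero _).2 hq))).div_const _
    · have hq : QQ B i (t, u) ≠ 0 := QQ_ne B i h
      have hq' : (starRingEnd ℂ) (QQ B i (t, u)) ≠ 0 := (map_ne_zero _).2 hq
      have htu : (u - t : ℂ) ≠ 0 := by
        intro h0
        apply hne
        have : u = t := by exact_mod_cast sub_eq_zero.1 h0
        rw [this]
      have hmm := hmH t u
      simp only [hm] at hmm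
      simp only [kk, QQ_mul, map_div₀, map_mul, map_sub, conj_ofReal]
      congr 1
      rw [div_sub_div _ _ (mul_ne_zero htu hq) (mul_ne_zero htu hq'), div_eq_div_iff (by positivity) (by positivity)]
      linear_combination (u - t : ℂ) * QQ B i (t, u) * (starRingEnd ℂ) (QQ B i (t, u)) * hmm
  · refine ⟨fun p => kk B (i, p.1) (j, p.2), fun p _ => ?_, fun _ _ _ _ => rfl⟩
    have hd : ContDiff ℝ (⊤ : ℕ∞) fun p : ℝ × ℝ => B.curve j p.2 - B.curve i p.1 :=
      ((B.smooth j).comp contDiff_snd).sub ((B.smooth i).comp contDiff_fst)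
    have hne : ∀ p : ℝ × ℝ, B.curve j p.2 - B.curve i p.1 ≠ 0 := fun p h =>
      hij (cv_eq B (sub_eq_zero.1 h)).1.symm
    have h1 : ContDiff ℝ (⊤ : ℕ∞) fun p : ℝ × ℝ => Tn B j p.2 / (B.curve j p.2 - B.curve i p.1) :=
      contDiff_iff_contDiffAt.2 fun p => cdiv ((Tn_smooth B j).comp contDiff_snd).contDiffAt hd.contDiffAt (hne p)
    have h2 : ContDiff ℝ (⊤ : ℕ∞) fun p : ℝ × ℝ => Tn B i p.1 / (B.curve j p.2 - B.curve i p.1) :=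
      contDiff_iff_contDiffAt.2 fun p => cdiv ((Tn_smooth B i).comp contDiff_fst).contDiffAt hd.contDiffAt (hne p)
    exact (((h1.sub (hconj.comp h2)).div_const _).of_le hle).contDiffAt

lemma kk_lip : ∃ M : ℝ, 0 ≤ M ∧ (∀ x y, ‖kk B x y‖ ≤ M) ∧ ∀ i j t t' u, B.curve i t ≠ B.curve j u →
    B.curve i t' ≠ B.curve j u → ‖kk B (i, t) (j, u) - kk B (i, t') (j, u)‖ ≤ M * |t - t'| := by
  choose F hF1 hF2 using kk_model B
  choose C hC using fun i j => lipK (hF1 i j)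
  obtain ⟨D, hD0, hD⟩ : ∃ D, 0 ≤ D ∧ ∀ i j, C i j ≤ D := by
    refine ⟨∑ i, ∑ j, |C i j|, by positivity, fun i j => (le_abs_self _).trans ?_⟩
    exact (Finset.single_le_sum (f := fun j => |C i j|) (fun _ _ => abs_nonneg _) (Finset.mem_univ j)).trans
      (Finset.single_le_sum (f := fun i => ∑ j, |C i j|) (fun _ _ => by positivity) (Finset.mem_univ i))
  have red : ∀ t u : ℝ, ∃ k l : ℤ, t + k ∈ Icc (0:ℝ) 1 ∧ |u + l - (t + k)| ≤ 1 / 2 := fun t u => by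
    refine ⟨-⌊t⌋, round ((t + (-⌊t⌋ : ℤ)) - u), ⟨?_, ?_⟩, ?_⟩
    · push_cast; linarith [Int.floor_le t]
    · push_cast; linarith [Int.lt_floor_add_one t]
    · have := abs_sub_round ((t + (-⌊t⌋ : ℤ)) - u)
      rw [abs_sub_comm] at this
      rwa [show ∀ a b c : ℝ, a + b - c = b - (c - a) from fun _ _ _ => by ring]
  have hb : ∀ i j t u, ‖kk B (i, t) (j, u)‖ ≤ D := by
    intro i j t u
    obtain ⟨k, l, h1, h2⟩ := red t u
    rw [← kk_per1 B i j t u k, ← kk_per2 B i j _ u l]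
    by_cases hne : B.curve i (t + k) = B.curve j (u + l)
    · simpa [kk, hne] using hD0
    · rw [hF2 i j _ _ (by linarith) hne]
      have h3 : t + k ∈ Icc (-2:ℝ) 3 := ⟨by linarith [h1.1], by linarith [h1.2]⟩
      exact ((hC i j _ _ _ h3 h3 (by linarith) (by linarith)).1).trans (hD i j)
  refine ⟨8 * D, by positivity, fun x y => (hb _ _ _ _).trans (by linarith), fun i j t t' u hne hne' => ?_⟩
  by_cases hs : |t - t'| ≤ 1 / 4
  · obtain ⟨k, l, h1, h2⟩ := red t u
    rw [← kk_per1 B i j t u k, ← kk_per2 B i j _ u l, ← kk_per1 B i j t' u k, ← kk_per2 B i j (t' + k) u l]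
    have h3 : t + k ∈ Icc (-2:ℝ) 3 := ⟨by linarith [h1.1], by linarith [h1.2]⟩
    have hs' := abs_le.1 hs
    have h4 : t' + k ∈ Icc (-2:ℝ) 3 := ⟨by linarith [h1.1], by linarith [h1.2]⟩
    have h2' := abs_le.1 h2
    have h5 : |u + l - (t' + k)| ≤ 3 / 4 := abs_le.2 ⟨by linarith, by linarith⟩
    rw [hF2 i j _ _ (by linarith) (by rwa [per_int, per_int]), hF2 i j _ _ (by linarith) (by rwa [per_int, per_int])]
    refine ((hC i j _ _ _ h3 h4 (by linarith) h5).2).trans ?_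
    rw [add_sub_add_right_eq_sub]
    exact mul_le_mul_of_nonneg_right (by linarith [hD i j]) (abs_nonneg _)
  · push Not at hs
    refine (norm_sub_le _ _).trans ?_
    nlinarith [hb i j t u, hb i j t' u]

end ACap

namespace ACap

variable {K : Set ℂ} (B : SmoothBoundary K)

/-- one component of arc length -/
def arcI (i : Fin B.n) : Measure (Fin B.n × ℝ) :=
  Measure.map (Prod.mk i) ((volume.restrict (Ioc 0 1)).withDensity fun t => (‖deriv (B.curve i) t‖₊ : ENNReal))

instance (i : Fin B.n) : IsFiniteMeasure (arcI B i) := by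
  have h : HasFiniteIntegral (deriv (B.curve i)) (volume.restrict (Ioc 0 1)) :=
    ((cv_dcont B i).integrableOn_Icc.mono_set Ioc_subset_Icc_self).2
  have := isFiniteMeasure_withDensity (μ := volume.restrict (Ioc (0:ℝ) 1))
    (f := fun t => (‖deriv (B.curve i) t‖₊ : ENNReal)) h.ne
  exact Measure.isFiniteMeasure_map _ _

lemma arcI_int (i : Fin B.n) (f : Fin B.n × ℝ → ℂ) :
    ∫ y, f y ∂(arcI B i) = ∫ t in (0:ℝ)..1, f (i, t) * ‖deriv (B.curve i) t‖ := by
  rw [arcI, (measurableEmbedding_prodMk_left i).integral_map,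
    integral_withDensity_eq_integral_smul (cv_dcont B i).measurable.nnnorm,
    intervalIntegral.integral_of_le zero_le_one]
  refine integral_congr_ae (ae_of_all _ fun t => ?_)
  simp only [NNReal.smul_def, real_smul, coe_nnnorm]; ring

lemma arcI_null (i : Fin B.n) (p : ℂ) : ∀ᵐ y ∂(arcI B i), p ≠ B.curve y.1 y.2 := by
  rw [arcI, (measurableEmbedding_prodMk_left i).ae_map_iff]
  refine (withDensity_absolutelyContinuous _ _).ae_le (ae_restrict_of_ae ?_)
  by_cases h : ∃ t, p = B.curve i t
  · obtain ⟨t, rfl⟩ := h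
    have hc : (range fun k : ℤ => t + (k:ℝ)).Countable := countable_range _
    filter_upwards [hc.ae_notMem volume] with u hu h
    obtain ⟨-, k, hk⟩ := cv_eq B h
    exact hu ⟨-k, by simp [hk]⟩
  · exact ae_of_all _ fun t ht => h ⟨t, ht⟩

lemma ks_solve : ∃ (S : Fin B.n → ℝ → ℂ) (Λ : ℝ), (∀ i t t', ‖S i t - S i t'‖ ≤ Λ * |t - t'|) ∧
    (∀ i t (k : ℤ), S i (t + k) = S i t) ∧
    ∀ i t, S i t = 1 + I * ∑ j, ∫ u in (0:ℝ)..1, kk B (i, t) (j, u) * S j u * ‖deriv (B.curve j) u‖ := by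
  obtain ⟨M, hM0, hM, hMl⟩ := kk_lip B
  obtain ⟨s, hs, he⟩ := fredholm (μ := ∑ i, arcI B i) (kk_meas B) hM (kk_sym B)
  have hki : ∀ x, Integrable (fun y => kk B x y * s y) (∑ i, arcI B i) := fun x =>
    hs.bdd_mul ((kk_meas B).comp measurable_prodMk_left).aestronglyMeasurable (ae_of_all _ (hM x))
  refine ⟨fun i t => s (i, t), M * ∫ y, ‖s y‖ ∂(∑ i, arcI B i), fun i t t' => ?_, fun i t k => ?_, fun i t => ?_⟩
  · beta_reduce
    rw [he (i, t), he (i, t'), add_sub_add_left_eq_sub, ← mul_sub, norm_mul, norm_I, one_mul,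
      ← integral_sub (hki _) (hki _), mul_right_comm, ← integral_const_mul]
    refine norm_integral_le_of_norm_le (hs.norm.const_mul _) ?_
    have h0 : ∀ p : ℂ, ∀ᵐ y ∂(∑ i, arcI B i), p ≠ B.curve y.1 y.2 := fun p => by
      rw [ae_iff, Measure.finsetSum_apply]
      exact Finset.sum_eq_zero fun j _ => ae_iff.1 (arcI_null B j p)
    filter_upwards [h0 (B.curve i t), h0 (B.curve i t')] with y h1 h2
    rw [← sub_mul, norm_mul]
    exact mul_le_mul_of_nonneg_right (hMl i y.1 t t' y.2 h1 h2) (norm_nonneg _)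
  · beta_reduce
    rw [he, he (i, t)]
    simp only [show ∀ y, kk B (i, t + k) y = kk B (i, t) y from fun y => kk_per1 B i y.1 t y.2 k]
  · beta_reduce
    rw [he, integral_finsetSum_measure (fun j _ => integrable_finsetSum_measure.1 (hki _) j (Finset.mem_univ j))]
    simp only [arcI_int]

/-- Lipschitz periodic data extends to a Lipschitz function on the plane. -/
lemma lip_ext {s : Fin B.n → ℝ → ℂ} {Λ : ℝ} (hl : ∀ i t t', ‖s i t - s i t'‖ ≤ Λ * |t - t'|)
    (hp : ∀ i t (k : ℤ), s i (t + k) = s i t) :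
    ∃ (f : ℂ → ℂ) (C : NNReal), LipschitzWith C f ∧ ∀ i t, f (B.curve i t) = s i t := by
  obtain ⟨c, hc, hch⟩ := chord B
  obtain ⟨d, hd, hsep⟩ := cv_sep B
  have hΛ : 0 ≤ Λ := by
    have := (norm_nonneg _).trans (hl ⟨0, B.npos⟩ 1 0)
    simpa using this
  have hb : ∃ M, 0 ≤ M ∧ ∀ i t, ‖s i t‖ ≤ M := by
    refine ⟨Λ + ∑ i, ‖s i 0‖, by positivity, fun i t => ?_⟩
    have h1 : s i t = s i (Int.fract t) := by
      conv_lhs => rw [← Int.fract_add_floor t]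
      exact hp i _ _
    have h2 := hl i (Int.fract t) 0
    rw [← h1, sub_zero, abs_of_nonneg (Int.fract_nonneg t)] at h2
    have h3 := Finset.single_le_sum (f := fun i => ‖s i 0‖) (fun _ _ => norm_nonneg _) (Finset.mem_univ i)
    have h4 := norm_sub_norm_le (s i t) (s i 0)
    nlinarith [Int.fract_lt_one t]
  obtain ⟨M, hM0, hM⟩ := hb
  have key : ∀ i j t u, ‖s i t - s j u‖ ≤ (2 * M / d + Λ / c) * ‖B.curve i t - B.curve j u‖ := by
    intro i j t u
    rw [add_mul]
    by_cases hij : i = j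
    · subst hij
      set u' := u + (round (t - u) : ℤ) with hu'
      have h1 : |u' - t| ≤ 1 / 2 := by
        have := abs_sub_round (t - u)
        rw [abs_sub_comm] at this
        rwa [hu', show ∀ a b c : ℝ, a + b - c = b - (c - a) from fun _ _ _ => by ring]
      have h2 := hch i t u' (by linarith)
      have h3 := hl i u' t
      rw [hu', hp, ← hu', norm_sub_rev] at h3
      rw [hu', per_int, ← hu', norm_sub_rev] at h2
      have h4 : Λ * |u' - t| ≤ Λ / c * ‖B.curve i t - B.curve i u‖ := by
        rw [div_mul_eq_mul_div, le_div_iff₀ hc, mul_assoc]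
        exact mul_le_mul_of_nonneg_left (by linarith) hΛ
      have : 0 ≤ 2 * M / d * ‖B.curve i t - B.curve i u‖ := by positivity
      linarith
    · have h1 := hsep i j hij t u
      have h2 : 2 * M ≤ 2 * M / d * ‖B.curve i t - B.curve j u‖ := by
        rw [div_mul_eq_mul_div, le_div_iff₀ hd]
        exact mul_le_mul_of_nonneg_left h1 (by linarith)
      have : 0 ≤ Λ / c * ‖B.curve i t - B.curve j u‖ := by positivity
      linarith [norm_sub_le (s i t) (s j u), hM i t, hM j u]
  have hex : ∀ z : ℂ, ∃ q : Fin B.n × ℝ, z ∈ frontier K → B.curve q.1 q.2 = z := by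
    intro z
    by_cases hz : z ∈ frontier K
    · rw [← B.boundary] at hz
      obtain ⟨i, t, ht⟩ := mem_iUnion.1 hz
      exact ⟨(i, t), fun _ => ht⟩
    · exact ⟨(⟨0, B.npos⟩, 0), fun h => absurd h hz⟩
  choose q hq using hex
  have hL : LipschitzOnWith ⟨2 * M / d + Λ / c, by positivity⟩ (fun z => s (q z).1 (q z).2) (frontier K) := by
    refine LipschitzOnWith.of_dist_le_mul fun z hz w hw => ?_
    have := key (q z).1 (q w).1 (q z).2 (q w).2
    rwa [hq z hz, hq w hw, ← dist_eq_norm, ← dist_eq_norm] at this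
  obtain ⟨f, hf, hfe⟩ := hL.extend_finite_dimension
  refine ⟨f, _, hf, fun i t => ?_⟩
  rw [← hfe (cv_mem B i t)]
  have := key (q (B.curve i t)).1 i (q (B.curve i t)).2 t
  rw [hq _ (cv_mem B i t), sub_self, norm_zero, mul_zero] at this
  exact sub_eq_zero.1 (norm_le_zero_iff.1 this)

end ACap

namespace ACap

variable {K : Set ℂ} (B : SmoothBoundary K)

/-- regularized Cauchy integral -/
def Gs (s : ℂ → ℂ) (a : ℂ) : ℂ :=
  ∑ j, ∫ u in (0:ℝ)..1, (s (B.curve j u) - s a) * deriv (B.curve j) u / (B.curve j u - a)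

/-- Cauchy integral -/
def Cs (s : ℂ → ℂ) (a : ℂ) : ℂ :=
  ∑ j, ∫ u in (0:ℝ)..1, s (B.curve j u) * deriv (B.curve j) u / (B.curve j u - a)

lemma ii_of_bdd {f : ℝ → ℂ} (hf : Measurable f) {M : ℝ} (hM : ∀ t, ‖f t‖ ≤ M) (a b : ℝ) :
    IntervalIntegrable f volume a b :=
  (intervalIntegrable_const (c := M)).mono_fun hf.aestronglyMeasurable
    (ae_of_all _ fun t => (hM t).trans (Real.norm_eq_abs M ▸ le_abs_self M))

variable {s : ℂ → ℂ} {C : NNReal}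

lemma Gs_bound {M : ℝ} (hM : ∀ j t, ‖deriv (B.curve j) t‖ ≤ M) (hs : LipschitzWith C s) (j : Fin B.n) (a : ℂ) (u : ℝ) :
    ‖(s (B.curve j u) - s a) * deriv (B.curve j) u / (B.curve j u - a)‖ ≤ C * M := by
  rw [norm_div, norm_mul]
  refine div_le_of_le_mul₀ (norm_nonneg _) (mul_nonneg C.2 ((norm_nonneg _).trans (hM j u))) ?_
  have h1 := hs.dist_le_mul (B.curve j u) a
  rw [dist_eq_norm, dist_eq_norm] at h1
  calc _ ≤ (C * ‖B.curve j u - a‖) * M := mul_le_mul h1 (hM j u) (norm_nonneg _) (by positivity)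
    _ = _ := by ring

lemma Gs_meas (hs : Continuous s) (j : Fin B.n) (a : ℂ) :
    Measurable fun u => (s (B.curve j u) - s a) * deriv (B.curve j) u / (B.curve j u - a) :=
  (((hs.comp (cv_cont B j)).measurable.sub_const _).mul (cv_dcont B j).measurable).div
    ((cv_cont B j).measurable.sub_const _)

lemma Gs_cont (hs : LipschitzWith C s) : Continuous (Gs B s) := by
  obtain ⟨M, -, hM⟩ := cv_bounds B
  refine continuous_iff_continuousAt.2 fun a => tendsto_finsetSum _ fun j _ => ?_
  refine intervalIntegral.tendsto_integral_filter_of_dominated_convergence (fun _ => C * M)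
    (Eventually.of_forall fun z => (Gs_meas B hs.continuous j z).aestronglyMeasurable)
    (Eventually.of_forall fun z => ae_of_all _ fun u _ => Gs_bound B (fun j t => (hM j t).1) hs j z u)
    intervalIntegrable_const ?_
  have hn : ∀ᵐ u : ℝ, B.curve j u ≠ a := by
    by_cases h : ∃ t, B.curve j t = a
    · obtain ⟨t, rfl⟩ := h
      have hc : (range fun k : ℤ => t + (k:ℝ)).Countable := countable_range _
      filter_upwards [hc.ae_notMem volume] with u hu h
      obtain ⟨-, k, hk⟩ := cv_eq B h
      exact hu ⟨k, hk.symm⟩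
    · exact ae_of_all _ fun t ht => h ⟨t, ht⟩
  filter_upwards [hn] with u hu _
  exact ((tendsto_const_nhds.sub hs.continuous.continuousAt).mul_const _).div
    (tendsto_const_nhds.sub tendsto_id) (sub_ne_zero.2 hu)

lemma curve_ne {a : ℂ} (ha : a ∉ frontier K) (j : Fin B.n) (u : ℝ) : B.curve j u ≠ a :=
  fun h => ha (h ▸ cv_mem B j u)

lemma Gs_eq (hs : Continuous s) {a : ℂ} (ha : a ∉ frontier K) : Gs B s a = Cs B s a - s a * Wn B a := by
  rw [Gs, Cs, Wn, Finset.mul_sum, ← Finset.sum_sub_distrib]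
  refine Finset.sum_congr rfl fun j _ => ?_
  have hne := fun u => sub_ne_zero.2 (curve_ne B ha j u)
  have hc1 : Continuous fun u => s (B.curve j u) * deriv (B.curve j) u / (B.curve j u - a) :=
    ((hs.comp (cv_cont B j)).mul (cv_dcont B j)).div ((cv_cont B j).sub continuous_const) hne
  have hc2 : Continuous fun u => s a * (deriv (B.curve j) u / (B.curve j u - a)) :=
    continuous_const.mul ((cv_dcont B j).div ((cv_cont B j).sub continuous_const) hne)
  rw [← intervalIntegral.integral_const_mul, ← intervalIntegral.integral_sub
    (hc1.intervalIntegrable _ _) (hc2.intervalIntegrable _ _)]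
  congr 1; ext u; ring

lemma Cs_diff (hs : Continuous s) {a : ℂ} (ha : a ∉ frontier K) : DifferentiableAt ℂ (Cs B s) a := by
  refine DifferentiableAt.fun_sum fun j _ => ?_
  exact (cauchyInt_hasDerivAt ((hs.comp (cv_cont B j)).mul (cv_dcont B j)) (cv_cont B j)
    fun u _ => curve_ne B ha j u).differentiableAt

lemma Cs_tendsto (hs : Continuous s) : Tendsto (fun z => z * Cs B s z) (cobounded ℂ)
    (𝓝 (-contourIntegralOf B.curve s)) := by
  simp only [Cs, contourIntegralOf, Finset.mul_sum, ← Finset.sum_neg_distrib]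
  exact tendsto_finsetSum _ fun j _ => cauchyInt_tendsto_mul (a := 0) (b := 1)
    ((hs.comp (cv_cont B j)).mul (cv_dcont B j)) (cv_cont B j)

lemma Gs_out (hK : IsCompact K) (hconn : IsConnected Kᶜ) (hs : Continuous s) {a : ℂ} (ha : a ∈ Kᶜ) :
    Gs B s a = Cs B s a := by
  rw [Gs_eq B hs (compl_notMem_frontier hK ha), Wn_compl B hK hconn ha, mul_zero, sub_zero]

lemma Gs_in (hs : Continuous s) {a : ℂ} (ha : a ∈ interior K) :
    Gs B s a = Cs B s a - s a * (2 * Real.pi * I) := by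
  rw [Gs_eq B hs (int_notMem_frontier ha), Wn, B.orientation a ha]

lemma Gs_out_diff (hK : IsCompact K) (hconn : IsConnected Kᶜ) (hs : Continuous s) :
    DifferentiableOn ℂ (Gs B s) Kᶜ := by
  refine DifferentiableOn.congr (f := Cs B s) (fun a ha => ?_) fun a ha => Gs_out B hK hconn hs ha
  exact (Cs_diff B hs (compl_notMem_frontier hK ha)).differentiableWithinAt

lemma Gs_in_diff (hs : Continuous s) :
    DifferentiableOn ℂ (fun a => Gs B s a + s a * (2 * Real.pi * I)) (interior K) := by
  refine DifferentiableOn.congr (f := Cs B s) (fun a ha => ?_) fun a ha => ?_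
  · exact (Cs_diff B hs (int_notMem_frontier ha)).differentiableWithinAt
  · rw [Gs_in B hs ha]; ring

lemma Gs_tendsto (hK : IsCompact K) (hconn : IsConnected Kᶜ) (hs : Continuous s) :
    Tendsto (fun z => z * Gs B s z) (cobounded ℂ) (𝓝 (-contourIntegralOf B.curve s)) := by
  refine (Cs_tendsto B hs).congr' ?_
  have : Kᶜ ∈ cobounded ℂ := by rw [Metric.cobounded_eq_cocompact]; exact hK.compl_mem_cocompact
  filter_upwards [this] with z hz
  rw [Gs_out B hK hconn hs hz]

/-- principal value identity -/
lemma pv (hK : IsCompact K) (hconn : IsConnected Kᶜ) {S L : ℂ → ℂ} {C' : NNReal} (hS : LipschitzWith C S)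
    (hL : LipschitzWith C' L)
    (hLS : ∀ i t, L (B.curve i t) = I * (starRingEnd ℂ) (S (B.curve i t) * Tn B i t)) (j : Fin B.n) (t0 : ℝ) :
    2 * Real.pi * ∑ i, ∫ u in (0:ℝ)..1, kk B (j, t0) (i, u) * S (B.curve i u) * ‖deriv (B.curve i) u‖ =
      Gs B S (B.curve j t0) - I * (starRingEnd ℂ) (Tn B j t0) * (starRingEnd ℂ) (Gs B L (B.curve j t0)) +
        2 * Real.pi * I * S (B.curve j t0) := by
  obtain ⟨M, hM0, hM⟩ := cv_bounds B
  obtain ⟨D, hD0, hD, -⟩ := kk_lip B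
  set p := B.curve j t0 with hp
  set κ := I * (starRingEnd ℂ) (Tn B j t0) with hκ
  set f1 : Fin B.n → ℝ → ℂ := fun i u => kk B (j, t0) (i, u) * S (B.curve i u) * ‖deriv (B.curve i) u‖ with hf1
  set f2 : Fin B.n → ℝ → ℂ := fun i u => (S (B.curve i u) - S p) * deriv (B.curve i) u / (B.curve i u - p) with hf2
  set f3 : Fin B.n → ℝ → ℂ := fun i u => (L (B.curve i u) - L p) * deriv (B.curve i) u / (B.curve i u - p) with hf3
  set φ : Fin B.n → ℝ → ℂ := fun i u => 2 * Real.pi * f1 i u - f2 i u + κ * (starRingEnd ℂ) (f3 i u) with hφ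
  have hI1 : ∀ i a b, IntervalIntegrable (f1 i) volume a b := fun i a b => by
    obtain ⟨E, hE⟩ := per_bound (hS.continuous.comp (cv_cont B i)) (fun t => by simp [B.periodic i t])
    refine ii_of_bdd ?_ (M := D * E * M) (fun u => ?_) a b
    · exact (((kk_meas B).comp (measurable_prodMk_left (x := (j, t0)))).comp (measurable_prodMk_left (x := i)) |>.mul
        (hS.continuous.comp (cv_cont B i)).measurable).mul (continuous_ofReal.comp (cv_dcont B i).norm).measurable
    · rw [norm_mul, norm_mul, norm_real, norm_norm]
      have h0 := (norm_nonneg _).trans (hE u)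
      have h1 := hE u
      have h2 := hD (j, t0) (i, u)
      have h3 := (hM i u).1
      simp only [Function.comp] at h1
      gcongr
  have hI2 : ∀ i a b, IntervalIntegrable (f2 i) volume a b := fun i =>
    ii_of_bdd (Gs_meas B hS.continuous i p) (Gs_bound B (fun j t => (hM j t).1) hS i p)
  have hI3 : ∀ i a b, IntervalIntegrable (fun u => (starRingEnd ℂ) (f3 i u)) volume a b := fun i =>
    ii_of_bdd (continuous_conj.measurable.comp (Gs_meas B hL.continuous i p))
      fun u => by rw [RCLike.norm_conj]; exact Gs_bound B (fun j t => (hM j t).1) hL i p u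
  have hIφ : ∀ i a b, IntervalIntegrable (φ i) volume a b := fun i a b =>
    (((hI1 i a b).const_mul _).sub (hI2 i a b)).add ((hI3 i a b).const_mul _)
  have hφe : ∀ i u, φ i u = S p * (deriv (B.curve i) u / (B.curve i u - p) -
      (starRingEnd ℂ) (deriv (B.curve i) u / (B.curve i u - p))) := by
    intro i u
    have hT := Tn_conj B i u
    have hT0 := Tn_conj B j t0
    have hd := Tn_mul B i u
    have hpi : (Real.pi : ℂ) ≠ 0 := ofReal_ne_zero.2 Real.pi_ne_zero
    simp only [hφ, hf1, hf2, hf3, kk, hκ, ← hp, hLS]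
    generalize ‖deriv (B.curve i) u‖ = w at hd ⊢
    rw [hp, hLS j t0, ← hp, ← hd]
    simp only [map_mul, map_sub, map_div₀, conj_ofReal, conj_conj, conj_I]
    generalize Tn B i u = T at *
    generalize Tn B j t0 = T0 at *
    generalize (starRingEnd ℂ) T = Tc at *
    generalize (starRingEnd ℂ) T0 = T0c at *
    simp only [div_eq_mul_inv, mul_inv]
    generalize (B.curve i u - p)⁻¹ = d
    generalize ((starRingEnd ℂ) (B.curve i u) - (starRingEnd ℂ) p)⁻¹ = dc
    have : (2:ℂ) * Real.pi * (2⁻¹ * (Real.pi : ℂ)⁻¹) = 1 := by field_simp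
    linear_combination (T * d - T0c * dc) * S (B.curve i u) * w * this
      + T0c * dc * w * S (B.curve i u) * hT - Tc * dc * w * S p * hT0
      + T0c * (Tc * w * dc) * (S p * T0 - S (B.curve i u) * T) * I_sq
  have hlim1 : Tendsto (fun η : ℝ => S p * (Far B j t0 η p - (starRingEnd ℂ) (Far B j t0 η p))) (𝓝[>] 0)
      (𝓝 (S p * (Real.pi * I - (starRingEnd ℂ) (Real.pi * I)))) := by
    have h := far_tendsto B hK hconn j t0
    exact (h.sub ((continuous_conj.tendsto _).comp h)).const_mul _
  have hlim2 : Tendsto (fun η : ℝ => ∑ i ∈ Finset.univ.erase j, (∫ u in (0:ℝ)..1, φ i u) +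
      ∫ u in (t0 + η)..(t0 + 1 - η), φ j u) (𝓝[>] 0)
      (𝓝 (∑ i ∈ Finset.univ.erase j, (∫ u in (0:ℝ)..1, φ i u) + ∫ u in t0..(t0 + 1), φ j u)) := by
    refine tendsto_const_nhds.add ?_
    have hc := intervalIntegral.continuous_primitive (hIφ j) 0
    have h1 : Continuous fun η : ℝ => (∫ u in (0:ℝ)..(t0 + 1 - η), φ j u) - ∫ u in (0:ℝ)..(t0 + η), φ j u :=
      (hc.comp (by fun_prop)).sub (hc.comp (by fun_prop))
    have h2 : ∀ a b : ℝ, (∫ u in (0:ℝ)..b, φ j u) - (∫ u in (0:ℝ)..a, φ j u) = ∫ u in a..b, φ j u := fun a b =>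
      intervalIntegral.integral_interval_sub_left (hIφ j _ _) (hIφ j _ _)
    have h3 := h1.tendsto 0
    simp only [h2, sub_zero, add_zero] at h3
    exact h3.mono_left nhdsWithin_le_nhds
  have hper : ∫ u in t0..(t0 + 1), φ j u = ∫ u in (0:ℝ)..1, φ j u := by
    have : Function.Periodic (φ j) 1 := fun u => by
      rw [hφe, hφe, B.periodic j u, cv_dper B j u]
    simpa using this.intervalIntegral_add_eq t0 0
  have hFar : ∀ᶠ η in 𝓝[>] (0:ℝ), S p * (Far B j t0 η p - (starRingEnd ℂ) (Far B j t0 η p)) =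
      ∑ i ∈ Finset.univ.erase j, (∫ u in (0:ℝ)..1, φ i u) + ∫ u in (t0 + η)..(t0 + 1 - η), φ j u := by
    filter_upwards [Ioo_mem_nhdsGT (show (0:ℝ) < 1 / 2 by norm_num)] with η hη
    have hsplit : ∀ (i : Fin B.n) (a b : ℝ), (∀ u ∈ uIcc a b, B.curve i u ≠ p) →
        ∫ u in a..b, φ i u = S p * ((∫ u in a..b, deriv (B.curve i) u / (B.curve i u - p)) -
          (starRingEnd ℂ) (∫ u in a..b, deriv (B.curve i) u / (B.curve i u - p))) := by
      intro i a b hne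
      have h1 : ContinuousOn (fun u => deriv (B.curve i) u / (B.curve i u - p)) (uIcc a b) :=
        (cv_dcont B i).continuousOn.div ((cv_cont B i).sub continuous_const).continuousOn
          fun u hu => sub_ne_zero.2 (hne u hu)
      have h2 : ContinuousOn (fun u => (starRingEnd ℂ) (deriv (B.curve i) u / (B.curve i u - p))) (uIcc a b) :=
        continuous_conj.comp_continuousOn h1
      rw [← intervalIntegral.intervalIntegral_conj, ← intervalIntegral.integral_sub h1.intervalIntegrable h2.intervalIntegrable,
        ← intervalIntegral.integral_const_mul]
      simp only [hφe]
    rw [Far, hsplit j _ _ fun u hu => ?_, Finset.sum_congr rfl fun i hi => hsplit i 0 1 fun u _ => ?_,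
      ← Finset.mul_sum, ← mul_add, Finset.sum_sub_distrib, map_add, map_sum]
    · ring
    · exact other_ne B (Finset.ne_of_mem_erase hi) u t0
    · exact far_ne B hη.1 hη.2 hu
  have hfin := tendsto_nhds_unique (hlim1.congr' hFar) hlim2
  rw [hper, Finset.sum_erase_add _ _ (Finset.mem_univ j)] at hfin
  have hsum : ∑ i, ∫ u in (0:ℝ)..1, φ i u = 2 * Real.pi * (∑ i, ∫ u in (0:ℝ)..1, f1 i u) - Gs B S p +
      κ * (starRingEnd ℂ) (Gs B L p) := by
    rw [Gs, Gs, map_sum, Finset.mul_sum, Finset.mul_sum, ← Finset.sum_sub_distrib, ← Finset.sum_add_distrib]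
    refine Finset.sum_congr rfl fun i _ => ?_
    rw [← intervalIntegral.intervalIntegral_conj, ← intervalIntegral.integral_const_mul, ← intervalIntegral.integral_const_mul,
      ← intervalIntegral.integral_sub ((hI1 i _ _).const_mul _) (hI2 i _ _),
      ← intervalIntegral.integral_add (((hI1 i _ _).const_mul _).sub (hI2 i _ _)) ((hI3 i _ _).const_mul _)]
  rw [hsum, map_mul, conj_ofReal, conj_I] at hfin
  linear_combination -hfin

end ACap

namespace ACap

/-- The ring system `R` is `ε`-close to the boundary parametrization `B`. -/
def Close {K : Set ℂ} (B : SmoothBoundary K) (ε : ℝ) (R : RingSys K) (e : Fin R.n ≃ Fin B.n) : Prop :=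
  ∀ (j : Fin R.n) (t r : ℝ), R.r0 ≤ r → r ≤ R.r1 →
    ‖R.Z j (circleMap 0 r (2 * Real.pi * t)) - B.curve (e j) t‖ ≤ ε ∧
    ‖2 * Real.pi * I * (circleMap 0 r (2 * Real.pi * t) *
      deriv (R.Z j) (circleMap 0 r (2 * Real.pi * t))) - deriv (B.curve (e j)) t‖ ≤ ε

section
variable {K : Set ℂ} (B : SmoothBoundary K) {E : Type*} [NormedAddCommGroup E] [NormedSpace ℝ E]

lemma ring_Zc (R : RingSys K) (j : Fin R.n) {r : ℝ} (h0 : R.r0 ≤ r) (h1 : r ≤ R.r1) :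
    Continuous (fun t : ℝ => R.Z j (circleMap 0 r (2 * Real.pi * t))) ∧
    Continuous (fun t : ℝ => 2 * Real.pi * I * (circleMap 0 r (2 * Real.pi * t) *
      deriv (R.Z j) (circleMap 0 r (2 * Real.pi * t)))) := by
  have hr : 0 < r := R.h0.trans_le h0
  have hc : Continuous fun t : ℝ => 2 * Real.pi * t := by fun_prop
  have e1 := (RingSys.cont_circle hr (R.continuousOn_Z j (R.sphere_sub h0 h1))).comp hc
  have e2 := (RingSys.cont_circle hr (R.continuousOn_dZ j (R.sphere_sub h0 h1))).comp hc
  exact ⟨e1, continuous_const.mul (((continuous_circleMap 0 r).comp hc).mul e2)⟩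

lemma ring_lim (hK : IsCompact K) {Φ : ℂ → ℂ → E} (hΦ : Continuous fun p : ℂ × ℂ => Φ p.1 p.2)
    {η : ℝ} (hη : 0 < η) :
    ∃ ε > 0, ∀ (R : RingSys K) (e : Fin R.n ≃ Fin B.n), Close B ε R e → ∀ r, R.r0 ≤ r → r ≤ R.r1 →
      ‖(∑ j, ∫ t in (0:ℝ)..1, Φ (R.Z j (circleMap 0 r (2 * Real.pi * t)))
        (2 * Real.pi * I * (circleMap 0 r (2 * Real.pi * t) *
          deriv (R.Z j) (circleMap 0 r (2 * Real.pi * t))))) -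
        ∑ i, ∫ t in (0:ℝ)..1, Φ (B.curve i t) (deriv (B.curve i) t)‖ ≤ η := by
  obtain ⟨M, hM, hb⟩ := cv_bounds B
  obtain ⟨M', hM'⟩ := hK.isBounded.exists_norm_le
  have hmem : ∀ i t, (B.curve i t, deriv (B.curve i) t) ∈ closedBall (0 : ℂ × ℂ) (max M M') := by
    intro i t
    rw [mem_closedBall_zero_iff, Prod.norm_def]
    exact max_le ((hM' _ (hK.isClosed.frontier_subset (cv_mem B i t))).trans (le_max_right _ _))
      ((hb i t).1.trans (le_max_left _ _))
  have huc := (isCompact_closedBall (0 : ℂ × ℂ) (max M M' + 1)).uniformContinuousOn_of_continuous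
    hΦ.continuousOn
  have hn : (0:ℝ) < B.n := by exact_mod_cast B.npos
  obtain ⟨δ, hδ, H⟩ := Metric.uniformContinuousOn_iff.1 huc (η / B.n) (by positivity)
  refine ⟨min (δ / 2) 1, by positivity, fun R e hC r h0 h1 => ?_⟩
  rw [← e.sum_comp, ← Finset.sum_sub_distrib]
  have key : ∀ j ∈ (Finset.univ : Finset (Fin R.n)), ‖(∫ t in (0:ℝ)..1, Φ (R.Z j (circleMap 0 r (2 * Real.pi * t)))
        (2 * Real.pi * I * (circleMap 0 r (2 * Real.pi * t) *
          deriv (R.Z j) (circleMap 0 r (2 * Real.pi * t))))) -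
        ∫ t in (0:ℝ)..1, Φ (B.curve (e j) t) (deriv (B.curve (e j)) t)‖ ≤ η / B.n := by
    intro j _
    obtain ⟨c1, c2⟩ := ring_Zc R j h0 h1
    have d1 : Continuous fun t => Φ (R.Z j (circleMap 0 r (2 * Real.pi * t)))
        (2 * Real.pi * I * (circleMap 0 r (2 * Real.pi * t) *
          deriv (R.Z j) (circleMap 0 r (2 * Real.pi * t)))) := hΦ.comp (c1.prodMk c2)
    have d2 : Continuous fun t => Φ (B.curve (e j) t) (deriv (B.curve (e j)) t) :=
      hΦ.comp ((cv_cont B _).prodMk (cv_dcont B _))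
    rw [← intervalIntegral.integral_sub (d1.intervalIntegrable _ _) (d2.intervalIntegrable _ _)]
    refine (intervalIntegral.norm_integral_le_of_norm_le_const (C := η / B.n) fun t _ => ?_).trans (by simp)
    obtain ⟨a1, a2⟩ := hC j t r h0 h1
    have hd : dist (R.Z j (circleMap 0 r (2 * Real.pi * t)), 2 * Real.pi * I * (circleMap 0 r (2 * Real.pi * t) *
          deriv (R.Z j) (circleMap 0 r (2 * Real.pi * t)))) (B.curve (e j) t, deriv (B.curve (e j)) t)
          ≤ min (δ / 2) 1 := by
      rw [Prod.dist_eq, dist_eq_norm, dist_eq_norm]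
      exact max_le a1 a2
    rw [← dist_eq_norm]
    generalize R.Z j (circleMap 0 r (2 * Real.pi * t)) = a at hd ⊢
    generalize 2 * Real.pi * I * (circleMap 0 r (2 * Real.pi * t) *
          deriv (R.Z j) (circleMap 0 r (2 * Real.pi * t))) = b at hd ⊢
    refine (H (a, b) ?_ (B.curve (e j) t, deriv (B.curve (e j)) t) (closedBall_subset_closedBall (by linarith) (hmem (e j) t)) ?_).le
    · rw [mem_closedBall]
      refine (dist_triangle _ (B.curve (e j) t, deriv (B.curve (e j)) t) _).trans ?_
      rw [add_comm]
      exact add_le_add (hmem (e j) t) (hd.trans (min_le_right _ _))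
    · exact hd.trans_lt ((min_le_left _ _).trans_lt (by linarith))
  refine (norm_sum_le_of_le _ key).trans ?_
  have : (R.n : ℝ) = B.n := by
    have := Fintype.card_congr e
    simp only [Fintype.card_fin] at this
    exact_mod_cast this
  simp only [Finset.sum_const, Finset.card_univ, Fintype.card_fin, nsmul_eq_mul, this]
  exact (mul_div_cancel₀ _ hn.ne').le

lemma int_rescale (f : ℝ → E) : ∫ θ in (0:ℝ)..2 * Real.pi, f θ =
    ∫ t in (0:ℝ)..1, (2 * Real.pi) • f (2 * Real.pi * t) := by
  rw [intervalIntegral.integral_smul, intervalIntegral.smul_integral_comp_mul_left]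
  simp

lemma CI_unit (R : RingSys K) (r : ℝ) (h : ℂ → ℂ) : R.CI r (fun j w => h (R.Z j w)) =
    ∑ j, ∫ t in (0:ℝ)..1, h (R.Z j (circleMap 0 r (2 * Real.pi * t))) *
        (2 * Real.pi * I * (circleMap 0 r (2 * Real.pi * t) *
          deriv (R.Z j) (circleMap 0 r (2 * Real.pi * t)))) := by
  rw [RingSys.CI_eq, Finset.mul_sum]
  refine Finset.sum_congr rfl fun j _ => ?_
  rw [int_rescale, ← intervalIntegral.integral_const_mul]
  refine intervalIntegral.integral_congr fun t _ => ?_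
  simp only [real_smul]
  push_cast
  ring

lemma arc_unit (R : RingSys K) (r : ℝ) (h : ℂ → ℝ) :
    ∑ j, ∫ θ in (0:ℝ)..2 * Real.pi, h (R.Z j (circleMap 0 r θ)) *
      ‖circleMap 0 r θ * deriv (R.Z j) (circleMap 0 r θ)‖ =
    ∑ j, ∫ t in (0:ℝ)..1, h (R.Z j (circleMap 0 r (2 * Real.pi * t))) *
        ‖2 * Real.pi * I * (circleMap 0 r (2 * Real.pi * t) *
          deriv (R.Z j) (circleMap 0 r (2 * Real.pi * t)))‖ := by
  refine Finset.sum_congr rfl fun j _ => ?_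
  rw [int_rescale]
  refine intervalIntegral.integral_congr fun t _ => ?_
  have : ‖(2 * Real.pi * I : ℂ)‖ = 2 * Real.pi := by
    simp [abs_of_pos Real.pi_pos]
  simp only [smul_eq_mul]
  rw [norm_mul (2 * Real.pi * I : ℂ), this]
  ring

/-- If all ring contour integrals (for some radius) of a continuous `h` equal `c`, so does the
boundary integral. -/
lemma contour_of_rings (hK : IsCompact K) (hconn : IsConnected Kᶜ) {h : ℂ → ℂ} (hh : Continuous h) {c : ℂ}
    (H : ∀ R : RingSys K, ∃ r, R.r0 ≤ r ∧ r ≤ R.r1 ∧ R.CI r (fun j w => h (R.Z j w)) = c) :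
    contourIntegralOf B.curve h = c := by
  refine eq_of_norm_sub_le_zero (le_of_forall_pos_le_add fun η hη => ?_)
  obtain ⟨ε, hε, hlim⟩ := ring_lim B hK (Φ := fun z v => h z * v) (by fun_prop) hη
  obtain ⟨R, e, hC⟩ := ring_exists B hK hconn hε
  obtain ⟨r, h0, h1, hr⟩ := H R
  have := hlim R e hC r h0 h1
  rw [← CI_unit, hr] at this
  rw [norm_sub_rev, zero_add]
  exact this

lemma tube (R : RingSys K) (e : Fin R.n ≃ Fin B.n) {ε : ℝ} (hC : Close B ε R e) {z : ℂ}
    (hz : z ∈ R.AA R.r0 R.r1) : ∃ x ∈ frontier K, ‖z - x‖ ≤ ε := by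
  obtain ⟨j, w, hw, rfl⟩ := R.mem_AA.1 hz
  have hw' := ann_subset_cann _ _ hw
  have : w = circleMap 0 ‖w‖ (2 * Real.pi * (arg w / (2 * Real.pi))) := by
    rw [mul_div_cancel₀ _ (by positivity), circleMap_zero, norm_mul_exp_arg_mul_I]
  have h2 : R.r0 ≤ ‖w‖ ∧ ‖w‖ ≤ R.r1 := by
    simpa [cann] using hw'
  refine ⟨_, cv_mem B (e j) (arg w / (2 * Real.pi)), ?_⟩
  have h3 := (hC j (arg w / (2 * Real.pi)) ‖w‖ h2.1 h2.2).1
  rwa [← this] at h3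

end

end ACap

namespace ACap

section
variable {K : Set ℂ} (B : SmoothBoundary K)

lemma per_one {f : ℝ → ℂ} (h : ∀ (t : ℝ) (k : ℤ), f (t + k) = f t) : Function.Periodic f 1 := fun t => by
  simpa using h t 1

lemma Tn_norm (i : Fin B.n) (t : ℝ) : ‖Tn B i t‖ = 1 := by
  have h := congrArg norm (Tn_conj B i t)
  rw [norm_mul, RCLike.norm_conj, norm_one] at h
  nlinarith [norm_nonneg (Tn B i t)]

lemma Tn_lip (i : Fin B.n) : ∃ M : ℝ, 0 ≤ M ∧ ∀ t t' : ℝ, ‖Tn B i t - Tn B i t'‖ ≤ M * |t - t'| := by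
  have hsm := Tn_smooth B i
  have hd : Continuous (deriv (Tn B i)) := hsm.continuous_deriv (by simp)
  have hp : Function.Periodic (deriv (Tn B i)) 1 := fun t => by
    rw [← deriv_comp_add_const]
    congr 1
    exact funext (per_one (Tn_per B i))
  obtain ⟨M, hM⟩ := per_bound hd hp
  refine ⟨M, (norm_nonneg _).trans (hM 0), fun t t' => ?_⟩
  exact convex_univ.norm_image_sub_le_of_norm_deriv_le
    (fun x _ => (hsm.differentiable (by simp)).differentiableAt) (fun x _ => hM x) (mem_univ t') (mem_univ t)

lemma SL_exists : ∃ (S L : ℂ → ℂ) (C C' : NNReal), LipschitzWith C S ∧ LipschitzWith C' L ∧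
    (∀ i t, L (B.curve i t) = I * (starRingEnd ℂ) (S (B.curve i t) * Tn B i t)) ∧
    ∀ i t, S (B.curve i t) = 1 + I * ∑ j, ∫ u in (0:ℝ)..1,
      kk B (i, t) (j, u) * S (B.curve j u) * ‖deriv (B.curve j) u‖ := by
  obtain ⟨s, Λ, h1, h2, h3⟩ := ks_solve B
  obtain ⟨S, C, hS, hSs⟩ := lip_ext B h1 h2
  have hΛ : ∀ i : Fin B.n, 0 ≤ Λ := fun i => by simpa using (norm_nonneg _).trans (h1 i 1 0)
  have hsc : ∀ i, Continuous (s i) := fun i =>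
    (LipschitzWith.of_dist_le_mul (K := ⟨Λ, hΛ i⟩) fun t t' => by
      rw [dist_eq_norm, Real.dist_eq]; exact h1 i t t').continuous
  choose M hM using fun i => per_bound (hsc i) (per_one (h2 i))
  choose N hN0 hN using fun i => Tn_lip B i
  have hM0 : ∀ i, 0 ≤ M i := fun i => (norm_nonneg _).trans (hM i 0)
  have hl : ∀ (i : Fin B.n) (t t' : ℝ), ‖I * (starRingEnd ℂ) (s i t * Tn B i t) -
      I * (starRingEnd ℂ) (s i t' * Tn B i t')‖ ≤ (∑ k, (Λ + M k * N k)) * |t - t'| := by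
    intro i t t'
    rw [← mul_sub, ← map_sub, norm_mul, norm_I, one_mul, RCLike.norm_conj]
    have e : s i t * Tn B i t - s i t' * Tn B i t' =
      (s i t - s i t') * Tn B i t + s i t' * (Tn B i t - Tn B i t') := by ring
    have hle : Λ + M i * N i ≤ ∑ k, (Λ + M k * N k) :=
      Finset.single_le_sum (f := fun k => Λ + M k * N k)
        (fun k _ => add_nonneg (hΛ k) (mul_nonneg (hM0 k) (hN0 k))) (Finset.mem_univ i)
    calc _ ≤ ‖s i t - s i t'‖ * 1 + ‖s i t'‖ * ‖Tn B i t - Tn B i t'‖ := by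
          rw [e, ← Tn_norm B i t, ← norm_mul, ← norm_mul]; exact norm_add_le _ _
      _ ≤ Λ * |t - t'| * 1 + M i * (N i * |t - t'|) := by
          gcongr
          exacts [h1 i t t', hM0 i, hM i t', hN i t t']
      _ = (Λ + M i * N i) * |t - t'| := by ring
      _ ≤ _ := by gcongr
  obtain ⟨L, C', hL, hLs⟩ := lip_ext B hl fun i t k => by rw [h2, Tn_per]
  refine ⟨S, L, C, C', hS, hL, fun i t => by rw [hLs, hSs], fun i t => ?_⟩
  simp only [hSs]
  exact h3 i t

lemma arc_congr {f g : ℂ → ℝ} (h : ∀ i, ∀ t ∈ Icc (0:ℝ) 1, f (B.curve i t) = g (B.curve i t)) :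
    arcIntegralOf B.curve f = arcIntegralOf B.curve g := by
  refine Finset.sum_congr rfl fun i _ => intervalIntegral.integral_congr fun t ht => ?_
  rw [uIcc_of_le zero_le_one] at ht
  simp only [h i t ht]

lemma contour_arc {f : ℂ → ℂ} {g : ℂ → ℝ} {c : ℂ} (h : ∀ i, ∀ t ∈ Icc (0:ℝ) 1,
    f (B.curve i t) * Tn B i t = c * g (B.curve i t)) :
    contourIntegralOf B.curve f = c * arcIntegralOf B.curve g := by
  rw [contourIntegralOf, arcIntegralOf, ofReal_sum, Finset.mul_sum]
  refine Finset.sum_congr rfl fun i _ => ?_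
  rw [← intervalIntegral.integral_ofReal, ← intervalIntegral.integral_const_mul]
  refine intervalIntegral.integral_congr fun t ht => ?_
  rw [uIcc_of_le zero_le_one] at ht
  push_cast
  linear_combination (‖deriv (B.curve i) t‖ : ℂ) * h i t ht - f (B.curve i t) * Tn_mul B i t

lemma arc_zero {f : ℂ → ℝ} (hf : Continuous f) (h0 : ∀ z, 0 ≤ f z) (h : arcIntegralOf B.curve f = 0)
    (i : Fin B.n) {t : ℝ} (ht : t ∈ Icc (0:ℝ) 1) : f (B.curve i t) = 0 := by
  have hc : ∀ i, Continuous fun t => f (B.curve i t) * ‖deriv (B.curve i) t‖ := fun i =>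
    (hf.comp (cv_cont B i)).mul (cv_dcont B i).norm
  have hn : ∀ i t, 0 ≤ f (B.curve i t) * ‖deriv (B.curve i) t‖ := fun i t => mul_nonneg (h0 _) (norm_nonneg _)
  by_contra hne
  have hpos : 0 < ∫ t in (0:ℝ)..1, f (B.curve i t) * ‖deriv (B.curve i) t‖ :=
    intervalIntegral.integral_pos one_pos (hc i).continuousOn (fun x _ => hn i x)
      ⟨t, ht, mul_pos (lt_of_le_of_ne (h0 _) (Ne.symm hne)) (norm_pos_iff.2 (B.regular i t))⟩
  have := (Finset.sum_eq_zero_iff_of_nonneg (s := Finset.univ)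
    (f := fun i => ∫ t in (0:ℝ)..1, f (B.curve i t) * ‖deriv (B.curve i) t‖)
    fun i _ => intervalIntegral.integral_nonneg zero_le_one fun t _ => hn i t).1 h i (Finset.mem_univ i)
  exact hpos.ne' this

/-- Szegő and Garabedian functions. -/
lemma garabedian (hK : IsCompact K) (hconn : IsConnected Kᶜ) : ∃ (S L : ℂ → ℂ) (lam : ℝ),
    Continuous S ∧ Continuous L ∧ DifferentiableOn ℂ S Kᶜ ∧ DifferentiableOn ℂ L Kᶜ ∧
    Tendsto S (cobounded ℂ) (𝓝 1) ∧ Tendsto (fun z => z * L z) (cobounded ℂ) (𝓝 (lam : ℂ)) ∧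
    lam = 1 / (2 * Real.pi) * arcIntegralOf B.curve (fun z => ‖S z‖ ^ 2) ∧
    arcIntegralOf B.curve (fun z => ‖L z‖ ^ 2) = 2 * Real.pi * lam := by
  obtain ⟨S, L, C, C', hS, hL, hLS, hks⟩ := SL_exists B
  have hpi : (2 * Real.pi * I : ℂ) ≠ 0 := by simp [Real.pi_ne_zero]
  have hcS := Gs_cont B hS
  have hcL := Gs_cont B hL
  set X : ℂ → ℂ := fun z => 1 - Gs B S z / (2 * Real.pi * I) - S z with hX
  set Y : ℂ → ℂ := fun z => - Gs B L z / (2 * Real.pi * I) - L z with hY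
  have hXc : Continuous X := (continuous_const.sub (hcS.div_const _)).sub hS.continuous
  have hYc : Continuous Y := (hcL.neg.div_const _).sub hL.continuous
  have hXY : ∀ i t, X (B.curve i t) = -I * (starRingEnd ℂ) (Tn B i t) * (starRingEnd ℂ) (Y (B.curve i t)) := by
    intro i t
    have h1 := pv B hK hconn hS hL hLS i t
    have h2 := hks i t
    have hT := Tn_conj B i t
    have h4 : S (B.curve i t) = I * (starRingEnd ℂ) (L (B.curve i t)) * (starRingEnd ℂ) (Tn B i t) := by
      rw [hLS]
      simp only [map_mul, conj_I, conj_conj]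
      linear_combination -S (B.curve i t) * hT + S (B.curve i t) * Tn B i t * (starRingEnd ℂ) (Tn B i t) * I_sq
    generalize (∑ j, ∫ u in (0:ℝ)..1,
      kk B (i, t) (j, u) * S (B.curve j u) * ‖deriv (B.curve j) u‖) = Q at h1 h2
    simp only [hX, hY, map_sub, map_div₀, map_neg, map_mul, conj_I, conj_ofReal, map_ofNat]
    field_simp
    linear_combination h1 + 2 * Real.pi * I * h4 - 2 * Real.pi * I * h2 - 2 * Real.pi * Q * I_sq
  have hInt : contourIntegralOf B.curve (fun z => X z * Y z) = 0 := by
    refine contour_of_rings B hK hconn (hXc.mul hYc) fun R => ?_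
    refine ⟨(R.r0 + R.ρ0) / 2, by linarith [R.h0ρ], by linarith [R.h0ρ, R.hρ1, R.h11], ?_⟩
    refine R.RS3 hK (ρ := R.ρ0) (by linarith [R.hρ1, R.h11]) (by linarith [R.h0ρ]) (by linarith [R.h0ρ])
      (h := fun z => X z * Y z) (DifferentiableOn.mono ?_ R.Ui_rho0_subset)
    have dX : DifferentiableOn ℂ X (interior K) :=
      (((Gs_in_diff B hS.continuous).div_const (2 * Real.pi * I)).const_sub 1).congr fun z _ => by
        simp only [hX]; field_simp; ring
    have dY : DifferentiableOn ℂ Y (interior K) :=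
      ((Gs_in_diff B hL.continuous).div_const (2 * Real.pi * I)).neg.congr fun z _ => by
        simp only [hY, Pi.neg_apply]; field_simp; ring
    exact dX.mul dY
  have harc : arcIntegralOf B.curve (fun z => ‖Y z‖ ^ 2) = 0 := by
    have h := contour_arc B (f := fun z => X z * Y z) (g := fun z => ‖Y z‖ ^ 2) (c := -I) fun i t _ => by
      simp only [hXY]
      push_cast
      rw [← Complex.conj_mul']
      linear_combination -I * (starRingEnd ℂ) (Y (B.curve i t)) * Y (B.curve i t) * Tn_conj B i t
    rw [hInt] at h
    have h' := (mul_eq_zero.1 h.symm).resolve_left (neg_ne_zero.2 I_ne_zero)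
    exact_mod_cast h'
  have hY0 : ∀ i, ∀ t ∈ Icc (0:ℝ) 1, Y (B.curve i t) = 0 := fun i t ht => by
    simpa using arc_zero B (f := fun z => ‖Y z‖ ^ 2) (hYc.norm.pow 2) (fun z => by positivity) harc i ht
  have hX0 : ∀ i, ∀ t ∈ Icc (0:ℝ) 1, X (B.curve i t) = 0 := fun i t ht => by
    rw [hXY, hY0 i t ht, map_zero, mul_zero]
  set s : ℂ → ℂ := fun z => 1 - Gs B S z / (2 * Real.pi * I) with hs
  set l : ℂ → ℂ := fun z => - Gs B L z / (2 * Real.pi * I) with hl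
  have es : ∀ i, ∀ t ∈ Icc (0:ℝ) 1, s (B.curve i t) = S (B.curve i t) := fun i t ht => sub_eq_zero.1 (hX0 i t ht)
  have el : ∀ i, ∀ t ∈ Icc (0:ℝ) 1, l (B.curve i t) = L (B.curve i t) := fun i t ht => sub_eq_zero.1 (hY0 i t ht)
  have hsc : Continuous s := continuous_const.sub (hcS.div_const _)
  have hlc : Continuous l := hcL.neg.div_const _
  have ds : DifferentiableOn ℂ s Kᶜ := ((Gs_out_diff B hK hconn hS.continuous).div_const _).const_sub 1
  have dl : DifferentiableOn ℂ l Kᶜ := (Gs_out_diff B hK hconn hL.continuous).neg.div_const _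
  have ts : Tendsto s (cobounded ℂ) (𝓝 1) := by
    have := ((tendsto_zero_of_tendsto_mul le_rfl (Gs_tendsto B hK hconn hS.continuous)).div_const
      (2 * Real.pi * I)).const_sub 1
    simpa using this
  set c : ℂ := contourIntegralOf B.curve L / (2 * Real.pi * I) with hc
  have tl : Tendsto (fun z => z * l z) (cobounded ℂ) (𝓝 c) := by
    have := (Gs_tendsto B hK hconn hL.continuous).neg.div_const (2 * Real.pi * I)
    rw [neg_neg] at this
    refine this.congr fun z => ?_
    simp only [hl]
    ring
  have h1 : contourIntegralOf B.curve (fun z => l z * s z) = 2 * Real.pi * I * c := by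
    refine contour_of_rings B hK hconn (hlc.mul hsc) fun R => ?_
    refine ⟨(1 + R.r1) / 2, by linarith [R.h0ρ, R.hρ1, R.h11], by linarith [R.h11], ?_⟩
    refine R.RS2 hK (ρ := 1) (by linarith [R.h0ρ, R.hρ1]) (by linarith [R.h11]) (by linarith [R.h11])
      (h := fun z => l z * s z) (l := 0) ((dl.mul ds).mono R.Uo_one_subset) ?_ ?_
    · simpa using (tendsto_zero_of_tendsto_mul le_rfl tl).mul ts
    · have := tl.mul ts
      rw [mul_one] at this
      exact this.congr fun z => by ring
  have h2 : contourIntegralOf B.curve (fun z => l z * s z) =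
      I * arcIntegralOf B.curve (fun z => ‖s z‖ ^ 2) := by
    refine contour_arc B fun i t ht => ?_
    simp only [es i t ht, el i t ht, hLS, map_mul]
    push_cast
    rw [← Complex.conj_mul']
    linear_combination I * S (B.curve i t) * (starRingEnd ℂ) (S (B.curve i t)) * Tn_conj B i t
  have h3 : c = ((1 / (2 * Real.pi) * arcIntegralOf B.curve (fun z => ‖s z‖ ^ 2) : ℝ) : ℂ) := by
    have hp : (Real.pi : ℂ) ≠ 0 := by exact_mod_cast Real.pi_ne_zero
    rw [h2] at h1
    push_cast
    field_simp
    refine mul_left_cancel₀ I_ne_zero ?_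
    linear_combination -h1
  refine ⟨s, l, _, hsc, hlc, ds, dl, ts, h3 ▸ tl, rfl, ?_⟩
  have : arcIntegralOf B.curve (fun z => ‖l z‖ ^ 2) = arcIntegralOf B.curve (fun z => ‖s z‖ ^ 2) := by
    refine arc_congr B fun i t ht => ?_
    rw [el i t ht, es i t ht, hLS, norm_mul, RCLike.norm_conj, norm_mul, Tn_norm, norm_I, one_mul, mul_one]
  rw [this]
  field_simp

end

end ACap

namespace ACap

section
variable {K : Set ℂ} (B : SmoothBoundary K)

lemma compl_cob (hK : IsCompact K) : Kᶜ ∈ cobounded ℂ := by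
  rw [Metric.cobounded_eq_cocompact]; exact hK.compl_mem_cocompact

lemma cob_inf (hK : IsCompact K) : cobounded ℂ ⊓ 𝓟 Kᶜ = cobounded ℂ :=
  inf_eq_left.2 (le_principal_iff.2 (compl_cob hK))

lemma capacity_eq (hK : IsCompact K) : analyticCapacity K = cap Kᶜ := by
  unfold analyticCapacity cap capSet HasDerivAtInftyOn
  simp only [cob_inf hK, and_assoc]

lemma lower_bound (hK : IsCompact K) (hconn : IsConnected Kᶜ) {g : ℂ → ℂ} (hg : MemA K g 1) :
    2 * Real.pi * cap Kᶜ ≤ arcIntegralOf B.curve (fun z => ‖g z‖ ^ 2) := by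
  obtain ⟨g1, g2, g3⟩ := hg
  rw [cob_inf hK] at g3
  have hcl : IsClosed (interior K)ᶜ := isOpen_interior.isClosed_compl
  obtain ⟨G, hG⟩ := ContinuousMap.exists_restrict_eq hcl ⟨_, g1.restrict⟩
  have hGg : ∀ z ∈ (interior K)ᶜ, G z = g z := fun z hz => DFunLike.congr_fun hG ⟨z, hz⟩
  have hsub : Kᶜ ⊆ (interior K)ᶜ := compl_subset_compl.2 interior_subset
  have harc : arcIntegralOf B.curve (fun z => ‖g z‖ ^ 2) = arcIntegralOf B.curve (fun z => ‖G z‖ ^ 2) :=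
    arc_congr B fun i t _ => by
      rw [hGg _ (cv_mem B i t).2]
  have dG : DifferentiableOn ℂ G Kᶜ := g2.congr fun z hz => hGg z (hsub hz)
  have tG : Tendsto G (cobounded ℂ) (𝓝 1) := g3.congr' (by
    filter_upwards [compl_cob hK] with z hz using (hGg z (hsub hz)).symm)
  obtain ⟨f, df, bf, f0, f1⟩ := exists_extremal hK.isClosed.isOpen_compl (compl_cob hK)
  rw [harc]
  have hcapn : 0 ≤ cap Kᶜ := cap_nonneg (compl_cob hK)
  refine le_of_forall_pos_le_add fun η hη => ?_
  have hGc := G.continuous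
  obtain ⟨ε, hε, hlim⟩ := ring_lim B hK (Φ := fun z v => ‖G z‖ ^ 2 * ‖v‖) (by fun_prop) hη
  obtain ⟨R, e, hC⟩ := ring_exists B hK hconn hε
  have hr0 : R.r0 ≤ (1 + R.r1) / 2 := by linarith [R.h0ρ, R.hρ1, R.h11]
  have hr1 : (1 + R.r1) / 2 ≤ R.r1 := by linarith [R.h11]
  have h1 := hlim R e hC _ hr0 hr1
  have h2 : R.CI ((1 + R.r1) / 2) (fun j w => (fun z => f z * G z ^ 2) (R.Z j w)) = 2 * Real.pi * I * cap Kᶜ := by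
    refine R.RS2 hK (ρ := 1) (by linarith [R.h0ρ, R.hρ1]) (by linarith [R.h11]) (by linarith [R.h11])
      (h := fun z => f z * G z ^ 2) (l := 0) ((df.mul (dG.pow 2)).mono R.Uo_one_subset) ?_ ?_
    · simpa using f0.mul (tG.pow 2)
    · have := f1.mul (tG.pow 2)
      rw [one_pow, mul_one] at this
      exact this.congr fun z => by ring
  rw [CI_unit R _ (fun z => f z * G z ^ 2)] at h2
  have h3 := congrArg norm h2
  have h4 : ‖(2 * Real.pi * I * cap Kᶜ : ℂ)‖ = 2 * Real.pi * cap Kᶜ := by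
    simp [abs_of_pos Real.pi_pos, abs_of_nonneg hcapn]
  rw [h4] at h3
  rw [← h3]
  refine (norm_sum_le _ _).trans (le_trans (Finset.sum_le_sum fun j _ => ?_)
    (sub_le_iff_le_add'.1 ((Real.le_norm_self _).trans h1)))
  obtain ⟨c1, c2⟩ := ring_Zc R j hr0 hr1
  have hci : Continuous fun t : ℝ => ‖G (R.Z j (circleMap 0 ((1 + R.r1) / 2) (2 * Real.pi * t)))‖ ^ 2 *
      ‖2 * Real.pi * I * (circleMap 0 ((1 + R.r1) / 2) (2 * Real.pi * t) *
        deriv (R.Z j) (circleMap 0 ((1 + R.r1) / 2) (2 * Real.pi * t)))‖ :=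
    ((hGc.comp c1).norm.pow 2).mul c2.norm
  refine intervalIntegral.norm_integral_le_of_norm_le zero_le_one (Eventually.of_forall fun t _ => ?_)
    (hci.intervalIntegrable 0 1)
  rw [norm_mul]
  gcongr
  rw [norm_mul, norm_pow]
  refine mul_le_of_le_one_left (by positivity) (bf _ (R.out j _ ?_))
  have : |(1 + R.r1) / 2| = (1 + R.r1) / 2 := abs_of_pos (by linarith [R.h11])
  simp only [cann, mem_setOf_eq, norm_circleMap_zero, this]
  constructor <;> linarith [R.h11]

lemma upper_bound (hK : IsCompact K) (hconn : IsConnected Kᶜ) {L : ℂ → ℂ} {lam : ℝ} (hlam : 0 ≤ lam)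
    (hLc : Continuous L) (dL : DifferentiableOn ℂ L Kᶜ)
    (tL : Tendsto (fun z => z * L z) (cobounded ℂ) (𝓝 (lam : ℂ)))
    (hA : arcIntegralOf B.curve (fun z => ‖L z‖ ^ 2) = 2 * Real.pi * lam) : lam ≤ cap Kᶜ := by
  have hη : ∀ N : ℕ, (0:ℝ) < 1 / ((N:ℝ) + 1) := fun N => by positivity
  have key : ∀ N : ℕ, ∃ (R : RingSys K) (e : Fin R.n ≃ Fin B.n), Close B (1 / ((N:ℝ) + 1)) R e ∧
      2 * Real.pi * lam ^ 2 ≤ (2 * Real.pi * lam + 1 / ((N:ℝ) + 1)) * cap (R.Uo 1) := by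
    intro N
    obtain ⟨ε, hε, hlim⟩ := ring_lim B hK (Φ := fun z v => ‖L z‖ ^ 2 * ‖v‖) (by fun_prop) (hη N)
    obtain ⟨R, e, hC⟩ := ring_exists B hK hconn (lt_min hε (hη N))
    refine ⟨R, e, fun j t r h0 h1 => ?_, ?_⟩
    · have := hC j t r h0 h1
      exact ⟨this.1.trans (min_le_right _ _), this.2.trans (min_le_right _ _)⟩
    · have h := R.ring_ineq hK hconn.isPreconnected dL (tendsto_zero_of_tendsto_mul le_rfl tL) tL
        (A := 2 * Real.pi * lam + 1 / ((N:ℝ) + 1)) ?_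
      · rwa [norm_real, Real.norm_of_nonneg hlam] at h
      · filter_upwards [Ioo_mem_nhdsGT R.h11] with s hs
        rw [arc_unit R s (fun z => ‖L z‖ ^ 2), ← hA]
        refine sub_le_iff_le_add'.1 ((Real.le_norm_self _).trans (hlim R e (fun j t r h0 h1 => ?_) s
          (by linarith [R.h0ρ, R.hρ1, hs.1]) hs.2.le))
        have := hC j t r h0 h1
        exact ⟨this.1.trans (min_le_left _ _), this.2.trans (min_le_left _ _)⟩
  choose R e hC hin using key
  have hfr : frontier K ⊆ K := hK.isClosed.frontier_subset
  obtain ⟨M', hM'⟩ := hK.isBounded.exists_norm_le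
  have hUo : ∀ N, IsOpen ((R N).Uo 1) := fun N =>
    (R N).isOpen_Uo hK (by linarith [(R N).h0ρ, (R N).hρ1]) (R N).h11
  choose f df bf f0 f1 using fun N => exists_extremal (hUo N) ((R N).Uo_cobounded hK)
  have hV : ∀ z ∈ Kᶜ, ∃ δ > 0, ∀ᶠ N in atTop, ball z δ ⊆ (R N).Uo 1 := by
    intro z hz
    obtain ⟨δ, hδ, hb⟩ := Metric.isOpen_iff.1 hK.isClosed.isOpen_compl z hz
    refine ⟨δ / 2, by positivity, ?_⟩
    have ht := tendsto_one_div_add_atTop_nhds_zero_nat (𝕜 := ℝ)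
    filter_upwards [ht.eventually_lt_const (show 0 < δ / 2 by positivity)] with N hN y hy
    refine Or.inl ⟨hb (ball_subset_ball (by linarith) hy), fun hy' => ?_⟩
    obtain ⟨x, hx, hxy⟩ := tube B (R N) (e N) (hC N) hy'
    refine hb (mem_ball.2 ?_) (hfr hx)
    have := dist_triangle_left x z y
    rw [dist_eq_norm y x] at this
    linarith [mem_ball.1 hy]
  have hVR : {z : ℂ | max M' 0 + 1 < ‖z‖} ⊆ Kᶜ := fun z hz hzK => by
    have := hM' z hzK
    have h2 := le_max_left M' 0
    simp only [mem_setOf_eq] at hz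
    linarith
  have hUR : ∀ N, {z : ℂ | max M' 0 + 1 < ‖z‖} ⊆ (R N).Uo 1 := fun N z hz => by
    refine Or.inl ⟨hVR hz, fun hz' => ?_⟩
    obtain ⟨x, hx, hxy⟩ := tube B (R N) (e N) (hC N) hz'
    have h1 : 1 / ((N:ℝ) + 1) ≤ 1 := by
      rw [div_le_one (by positivity)]
      linarith [Nat.cast_nonneg (α := ℝ) N]
    have h2 := hM' x (hfr hx)
    have h3 := le_max_left M' 0
    have h4 : ‖z‖ ≤ ‖z - x‖ + ‖x‖ := by simpa using norm_add_le (z - x) x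
    simp only [mem_setOf_eq] at hz
    linarith
  obtain ⟨F, l', w', dF, bF, tF, tF', hw⟩ := montel_inf hK.isClosed.isOpen_compl hV
    (R := max M' 0 + 1) (by positivity) hUR hVR df bf (l := fun _ => 0) f1
  have hw' : ‖w'‖ ≤ cap Kᶜ := by
    simpa using le_cap (compl_cob hK) dF one_pos bF tF tF'
  have hfin : ∀ δ : ℝ, 0 < δ → 2 * Real.pi * lam ^ 2 ≤ (2 * Real.pi * lam + δ) * (cap Kᶜ + δ) := by
    intro δ hδ
    have ht := tendsto_one_div_add_atTop_nhds_zero_nat (𝕜 := ℝ)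
    obtain ⟨N, hN1, hN2⟩ := ((mapClusterPt_iff_frequently.1 hw _ (ball_mem_nhds w' hδ)).and_eventually
      (ht.eventually_lt_const hδ)).exists
    have h1 : cap ((R N).Uo 1) ≤ cap Kᶜ + δ := by
      have h2 : ‖((cap ((R N).Uo 1) : ℝ) : ℂ)‖ ≤ ‖w'‖ + δ := by
        have := norm_le_norm_add_norm_sub' ((cap ((R N).Uo 1) : ℝ) : ℂ) w'
        have h3 := mem_ball_iff_norm.1 hN1
        linarith
      rw [norm_real] at h2
      linarith [Real.le_norm_self (cap ((R N).Uo 1))]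
    refine (hin N).trans (mul_le_mul (by linarith) h1 (cap_nonneg ((R N).Uo_cobounded hK)) (by positivity))
  have hlim : 2 * Real.pi * lam ^ 2 ≤ (2 * Real.pi * lam + 0) * (cap Kᶜ + 0) := by
    have hc : Continuous fun δ : ℝ => (2 * Real.pi * lam + δ) * (cap Kᶜ + δ) := by fun_prop
    exact ge_of_tendsto ((hc.tendsto 0).mono_left nhdsWithin_le_nhds)
      (by filter_upwards [self_mem_nhdsWithin] with δ hδ using hfin δ hδ : ∀ᶠ δ in 𝓝[>] (0:ℝ), _)
  rcases hlam.eq_or_lt with h | h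
  · rw [← h]; exact cap_nonneg (compl_cob hK)
  · have hp := Real.pi_pos
    refine le_of_mul_le_mul_left ?_ (show 0 < 2 * Real.pi * lam by positivity)
    linarith [hlim]

end

end ACap

namespace ACap

theorem main_min (K : Set ℂ) (hK : IsCompact K) (hconn : IsConnected Kᶜ)
    (B : SmoothBoundary K) :
    IsLeast {r : ℝ | ∃ g : ℂ → ℂ, MemA K g 1 ∧
      r = 1 / (2 * Real.pi) * arcIntegralOf B.curve (fun z => ‖g z‖ ^ 2)} (analyticCapacity K) := by
  rw [capacity_eq hK]
  have hp := Real.pi_pos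
  have hlow : ∀ g, MemA K g 1 → cap Kᶜ ≤ 1 / (2 * Real.pi) * arcIntegralOf B.curve (fun z => ‖g z‖ ^ 2) := by
    intro g hg
    have := lower_bound B hK hconn hg
    rw [one_div, inv_mul_eq_div, le_div_iff₀ (by positivity)]
    linarith
  constructor
  · obtain ⟨S, L, lam, hS, hL, dS, dL, tS, tL, h1, h2⟩ := garabedian B hK hconn
    have hmem : MemA K S 1 := ⟨hS.continuousOn, dS, by rwa [cob_inf hK]⟩
    refine ⟨S, hmem, le_antisymm (hlow S hmem) ?_⟩
    rw [← h1]
    refine upper_bound B hK hconn ?_ hL dL tL h2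
    exact (cap_nonneg (compl_cob hK)).trans (h1 ▸ hlow S hmem)
  · rintro r ⟨g, hg, rfl⟩
    exact hlow g hg

end ACap

/-- If `K ⊆ ℂ` is compact with `Ω = ℂ∞ ∖ K` a finitely connected domain with
`C^∞` boundary, then `γ(K) = min { (1/2π) ∫_{∂Ω} |g(z)|² |dz| : g ∈ A(Ω), g(∞) = 1 }`,
the minimum being attained. -/
theorem analyticCapacity_eq_min (K : Set ℂ) (hK : IsCompact K)
    (hconn : IsConnected Kᶜ) (B : SmoothBoundary K) :
    IsLeast { r : ℝ | ∃ g : ℂ → ℂ, MemA K g 1 ∧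
        r = 1 / (2 * Real.pi) * arcIntegralOf B.curve (fun z => ‖g z‖ ^ 2) }
      (analyticCapacity K) := by
  exact ACap.main_min K hK hconn B
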